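/- Let u be a radially symmetric solution of problem (E) (with Ω = B(R) ⊂ ℝ^N, N ≥ 1) that blows up at t = T and satisfies u(0,t) = max_{x∈Ω} u(x,t) for every t ∈ (0,T). For a sequence of times t_i define the rescaled functions w_i(ρ,τ) = −u(0,t_i) + U(e^{−u(0,t_i)/2} ρ, t_i + e^{−u(0,t_i)} τ), where U(|x|,t) = u(x,t), defined for (ρ,τ) ∈ (0, e^{u(0,t_i)/2} R) × (−e^{u(0,t_i)} t_i, e^{u(0,t_i)} (T−t_i)). If the blow-up is of type II, then there exists a sequence t_i ↑ T such that w_i(ρ,τ) → ψ(ρ) uniformly for (ρ,τ) in compact subsets of (0,∞) × (−∞, 1/4), where ψ satisfies ψ'' + ((N−1)/ρ) ψ' + e^ψ = 0 for ρ > 0, with ψ(0) = 0 and ψ'(0) = 0. -/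

import Mathlib

open MeasureTheory Real Filter Topology Metric Set
open scoped ENNReal NNReal

noncomputable section

namespace ExpBlowup

/-- Euclidean space `ℝ^N`. -/
abbrev Euc (N : ℕ) := EuclideanSpace ℝ (Fin N)

/-- The Laplacian of a function `f : ℝ^N → ℝ` at a point `x`. -/
def lap {N : ℕ} (f : Euc N → ℝ) (x : Euc N) : ℝ :=
  ∑ i : Fin N, fderiv ℝ (fun y => fderiv ℝ f y (EuclideanSpace.single i 1)) x
    (EuclideanSpace.single i 1)

/-- The (extended-real valued) sup norm of `|v|` over a set `Ω`. -/
def supAbs {N : ℕ} (Ω : Set (Euc N)) (v : Euc N → ℝ) : ℝ≥0∞ :=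
  ⨆ x ∈ Ω, ENNReal.ofReal |v x|

/-- `u` blows up at time `T`. -/
def BlowsUpAt {N : ℕ} (Ω : Set (Euc N)) (u : ℝ → Euc N → ℝ) (T : ℝ) : Prop :=
  0 < T ∧ (∀ t ∈ Set.Ioo (0:ℝ) T, supAbs Ω (u t) < ⊤) ∧
    Filter.limsup (fun t => supAbs Ω (u t)) (𝓝[<] T) = ⊤

/-- The blow-up of `u` at time `T` is of type I. -/
def TypeIRate {N : ℕ} (Ω : Set (Euc N)) (u : ℝ → Euc N → ℝ) (T : ℝ) : Prop :=
  ∃ C₁ C₂ : ℝ, ∀ t ∈ Set.Ioo (0:ℝ) T,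
    C₁ ≤ Real.log (T - t) + (supAbs Ω (u t)).toReal ∧
      Real.log (T - t) + (supAbs Ω (u t)).toReal ≤ C₂

/-- `x₀` is a blow-up point of `u` (blowing up at time `T`). -/
def IsBlowUpPoint {N : ℕ} (Ω : Set (Euc N)) (u : ℝ → Euc N → ℝ) (T : ℝ) (x₀ : Euc N) : Prop :=
  ∃ x : ℕ → Euc N, ∃ t : ℕ → ℝ, (∀ n, x n ∈ Ω) ∧ (∀ n, t n ∈ Set.Ioo 0 T) ∧
    Filter.Tendsto x Filter.atTop (𝓝 x₀) ∧ Filter.Tendsto t Filter.atTop (𝓝 T) ∧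
    Filter.Tendsto (fun n => u (t n) (x n)) Filter.atTop Filter.atTop

/-- A function is radially symmetric. -/
def RadiallySymmetric {N : ℕ} (v : Euc N → ℝ) : Prop :=
  ∀ x y : Euc N, ‖x‖ = ‖y‖ → v x = v y

/-- A classical solution of `u_t = Δu + e^u` on `Ω` with Dirichlet boundary condition and
initial data `u₀`, for times in the set `I`. -/
structure IsClassicalSol {N : ℕ} (Ω : Set (Euc N)) (u : ℝ → Euc N → ℝ)
    (u₀ : Euc N → ℝ) (I : Set ℝ) : Prop where
  space_reg : ∀ t ∈ I, 0 < t → ContDiffOn ℝ 2 (u t) Ω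
  cont : ContinuousOn (fun p : ℝ × Euc N => u p.1 p.2) (I ×ˢ closure Ω)
  eq : ∀ t ∈ I, 0 < t → ∀ x ∈ Ω,
    HasDerivAt (fun s => u s x) (lap (u t) x + Real.exp (u t x)) t
  bc : ∀ t ∈ I, ∀ x ∈ frontier Ω, u t x = 0
  ic : ∀ x ∈ closure Ω, u 0 x = u₀ x

/-- An `L¹`-solution of `u_t = Δu + e^u` on `B(0,R) × [0,𝓣]` with Dirichlet boundary
conditions (Definition 1.1 of the paper). -/
structure IsL1Sol {N : ℕ} (R 𝓣 : ℝ) (u : ℝ → Euc N → ℝ) : Prop where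
  integrable : ∀ t ∈ Set.Icc (0:ℝ) 𝓣, IntegrableOn (u t) (ball (0:Euc N) R)
  contL1 : ∀ t₀ ∈ Set.Icc (0:ℝ) 𝓣,
    Filter.Tendsto (fun t => ∫ x in ball (0:Euc N) R, |u t x - u t₀ x|)
      (𝓝[Set.Icc (0:ℝ) 𝓣] t₀) (𝓝 0)
  exp_int : IntegrableOn (fun p : ℝ × Euc N => Real.exp (u p.1 p.2))
      (Set.Ioc (0:ℝ) 𝓣 ×ˢ ball (0:Euc N) R)
  weak : ∀ t₁ t₂, 0 ≤ t₁ → t₁ < t₂ → t₂ ≤ 𝓣 → ∀ Ψ : ℝ → Euc N → ℝ,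
    ContDiffOn ℝ 2 (fun p : ℝ × Euc N => Ψ p.1 p.2)
      (Set.Icc (0:ℝ) 𝓣 ×ˢ closure (ball (0:Euc N) R)) →
    (∀ t ∈ Set.Icc (0:ℝ) 𝓣, ∀ x ∈ sphere (0:Euc N) R, Ψ t x = 0) →
    ((∫ x in ball (0:Euc N) R, (u t₂ x * Ψ t₂ x - u t₁ x * Ψ t₁ x)) -
        ∫ t in t₁..t₂, ∫ x in ball (0:Euc N) R, u t x * deriv (fun s => Ψ s x) t)
      = ∫ t in t₁..t₂, ∫ x in ball (0:Euc N) R,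
          (u t x * lap (Ψ t) x + Real.exp (u t x) * Ψ t x)

/-- The approximation property defining limit `L¹`-solutions on `[0,𝓣)`:
`v n` are classical solutions with initial data `v₀ n` approximating `u`, `u₀`. -/
def IsLimitL1SolAux {N : ℕ} (R 𝓣 : ℝ) (u : ℝ → Euc N → ℝ) (u₀ : Euc N → ℝ)
    (v : ℕ → ℝ → Euc N → ℝ) (v₀ : ℕ → Euc N → ℝ) : Prop :=
  (∀ n, IsClassicalSol (ball (0:Euc N) R) (v n) (v₀ n) (Set.Ico 0 𝓣)) ∧
  (∀ n, ContinuousOn (v₀ n) (closure (ball (0:Euc N) R))) ∧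
  TendstoUniformlyOn v₀ u₀ Filter.atTop (closure (ball (0:Euc N) R)) ∧
  (∀ t ∈ Set.Ico (0:ℝ) 𝓣,
    Filter.Tendsto (fun n => ∫ x in ball (0:Euc N) R, |v n t x - u t x|)
      Filter.atTop (𝓝 0)) ∧
  (∀ t ∈ Set.Ico (0:ℝ) 𝓣, 0 < t →
    Filter.Tendsto (fun n => ∫ p in Set.Ioc (0:ℝ) t ×ˢ ball (0:Euc N) R,
      |Real.exp (v n p.1 p.2) - Real.exp (u p.1 p.2)|) Filter.atTop (𝓝 0))

/-- A limit `L¹`-solution of the problem on `[0,𝓣)`. -/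
def IsLimitL1Sol {N : ℕ} (R 𝓣 : ℝ) (u : ℝ → Euc N → ℝ) (u₀ : Euc N → ℝ) : Prop :=
  (∀ T' ∈ Set.Ico (0:ℝ) 𝓣, IsL1Sol R T' u) ∧
  ∃ v v₀, IsLimitL1SolAux R 𝓣 u u₀ v v₀

/-- A minimal (limit) `L¹`-solution of the problem on `[0,𝓣)`: a limit `L¹`-solution whose
approximating initial data increase monotonically. -/
def IsMinimalL1Sol {N : ℕ} (R 𝓣 : ℝ) (u : ℝ → Euc N → ℝ) (u₀ : Euc N → ℝ) : Prop :=
  (∀ T' ∈ Set.Ico (0:ℝ) 𝓣, IsL1Sol R T' u) ∧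
  ∃ v v₀, IsLimitL1SolAux R 𝓣 u u₀ v v₀ ∧
    ∀ n, ∀ x ∈ closure (ball (0:Euc N) R), 0 ≤ v₀ n x ∧ v₀ n x ≤ v₀ (n + 1) x

/-- A minimal `L¹`-solution on the closed time interval `[0,𝓣]`. -/
def IsMinimalL1SolClosed {N : ℕ} (R 𝓣 : ℝ) (u : ℝ → Euc N → ℝ) (u₀ : Euc N → ℝ) : Prop :=
  IsL1Sol R 𝓣 u ∧
  ∃ v v₀, IsLimitL1SolAux R 𝓣 u u₀ v v₀ ∧
    ∀ n, ∀ x ∈ closure (ball (0:Euc N) R), 0 ≤ v₀ n x ∧ v₀ n x ≤ v₀ (n + 1) x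

/-- The zero number (maximal number of sign changes) of `v` on `(0,R)`. -/
def zeroNumber (R : ℝ) (v : ℝ → ℝ) : ℕ∞ :=
  ⨆ k ∈ {k : ℕ | ∃ x : Fin (k + 1) → ℝ, StrictMono x ∧ (∀ i, x i ∈ Set.Ioo 0 R) ∧
      ∀ i : Fin k, v (x i.castSucc) * v (x i.succ) < 0}, (k : ℕ∞)

theorem nonpos_of_max_right {f : ℝ → ℝ} {c r : ℝ} (h : HasDerivAt f c r)
    (hm : ∀ᶠ s in 𝓝[>] r, f s ≤ f r) : c ≤ 0 := by
  have h1 : Tendsto (slope f r) (𝓝[>] r) (𝓝 c) := (hasDerivAt_iff_tendsto_slope.1 h).mono_left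
    (nhdsWithin_mono r (show Ioi r ⊆ {r}ᶜ from fun x hx => ne_of_gt hx))
  refine le_of_tendsto h1 ?_
  filter_upwards [hm, self_mem_nhdsWithin] with s hs hs'
  rw [slope_def_field]
  exact div_nonpos_of_nonpos_of_nonneg (by linarith) (by have : r < s := hs'; linarith)

theorem nonneg_of_max_left {f : ℝ → ℝ} {c r : ℝ} (h : HasDerivAt f c r)
    (hm : ∀ᶠ s in 𝓝[<] r, f s ≤ f r) : 0 ≤ c := by
  have h1 : Tendsto (slope f r) (𝓝[<] r) (𝓝 c) := (hasDerivAt_iff_tendsto_slope.1 h).mono_left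
    (nhdsWithin_mono r (show Iio r ⊆ {r}ᶜ from fun x hx => ne_of_lt hx))
  refine ge_of_tendsto h1 ?_
  filter_upwards [hm, self_mem_nhdsWithin] with s hs hs'
  rw [slope_def_field]
  exact div_nonneg_of_nonpos (by linarith) (by have : s < r := hs'; linarith)

theorem second_deriv_nonpos_of_max_right {f f1 : ℝ → ℝ} {c r : ℝ}
    (h : ∀ᶠ s in 𝓝[>] r, HasDerivAt f (f1 s) s) (h0 : HasDerivAt f (f1 r) r)
    (h1 : HasDerivAt f1 c r) (hr : f1 r = 0)
    (hm : ∀ᶠ s in 𝓝[>] r, f s ≤ f r) : c ≤ 0 := by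
  by_contra hc
  push Not at hc
  have h2 : Tendsto (slope f1 r) (𝓝[>] r) (𝓝 c) := (hasDerivAt_iff_tendsto_slope.1 h1).mono_left
    (nhdsWithin_mono r (show Ioi r ⊆ {r}ᶜ from fun x hx => ne_of_gt hx))
  have h3 : ∀ᶠ s in 𝓝[>] r, 0 < f1 s := by
    filter_upwards [h2.eventually (lt_mem_nhds hc), self_mem_nhdsWithin] with s hs hs'
    rw [slope_def_field, hr, sub_zero] at hs
    have : r < s := hs'
    by_contra hneg
    push Not at hneg
    exact absurd hs (not_lt.2 (div_nonpos_of_nonpos_of_nonneg hneg (by linarith)))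
  obtain ⟨u, hu, hu'⟩ := (mem_nhdsGT_iff_exists_Ioo_subset).1 (h.and (h3.and hm))
  have hru : r < u := hu
  set s := (r + u) / 2 with hs
  have hsu : s < u := by simp only [hs]; linarith
  have hrs : r < s := by simp only [hs]; linarith
  have hd : ∀ x ∈ Icc r s, HasDerivAt f (f1 x) x := by
    intro x hx
    rcases eq_or_lt_of_le hx.1 with h | h
    · rw [← h]; exact h0
    · exact (hu' ⟨h, lt_of_le_of_lt hx.2 hsu⟩).1
  obtain ⟨x, hx, hx'⟩ := exists_hasDerivAt_eq_slope f f1 hrs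
    (fun x hx => (hd x hx).continuousAt.continuousWithinAt)
    (fun x hx => hd x ⟨hx.1.le, hx.2.le⟩)
  have h4 := (hu' ⟨hx.1, hx.2.trans hsu⟩).2.1
  have h5 := (hu' ⟨hrs, hsu⟩).2.2
  rw [hx'] at h4
  have := div_nonpos_of_nonpos_of_nonneg (sub_nonpos.2 h5) (sub_nonneg.2 hrs.le)
  linarith

/-- First and second order conditions at an interior local maximum. -/
theorem deriv_conditions_of_localMax {f f1 : ℝ → ℝ} {c r : ℝ}
    (h : ∀ᶠ s in 𝓝 r, HasDerivAt f (f1 s) s)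
    (h1 : HasDerivAt f1 c r) (hm : ∀ᶠ s in 𝓝 r, f s ≤ f r) : f1 r = 0 ∧ c ≤ 0 := by
  have h0 : f1 r = 0 := IsLocalMax.hasDerivAt_eq_zero (f := f) hm h.self_of_nhds
  exact ⟨h0, second_deriv_nonpos_of_max_right (h.filter_mono nhdsWithin_le_nhds)
    h.self_of_nhds h1 h0 (hm.filter_mono nhdsWithin_le_nhds)⟩

/-- A classical solution of the radial inhomogeneous heat equation
`w_t = w_rr + (n / r) w_r + g`, written with its derivatives. -/
structure RadSol (n : ℝ) (w wr wrr wt g : ℝ → ℝ → ℝ) (I : Set ℝ) (X : ℝ) : Prop where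
  dr : ∀ t ∈ I, ∀ r ∈ Ioo (-X) X, HasDerivAt (w t) (wr t r) r
  drr : ∀ t ∈ I, ∀ r ∈ Ioo (-X) X, HasDerivAt (wr t) (wrr t r) r
  dt : ∀ t ∈ I, ∀ r ∈ Ico 0 X, HasDerivAt (fun s => w s r) (wt t r) t
  axis : ∀ t ∈ I, wr t 0 = 0
  eq_pos : ∀ t ∈ I, ∀ r ∈ Ioo 0 X, wt t r = wrr t r + n / r * wr t r + g t r
  eq_zero : ∀ t ∈ I, 0 < X → wt t 0 = (n + 1) * wrr t 0 + g t 0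

theorem RadSol.mono {n : ℝ} {w wr wrr wt g : ℝ → ℝ → ℝ} {I J : Set ℝ} {X Y : ℝ}
    (h : RadSol n w wr wrr wt g I X) (hJ : J ⊆ I) (hY : Y ≤ X) :
    RadSol n w wr wrr wt g J Y where
  dr t ht r hr := h.dr t (hJ ht) r ⟨by linarith [hr.1], by linarith [hr.2]⟩
  drr t ht r hr := h.drr t (hJ ht) r ⟨by linarith [hr.1], by linarith [hr.2]⟩
  dt t ht r hr := h.dt t (hJ ht) r ⟨hr.1, by linarith [hr.2]⟩
  axis t ht := h.axis t (hJ ht)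
  eq_pos t ht r hr := h.eq_pos t (hJ ht) r ⟨hr.1, by linarith [hr.2]⟩
  eq_zero t ht hX := h.eq_zero t (hJ ht) (by linarith)

/-- One-point comparison at the outer boundary. -/
theorem RadSol.one_point {n X a b ξ T₀ : ℝ} {w wr wrr wt g : ℝ → ℝ → ℝ} {I : Set ℝ}
    {φ φ1 φ2 : ℝ → ℝ} (hn : 0 ≤ n) (hX : 0 < X) (hab : a < b) (hI : Ioc a b ⊆ I)
    (h : RadSol n w wr wrr wt g I X)
    (hc : ContinuousOn (fun p : ℝ × ℝ => w p.1 p.2) (Icc a b ×ˢ Icc 0 X))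
    (hξ : 0 < ξ)
    (hφc : Continuous φ)
    (hφ1 : ∀ y, 0 < y → HasDerivAt φ (φ1 y) y)
    (hφ2 : ∀ y, 0 < y → HasDerivAt φ1 (φ2 y) y)
    (hφpos : ∀ y, 0 < y → y < ξ → 0 < φ1 y)
    (h_init : ∀ s ∈ Icc 0 X, X - s ≤ ξ → w a s - φ (X - s) - T₀ ≤ 0)
    (h_far : ∀ t ∈ Icc a b, 0 ≤ X - ξ → w t (X - ξ) - φ ξ - T₀ * (1 - (t - a) / (b - a)) ≤ 0)
    (h_bd : ∀ t ∈ Icc a b, w t X - φ 0 - T₀ * (1 - (t - a) / (b - a)) ≤ 0)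
    (h_int : ∀ t ∈ Ioc a b, ∀ s ∈ Ioo 0 X, X - s < ξ → wr t s = - φ1 (X - s) →
      0 < w t s - φ (X - s) - T₀ * (1 - (t - a) / (b - a)) →
      g t s + φ2 (X - s) + T₀ / (b - a) < 0) :
    ∀ t ∈ Icc a b, ∀ s ∈ Icc 0 X, X - s ≤ ξ →
      w t s ≤ φ (X - s) + T₀ * (1 - (t - a) / (b - a)) := by
  set Z : ℝ × ℝ → ℝ := fun p => w p.1 p.2 - φ (X - p.2) - T₀ * (1 - (p.1 - a) / (b - a)) with hZ
  set m := max 0 (X - ξ) with hm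
  have hmX : m ≤ X := max_le hX.le (by linarith)
  have hK : IsCompact (Icc a b ×ˢ Icc m X) := isCompact_Icc.prod isCompact_Icc
  have hne : (Icc a b ×ˢ Icc m X).Nonempty := ⟨(a, X), ⟨le_refl _, hab.le⟩, ⟨hmX, le_refl _⟩⟩
  have hZc : ContinuousOn Z (Icc a b ×ˢ Icc m X) := by
    refine ContinuousOn.sub (ContinuousOn.sub (hc.mono ?_) ?_) ?_
    · exact prod_mono (le_refl _) (Icc_subset_Icc_left (le_max_left _ _))
    · exact (hφc.comp (continuous_const.sub continuous_snd)).continuousOn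
    · fun_prop
  obtain ⟨⟨t, s⟩, ⟨ht, hs⟩, hmax⟩ := hK.exists_isMaxOn hne hZc
  have key : Z (t, s) ≤ 0 := by
    by_contra hpos
    push Not at hpos
    simp only [hZ] at hpos
    simp only at ht hs
    have hs0 : 0 ≤ s := (le_max_left _ _).trans hs.1
    have hsξ : X - s ≤ ξ := by have := (le_max_right 0 (X - ξ)).trans hs.1; linarith
    have hat : a < t := by
      rcases eq_or_lt_of_le ht.1 with h' | h'
      · subst h'
        have := h_init s ⟨hs0, hs.2⟩ hsξ
        simp at hpos
        linarith
      · exact h'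
    have hsX : s < X := by
      rcases eq_or_lt_of_le hs.2 with h' | h'
      · subst h'
        have := h_bd t ht
        simp only [sub_self] at hpos
        linarith
      · exact h'
    have hsξ' : X - s < ξ := by
      rcases eq_or_lt_of_le hsξ with h' | h'
      · have e : s = X - ξ := by linarith
        have := h_far t ht (by linarith)
        rw [h', e] at hpos
        linarith
      · exact h'
    have htI : t ∈ I := hI ⟨hat, ht.2⟩
    have hder : ∀ x ∈ Ioo (-X) X, HasDerivAt (fun x => w t x - φ (X - x))
        (wr t x + φ1 (X - x)) x := by
      intro x hx
      have h1 := h.dr t htI x hx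
      have h2 := (hφ1 (X - x) (by linarith [hx.2])).comp x ((hasDerivAt_id x).const_sub X)
      exact (h1.sub h2).congr_deriv (by ring)
    have hcmp : ∀ x, m ≤ x → x ≤ X → w t x - φ (X - x) ≤ w t s - φ (X - s) := by
      intro x h1 h2
      have := hmax (show (t, x) ∈ Icc a b ×ˢ Icc m X from ⟨ht, h1, h2⟩)
      simp only [hZ, mem_ofPred_eq] at this
      linarith
    rcases eq_or_lt_of_le hs0 with h0 | h0
    · have h1 := hder s ⟨by linarith, hsX⟩
      have h2 : wr t s + φ1 (X - s) ≤ 0 := by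
        refine nonpos_of_max_right h1 ?_
        filter_upwards [Ioo_mem_nhdsGT hsX] with x hx
        exact hcmp x (hs.1.trans hx.1.le) hx.2.le
      rw [← h0, h.axis t htI] at h2
      have := hφpos (X - 0) (by linarith) (by linarith)
      linarith
    · have hms : m < s := by
        rw [hm]; exact max_lt h0 (by linarith)
      have hev : ∀ᶠ x in 𝓝 s, x ∈ Ioo m X := Ioo_mem_nhds hms hsX
      have h2 : HasDerivAt (fun x => wr t x + φ1 (X - x)) (wrr t s - φ2 (X - s)) s := by
        have h1 := h.drr t htI s ⟨by linarith, hsX⟩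
        have h2 := (hφ2 (X - s) (by linarith)).comp s ((hasDerivAt_id s).const_sub X)
        exact (h1.add h2).congr_deriv (by ring)
      obtain ⟨e1, e2⟩ := deriv_conditions_of_localMax (f := fun x => w t x - φ (X - x))
        (f1 := fun x => wr t x + φ1 (X - x))
        (by filter_upwards [hev] with x hx
            exact hder x ⟨by linarith [hx.1, le_max_left 0 (X - ξ)], hx.2⟩) h2
        (by filter_upwards [hev] with x hx using hcmp x hx.1.le hx.2.le)
      have h3 : 0 ≤ wt t s + T₀ / (b - a) := by
        have hd : HasDerivAt (fun x => w x s - φ (X - s) - T₀ * (1 - (x - a) / (b - a)))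
            (wt t s + T₀ / (b - a)) t := by
          have h1 := h.dt t htI s ⟨hs0, hsX⟩
          have h4 : HasDerivAt (fun x => T₀ * (1 - (x - a) / (b - a))) (-(T₀ / (b - a))) t := by
            have := ((((hasDerivAt_id t).sub_const a).div_const (b - a)).const_sub 1).const_mul T₀
            exact this.congr_deriv (by ring)
          exact ((h1.sub_const _).sub h4).congr_deriv (by ring)
        refine nonneg_of_max_left hd ?_
        filter_upwards [Ioo_mem_nhdsLT hat] with x hx
        have := hmax (show (x, s) ∈ Icc a b ×ˢ Icc m X from ⟨⟨hx.1.le, hx.2.le.trans ht.2⟩, hs⟩)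
        simpa only [hZ, mem_ofPred_eq] using this
      have h5 := h_int t ⟨hat, ht.2⟩ s ⟨h0, hsX⟩ hsξ' (by linarith) hpos
      rw [h.eq_pos t htI s ⟨h0, hsX⟩] at h3
      have h6 : n / s * wr t s ≤ 0 := by
        have : wr t s = - φ1 (X - s) := by linarith
        rw [this]
        have := hφpos (X - s) (by linarith) hsξ'
        have h7 : 0 ≤ n / s := by positivity
        nlinarith
      linarith
  intro t' ht' s' hs' hsξ
  have := hmax (show (t', s') ∈ Icc a b ×ˢ Icc m X from
    ⟨ht', max_le hs'.1 (by linarith), hs'.2⟩)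
  simp only [hZ, mem_ofPred_eq] at this key
  linarith

/-- Two-point comparison for ordered pairs of radii. -/
theorem RadSol.two_point {n X a b ξ T₀ : ℝ} {w wr wrr wt g : ℝ → ℝ → ℝ} {I : Set ℝ}
    {φ φ1 φ2 : ℝ → ℝ} (hn : 0 ≤ n) (hX : 0 < X) (hab : a < b) (hI : Ioc a b ⊆ I)
    (h : RadSol n w wr wrr wt g I X)
    (hc : ContinuousOn (fun p : ℝ × ℝ => w p.1 p.2) (Icc a b ×ˢ Icc 0 X))
    (hφc : Continuous φ) (hφ0 : 0 ≤ φ 0) (hT₀ : 0 ≤ T₀)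
    (hφ1 : ∀ y, 0 < y → HasDerivAt φ (φ1 y) y)
    (hφ2 : ∀ y, 0 < y → HasDerivAt φ1 (φ2 y) y)
    (hφpos : ∀ y, 0 < y → y < ξ → 0 < φ1 y)
    (h_init : ∀ r ∈ Icc 0 X, ∀ s ∈ Icc 0 X, s ≤ r → r - s ≤ ξ →
      w a r - w a s - φ (r - s) - T₀ ≤ 0)
    (h_far : ∀ t ∈ Icc a b, ∀ r ∈ Icc 0 X, ∀ s ∈ Icc 0 X, r - s = ξ →
      w t r - w t s - φ ξ - T₀ * (1 - (t - a) / (b - a)) ≤ 0)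
    (h_bd : ∀ t ∈ Icc a b, ∀ s ∈ Icc 0 X, X - s ≤ ξ →
      w t X - w t s - φ (X - s) - T₀ * (1 - (t - a) / (b - a)) ≤ 0)
    (h_int : ∀ t ∈ Ioc a b, ∀ r ∈ Ioo 0 X, ∀ s ∈ Ioo 0 X, s < r → r - s < ξ →
      wr t r = φ1 (r - s) → wr t s = φ1 (r - s) →
      0 < w t r - w t s - φ (r - s) - T₀ * (1 - (t - a) / (b - a)) →
      g t r - g t s + 2 * φ2 (r - s) + T₀ / (b - a) < 0) :
    ∀ t ∈ Icc a b, ∀ r ∈ Icc 0 X, ∀ s ∈ Icc 0 X, s ≤ r → r - s ≤ ξ →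
      w t r - w t s ≤ φ (r - s) + T₀ * (1 - (t - a) / (b - a)) := by
  set Z : ℝ × ℝ × ℝ → ℝ := fun p => w p.1 p.2.1 - w p.1 p.2.2 - φ (p.2.1 - p.2.2)
    - T₀ * (1 - (p.1 - a) / (b - a)) with hZ
  set S : Set (ℝ × ℝ × ℝ) := (Icc a b ×ˢ Icc 0 X ×ˢ Icc 0 X) ∩
    {p | p.2.2 ≤ p.2.1 ∧ p.2.1 - p.2.2 ≤ ξ} with hS
  have hK : IsCompact S := by
    refine (isCompact_Icc.prod (isCompact_Icc.prod isCompact_Icc)).inter_right ?_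
    have c1 : IsClosed {p : ℝ × ℝ × ℝ | p.2.2 ≤ p.2.1} := isClosed_le (by fun_prop) (by fun_prop)
    have c2 : IsClosed {p : ℝ × ℝ × ℝ | p.2.1 - p.2.2 ≤ ξ} :=
      isClosed_le (by fun_prop) (by fun_prop)
    exact c1.inter c2
  intro t' ht' r' hr' s' hs' hsr' hξ'
  have hmem : (t', r', s') ∈ S := ⟨⟨ht', hr', hs'⟩, hsr', hξ'⟩
  have hZc : ContinuousOn Z S := by
    refine ContinuousOn.sub (ContinuousOn.sub (ContinuousOn.sub ?_ ?_) ?_) ?_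
    · exact hc.comp (f := fun p : ℝ × ℝ × ℝ => (p.1, p.2.1)) (by fun_prop)
        (fun p hp => ⟨hp.1.1, hp.1.2.1⟩)
    · exact hc.comp (f := fun p : ℝ × ℝ × ℝ => (p.1, p.2.2)) (by fun_prop)
        (fun p hp => ⟨hp.1.1, hp.1.2.2⟩)
    · exact (hφc.comp (by fun_prop)).continuousOn
    · fun_prop
  obtain ⟨⟨t, r, s⟩, ⟨⟨ht, hr, hs⟩, hsr, hrs⟩, hmax⟩ := hK.exists_isMaxOn ⟨_, hmem⟩ hZc
  have key : Z (t, r, s) ≤ 0 := by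
    by_contra hpos
    push Not at hpos
    simp only [hZ] at hpos
    simp only at ht hr hs hsr hrs
    have hfrac : 0 ≤ T₀ * (1 - (t - a) / (b - a)) := by
      refine mul_nonneg hT₀ (sub_nonneg.2 ((div_le_one (by linarith)).2 (by linarith [ht.2])))
    have hat : a < t := by
      rcases eq_or_lt_of_le ht.1 with h' | h'
      · subst h'
        have := h_init r hr s hs hsr hrs
        simp at hpos
        linarith
      · exact h'
    have hlt : s < r := by
      rcases eq_or_lt_of_le hsr with h' | h'
      · subst h'
        simp only [sub_self] at hpos
        linarith
      · exact h'
    have hrX : r < X := by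
      rcases eq_or_lt_of_le hr.2 with h' | h'
      · subst h'
        have := h_bd t ht s hs hrs
        linarith
      · exact h'
    have hsξ' : r - s < ξ := by
      rcases eq_or_lt_of_le hrs with h' | h'
      · have := h_far t ht r hr s hs h'
        rw [h'] at hpos
        linarith
      · exact h'
    have htI : t ∈ I := hI ⟨hat, ht.2⟩
    have hders : ∀ x ∈ Ioo (-X) r, HasDerivAt (fun x => - w t x - φ (r - x))
        (- wr t x + φ1 (r - x)) x := by
      intro x hx
      have h1 := h.dr t htI x ⟨hx.1, hx.2.trans hrX⟩
      have h2 := (hφ1 (r - x) (by linarith [hx.2])).comp x ((hasDerivAt_id x).const_sub r)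
      exact (h1.neg.sub h2).congr_deriv (by ring)
    have hderr : ∀ x ∈ Ioo s X, HasDerivAt (fun x => w t x - φ (x - s))
        (wr t x - φ1 (x - s)) x := by
      intro x hx
      have h1 := h.dr t htI x ⟨by linarith [hx.1, hs.1], hx.2⟩
      have h2 := (hφ1 (x - s) (by linarith [hx.1])).comp x ((hasDerivAt_id x).sub_const s)
      exact (h1.sub h2).congr_deriv (by ring)
    have hcmps : ∀ x, 0 ≤ x → x ≤ r → r - x ≤ ξ →
        - w t x - φ (r - x) ≤ - w t s - φ (r - s) := by
      intro x h1 h2 h3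
      have := hmax (show (t, r, x) ∈ S from ⟨⟨ht, hr, h1, h2.trans hr.2⟩, h2, h3⟩)
      simp only [hZ, mem_ofPred_eq] at this
      linarith
    have hcmpr : ∀ x, s ≤ x → x ≤ X → x - s ≤ ξ →
        w t x - φ (x - s) ≤ w t r - φ (r - s) := by
      intro x h1 h2 h3
      have := hmax (show (t, x, s) ∈ S from ⟨⟨ht, ⟨hs.1.trans h1, h2⟩, hs⟩, h1, h3⟩)
      simp only [hZ, mem_ofPred_eq] at this
      linarith
    rcases eq_or_lt_of_le hs.1 with h0 | h0
    · have h1 := hders s ⟨by linarith, hlt⟩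
      have h2 : - wr t s + φ1 (r - s) ≤ 0 := by
        refine nonpos_of_max_right h1 ?_
        filter_upwards [Ioo_mem_nhdsGT hlt] with x hx
        exact hcmps x (hs.1.trans hx.1.le) hx.2.le (by linarith [hx.1])
      rw [← h0, h.axis t htI] at h2
      have := hφpos (r - 0) (by linarith) (by linarith)
      linarith
    · have hevs : ∀ᶠ x in 𝓝 s, x ∈ Ioo (max 0 (r - ξ)) r :=
        Ioo_mem_nhds (max_lt h0 (by linarith)) hlt
      have hevr : ∀ᶠ x in 𝓝 r, x ∈ Ioo s (min X (s + ξ)) :=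
        Ioo_mem_nhds hlt (lt_min hrX (by linarith))
      have h2s : HasDerivAt (fun x => - wr t x + φ1 (r - x)) (- wrr t s - φ2 (r - s)) s := by
        have h1 := h.drr t htI s ⟨by linarith, hlt.trans hrX⟩
        have h2 := (hφ2 (r - s) (by linarith)).comp s ((hasDerivAt_id s).const_sub r)
        exact (h1.neg.add h2).congr_deriv (by ring)
      have h2r : HasDerivAt (fun x => wr t x - φ1 (x - s)) (wrr t r - φ2 (r - s)) r := by
        have h1 := h.drr t htI r ⟨by linarith, hrX⟩
        have h2 := (hφ2 (r - s) (by linarith)).comp r ((hasDerivAt_id r).sub_const s)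
        exact (h1.sub h2).congr_deriv (by ring)
      obtain ⟨e1, e2⟩ := deriv_conditions_of_localMax (f := fun x => - w t x - φ (r - x))
        (f1 := fun x => - wr t x + φ1 (r - x))
        (by filter_upwards [hevs] with x hx
            exact hders x ⟨by linarith [hx.1, le_max_left 0 (r - ξ)], hx.2⟩) h2s
        (by filter_upwards [hevs] with x hx
            exact hcmps x ((le_max_left _ _).trans hx.1.le) hx.2.le
              (by linarith [hx.1, le_max_right 0 (r - ξ)]))
      obtain ⟨e3, e4⟩ := deriv_conditions_of_localMax (f := fun x => w t x - φ (x - s))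
        (f1 := fun x => wr t x - φ1 (x - s))
        (by filter_upwards [hevr] with x hx
            exact hderr x ⟨hx.1, hx.2.trans_le (min_le_left _ _)⟩) h2r
        (by filter_upwards [hevr] with x hx
            exact hcmpr x hx.1.le (hx.2.le.trans (min_le_left _ _))
              (by linarith [hx.2, min_le_right X (s + ξ)]))
      have h3 : 0 ≤ wt t r - wt t s + T₀ / (b - a) := by
        have hd : HasDerivAt (fun x => w x r - w x s - φ (r - s) - T₀ * (1 - (x - a) / (b - a)))
            (wt t r - wt t s + T₀ / (b - a)) t := by
          have h1 := h.dt t htI r ⟨hr.1, hrX⟩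
          have h1' := h.dt t htI s ⟨hs.1, hlt.trans hrX⟩
          have h4 : HasDerivAt (fun x => T₀ * (1 - (x - a) / (b - a))) (-(T₀ / (b - a))) t := by
            have := ((((hasDerivAt_id t).sub_const a).div_const (b - a)).const_sub 1).const_mul T₀
            exact this.congr_deriv (by ring)
          exact (((h1.sub h1').sub_const _).sub h4).congr_deriv (by ring)
        refine nonneg_of_max_left hd ?_
        filter_upwards [Ioo_mem_nhdsLT hat] with x hx
        have := hmax (show (x, r, s) ∈ S from ⟨⟨⟨hx.1.le, hx.2.le.trans ht.2⟩, hr, hs⟩, hsr, hrs⟩)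
        simpa only [hZ, mem_ofPred_eq] using this
      have hwr : wr t r = φ1 (r - s) := by linarith
      have hws : wr t s = φ1 (r - s) := by linarith
      have h5 := h_int t ⟨hat, ht.2⟩ r ⟨h0.trans hlt, hrX⟩ s ⟨h0, hlt.trans hrX⟩ hlt hsξ' hwr hws hpos
      rw [h.eq_pos t htI s ⟨h0, hlt.trans hrX⟩, h.eq_pos t htI r ⟨h0.trans hlt, hrX⟩,
        hwr, hws] at h3
      have h6 : n / r * φ1 (r - s) ≤ n / s * φ1 (r - s) :=
        mul_le_mul_of_nonneg_right (div_le_div_of_nonneg_left hn h0 hlt.le)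
          (hφpos (r - s) (by linarith) hsξ').le
      linarith
  have := hmax hmem
  simp only [hZ, mem_ofPred_eq] at this key
  linarith

theorem RadSol.neg {n X : ℝ} {w wr wrr wt g : ℝ → ℝ → ℝ} {I : Set ℝ}
    (h : RadSol n w wr wrr wt g I X) :
    RadSol n (fun t r => - w t r) (fun t r => - wr t r) (fun t r => - wrr t r)
      (fun t r => - wt t r) (fun t r => - g t r) I X where
  dr t ht r hr := (h.dr t ht r hr).fun_neg
  drr t ht r hr := (h.drr t ht r hr).fun_neg
  dt t ht r hr := (h.dt t ht r hr).fun_neg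
  axis t ht := by simp [h.axis t ht]
  eq_pos t ht r hr := by rw [h.eq_pos t ht r hr]; ring
  eq_zero t ht hX := by rw [h.eq_zero t ht hX]; ring

theorem RadSol.shift {n X : ℝ} {w wr wrr wt g : ℝ → ℝ → ℝ} {I : Set ℝ}
    (h : RadSol n w wr wrr wt g I X) (k : ℝ) :
    RadSol n (fun t r => w (t + k) r) (fun t r => wr (t + k) r) (fun t r => wrr (t + k) r)
      (fun t r => wt (t + k) r) (fun t r => g (t + k) r) {t | t + k ∈ I} X where
  dr t ht r hr := h.dr _ ht r hr
  drr t ht r hr := h.drr _ ht r hr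
  dt t ht r hr := HasDerivAt.comp_add_const t k (h.dt _ ht r hr)
  axis t ht := h.axis _ ht
  eq_pos t ht r hr := h.eq_pos _ ht r hr
  eq_zero t ht hX := h.eq_zero _ ht hX

/-- Linear combination of two solutions. -/
theorem RadSol.lin {n X : ℝ} {w wr wrr wt g v vr vrr vt k : ℝ → ℝ → ℝ} {I J : Set ℝ}
    (h : RadSol n w wr wrr wt g I X) (h' : RadSol n v vr vrr vt k J X) (α β : ℝ) :
    RadSol n (fun t r => α * w t r + β * v t r) (fun t r => α * wr t r + β * vr t r)
      (fun t r => α * wrr t r + β * vrr t r)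
      (fun t r => α * wt t r + β * vt t r) (fun t r => α * g t r + β * k t r) (I ∩ J) X where
  dr t ht r hr := ((h.dr t ht.1 r hr).const_mul α).fun_add ((h'.dr t ht.2 r hr).const_mul β)
  drr t ht r hr := ((h.drr t ht.1 r hr).const_mul α).fun_add ((h'.drr t ht.2 r hr).const_mul β)
  dt t ht r hr := ((h.dt t ht.1 r hr).const_mul α).fun_add ((h'.dt t ht.2 r hr).const_mul β)
  axis t ht := by simp [h.axis t ht.1, h'.axis t ht.2]
  eq_pos t ht r hr := by rw [h.eq_pos t ht.1 r hr, h'.eq_pos t ht.2 r hr]; ring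
  eq_zero t ht hX := by rw [h.eq_zero t ht.1 hX, h'.eq_zero t ht.2 hX]; ring

/-- Parabolic rescaling. -/
theorem RadSol.rescale {n X : ℝ} {w wr wrr wt g : ℝ → ℝ → ℝ} {I : Set ℝ}
    (h : RadSol n w wr wrr wt g I X) {l : ℝ} (hl : 0 < l) (c μ : ℝ) :
    RadSol n (fun t r => w (c + l ^ 2 * t) (l * r) - μ) (fun t r => l * wr (c + l ^ 2 * t) (l * r))
      (fun t r => l ^ 2 * wrr (c + l ^ 2 * t) (l * r))
      (fun t r => l ^ 2 * wt (c + l ^ 2 * t) (l * r))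
      (fun t r => l ^ 2 * g (c + l ^ 2 * t) (l * r)) {t | c + l ^ 2 * t ∈ I} (X / l) where
  dr t ht r hr := by
    have hm : l * r ∈ Ioo (-X) X := by
      constructor
      · have := hr.1; rw [← neg_div, div_lt_iff₀ hl] at this; linarith
      · have := hr.2; rw [lt_div_iff₀ hl] at this; linarith
    have := (h.dr _ ht _ hm).comp r ((hasDerivAt_id r).const_mul l)
    exact (this.sub_const μ).congr_deriv (by ring)
  drr t ht r hr := by
    have hm : l * r ∈ Ioo (-X) X := by
      constructor
      · have := hr.1; rw [← neg_div, div_lt_iff₀ hl] at this; linarith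
      · have := hr.2; rw [lt_div_iff₀ hl] at this; linarith
    have := (h.drr _ ht _ hm).comp r ((hasDerivAt_id r).const_mul l)
    exact (this.const_mul l).congr_deriv (by ring)
  dt t ht r hr := by
    have hm : l * r ∈ Ico 0 X := by
      constructor
      · exact mul_nonneg hl.le hr.1
      · have := hr.2; rw [lt_div_iff₀ hl] at this; linarith
    have := (h.dt _ ht _ hm).comp t (((hasDerivAt_id t).const_mul (l ^ 2)).const_add c)
    exact (this.sub_const μ).congr_deriv (by ring)
  axis t ht := by simp [h.axis _ ht]
  eq_pos t ht r hr := by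
    have hm : l * r ∈ Ioo 0 X := by
      constructor
      · exact mul_pos hl hr.1
      · have := hr.2; rw [lt_div_iff₀ hl] at this; linarith
    rw [h.eq_pos _ ht _ hm]
    have := hr.1
    field_simp
  eq_zero t ht hX := by
    have hX' : 0 < X := by
      by_contra hn; push Not at hn
      exact absurd hX (not_lt.2 (div_nonpos_of_nonpos_of_nonneg hn hl.le))
    rw [mul_zero, h.eq_zero _ ht hX']
    ring

theorem RadSol.comp {n X : ℝ} {w wr wrr wt g : ℝ → ℝ → ℝ} {I : Set ℝ}
    (h : RadSol n w wr wrr wt g I X) {H H1 H2 : ℝ → ℝ} {D : Set ℝ}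
    (hD : ∀ t ∈ I, ∀ r ∈ Ioo (-X) X, w t r ∈ D)
    (h1 : ∀ y ∈ D, HasDerivAt H (H1 y) y) (h2 : ∀ y ∈ D, HasDerivAt H1 (H2 y) y) :
    RadSol n (fun t r => H (w t r)) (fun t r => H1 (w t r) * wr t r)
      (fun t r => H1 (w t r) * wrr t r + H2 (w t r) * wr t r ^ 2)
      (fun t r => H1 (w t r) * wt t r)
      (fun t r => H1 (w t r) * g t r - H2 (w t r) * wr t r ^ 2) I X where
  dr t ht r hr := (h1 _ (hD t ht r hr)).comp r (h.dr t ht r hr)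
  drr t ht r hr := by
    have := ((h2 _ (hD t ht r hr)).comp r (h.dr t ht r hr)).fun_mul (h.drr t ht r hr)
    exact this.congr_deriv (by simp only [Function.comp]; ring)
  dt t ht r hr := by
    have hr' : r ∈ Ioo (-X) X := ⟨by linarith [hr.1, hr.2], hr.2⟩
    exact (h1 _ (hD t ht r hr')).comp t (h.dt t ht r hr)
  axis t ht := by simp [h.axis t ht]
  eq_pos t ht r hr := by rw [h.eq_pos t ht r hr]; ring
  eq_zero t ht hX := by rw [h.eq_zero t ht hX, h.axis t ht]; ring

/-- The change of variables straightening the one-dimensional stationary profile. -/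
def straight (μ w : ℝ) : ℝ := (log (1 + √(1 - exp (w - μ))) - log (1 - √(1 - exp (w - μ)))) / 2

theorem one_sub_exp_pos {μ w : ℝ} (h : w < μ) : 0 < 1 - exp (w - μ) := by
  have : exp (w - μ) < 1 := by rw [exp_lt_one_iff]; linarith
  linarith

theorem hasDerivAt_sqrt_one_sub_exp {μ w : ℝ} (h : w < μ) :
    HasDerivAt (fun w => √(1 - exp (w - μ))) (-exp (w - μ) / (2 * √(1 - exp (w - μ)))) w := by
  have h1 := ((((hasDerivAt_id w).sub_const μ).exp).const_sub 1).sqrt (one_sub_exp_pos h).ne'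
  exact h1.congr_deriv (by simp)

theorem hasDerivAt_straight {μ w : ℝ} (h : w < μ) :
    HasDerivAt (straight μ) (-(1 / (2 * √(1 - exp (w - μ))))) w := by
  have hp := one_sub_exp_pos h
  have hy := sqrt_pos.2 hp
  have hs := hasDerivAt_sqrt_one_sub_exp h
  have hsq := sq_sqrt hp.le
  have he := exp_pos (w - μ)
  have hy1 : √(1 - exp (w - μ)) < 1 := by nlinarith
  have h1 := (hs.const_add 1).log (by positivity)
  have h2 := (hs.const_sub 1).log (sub_ne_zero.2 hy1.ne')
  refine ((h1.sub h2).div_const 2).congr_deriv ?_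
  have e : exp (w - μ) = (1 + √(1 - exp (w - μ))) * (1 - √(1 - exp (w - μ))) := by nlinarith
  set y := √(1 - exp (w - μ))
  rw [e]
  have : 1 - y ≠ 0 := sub_ne_zero.2 hy1.ne'
  field_simp
  ring

theorem hasDerivAt_straight_deriv {μ w : ℝ} (h : w < μ) :
    HasDerivAt (fun w => -(1 / (2 * √(1 - exp (w - μ)))))
      (-(exp (w - μ) / (4 * √(1 - exp (w - μ)) ^ 3))) w := by
  have hp := one_sub_exp_pos h
  have hy := sqrt_pos.2 hp
  have hs := hasDerivAt_sqrt_one_sub_exp h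
  have h1 := ((hs.const_mul 2).inv (by positivity)).neg
  have h2 : (fun w => -(1 / (2 * √(1 - exp (w - μ))))) =
    -(fun w => 2 * √(1 - exp (w - μ)))⁻¹ := by ext; simp
  rw [h2]
  refine h1.congr_deriv ?_
  field_simp
  ring

theorem straight_sub_mem {μ a b : ℝ} (hab : a ≤ b) (hb : b ≤ μ - 1) :
    (b - a) / 2 ≤ straight μ a - straight μ b ∧ straight μ a - straight μ b ≤ b - a := by
  rcases eq_or_lt_of_le hab with rfl | hab
  · simp
  obtain ⟨c, hc, hc'⟩ := exists_hasDerivAt_eq_slope (straight μ) _ hab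
    (fun x hx => (hasDerivAt_straight (by linarith [hx.2])).continuousAt.continuousWithinAt)
    (fun x hx => hasDerivAt_straight (μ := μ) (by linarith [hx.2]))
  have hp := one_sub_exp_pos (show c < μ by linarith [hc.2])
  have he := exp_pos (c - μ)
  have he' : exp (c - μ) ≤ 1 / 2 := by
    have h1 : exp (c - μ) ≤ exp (-1) := exp_le_exp.2 (by linarith [hc.2])
    have := exp_neg_one_lt_d9
    linarith
  have hsq := sq_sqrt hp.le
  have hy := sqrt_pos.2 hp
  have l1 : √(1 - exp (c - μ)) ≤ 1 := by nlinarith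
  have l2 : 1 / 2 ≤ √(1 - exp (c - μ)) := by nlinarith
  have e : straight μ a - straight μ b = (1 / (2 * √(1 - exp (c - μ)))) * (b - a) := by
    have : b - a ≠ 0 := by linarith
    rw [eq_div_iff this] at hc'
    linarith
  rw [e]
  constructor
  · have : 1 / 2 ≤ 1 / (2 * √(1 - exp (c - μ))) :=
      one_div_le_one_div_of_le (by positivity) (by linarith)
    nlinarith
  · have : 1 / (2 * √(1 - exp (c - μ))) ≤ 1 := by
      rw [div_le_one (by positivity)]; linarith
    nlinarith

theorem straight_source_lt {μ a b : ℝ} (hab : a < b) (hb : b < μ) :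
    exp (a - μ) / √(1 - exp (a - μ)) < exp (b - μ) / √(1 - exp (b - μ)) := by
  have h1 : exp (a - μ) < exp (b - μ) := exp_lt_exp.2 (by linarith)
  exact div_lt_div₀ h1 (sqrt_le_sqrt (by linarith)) (exp_pos _).le
    (sqrt_pos.2 (one_sub_exp_pos hb))

/-- If `θ_r² = e^μ`, the source of the straightened equation is explicit. -/
theorem straight_source {μ w wr : ℝ} (h : w < μ)
    (hl : (-(1 / (2 * √(1 - exp (w - μ)))) * wr) ^ 2 = exp μ) :
    -(1 / (2 * √(1 - exp (w - μ)))) * exp w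
      - -(exp (w - μ) / (4 * √(1 - exp (w - μ)) ^ 3)) * wr ^ 2 =
    exp μ / 2 * (exp (w - μ) / √(1 - exp (w - μ))) := by
  have hy := sqrt_pos.2 (one_sub_exp_pos h)
  have e : exp w = exp μ * exp (w - μ) := by rw [← exp_add]; ring_nf
  set y := √(1 - exp (w - μ))
  have : wr ^ 2 = 4 * y ^ 2 * exp μ := by rw [← hl]; field_simp; ring
  rw [this, e]
  field_simp
  ring

/-- Gradient bound at the scale of the maximum. -/
theorem RadSol.lipschitz {n X b μ : ℝ} {w wr wrr wt : ℝ → ℝ → ℝ} {I : Set ℝ}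
    (hn : 0 ≤ n) (hX : 0 < X) (hb : 0 < b) (hI : Ioc 0 b ⊆ I)
    (h : RadSol n w wr wrr wt (fun t r => exp (w t r)) I X)
    (hc : ContinuousOn (fun p : ℝ × ℝ => w p.1 p.2) (Icc 0 b ×ˢ Icc 0 X))
    (hsym : ∀ t r, w t (-r) = w t r)
    (hw0 : ∀ t ∈ Icc 0 b, ∀ r ∈ Icc 0 X, 0 ≤ w t r)
    (hbd : ∀ t ∈ Icc 0 b, w t X = 0)
    (hμ : ∀ t ∈ Icc 0 b, ∀ r ∈ Icc 0 X, w t r ≤ μ - 1)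
    (hin : ∀ r ∈ Icc 0 X, ∀ s ∈ Icc 0 X, |w 0 r - w 0 s| ≤ exp (μ / 2) * |r - s|) :
    ∀ t ∈ Icc 0 b, ∀ r ∈ Icc 0 X, ∀ s ∈ Icc 0 X,
      |w t r - w t s| ≤ 2 * exp (μ / 2) * |r - s| := by
  set l := exp (μ / 2) with hl
  have hlpos : 0 < l := exp_pos _
  have hl2 : l ^ 2 = exp μ := by rw [hl, ← exp_nat_mul]; ring_nf
  have hD : ∀ t ∈ Ioc 0 b, ∀ r ∈ Ioo (-X) X, w t r ∈ Iio μ := by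
    intro t ht r hr
    rcases le_total 0 r with h0 | h0
    · have := hμ t ⟨ht.1.le, ht.2⟩ r ⟨h0, hr.2.le⟩
      exact mem_Iio.2 (by linarith)
    · have := hμ t ⟨ht.1.le, ht.2⟩ (-r) ⟨by linarith, by linarith [hr.1]⟩
      rw [hsym] at this
      exact mem_Iio.2 (by linarith)
  have hθ := (h.mono hI le_rfl).comp hD (fun y hy => hasDerivAt_straight hy)
    (fun y hy => hasDerivAt_straight_deriv hy)
  have hlt : ∀ {t r : ℝ}, t ∈ Icc 0 b → r ∈ Icc 0 X → w t r < μ :=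
    fun {t r} ht hr => by linarith [hμ t ht r hr]
  have hθc : ContinuousOn (fun p : ℝ × ℝ => straight μ (w p.1 p.2)) (Icc 0 b ×ˢ Icc 0 X) := by
    intro p hp
    exact ContinuousAt.comp_continuousWithinAt (g := straight μ)
      (hasDerivAt_straight (hlt hp.1 hp.2)).continuousAt (hc p hp)
  have hφ1 : ∀ y : ℝ, 0 < y → HasDerivAt (fun y => l * y) ((fun _ => l) y) y :=
    fun y _ => by simpa using (hasDerivAt_id y).const_mul l
  have hφ2 : ∀ y : ℝ, 0 < y → HasDerivAt (fun _ : ℝ => l) ((fun _ => (0 : ℝ)) y) y :=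
    fun y _ => hasDerivAt_const _ _
  have hstr : ∀ {t r s : ℝ}, t ∈ Icc 0 b → r ∈ Icc 0 X → s ∈ Icc 0 X → w t r ≤ w t s →
      (w t s - w t r) / 2 ≤ straight μ (w t r) - straight μ (w t s) ∧
      straight μ (w t r) - straight μ (w t s) ≤ w t s - w t r :=
    fun {t r s} ht hr hs hrs => straight_sub_mem hrs (hμ t ht s hs)
  have h00 : (0 : ℝ) ∈ Icc 0 b := ⟨le_rfl, hb.le⟩
  have hXX : X ∈ Icc 0 X := ⟨hX.le, le_rfl⟩
  have hin' : ∀ r ∈ Icc 0 X, ∀ s ∈ Icc 0 X, s ≤ r →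
      straight μ (w 0 r) - straight μ (w 0 s) ≤ l * (r - s) := by
    intro r hr s hs hsr
    have h1 := hin r hr s hs
    rw [abs_of_nonneg (sub_nonneg.2 hsr)] at h1
    have h1' := abs_le.1 h1
    rcases le_total (w 0 r) (w 0 s) with h2 | h2
    · linarith [(hstr h00 hr hs h2).2]
    · have := (hstr h00 hs hr h2).1
      have : 0 ≤ l * (r - s) := mul_nonneg hlpos.le (by linarith)
      linarith
  have hin'' : ∀ r ∈ Icc 0 X, ∀ s ∈ Icc 0 X, s ≤ r →
      straight μ (w 0 s) - straight μ (w 0 r) ≤ l * (r - s) := by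
    intro r hr s hs hsr
    have h1 := hin r hr s hs
    rw [abs_of_nonneg (sub_nonneg.2 hsr)] at h1
    have h1' := abs_le.1 h1
    rcases le_total (w 0 s) (w 0 r) with h2 | h2
    · linarith [(hstr h00 hs hr h2).2]
    · have := (hstr h00 hr hs h2).1
      have : 0 ≤ l * (r - s) := mul_nonneg hlpos.le (by linarith)
      linarith
  have hmono : ∀ {t r s : ℝ}, t ∈ Icc 0 b → r ∈ Icc 0 X → s ∈ Icc 0 X →
      straight μ (w t s) < straight μ (w t r) → w t r < w t s := by
    intro t r s ht hr hs hh
    by_contra hcon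
    push Not at hcon
    linarith [(hstr ht hs hr hcon).1]
  have hsource : ∀ {t r : ℝ}, t ∈ Icc 0 b → r ∈ Icc 0 X →
      (-(1 / (2 * √(1 - exp (w t r - μ)))) * wr t r) ^ 2 = l ^ 2 →
      -(1 / (2 * √(1 - exp (w t r - μ)))) * exp (w t r)
        - -(exp (w t r - μ) / (4 * √(1 - exp (w t r - μ)) ^ 3)) * wr t r ^ 2 =
      exp μ / 2 * (exp (w t r - μ) / √(1 - exp (w t r - μ))) := by
    intro t r ht hr he
    exact straight_source (hlt ht hr) (by rw [he, hl2])
  have hbound : ∀ t ∈ Icc 0 b, ∀ s ∈ Icc 0 X,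
      straight μ (w t X) - straight μ (w t s) ≤ l * (X - s) := by
    intro t ht s hs
    have hop := RadSol.one_point (ξ := X + 1) (T₀ := 0) (φ := fun y => l * y) (φ1 := fun _ => l)
      (φ2 := fun _ => 0) hn hX hb (le_refl _)
      ((hθ.neg).comp (H := fun y => straight μ 0 + y) (H1 := fun _ => 1) (H2 := fun _ => 0)
        (D := univ) (fun _ _ _ _ => mem_univ _)
        (fun y _ => by simpa using (hasDerivAt_id y).const_add (straight μ 0))
        (fun y _ => hasDerivAt_const _ _))
      (by
        refine ContinuousOn.add continuousOn_const hθc.neg)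
      (by linarith) (by fun_prop) hφ1 hφ2 (fun _ _ _ => hlpos)
      (by
        intro s hs _
        have := hin' X hXX s hs hs.2
        rw [hbd 0 h00] at this
        linarith)
      (by intro t _ h'; linarith)
      (by intro t ht; rw [hbd t ht]; simp)
      (by
        intro t ht s hs _ he _
        have ht' : t ∈ Icc 0 b := ⟨ht.1.le, ht.2⟩
        have hs' : s ∈ Icc 0 X := ⟨hs.1.le, hs.2.le⟩
        have e := hsource ht' hs' (by
          have : -(1 / (2 * √(1 - exp (w t s - μ)))) * wr t s = l := by linarith
          rw [this])
        have hp : 0 < exp μ / 2 * (exp (w t s - μ) / √(1 - exp (w t s - μ))) := by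
          have := sqrt_pos.2 (one_sub_exp_pos (hlt ht' hs'))
          have := exp_pos μ
          have := exp_pos (w t s - μ)
          positivity
        simp only [zero_div, one_mul, zero_mul]
        linarith)
      t ht s hs (by linarith [hs.1])
    rw [hbd t ht]
    linarith
  have up := RadSol.two_point (ξ := X + 1) (T₀ := 0) (φ := fun y => l * y) (φ1 := fun _ => l)
      (φ2 := fun _ => 0) hn hX hb (le_refl _) hθ hθc (by fun_prop) (by simp) le_rfl
      hφ1 hφ2 (fun _ _ _ => hlpos)
      (by intro r hr s hs hsr _; linarith [hin' r hr s hs hsr])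
      (by intro t _ r hr s hs he; linarith [hr.2, hs.1])
      (by intro t ht s hs _; linarith [hbound t ht s hs])
      (by
        intro t ht r hr s hs hsr _ her hes hpos
        have ht' : t ∈ Icc 0 b := ⟨ht.1.le, ht.2⟩
        have hr' : r ∈ Icc 0 X := ⟨hr.1.le, hr.2.le⟩
        have hs' : s ∈ Icc 0 X := ⟨hs.1.le, hs.2.le⟩
        have e1 := hsource ht' hr' (by rw [her])
        have e2 := hsource ht' hs' (by rw [hes])
        have hlr : 0 < l * (r - s) := mul_pos hlpos (by linarith)
        have hw := hmono ht' hr' hs' (by linarith)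
        have := straight_source_lt hw (hlt ht' hs')
        have := mul_lt_mul_of_pos_left this (half_pos (exp_pos μ))
        simp only [zero_div, mul_zero]
        linarith)
  have down := RadSol.two_point (ξ := X + 1) (T₀ := 0) (φ := fun y => l * y) (φ1 := fun _ => l)
      (φ2 := fun _ => 0) hn hX hb (le_refl _) hθ.neg hθc.neg (by fun_prop) (by simp) le_rfl
      hφ1 hφ2 (fun _ _ _ => hlpos)
      (by intro r hr s hs hsr _; linarith [hin'' r hr s hs hsr])
      (by intro t _ r hr s hs he; linarith [hr.2, hs.1])
      (by
        intro t ht s hs _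
        have h1 := (hstr ht hXX hs (by rw [hbd t ht]; exact hw0 t ht s hs)).1
        rw [hbd t ht] at h1 ⊢
        have := hw0 t ht s hs
        have : 0 ≤ l * (X - s) := mul_nonneg hlpos.le (by linarith [hs.2])
        linarith)
      (by
        intro t ht r hr s hs hsr _ her hes hpos
        have ht' : t ∈ Icc 0 b := ⟨ht.1.le, ht.2⟩
        have hr' : r ∈ Icc 0 X := ⟨hr.1.le, hr.2.le⟩
        have hs' : s ∈ Icc 0 X := ⟨hs.1.le, hs.2.le⟩
        have e1 := hsource ht' hr' (by rw [← her]; ring)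
        have e2 := hsource ht' hs' (by rw [← hes]; ring)
        have hlr : 0 < l * (r - s) := mul_pos hlpos (by linarith)
        have hw := hmono ht' hs' hr' (by linarith)
        have := straight_source_lt hw (hlt ht' hr')
        have := mul_lt_mul_of_pos_left this (half_pos (exp_pos μ))
        simp only [zero_div, mul_zero]
        linarith)
  have main : ∀ t ∈ Icc 0 b, ∀ r ∈ Icc 0 X, ∀ s ∈ Icc 0 X, s ≤ r →
      |w t r - w t s| ≤ 2 * l * |r - s| := by
    intro t ht r hr s hs hsr
    have h1 := up t ht r hr s hs hsr (by linarith [hr.2, hs.1])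
    have h2 := down t ht r hr s hs hsr (by linarith [hr.2, hs.1])
    rw [abs_of_nonneg (sub_nonneg.2 hsr)]
    rcases le_total (w t r) (w t s) with h3 | h3
    · have := (hstr ht hr hs h3).1
      rw [abs_of_nonpos (by linarith)]
      linarith
    · have := (hstr ht hs hr h3).1
      rw [abs_of_nonneg (by linarith)]
      linarith
  intro t ht r hr s hs
  rcases le_total s r with h3 | h3
  · exact main t ht r hr s hs h3
  · rw [abs_sub_comm, abs_sub_comm r s]
    exact main t ht s hs r hr h3

theorem RadSol.smoothing_aux {n X a d A B : ℝ} {w wr wrr wt g : ℝ → ℝ → ℝ} {I : Set ℝ}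
    (hn : 0 ≤ n) (hd : 0 < d) (hdX : d ≤ X) (hA : 0 < A) (hI : Ioc a (a + d ^ 2) ⊆ I)
    (h : RadSol n w wr wrr wt g I X)
    (hc : ContinuousOn (fun p : ℝ × ℝ => w p.1 p.2) (Icc a (a + d ^ 2) ×ˢ Icc 0 X))
    (hw : ∀ t ∈ Icc a (a + d ^ 2), ∀ r ∈ Icc 0 X, |w t r| ≤ A)
    (hg : ∀ t ∈ Ioc a (a + d ^ 2), ∀ r ∈ Ico 0 X, |g t r| ≤ B)
    (hbd : ∀ t ∈ Icc a (a + d ^ 2), w t X = 0) :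
    ∀ r ∈ Icc 0 X, ∀ s ∈ Icc 0 X, s ≤ r →
      w (a + d ^ 2) r - w (a + d ^ 2) s ≤ (6 * A + 2 * B * d ^ 2) / d * (r - s) := by
  have hX : 0 < X := hd.trans_le hdX
  have hd2 : 0 < d ^ 2 := by positivity
  have hB : 0 ≤ B := (abs_nonneg _).trans
    (hg (a + d ^ 2) ⟨by linarith, le_rfl⟩ 0 ⟨le_rfl, hX⟩)
  set Λ := 3 * A + B * d ^ 2 with hΛ
  have hΛpos : 0 < Λ := by positivity
  set φ : ℝ → ℝ := fun y => Λ * (2 * (y / d) - (y / d) ^ 2) with hφ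
  set φ1 : ℝ → ℝ := fun y => Λ * (2 / d - 2 * y / d ^ 2) with hφ1d
  set φ2 : ℝ → ℝ := fun _ => - (2 * Λ / d ^ 2) with hφ2d
  have hφc : Continuous φ := by fun_prop
  have hφ1 : ∀ y : ℝ, 0 < y → HasDerivAt φ (φ1 y) y := by
    intro y _
    have h1 := (hasDerivAt_id y).div_const d
    have := ((h1.const_mul 2).sub (h1.pow 2)).const_mul Λ
    refine this.congr_deriv ?_
    simp only [hφ1d, id, Nat.reduceSub, pow_one, Nat.cast_ofNat]; field_simp
  have hφ2 : ∀ y : ℝ, 0 < y → HasDerivAt φ1 (φ2 y) y := by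
    intro y _
    have := ((((hasDerivAt_id y).const_mul 2).div_const (d ^ 2)).const_sub (2 / d)).const_mul Λ
    refine this.congr_deriv ?_
    simp only [hφ2d]; field_simp
  have hφpos : ∀ y : ℝ, 0 < y → y < d → 0 < φ1 y := by
    intro y hy hyd
    refine mul_pos hΛpos (sub_pos.2 ?_)
    rw [div_lt_div_iff₀ hd2 hd]; nlinarith
  have hφnn : ∀ y : ℝ, 0 ≤ y → y ≤ d → 0 ≤ φ y := by
    intro y hy hyd
    have h1 : y / d ≤ 1 := (div_le_one hd).2 hyd
    have h2 : 0 ≤ y / d := by positivity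
    exact mul_nonneg hΛpos.le (by nlinarith)
  have hφd : φ d = Λ := by simp only [hφ]; rw [div_self hd.ne']; ring
  have hφ0 : φ 0 = 0 := by simp [hφ]
  have hfrac : ∀ t ∈ Icc a (a + d ^ 2), ∀ T₀ : ℝ, 0 ≤ T₀ →
      0 ≤ T₀ * (1 - (t - a) / (a + d ^ 2 - a)) := by
    intro t ht T₀ hT
    refine mul_nonneg hT (sub_nonneg.2 ((div_le_one (by linarith)).2 (by linarith [ht.2])))
  have hφ2v : ∀ y, φ2 y * d ^ 2 = -2 * Λ := by
    intro y; simp only [hφ2d]; field_simp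
  have hop : ∀ {v vr vrr vt k : ℝ → ℝ → ℝ}, RadSol n v vr vrr vt k I X →
      ContinuousOn (fun p : ℝ × ℝ => v p.1 p.2) (Icc a (a + d ^ 2) ×ˢ Icc 0 X) →
      (∀ t ∈ Icc a (a + d ^ 2), ∀ r ∈ Icc 0 X, |v t r| ≤ A) →
      (∀ t ∈ Ioc a (a + d ^ 2), ∀ r ∈ Ico 0 X, |k t r| ≤ B) →
      (∀ t ∈ Icc a (a + d ^ 2), v t X = 0) →
      ∀ t ∈ Icc a (a + d ^ 2), ∀ s ∈ Icc 0 X, X - s ≤ d →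
        v t s ≤ φ (X - s) + A * (1 - (t - a) / (a + d ^ 2 - a)) := by
    intro v vr vrr vt k hv hvc hvA hkB hvb
    refine RadSol.one_point hn hX (by linarith) hI hv hvc hd hφc hφ1 hφ2 hφpos ?_ ?_ ?_ ?_
    · intro s hs hsd
      have := (abs_le.1 (hvA a ⟨le_rfl, by linarith⟩ s hs)).2
      have := hφnn (X - s) (by linarith [hs.2]) hsd
      linarith
    · intro t ht h0
      have := (abs_le.1 (hvA t ht (X - d) ⟨h0, by linarith⟩)).2
      have := hfrac t ht A hA.le
      have : A ≤ Λ := by rw [hΛ]; nlinarith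
      rw [hφd]; linarith
    · intro t ht
      have := hfrac t ht A hA.le
      rw [hvb t ht, hφ0]; linarith
    · intro t ht s hs _ _ _
      have := (abs_le.1 (hkB t ht s ⟨hs.1.le, hs.2⟩)).2
      have e : φ2 (X - s) = - (6 * A + 2 * B * d ^ 2) / d ^ 2 := by
        simp only [hφ2d, hΛ]; ring
      rw [e, add_sub_cancel_left]
      have : -(6 * A + 2 * B * d ^ 2) / d ^ 2 + A / d ^ 2 < - B := by
        rw [← add_div, div_lt_iff₀ hd2]; nlinarith
      linarith
  have htp := RadSol.two_point (ξ := d) (T₀ := 2 * A) hn hX (by linarith) hI h hc hφc hφ0.ge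
    (by linarith) hφ1 hφ2 hφpos
    (by
      intro r hr s hs hsr hrs
      have h1 := (abs_le.1 (hw a ⟨le_rfl, by linarith⟩ r hr)).2
      have h2 := (abs_le.1 (hw a ⟨le_rfl, by linarith⟩ s hs)).1
      have := hφnn (r - s) (by linarith) hrs
      linarith)
    (by
      intro t ht r hr s hs _
      have h1 := (abs_le.1 (hw t ht r hr)).2
      have h2 := (abs_le.1 (hw t ht s hs)).1
      have := hfrac t ht (2 * A) (by linarith)
      have : 2 * A ≤ Λ := by rw [hΛ]; nlinarith
      rw [hφd]; linarith)
    (by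
      intro t ht s hs hsd
      have := hop h.neg hc.neg (by simpa using hw) (by simpa using hg) (by simpa using hbd)
        t ht s hs hsd
      have := hfrac t ht A hA.le
      rw [hbd t ht]; linarith)
    (by
      intro t ht r hr s hs _ _ _ _ _
      have h1 := (abs_le.1 (hg t ht r ⟨hr.1.le, hr.2⟩)).2
      have h2 := (abs_le.1 (hg t ht s ⟨hs.1.le, hs.2⟩)).1
      have e : φ2 (r - s) = - (6 * A + 2 * B * d ^ 2) / d ^ 2 := by
        simp only [hφ2d, hΛ]; ring
      rw [e, add_sub_cancel_left]
      have : 2 * (-(6 * A + 2 * B * d ^ 2) / d ^ 2) + 2 * A / d ^ 2 < - 2 * B := by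
        rw [← mul_div_assoc, ← add_div, div_lt_iff₀ hd2]; nlinarith
      linarith)
  intro r hr s hs hsr
  have hb : a + d ^ 2 ∈ Icc a (a + d ^ 2) := ⟨by linarith, le_rfl⟩
  have hco : (6 * A + 2 * B * d ^ 2) / d * (r - s) = 2 * Λ * ((r - s) / d) := by
    rw [hΛ]; ring
  rw [hco]
  rcases le_total (r - s) d with h1 | h1
  · have := htp _ hb r hr s hs hsr h1
    rw [add_sub_cancel_left, div_self hd2.ne', sub_self, mul_zero, add_zero] at this
    refine this.trans ?_
    simp only [hφ]
    have : 0 ≤ ((r - s) / d) ^ 2 := sq_nonneg _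
    nlinarith
  · have h3 := (abs_le.1 (hw _ hb r hr)).2
    have h2 := (abs_le.1 (hw _ hb s hs)).1
    have : 1 ≤ (r - s) / d := (one_le_div hd).2 h1
    have : 2 * A ≤ Λ := by rw [hΛ]; nlinarith
    nlinarith

/-- Parabolic smoothing: bounded solutions become Lipschitz. -/
theorem RadSol.smoothing {n X a d A B : ℝ} {w wr wrr wt g : ℝ → ℝ → ℝ} {I : Set ℝ}
    (hn : 0 ≤ n) (hd : 0 < d) (hdX : d ≤ X) (hA : 0 < A) (hI : Ioc a (a + d ^ 2) ⊆ I)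
    (h : RadSol n w wr wrr wt g I X)
    (hc : ContinuousOn (fun p : ℝ × ℝ => w p.1 p.2) (Icc a (a + d ^ 2) ×ˢ Icc 0 X))
    (hw : ∀ t ∈ Icc a (a + d ^ 2), ∀ r ∈ Icc 0 X, |w t r| ≤ A)
    (hg : ∀ t ∈ Ioc a (a + d ^ 2), ∀ r ∈ Ico 0 X, |g t r| ≤ B)
    (hbd : ∀ t ∈ Icc a (a + d ^ 2), w t X = 0) :
    ∀ r ∈ Icc 0 X, ∀ s ∈ Icc 0 X,
      |w (a + d ^ 2) r - w (a + d ^ 2) s| ≤ (6 * A + 2 * B * d ^ 2) / d * |r - s| := by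
  have h1 := RadSol.smoothing_aux hn hd hdX hA hI h hc hw hg hbd
  have h2 := RadSol.smoothing_aux hn hd hdX hA hI h.neg hc.neg (by simpa using hw)
    (by simpa using hg) (by simpa using hbd)
  have key : ∀ r ∈ Icc 0 X, ∀ s ∈ Icc 0 X, s ≤ r →
      |w (a + d ^ 2) r - w (a + d ^ 2) s| ≤ (6 * A + 2 * B * d ^ 2) / d * |r - s| := by
    intro r hr s hs hsr
    rw [abs_of_nonneg (sub_nonneg.2 hsr), abs_le]
    constructor <;> linarith [h1 r hr s hs hsr, h2 r hr s hs hsr]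
  intro r hr s hs
  rcases le_total s r with h3 | h3
  · exact key r hr s hs h3
  · rw [abs_sub_comm, abs_sub_comm r s]
    exact key s hs r hr h3

theorem RadSol.time_mod_aux {n X t h L B d κ : ℝ} {w wr wrr wt g : ℝ → ℝ → ℝ} {I : Set ℝ}
    (hn : 0 ≤ n) (hX : 0 < X) (hh : 0 < h) (hI : Ioc t (t + h) ⊆ I) (hL : 0 ≤ L) (hd : 0 < d)
    (hκ : 0 < κ) (hB : 0 ≤ B)
    (hs : RadSol n w wr wrr wt g I X)
    (hc : ContinuousOn (fun p : ℝ × ℝ => w p.1 p.2) (Icc t (t + h) ×ˢ Icc 0 X))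
    (hlip : ∀ r ∈ Icc 0 X, ∀ s ∈ Icc 0 X, |w t r - w t s| ≤ L * |r - s|)
    (hg : ∀ t' ∈ Ioc t (t + h), ∀ r ∈ Ico 0 X, g t' r ≤ B)
    (hbd : ∀ t' ∈ Icc t (t + h), w t' X = w t X) :
    ∀ t' ∈ Icc t (t + h), ∀ r ∈ Icc 0 X,
      w t' r - w t r ≤ L * d / 2 + κ + ((n + 1) * L / d + B + κ) * (t' - t) := by
  intro t' ht' r₀ hr₀
  set β : ℝ → ℝ := fun x => κ + ((n + 1) * L / d + B + κ) * (x - t) with hβ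
  set Z : ℝ × ℝ → ℝ := fun p => w p.1 p.2 - L * (p.2 - r₀) ^ 2 / (2 * d) - β p.1 with hZ
  have hK : IsCompact (Icc t (t + h) ×ˢ Icc 0 X) := isCompact_Icc.prod isCompact_Icc
  have hZc : ContinuousOn Z (Icc t (t + h) ×ˢ Icc 0 X) := by
    refine (hc.sub ?_).sub ?_
    · fun_prop
    · fun_prop
  have hquad : ∀ x ∈ Icc 0 X, w t x ≤ w t r₀ + L * d / 2 + L * (x - r₀) ^ 2 / (2 * d) := by
    intro x hx
    have h1 := (abs_le.1 (hlip x hx r₀ hr₀)).2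
    have h2 : |x - r₀| ≤ d / 2 + (x - r₀) ^ 2 / (2 * d) := by
      rw [← sq_abs (x - r₀)]
      have : d / 2 + |x - r₀| ^ 2 / (2 * d) - |x - r₀| = (d - |x - r₀|) ^ 2 / (2 * d) := by
        field_simp; ring
      have : 0 ≤ (d - |x - r₀|) ^ 2 / (2 * d) := by positivity
      linarith
    have h3 := mul_le_mul_of_nonneg_left h2 hL
    have h4 : L * (d / 2 + (x - r₀) ^ 2 / (2 * d)) = L * d / 2 + L * (x - r₀) ^ 2 / (2 * d) := by
      ring
    linarith
  obtain ⟨⟨τ, s⟩, ⟨hτ, hs'⟩, hmax⟩ := hK.exists_isMaxOn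
    ⟨(t', r₀), ht', hr₀⟩ hZc
  simp only at hτ hs'
  have key : Z (τ, s) ≤ w t r₀ + L * d / 2 := by
    by_contra hpos
    push Not at hpos
    simp only [hZ] at hpos
    have htτ : t < τ := by
      rcases eq_or_lt_of_le hτ.1 with h' | h'
      · subst h'
        have := hquad s hs'
        simp only [hβ, sub_self, mul_zero] at hpos
        linarith
      · exact h'
    have hτI := hI ⟨htτ, hτ.2⟩
    have hcmp : ∀ x ∈ Icc 0 X, w τ x - L * (x - r₀) ^ 2 / (2 * d) ≤
        w τ s - L * (s - r₀) ^ 2 / (2 * d) := by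
      intro x hx
      have := hmax (show (τ, x) ∈ Icc t (t + h) ×ˢ Icc 0 X from ⟨hτ, hx⟩)
      simp only [hZ, mem_ofPred_eq] at this
      linarith
    have hsX : s < X := by
      rcases eq_or_lt_of_le hs'.2 with h' | h'
      · exfalso
        subst h'
        have h1 := hquad s hs'
        rw [hbd τ hτ] at hpos
        have : 0 ≤ β τ := by
          have : 0 ≤ τ - t := by linarith
          simp only [hβ]; positivity
        linarith
      · exact h'
    have hder : ∀ x ∈ Ioo (-X) X, HasDerivAt (fun x => w τ x - L * (x - r₀) ^ 2 / (2 * d))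
        (wr τ x - L * (x - r₀) / d) x := by
      intro x hx
      have h1 := hs.dr τ hτI x hx
      have h2 := ((((hasDerivAt_id x).sub_const r₀).pow 2).const_mul L).div_const (2 * d)
      refine (h1.sub h2).congr_deriv ?_
      simp only [id]; field_simp; ring
    have hder2 : HasDerivAt (fun x => wr τ x - L * (x - r₀) / d) (wrr τ s - L / d) s := by
      have h1 := hs.drr τ hτI s ⟨by linarith [hs'.1], hsX⟩
      have h2 := (((hasDerivAt_id s).sub_const r₀).const_mul L).div_const d
      exact (h1.sub h2).congr_deriv (by ring)
    have hmr : ∀ᶠ x in 𝓝[>] s, w τ x - L * (x - r₀) ^ 2 / (2 * d) ≤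
        w τ s - L * (s - r₀) ^ 2 / (2 * d) := by
      filter_upwards [Ioo_mem_nhdsGT hsX] with x hx
      exact hcmp x ⟨hs'.1.trans hx.1.le, hx.2.le⟩
    have hevd : ∀ᶠ x in 𝓝[>] s, HasDerivAt (fun x => w τ x - L * (x - r₀) ^ 2 / (2 * d))
        (wr τ x - L * (x - r₀) / d) x := by
      filter_upwards [Ioo_mem_nhdsGT hsX] with x hx
      exact hder x ⟨by linarith [hx.1, hs'.1], hx.2⟩
    have hder0 := hder s ⟨by linarith [hs'.1], hsX⟩
    have hle := nonpos_of_max_right hder0 hmr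
    have h3 : (n + 1) * L / d + B + κ ≤ wt τ s := by
      have hd1 : HasDerivAt (fun x => w x s - L * (s - r₀) ^ 2 / (2 * d) - β x)
          (wt τ s - ((n + 1) * L / d + B + κ)) τ := by
        have h1 := hs.dt τ hτI s ⟨hs'.1, hsX⟩
        have h4 : HasDerivAt β ((n + 1) * L / d + B + κ) τ := by
          have := (((hasDerivAt_id τ).sub_const t).const_mul ((n + 1) * L / d + B + κ)).const_add κ
          exact this.congr_deriv (by ring)
        exact (h1.sub_const _).sub h4
      have := nonneg_of_max_left hd1 (by
        filter_upwards [Ioo_mem_nhdsLT htτ] with x hx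
        have := hmax (show (x, s) ∈ Icc t (t + h) ×ˢ Icc 0 X from
          ⟨⟨hx.1.le, hx.2.le.trans hτ.2⟩, hs'⟩)
        simpa only [hZ, mem_ofPred_eq] using this)
      linarith
    have hgB := hg τ ⟨htτ, hτ.2⟩ s ⟨hs'.1, hsX⟩
    have hLd : 0 ≤ L / d := by positivity
    have e0 : (n + 1) * L / d = n * (L / d) + L / d := by ring
    have e1 : L * (s - r₀) / d = L / d * (s - r₀) := by ring
    rw [e1] at hle hder0
    rcases eq_or_lt_of_le hs'.1 with h0 | h0
    · have hz : wr τ s - L * (s - r₀) / d = 0 := by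
        rw [e1]
        refine le_antisymm hle ?_
        rw [← h0, hs.axis τ hτI]
        have := mul_nonneg hLd hr₀.1
        linarith
      have h5 := second_deriv_nonpos_of_max_right hevd (hder s ⟨by linarith [hs'.1], hsX⟩)
        hder2 hz hmr
      rw [← h0, hs.eq_zero τ hτI hX, ← e0.symm] at h3
      rw [← h0] at h5 hgB
      nlinarith
    · have hev : ∀ᶠ x in 𝓝 s, x ∈ Ioo 0 X := Ioo_mem_nhds h0 hsX
      obtain ⟨z1, z2⟩ := deriv_conditions_of_localMax
        (f := fun x => w τ x - L * (x - r₀) ^ 2 / (2 * d))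
        (f1 := fun x => wr τ x - L * (x - r₀) / d)
        (by filter_upwards [hev] with x hx
            exact hder x ⟨by linarith [hx.1], hx.2⟩) hder2
        (by filter_upwards [hev] with x hx using hcmp x ⟨hx.1.le, hx.2.le⟩)
      rw [hs.eq_pos τ hτI s ⟨h0, hsX⟩] at h3
      have h6 : n / s * wr τ s ≤ n * (L / d) := by
        have : wr τ s = L / d * (s - r₀) := by linarith
        rw [this]
        have : n / s * (L / d * (s - r₀)) = n * (L / d) - n * (L / d) * r₀ / s := by
          field_simp
        rw [this]
        have : 0 ≤ n * (L / d) * r₀ / s := by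
          have := hr₀.1
          positivity
        linarith
      linarith
  have := hmax (show (t', r₀) ∈ Icc t (t + h) ×ˢ Icc 0 X from ⟨ht', hr₀⟩)
  simp only [hZ, mem_ofPred_eq, sub_self] at this key
  simp only [hβ] at this key
  have e : L * (0 : ℝ) ^ 2 / (2 * d) = 0 := by ring
  rw [e] at this
  linarith

/-- Modulus of continuity in time of solutions that are Lipschitz in space. -/
theorem RadSol.time_mod {n X t h L B : ℝ} {w wr wrr wt g : ℝ → ℝ → ℝ} {I : Set ℝ}
    (hn : 0 ≤ n) (hX : 0 < X) (hh : 0 < h) (hI : Ioc t (t + h) ⊆ I) (hL : 0 ≤ L)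
    (hs : RadSol n w wr wrr wt g I X)
    (hc : ContinuousOn (fun p : ℝ × ℝ => w p.1 p.2) (Icc t (t + h) ×ˢ Icc 0 X))
    (hlip : ∀ r ∈ Icc 0 X, ∀ s ∈ Icc 0 X, |w t r - w t s| ≤ L * |r - s|)
    (hg : ∀ t' ∈ Ioc t (t + h), ∀ r ∈ Ico 0 X, |g t' r| ≤ B)
    (hbd : ∀ t' ∈ Icc t (t + h), w t' X = w t X) :
    ∀ r ∈ Icc 0 X, |w (t + h) r - w t r| ≤ (n + 2) * L * √h + B * h := by
  intro r hr
  have hB : 0 ≤ B := (abs_nonneg _).trans (hg (t + h) ⟨by linarith, le_rfl⟩ 0 ⟨le_rfl, hX⟩)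
  have hsh : 0 < √h := sqrt_pos.2 hh
  have hsq : √h * √h = h := mul_self_sqrt hh.le
  have hm : t + h ∈ Icc t (t + h) := ⟨by linarith, le_rfl⟩
  have e : (n + 1) * L / √h * h = (n + 1) * L * √h := by
    rw [div_mul_eq_mul_div, div_eq_iff hsh.ne']; rw [mul_assoc ((n + 1) * L), hsq]
  have hLs : 0 ≤ L * √h := by positivity
  refine le_of_forall_pos_le_add fun κ hκ => ?_
  have hκ' : 0 < κ / (1 + h) := by positivity
  have ek : κ / (1 + h) + κ / (1 + h) * h = κ := by field_simp
  have h1 := RadSol.time_mod_aux hn hX hh hI hL hsh hκ' hB hs hc hlip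
    (fun t' ht' r hr => (abs_le.1 (hg t' ht' r hr)).2) hbd _ hm r hr
  have h2 := RadSol.time_mod_aux hn hX hh hI hL hsh hκ' hB hs.neg hc.neg
    (by
      intro r hr s hs
      rw [show -w t r - -w t s = -(w t r - w t s) by ring, abs_neg]
      exact hlip r hr s hs)
    (fun t' ht' r hr => by have := (abs_le.1 (hg t' ht' r hr)).1; linarith)
    (fun t' ht' => by rw [hbd t' ht']) _ hm r hr
  rw [add_sub_cancel_left] at h1 h2
  rw [abs_le]
  constructor <;> nlinarith

theorem dyadic_bound {a e F : ℝ → ℝ} (hbase : ∀ h, 1 / 2 < h → h ≤ 1 → a h ≤ F h)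
    (hstep : ∀ h, 0 < h → h ≤ 1 / 2 → a h ≤ a (2 * h) / 2 + e h)
    (hF : ∀ h, 0 < h → h ≤ 1 / 2 → F (2 * h) / 2 + e h ≤ F h) :
    ∀ h, 0 < h → h ≤ 1 → a h ≤ F h := by
  have key : ∀ k : ℕ, ∀ h, (1 / 2 : ℝ) ^ (k + 1) < h → h ≤ 1 → a h ≤ F h := by
    intro k
    induction k with
    | zero => intro h h1 h2; exact hbase h (by simpa using h1) h2
    | succ k ih =>
      intro h h1 h2
      rcases le_or_gt h (1 / 2) with h3 | h3
      · have h0 : 0 < h := lt_trans (by positivity) h1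
        have := ih (2 * h) (by rw [pow_succ] at h1; linarith) (by linarith)
        linarith [hstep h h0 h3, hF h h0 h3]
      · exact hbase h h3 h2
  intro h h0 h1
  obtain ⟨k, hk⟩ := exists_pow_lt_of_lt_one h0 (show (1 / 2 : ℝ) < 1 by norm_num)
  exact key k h (lt_of_le_of_lt (pow_le_pow_of_le_one (by norm_num) (by norm_num) (by omega)) hk) h1

/-- Solutions of the rescaled equation that are bounded above, uniformly Lipschitz in space,
and constant on the boundary. -/
structure CoreSol (n L₀ : ℝ) (w wr wrr wt : ℝ → ℝ → ℝ) (α β X : ℝ) : Prop where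
  sol : RadSol n w wr wrr wt (fun t r => exp (w t r)) (Icc α β) X
  cont : ContinuousOn (fun p : ℝ × ℝ => w p.1 p.2) (Icc α β ×ˢ Icc 0 X)
  le_one : ∀ t ∈ Icc α β, ∀ r ∈ Icc 0 X, w t r ≤ 1
  bdry : ∀ t ∈ Icc α β, ∀ s ∈ Icc α β, w t X = w s X
  lip : ∀ t ∈ Icc α β, ∀ r ∈ Icc 0 X, ∀ s ∈ Icc 0 X, |w t r - w t s| ≤ L₀ * |r - s|

theorem exp_lipschitz_of_le_one {x y : ℝ} (hx : x ≤ 1) (hy : y ≤ 1) :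
    |exp x - exp y| ≤ 3 * |x - y| := by
  have he := exp_one_lt_d9
  have key : ∀ {x y : ℝ}, x ≤ y → y ≤ 1 → exp y - exp x ≤ 3 * (y - x) := by
    intro x y hxy hy
    have h1 := add_one_le_exp (x - y)
    have h2 : exp x = exp y * exp (x - y) := by rw [← exp_add]; ring_nf
    have h3 : exp y ≤ exp 1 := exp_le_exp.2 hy
    have h4 := exp_pos y
    nlinarith
  rcases le_total x y with h | h
  · rw [abs_sub_comm, abs_sub_comm x y, abs_of_nonneg (sub_nonneg.2 h),
      abs_of_nonneg (sub_nonneg.2 (exp_le_exp.2 h))]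
    exact key h hy
  · rw [abs_of_nonneg (sub_nonneg.2 h), abs_of_nonneg (sub_nonneg.2 (exp_le_exp.2 h))]
    exact key h hx

namespace CoreSol

variable {n L₀ α β X : ℝ} {w wr wrr wt : ℝ → ℝ → ℝ}

theorem diff_sol (h : CoreSol n L₀ w wr wrr wt α β X) (k : ℝ) :
    RadSol n (fun t r => w (t + k) r - w t r) (fun t r => wr (t + k) r - wr t r)
      (fun t r => wrr (t + k) r - wrr t r) (fun t r => wt (t + k) r - wt t r)
      (fun t r => exp (w (t + k) r) - exp (w t r)) ({t | t + k ∈ Icc α β} ∩ Icc α β) X := by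
  have := (h.sol.shift k).lin h.sol 1 (-1)
  simpa [sub_eq_add_neg] using this

theorem diff_cont (h : CoreSol n L₀ w wr wrr wt α β X) {k p q : ℝ} (hk : 0 ≤ k) (hp : α ≤ p)
    (hq : q + k ≤ β) :
    ContinuousOn (fun x : ℝ × ℝ => w (x.1 + k) x.2 - w x.1 x.2) (Icc p q ×ˢ Icc 0 X) := by
  refine ContinuousOn.sub ?_ ?_
  · refine h.cont.comp (f := fun x : ℝ × ℝ => (x.1 + k, x.2)) (by fun_prop) ?_
    intro x hx
    exact ⟨⟨by linarith [hx.1.1], by linarith [hx.1.2]⟩, hx.2⟩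
  · exact h.cont.mono (prod_mono (Icc_subset_Icc hp (by linarith)) le_rfl)

theorem diff_gain (h : CoreSol n L₀ w wr wrr wt α β X) (hn : 0 ≤ n) (hX : 1 ≤ X)
    {k p q A : ℝ} (hk : 0 ≤ k) (hp : α ≤ p) (hq : q + k ≤ β) (hA : 0 < A)
    (hb : ∀ t ∈ Icc p q, ∀ r ∈ Icc 0 X, |w (t + k) r - w t r| ≤ A) :
    (∀ t ∈ Icc (p + 1) q, ∀ r ∈ Icc 0 X, ∀ s ∈ Icc 0 X,
      |(w (t + k) r - w t r) - (w (t + k) s - w t s)| ≤ 12 * A * |r - s|) ∧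
    (∀ t l, p + 1 ≤ t → 0 < l → t + l ≤ q → ∀ r ∈ Icc 0 X,
      |(w (t + l + k) r - w (t + l) r) - (w (t + k) r - w t r)| ≤
        12 * (n + 2) * A * √l + 3 * A * l) := by
  have hg : ∀ t ∈ Icc p q, ∀ r ∈ Icc 0 X, |exp (w (t + k) r) - exp (w t r)| ≤ 3 * A := by
    intro t ht r hr
    have h1 := h.le_one (t + k) ⟨by linarith [ht.1], by linarith [ht.2]⟩ r hr
    have h2 := h.le_one t ⟨by linarith [ht.1], by linarith [ht.2]⟩ r hr
    have := exp_lipschitz_of_le_one h1 h2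
    linarith [hb t ht r hr]
  have hz : ∀ t ∈ Icc p q, w (t + k) X - w t X = 0 := by
    intro t ht
    rw [h.bdry (t + k) ⟨by linarith [ht.1], by linarith [ht.2]⟩ t
      ⟨by linarith [ht.1], by linarith [ht.2]⟩, sub_self]
  have hI : Icc p q ⊆ {t | t + k ∈ Icc α β} ∩ Icc α β := fun t ht =>
    ⟨⟨by linarith [ht.1], by linarith [ht.2]⟩, ⟨by linarith [ht.1], by linarith [ht.2]⟩⟩
  have hlip : ∀ t ∈ Icc (p + 1) q, ∀ r ∈ Icc 0 X, ∀ s ∈ Icc 0 X,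
      |(w (t + k) r - w t r) - (w (t + k) s - w t s)| ≤ 12 * A * |r - s| := by
    intro t ht r hr s hs
    have hsub : Icc (t - 1) (t - 1 + 1 ^ 2) ⊆ Icc p q := by
      intro x hx
      exact ⟨by linarith [ht.1, hx.1], by have := hx.2; norm_num at this; linarith [ht.2]⟩
    have := RadSol.smoothing (a := t - 1) (d := 1) (B := 3 * A) hn one_pos hX hA
      ((Ioc_subset_Icc_self.trans hsub).trans hI) (h.diff_sol k)
      ((h.diff_cont hk hp hq).mono (prod_mono hsub le_rfl))
      (fun t ht => hb t (hsub ht))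
      (fun t ht r hr => hg t (hsub ⟨ht.1.le, ht.2⟩) r ⟨hr.1, hr.2.le⟩)
      (fun t ht => hz t (hsub ht)) r hr s hs
    rw [show t - 1 + 1 ^ 2 = t by ring] at this
    refine this.trans (le_of_eq ?_)
    ring
  refine ⟨hlip, ?_⟩
  intro t l ht hl hlq r hr
  have hsub : Icc t (t + l) ⊆ Icc p q := Icc_subset_Icc (by linarith) hlq
  have := RadSol.time_mod (t := t) (h := l) (L := 12 * A) (B := 3 * A) hn (by linarith) hl
    ((Ioc_subset_Icc_self.trans hsub).trans hI) (by positivity) (h.diff_sol k)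
    ((h.diff_cont hk hp hq).mono (prod_mono hsub le_rfl))
    (hlip t ⟨ht, by linarith⟩)
    (fun t ht r hr => hg t (hsub ⟨ht.1.le, ht.2⟩) r ⟨hr.1, hr.2.le⟩)
    (fun t' ht' => by rw [hz t' (hsub ht'), hz t (hsub ⟨le_rfl, by linarith⟩)]) r hr
  refine this.trans (le_of_eq ?_)
  ring

end CoreSol

theorem fourth_root_facts : ∃ c : ℝ, 1.18 ≤ c ∧ c ≤ 1.2 ∧ c ^ 4 = 2 ∧
    ∀ h : ℝ, √√(2 * h) = c * √√h := by
  refine ⟨√√2, ?_, ?_, ?_, ?_⟩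
  · refine le_sqrt_of_sq_le (le_sqrt_of_sq_le ?_); norm_num
  · refine sqrt_le_iff.2 ⟨by norm_num, sqrt_le_iff.2 ⟨by norm_num, by norm_num⟩⟩
  · have h1 : √√2 ^ 2 = √2 := sq_sqrt (sqrt_nonneg _)
    have h2 : √2 ^ 2 = (2 : ℝ) := sq_sqrt (by norm_num)
    calc √√(2 : ℝ) ^ 4 = (√√2 ^ 2) ^ 2 := by ring
      _ = 2 := by rw [h1, h2]
  · intro h
    rw [sqrt_mul (by norm_num), sqrt_mul (sqrt_nonneg _)]

set_option maxHeartbeats 2000000 in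
/-- Uniform regularity in time. -/
theorem CoreSol.time_regularity (n L₀ : ℝ) (hn : 0 ≤ n) (hL : 0 ≤ L₀) : ∃ K : ℝ, 0 < K ∧
    ∀ {α β X : ℝ} {w wr wrr wt : ℝ → ℝ → ℝ}, 1 ≤ X → CoreSol n L₀ w wr wrr wt α β X →
    ∀ h, 0 < h → h ≤ 1 →
      (∀ t ∈ Icc (α + 3) (β - 3), ∀ r ∈ Icc 0 X, |w (t + h) r - w t r| ≤ K * h) ∧
      (∀ t ∈ Icc (α + 3) (β - 3), ∀ r ∈ Icc 0 X, ∀ s ∈ Icc 0 X,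
        |(w (t + h) r - w t r) - (w (t + h) s - w t s)| ≤ K * h * |r - s|) ∧
      (∀ t l, α + 3 ≤ t → 0 < l → l ≤ 1 → t + l ≤ β - 3 → ∀ r ∈ Icc 0 X,
        |(w (t + l + h) r - w (t + l) r) - (w (t + h) r - w t r)| ≤ K * h * √l) := by
  obtain ⟨c, hc1, hc2, hc4, hc⟩ := fourth_root_facts
  set A₀ := (n + 2) * L₀ + 3 with hA₀
  have hA₀pos : 0 < A₀ := by positivity
  set M₁ := 15 * (n + 2) * A₀ with hM₁
  have hM₁pos : 0 < M₁ := by positivity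
  set C₁ := 4 * M₁ + 2 * A₀ with hC₁
  have hC₁pos : 0 < C₁ := by positivity
  set M₂ := 15 * (n + 2) * C₁ with hM₂
  have hM₂pos : 0 < M₂ := by positivity
  set C₂ := 4 * M₂ + 2 * A₀ with hC₂
  have hC₂pos : 0 < C₂ := by positivity
  refine ⟨15 * (n + 2) * C₂, by positivity, ?_⟩
  intro α β X w wr wrr wt hX hw
  have hX0 : 0 < X := by linarith
  have hp : ∀ h : ℝ, 0 < h → h ≤ 1 → 0 < √√h ∧ √√h ≤ 1 ∧ √√h ^ 4 = h ∧ √√h ^ 2 = √h := by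
    intro h h0 h1
    have e1 : √√h ^ 2 = √h := sq_sqrt (sqrt_nonneg _)
    have e2 : √h ^ 2 = h := sq_sqrt h0.le
    refine ⟨sqrt_pos.2 (sqrt_pos.2 h0), ?_, ?_, e1⟩
    · exact sqrt_le_one.2 (sqrt_le_one.2 h1)
    · calc √√h ^ 4 = (√√h ^ 2) ^ 2 := by ring
        _ = h := by rw [e1, e2]
  have s1 : ∀ h, 0 < h → h ≤ 1 → ∀ t ∈ Icc α (β - 1), ∀ r ∈ Icc 0 X,
      |w (t + h) r - w t r| ≤ A₀ * √h := by
    intro h h0 h1 t ht r hr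
    have hsub : Icc t (t + h) ⊆ Icc α β := Icc_subset_Icc ht.1 (by linarith [ht.2])
    have htm : t ∈ Icc α β := hsub ⟨le_rfl, by linarith⟩
    have := RadSol.time_mod (t := t) (h := h) (L := L₀) (B := 3) hn hX0 h0
      (Ioc_subset_Icc_self.trans hsub) hL hw.sol (hw.cont.mono (prod_mono hsub le_rfl))
      (hw.lip t htm)
      (by
        intro t' ht' r hr
        have h1 := hw.le_one t' (hsub ⟨ht'.1.le, ht'.2⟩) r ⟨hr.1, hr.2.le⟩
        have h2 := exp_le_exp.2 h1
        have := exp_one_lt_d9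
        rw [abs_of_pos (exp_pos _)]
        linarith)
      (fun t' ht' => hw.bdry t' (hsub ht') t htm) r hr
    have hle : h ≤ √h := by
      rw [le_sqrt h0.le h0.le]; nlinarith
    rw [hA₀]; nlinarith
  have gain2 : ∀ {h p q A : ℝ}, 0 < h → h ≤ 1 → α ≤ p → q + 1 ≤ β → 0 < A →
      (∀ t ∈ Icc p q, ∀ r ∈ Icc 0 X, |w (t + h) r - w t r| ≤ A) →
      ∀ l, 0 < l → l ≤ 1 → ∀ t, p + 1 ≤ t → t + l ≤ q → ∀ r ∈ Icc 0 X,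
        |(w (t + l + h) r - w (t + l) r) - (w (t + h) r - w t r)| ≤ 15 * (n + 2) * A * √l := by
    intro h p q A h0 h1 hp hq hA hb l hl hl1 t ht htq r hr
    have := (hw.diff_gain hn hX h0.le hp (by linarith) hA hb).2 t l ht hl htq r hr
    have hle : l ≤ √l := by
      rw [le_sqrt hl.le hl.le]; nlinarith
    have h3 : 3 * A * l ≤ 3 * (n + 2) * A * √l := by
      have e1 : A * l ≤ A * √l := mul_le_mul_of_nonneg_left hle hA.le
      have e2 : 0 ≤ n * (A * √l) := mul_nonneg hn (by positivity)
      have e3 : 0 ≤ A * √l := by positivity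
      nlinarith
    nlinarith
  have split : ∀ h t r, |w (t + h) r - w t r| ≤ |w (t + 2 * h) r - w t r| / 2 +
      |(w (t + h + h) r - w (t + h) r) - (w (t + h) r - w t r)| / 2 := by
    intro h t r
    rw [show t + 2 * h = t + h + h by ring]
    have e : w (t + h) r - w t r = (w (t + h + h) r - w t r) / 2 -
      ((w (t + h + h) r - w (t + h) r) - (w (t + h) r - w t r)) / 2 := by ring
    calc |w (t + h) r - w t r| = |(w (t + h + h) r - w t r) / 2 -
      ((w (t + h + h) r - w (t + h) r) - (w (t + h) r - w t r)) / 2| := by rw [← e]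
      _ ≤ _ := by
        refine (abs_sub _ _).trans ?_
        rw [abs_div, abs_div, abs_two]
  have s0 : ∀ h, 0 < h → h ≤ 1 → ∀ t ∈ Icc α (β - 1), ∀ r ∈ Icc 0 X,
      |w (t + h) r - w t r| ≤ A₀ := by
    intro h h0 h1 t ht r hr
    have := s1 h h0 h1 t ht r hr
    have h2 : √h ≤ 1 := sqrt_le_one.2 h1
    nlinarith
  have s2 : ∀ h, 0 < h → h ≤ 1 → ∀ t ∈ Icc (α + 1) (β - 2), ∀ r ∈ Icc 0 X,
      |w (t + h) r - w t r| ≤ C₁ * √√h ^ 3 := by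
    intro h h0 h1 t ht r hr
    refine dyadic_bound (a := fun h => |w (t + h) r - w t r|) (e := fun h => M₁ * √√h ^ 4 / 2)
      (F := fun h => C₁ * √√h ^ 3) ?_ ?_ ?_ h h0 h1
    · intro k k1 k2
      obtain ⟨p0, p1, p4, -⟩ := hp k (by linarith) k2
      have := s0 k (by linarith) k2 t ⟨by linarith [ht.1], by linarith [ht.2]⟩ r hr
      have p3 : 1 / 2 ≤ √√k ^ 3 := by
        have : √√k ^ 4 = √√k ^ 3 * √√k := by ring
        have : 0 < √√k ^ 3 := by positivity
        nlinarith
      refine this.trans ?_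
      rw [hC₁]; nlinarith
    · intro k k0 k1
      obtain ⟨p0, p1, p4, p2⟩ := hp k k0 (by linarith)
      have g := gain2 (A := A₀ * √k) k0 (by linarith) le_rfl (q := β - 1) (by linarith)
        (by have := sqrt_pos.2 k0; positivity) (s1 k k0 (by linarith)) k k0 (by linarith) t ht.1
        (by linarith [ht.2]) r hr
      have := split k t r
      have e : 15 * (n + 2) * (A₀ * √k) * √k = M₁ * √√k ^ 4 := by
        rw [hM₁, p4, mul_assoc, mul_assoc A₀, mul_self_sqrt k0.le]; ring
      rw [e] at g
      linarith
    · intro k k0 k1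
      obtain ⟨p0, p1, p4, p2⟩ := hp k k0 (by linarith)
      simp only [hc]
      set p := √√k
      have p3 : 0 < p ^ 3 := by positivity
      have hcc : c ^ 3 ≤ 1.7 := by
        have : c ^ 4 = c ^ 3 * c := by ring
        have : 0 < c ^ 3 := by positivity
        nlinarith
      have e1 : (c * p) ^ 3 = c ^ 3 * p ^ 3 := by ring
      have e2 : p ^ 4 ≤ p ^ 3 := by
        calc p ^ 4 = p ^ 3 * p := by ring
          _ ≤ p ^ 3 * 1 := by gcongr
          _ = p ^ 3 := mul_one _
      have e3 : c ^ 3 * p ^ 3 ≤ 1.7 * p ^ 3 := by gcongr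
      have e4 : C₁ * (c ^ 3 * p ^ 3) ≤ C₁ * (1.7 * p ^ 3) := by gcongr
      have e5 : M₁ * p ^ 4 ≤ M₁ * p ^ 3 := by gcongr
      have e6 : M₁ * p ^ 3 ≤ C₁ * p ^ 3 / 4 := by
        rw [hC₁]; nlinarith
      rw [e1]
      nlinarith
  have s3 : ∀ h, 0 < h → h ≤ 1 → ∀ t ∈ Icc (α + 2) (β - 3), ∀ r ∈ Icc 0 X,
      |w (t + h) r - w t r| ≤ C₂ * h := by
    intro h h0 h1 t ht r hr
    have hd := dyadic_bound (a := fun h => |w (t + h) r - w t r|) (e := fun h => M₂ * √√h ^ 5 / 2)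
      (F := fun h => C₂ * √√h ^ 4 - 4 * M₂ * √√h ^ 5) ?_ ?_ ?_ h h0 h1
    · obtain ⟨p0, p1, p4, p2⟩ := hp h h0 h1
      simp only [p4] at hd
      have : 0 ≤ 4 * M₂ * √√h ^ 5 := by positivity
      linarith
    · intro k k1 k2
      obtain ⟨p0, p1, p4, -⟩ := hp k (by linarith) k2
      have := s0 k (by linarith) k2 t ⟨by linarith [ht.1], by linarith [ht.2]⟩ r hr
      refine this.trans ?_
      have e : C₂ * √√k ^ 4 - 4 * M₂ * √√k ^ 5 = k * (C₂ - 4 * M₂ * √√k) := by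
        calc C₂ * √√k ^ 4 - 4 * M₂ * √√k ^ 5 = √√k ^ 4 * (C₂ - 4 * M₂ * √√k) := by ring
          _ = _ := by rw [p4]
      rw [e]
      have : 2 * A₀ ≤ C₂ - 4 * M₂ * √√k := by rw [hC₂]; nlinarith
      nlinarith
    · intro k k0 k1
      obtain ⟨p0, p1, p4, p2⟩ := hp k k0 (by linarith)
      have g := gain2 (A := C₁ * √√k ^ 3) k0 (by linarith) (p := α + 1) (by linarith)
        (q := β - 2) (by linarith)
        (by positivity) (s2 k k0 (by linarith)) k k0 (by linarith) t (by linarith [ht.1])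
        (by linarith [ht.2]) r hr
      have := split k t r
      have e : 15 * (n + 2) * (C₁ * √√k ^ 3) * √k = M₂ * √√k ^ 5 := by
        calc 15 * (n + 2) * (C₁ * √√k ^ 3) * √k = 15 * (n + 2) * (C₁ * √√k ^ 3) * √√k ^ 2 := by
              rw [p2]
          _ = _ := by rw [hM₂]; ring
      rw [e] at g
      linarith
    · intro k k0 k1
      obtain ⟨p0, p1, p4, p2⟩ := hp k k0 (by linarith)
      simp only [hc]
      set p := √√k
      have e1 : (c * p) ^ 4 = 2 * p ^ 4 := by rw [mul_pow, hc4]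
      have e2 : (c * p) ^ 5 = 2 * c * p ^ 5 := by
        calc (c * p) ^ 5 = c ^ 4 * c * p ^ 5 := by ring
          _ = _ := by rw [hc4]
      rw [e1, e2]
      have : 0 < M₂ * p ^ 5 := by positivity
      nlinarith
  intro h h0 h1
  have hA : 0 < C₂ * h := by positivity
  have hg1 := (hw.diff_gain hn hX h0.le (p := α + 2) (q := β - 3) (by linarith) (by linarith) hA
    (s3 h h0 h1)).1
  refine ⟨?_, ?_, ?_⟩
  · intro t ht r hr
    refine (s3 h h0 h1 t ⟨by linarith [ht.1], ht.2⟩ r hr).trans ?_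
    nlinarith [mul_nonneg hn hA.le]
  · intro t ht r hr s hs
    refine (hg1 t ⟨by linarith [ht.1], ht.2⟩ r hr s hs).trans ?_
    have := abs_nonneg (r - s)
    refine mul_le_mul_of_nonneg_right ?_ this
    nlinarith [mul_nonneg hn hA.le]
  · intro t l ht hl hl1 htl r hr
    have := gain2 h0 h1 (p := α + 2) (q := β - 3) (by linarith) (by linarith) hA
      (s3 h h0 h1) l hl hl1 t (by linarith) htl r hr
    refine this.trans (le_of_eq ?_)
    ring

/-- Quantitative regularity of the time derivative `wt` of `w`. -/
structure TimeReg (w wt : ℝ → ℝ → ℝ) (K h₀ X a b : ℝ) : Prop where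
  bound : ∀ t ∈ Icc a b, ∀ r ∈ Ico 0 X, |wt t r| ≤ K
  lip : ∀ t ∈ Icc a b, ∀ r ∈ Ico 0 X, ∀ s ∈ Ico 0 X, |wt t r - wt t s| ≤ K * |r - s|
  bdry : ∀ t ∈ Icc a b, ∀ r ∈ Ico 0 X, |wt t r| ≤ K * (X - r)
  holder : ∀ t ∈ Icc a b, ∀ s ∈ Icc a b, |t - s| ≤ h₀ → ∀ r ∈ Ico 0 X,
    |wt t r - wt s r| ≤ K * √|t - s|
  approx : ∀ t ∈ Icc a b, ∀ h, 0 < h → h ≤ h₀ → ∀ r ∈ Ico 0 X,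
    |(w (t + h) r - w t r) / h - wt t r| ≤ K * √h

theorem tendsto_diff_quotient {f : ℝ → ℝ} {c t : ℝ} (h : HasDerivAt f c t) :
    Tendsto (fun h => (f (t + h) - f t) / h) (𝓝[>] 0) (𝓝 c) := by
  have := (hasDerivAt_iff_tendsto_slope_zero.1 h).mono_left
    (nhdsWithin_mono 0 (show Ioi (0 : ℝ) ⊆ {0}ᶜ from fun x hx => ne_of_gt hx))
  refine this.congr fun x => ?_
  rw [smul_eq_mul, div_eq_inv_mul]

theorem CoreSol.timeReg (n L₀ : ℝ) (hn : 0 ≤ n) (hL : 0 ≤ L₀) : ∃ K : ℝ, 0 < K ∧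
    ∀ {α β X : ℝ} {w wr wrr wt : ℝ → ℝ → ℝ}, 1 ≤ X → CoreSol n L₀ w wr wrr wt α β X →
      TimeReg w wt K 1 X (α + 3) (β - 4) := by
  obtain ⟨K, hK, hreg⟩ := CoreSol.time_regularity n L₀ hn hL
  refine ⟨K, hK, ?_⟩
  intro α β X w wr wrr wt hX hw
  have hder : ∀ t ∈ Icc α β, ∀ r ∈ Ico 0 X,
      Tendsto (fun h => (w (t + h) r - w t r) / h) (𝓝[>] 0) (𝓝 (wt t r)) :=
    fun t ht r hr => tendsto_diff_quotient (hw.sol.dt t ht r hr)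
  have hev : ∀ᶠ h : ℝ in 𝓝[>] 0, 0 < h ∧ h ≤ 1 := by
    filter_upwards [Ioo_mem_nhdsGT (one_pos : (0 : ℝ) < 1)] with h hh using ⟨hh.1, hh.2.le⟩
  have hin : ∀ {r : ℝ}, r ∈ Ico 0 X → r ∈ Icc 0 X := fun hr => ⟨hr.1, hr.2.le⟩
  have hXX : X ∈ Icc 0 X := ⟨by linarith, le_rfl⟩
  have holder : ∀ t l, α + 3 ≤ t → 0 < l → l ≤ 1 → t + l ≤ β - 3 → ∀ r ∈ Ico 0 X,
      |wt (t + l) r - wt t r| ≤ K * √l := by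
    intro t l ht hl hl1 htl r hr
    have h1 := hder (t + l) ⟨by linarith, by linarith⟩ r hr
    have h2 := hder t ⟨by linarith, by linarith⟩ r hr
    refine le_of_tendsto (h1.sub h2).abs ?_
    filter_upwards [hev] with h hh
    have := (hreg hX hw h hh.1 hh.2).2.2 t l ht hl hl1 htl r (hin hr)
    rw [← sub_div, abs_div, abs_of_pos hh.1, div_le_iff₀ hh.1]
    linarith
  have lip : ∀ t ∈ Icc (α + 3) (β - 4), ∀ r ∈ Ico 0 X, ∀ s ∈ Ico 0 X,
      |wt t r - wt t s| ≤ K * |r - s| := by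
    intro t ht r hr s hs
    have htm : t ∈ Icc α β := ⟨by linarith [ht.1], by linarith [ht.2]⟩
    refine le_of_tendsto ((hder t htm r hr).sub (hder t htm s hs)).abs ?_
    filter_upwards [hev] with h hh
    have := (hreg hX hw h hh.1 hh.2).2.1 t ⟨ht.1, by linarith [ht.2]⟩ r (hin hr) s (hin hs)
    rw [← sub_div, abs_div, abs_of_pos hh.1, div_le_iff₀ hh.1]
    linarith
  refine ⟨?_, lip, ?_, ?_, ?_⟩
  · intro t ht r hr
    refine le_of_tendsto (hder t ⟨by linarith [ht.1], by linarith [ht.2]⟩ r hr).abs ?_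
    filter_upwards [hev] with h hh
    have := (hreg hX hw h hh.1 hh.2).1 t ⟨ht.1, by linarith [ht.2]⟩ r (hin hr)
    rw [abs_div, abs_of_pos hh.1, div_le_iff₀ hh.1]
    linarith
  · intro t ht r hr
    refine le_of_tendsto (hder t ⟨by linarith [ht.1], by linarith [ht.2]⟩ r hr).abs ?_
    filter_upwards [hev] with h hh
    have := (hreg hX hw h hh.1 hh.2).2.1 t ⟨ht.1, by linarith [ht.2]⟩ r (hin hr) X hXX
    rw [hw.bdry (t + h) ⟨by linarith [ht.1, hh.1], by linarith [ht.2, hh.2]⟩ t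
      ⟨by linarith [ht.1], by linarith [ht.2]⟩, sub_self, sub_zero, abs_sub_comm r,
      abs_of_pos (sub_pos.2 hr.2)] at this
    rw [abs_div, abs_of_pos hh.1, div_le_iff₀ hh.1]
    linarith
  · have key : ∀ t ∈ Icc (α + 3) (β - 4), ∀ s ∈ Icc (α + 3) (β - 4), t < s → |t - s| ≤ 1 →
        ∀ r ∈ Ico 0 X, |wt t r - wt s r| ≤ K * √|t - s| := by
      intro t ht s hs hts h1 r hr
      rw [abs_sub_comm t s, abs_of_pos (sub_pos.2 hts)] at h1 ⊢
      have := holder t (s - t) ht.1 (by linarith) h1 (by linarith [hs.2]) r hr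
      rw [abs_sub_comm]
      simpa using this
    intro t ht s hs h1 r hr
    rcases lt_trichotomy t s with h | h | h
    · exact key t ht s hs h h1 r hr
    · subst h; simp
    · rw [abs_sub_comm, abs_sub_comm t]
      exact key s hs t ht h (by rwa [abs_sub_comm]) r hr
  · intro t ht h h0 h1 r hr
    obtain ⟨τ, hτ, hτ'⟩ := exists_hasDerivAt_eq_slope (fun s => w s r) (fun s => wt s r)
      (show t < t + h by linarith)
      (fun x hx => (hw.sol.dt x ⟨by linarith [ht.1, hx.1], by linarith [ht.2, hx.2]⟩
        r hr).continuousAt.continuousWithinAt)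
      (fun x hx => hw.sol.dt x ⟨by linarith [ht.1, hx.1], by linarith [ht.2, hx.2]⟩ r hr)
    rw [add_sub_cancel_left] at hτ'
    rw [← hτ']
    have := holder t (τ - t) ht.1 (by linarith [hτ.1]) (by linarith [hτ.2])
      (by linarith [hτ.2, ht.2]) r hr
    rw [add_sub_cancel] at this
    refine this.trans (mul_le_mul_of_nonneg_left (sqrt_le_sqrt (by linarith [hτ.2])) hK.le)

/-- Regularity of the time derivative on smaller time intervals, without normalisation. -/
theorem exists_timeReg {n L M X a' b' a b : ℝ} {w wr wrr wt : ℝ → ℝ → ℝ} (hn : 0 ≤ n)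
    (hX : 0 < X) (hL : 0 ≤ L) (ha : a' < a) (hb : b < b')
    (sol : RadSol n w wr wrr wt (fun t r => exp (w t r)) (Icc a' b') X)
    (cont : ContinuousOn (fun p : ℝ × ℝ => w p.1 p.2) (Icc a' b' ×ˢ Icc 0 X))
    (hM : ∀ t ∈ Icc a' b', ∀ r ∈ Icc 0 X, w t r ≤ M)
    (bdry : ∀ t ∈ Icc a' b', ∀ s ∈ Icc a' b', w t X = w s X)
    (lip : ∀ t ∈ Icc a' b', ∀ r ∈ Icc 0 X, ∀ s ∈ Icc 0 X, |w t r - w t s| ≤ L * |r - s|) :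
    ∃ K h₀ : ℝ, 0 < K ∧ 0 < h₀ ∧ TimeReg w wt K h₀ X a b := by
  obtain ⟨l, hl0, hl1, hlX, hla, hlb, hlM⟩ : ∃ l : ℝ, 0 < l ∧ l ≤ 1 ∧ l ≤ X ∧ 3 * l ^ 2 ≤ a - a' ∧
      4 * l ^ 2 ≤ b' - b ∧ l ≤ exp (-M / 2) := by
    refine ⟨min (min 1 X) (min (min ((a - a') / 3) ((b' - b) / 4)) (exp (-M / 2))), ?_⟩
    set l := min (min 1 X) (min (min ((a - a') / 3) ((b' - b) / 4)) (exp (-M / 2))) with hl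
    have h1 : l ≤ 1 := (min_le_left _ _).trans (min_le_left _ _)
    have h2 : l ≤ X := (min_le_left _ _).trans (min_le_right _ _)
    have h3 : l ≤ (a - a') / 3 :=
      (min_le_right _ _).trans ((min_le_left _ _).trans (min_le_left _ _))
    have h4 : l ≤ (b' - b) / 4 :=
      (min_le_right _ _).trans ((min_le_left _ _).trans (min_le_right _ _))
    have h5 : l ≤ exp (-M / 2) := (min_le_right _ _).trans (min_le_right _ _)
    have h0 : 0 < l := by
      refine lt_min (lt_min one_pos hX) (lt_min (lt_min ?_ ?_) (exp_pos _)) <;> linarith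
    refine ⟨h0, h1, h2, ?_, ?_, h5⟩ <;> nlinarith
  have hl2 : 0 < l ^ 2 := by positivity
  set μ := - 2 * log l with hμ
  have hlμ : l ^ 2 = exp (-μ) := by
    rw [hμ, show -(-2 * log l) = log l + log l by ring, exp_add, exp_log hl0]; ring
  have hMμ : M ≤ μ := by
    have := (log_le_iff_le_exp hl0).2 hlM
    rw [hμ]; linarith
  have hmul : ∀ {x r : ℝ}, r ∈ Icc 0 (X / l) → l * r ∈ Icc 0 X := by
    intro _ r hr
    refine ⟨mul_nonneg hl0.le hr.1, ?_⟩
    have := (le_div_iff₀ hl0).1 hr.2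
    linarith
  have htm : ∀ {t : ℝ}, t ∈ Icc (a' / l ^ 2) (b' / l ^ 2) → 0 + l ^ 2 * t ∈ Icc a' b' := by
    intro t ht
    have h1 := (div_le_iff₀ hl2).1 ht.1
    have h2 := (le_div_iff₀ hl2).1 ht.2
    exact ⟨by linarith, by linarith⟩
  obtain ⟨K, hK, hreg⟩ := CoreSol.timeReg n (L * l) hn (by positivity)
  have hsol := (sol.rescale hl0 0 μ).mono (J := Icc (a' / l ^ 2) (b' / l ^ 2))
    (fun t ht => htm ht) le_rfl
  have hg : (fun t r => l ^ 2 * (fun t r => exp (w t r)) (0 + l ^ 2 * t) (l * r)) =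
      fun t r => exp (w (0 + l ^ 2 * t) (l * r) - μ) := by
    ext t r
    rw [sub_eq_neg_add, exp_add, hlμ]
  rw [hg] at hsol
  have core : CoreSol n (L * l) _ _ _ _ (a' / l ^ 2) (b' / l ^ 2) (X / l) := {
    sol := hsol
    cont := by
      refine ContinuousOn.sub ?_ continuousOn_const
      exact cont.comp (f := fun p : ℝ × ℝ => (0 + l ^ 2 * p.1, l * p.2)) (by fun_prop)
        (fun p hp => ⟨htm hp.1, hmul (x := 0) hp.2⟩)
    le_one := fun t ht r hr => by linarith [hM _ (htm ht) _ (hmul (x := 0) hr)]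
    bdry := fun t ht s hs => by
      simp only [mul_div_cancel₀ X hl0.ne', bdry _ (htm ht) _ (htm hs)]
    lip := fun t ht r hr s hs => by
      have := lip _ (htm ht) _ (hmul (x := 0) hr) _ (hmul (x := 0) hs)
      rw [← mul_sub, abs_mul, abs_of_pos hl0] at this
      simpa [mul_assoc] using this }
  have R := hreg ((one_le_div hl0).2 hlX) core
  have htime : ∀ {t : ℝ}, t ∈ Icc a b → t / l ^ 2 ∈ Icc (a' / l ^ 2 + 3) (b' / l ^ 2 - 4) := by
    intro t ht
    constructor
    · rw [le_div_iff₀ hl2, add_mul, div_mul_cancel₀ _ hl2.ne']; linarith [ht.1]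
    · rw [div_le_iff₀ hl2, sub_mul, div_mul_cancel₀ _ hl2.ne']; linarith [ht.2]
  have hrad : ∀ {r : ℝ}, r ∈ Ico 0 X → r / l ∈ Ico 0 (X / l) := fun hr =>
    ⟨div_nonneg hr.1 hl0.le, (div_lt_div_iff_of_pos_right hl0).2 hr.2⟩
  have ht' : ∀ t : ℝ, 0 + l ^ 2 * (t / l ^ 2) = t := fun t => by field_simp; ring
  have hr' : ∀ r : ℝ, l * (r / l) = r := fun t => by field_simp
  have hL2 : ∀ x y : ℝ, l ^ 2 * x - l ^ 2 * y = l ^ 2 * (x - y) := fun x y => by ring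
  have up : ∀ {x y : ℝ}, l ^ 2 * x ≤ K * y → x ≤ K / l ^ 2 * y := by
    intro x y hxy
    rw [div_mul_eq_mul_div, le_div_iff₀ hl2]; linarith
  have hl3 : l ^ 3 ≤ l ^ 2 := by nlinarith
  have hl3p : 0 < l ^ 3 := by positivity
  have up' : ∀ {x y : ℝ}, 0 ≤ y → l ^ 2 * x ≤ K * (y / l) → x ≤ K / l ^ 3 * y := by
    intro x y _ hxy
    rw [div_mul_eq_mul_div, le_div_iff₀ hl3p]
    have := mul_le_mul_of_nonneg_right hxy hl0.le
    have e : K * (y / l) * l = K * y := by field_simp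
    rw [e] at this
    linarith
  have hKK : K / l ^ 2 ≤ K / l ^ 3 := div_le_div_of_nonneg_left hK.le hl3p hl3
  refine ⟨K / l ^ 3, l ^ 2, by positivity, hl2, ?_, ?_, ?_, ?_, ?_⟩
  · intro t ht r hr
    have := R.bound _ (htime ht) _ (hrad hr)
    rw [ht', hr', abs_mul, abs_of_pos hl2] at this
    have := up (y := 1) (by linarith)
    linarith
  · intro t ht r hr s hs
    have := R.lip _ (htime ht) _ (hrad hr) _ (hrad hs)
    rw [ht', hr', hr', hL2, abs_mul, abs_of_pos hl2, ← sub_div, abs_div, abs_of_pos hl0] at this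
    exact up' (abs_nonneg _) this
  · intro t ht r hr
    have := R.bdry _ (htime ht) _ (hrad hr)
    rw [ht', hr', abs_mul, abs_of_pos hl2, ← sub_div] at this
    exact up' (by linarith [hr.2]) this
  · intro t ht s hs hts r hr
    have hd : |t / l ^ 2 - s / l ^ 2| = |t - s| / l ^ 2 := by
      rw [← sub_div, abs_div, abs_of_pos hl2]
    have := R.holder _ (htime ht) _ (htime hs) (by rw [hd, div_le_one hl2]; exact hts) _ (hrad hr)
    rw [ht', ht', hr', hL2, abs_mul, abs_of_pos hl2, hd, sqrt_div (abs_nonneg _),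
      sqrt_sq hl0.le] at this
    exact up' (sqrt_nonneg _) this
  · intro t ht h h0 h1 r hr
    have := R.approx _ (htime ht) (h / l ^ 2) (by positivity) ((div_le_one hl2).2 h1) _ (hrad hr)
    rw [← add_div, ht', ht', hr', sqrt_div h0.le, sqrt_sq hl0.le] at this
    refine up' (sqrt_nonneg _) (le_trans (le_of_eq ?_) this)
    have e : (w (t + h) r - μ - (w t r - μ)) / (h / l ^ 2) - l ^ 2 * wt t r =
      l ^ 2 * ((w (t + h) r - w t r) / h - wt t r) := by field_simp; ring
    rw [e, abs_mul, abs_of_pos hl2]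

/-- At a maximum over the past, the source of a radial solution is nonnegative. -/
theorem RadSol.source_nonneg_of_max {n X t r : ℝ} {w wr wrr wt g : ℝ → ℝ → ℝ} {I : Set ℝ}
    (hn : 0 ≤ n) (h : RadSol n w wr wrr wt g I X) (ht : t ∈ I) (hr : r ∈ Ico 0 X)
    (hleft : ∀ᶠ s in 𝓝[<] t, w s r ≤ w t r)
    (hspace : ∀ᶠ s in 𝓝 r, 0 ≤ s → w t s ≤ w t r) : 0 ≤ g t r := by
  have hX : 0 < X := hr.1.trans_lt hr.2
  have h1 : 0 ≤ wt t r := nonneg_of_max_left (h.dt t ht r hr) hleft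
  have hev : ∀ᶠ s in 𝓝 r, HasDerivAt (w t) (wr t s) s := by
    filter_upwards [Ioo_mem_nhds (show -X < r by linarith [hr.1]) hr.2] with s hs
    exact h.dr t ht s hs
  have hrr := h.drr t ht r ⟨by linarith [hr.1], hr.2⟩
  rcases hr.1.eq_or_lt with h0 | h0
  · subst h0
    have h2 := second_deriv_nonpos_of_max_right (hev.filter_mono nhdsWithin_le_nhds)
      hev.self_of_nhds hrr (h.axis t ht) (by
        filter_upwards [hspace.filter_mono nhdsWithin_le_nhds, self_mem_nhdsWithin] with s hs hs'
        exact hs (le_of_lt hs'))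
    have := h.eq_zero t ht hX
    nlinarith
  · obtain ⟨h2, h3⟩ := deriv_conditions_of_localMax hev hrr (by
      filter_upwards [hspace, lt_mem_nhds h0] with s hs hs'
      exact hs hs'.le)
    have := h.eq_pos t ht r ⟨h0, hr.2⟩
    rw [h2, mul_zero] at this
    linarith

/-- The penalisation used to localise maxima. -/
theorem radSol_penalty (n X c d : ℝ) (I : Set ℝ) :
    RadSol n (fun t r => (r ^ 2 - c ^ 2) ^ 2 + (t - d) ^ 2) (fun _ r => 4 * r * (r ^ 2 - c ^ 2))
      (fun _ r => 12 * r ^ 2 - 4 * c ^ 2) (fun t _ => 2 * (t - d))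
      (fun t r => 2 * (t - d) - (12 * r ^ 2 - 4 * c ^ 2) - 4 * n * (r ^ 2 - c ^ 2)) I X where
  dr t _ r _ := by
    have h := (((((hasDerivAt_id r).pow 2).sub_const (c ^ 2)).pow 2).add_const ((t - d) ^ 2))
    refine h.congr_deriv ?_
    simp
    ring
  drr t _ r _ := by
    have h := (((hasDerivAt_id r).const_mul 4).mul (((hasDerivAt_id r).pow 2).sub_const (c ^ 2)))
    refine h.congr_deriv ?_
    simp
    ring
  dt t _ r _ := by
    have h := (((hasDerivAt_id t).sub_const d).pow 2).const_add ((r ^ 2 - c ^ 2) ^ 2)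
    refine h.congr_deriv ?_
    simp
  axis t _ := by simp
  eq_pos t _ r hr := by
    have := hr.1.ne'
    field_simp
    ring
  eq_zero t _ _ := by ring

/-- `v` is, on `[a, b] × [0, Y)`, a uniform limit of classical solutions of equations converging
to `v_t = v_rr + (n / r) v_r + pot * v`. -/
def ApproxSol (n : ℝ) (v pot : ℝ → ℝ → ℝ) (a b Y : ℝ) : Prop :=
  ∀ ε > 0, ∃ q qr qrr qt g : ℝ → ℝ → ℝ, RadSol n q qr qrr qt g (Icc a b) Y ∧
    ContinuousOn (fun p : ℝ × ℝ => q p.1 p.2) (Icc a b ×ˢ Ico 0 Y) ∧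
    ContinuousOn (fun p : ℝ × ℝ => qt p.1 p.2) (Icc a b ×ˢ Ico 0 Y) ∧
    ContinuousOn (fun p : ℝ × ℝ => g p.1 p.2) (Icc a b ×ˢ Ico 0 Y) ∧
    ∀ t ∈ Icc a b, ∀ r ∈ Ico 0 Y, |q t r - v t r| ≤ ε ∧ |g t r - pot t r * v t r| ≤ ε

theorem ApproxSol.neg {n a b Y : ℝ} {v pot : ℝ → ℝ → ℝ} (h : ApproxSol n v pot a b Y) :
    ApproxSol n (fun t r => - v t r) pot a b Y := by
  intro ε hε
  obtain ⟨q, qr, qrr, qt, g, h1, h2, h3, h4, h5⟩ := h ε hε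
  refine ⟨_, _, _, _, _, h1.neg, h2.neg, h3.neg, h4.neg, fun t ht r hr => ?_⟩
  obtain ⟨h6, h7⟩ := h5 t ht r hr
  constructor
  · rwa [← abs_neg, show -(-q t r - -v t r) = q t r - v t r by ring]
  · rwa [← abs_neg, show -(-g t r - pot t r * -v t r) = g t r - pot t r * v t r by ring]

/-- The viscosity-type inequality at a maximum over the past of `v - φ`. -/
theorem ApproxSol.viscosity {n a b Y t₀ r₀ : ℝ} {v pot φ φr φrr φt k : ℝ → ℝ → ℝ} (hn : 0 ≤ n)
    (h : ApproxSol n v pot a b Y) (hφ : RadSol n φ φr φrr φt k (Icc a b) Y)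
    (hφc : ContinuousOn (fun p : ℝ × ℝ => φ p.1 p.2) (Icc a b ×ˢ Ico 0 Y))
    (hk : ContinuousOn (fun p : ℝ × ℝ => k p.1 p.2) (Icc a b ×ˢ Ico 0 Y))
    (hv : ContinuousOn (fun p : ℝ × ℝ => v p.1 p.2) (Icc a b ×ˢ Ico 0 Y))
    (hp : ContinuousOn (fun p : ℝ × ℝ => pot p.1 p.2) (Icc a b ×ˢ Ico 0 Y))
    (ht : t₀ ∈ Ioc a b) (hr : r₀ ∈ Ico 0 Y)
    (hmax : ∃ δ > 0, ∀ t ∈ Icc a t₀, ∀ r ∈ Ico 0 Y, t₀ - t < δ → |r - r₀| < δ →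
      v t r - φ t r ≤ v t₀ r₀ - φ t₀ r₀) : k t₀ r₀ ≤ pot t₀ r₀ * v t₀ r₀ := by
  by_contra hcon
  push Not at hcon
  obtain ⟨δ₁, hδ₁, hmax⟩ := hmax
  set c := (k t₀ r₀ - pot t₀ r₀ * v t₀ r₀) / 4 with hc
  have hc0 : 0 < c := by rw [hc]; linarith
  have hmem : ((t₀, r₀) : ℝ × ℝ) ∈ Icc a b ×ˢ Ico 0 Y := ⟨Ioc_subset_Icc_self ht, hr⟩
  have hcont := (hk.sub (hp.mul hv)) _ hmem
  rw [Metric.continuousWithinAt_iff] at hcont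
  obtain ⟨δ₂, hδ₂, hcont⟩ := hcont c hc0
  obtain ⟨δ, hδ, hd1, hd2, hdY, hda, hd11⟩ : ∃ δ : ℝ, 0 < δ ∧ δ < δ₁ ∧ δ < δ₂ ∧ r₀ + δ < Y ∧
      δ < t₀ - a ∧ δ ≤ 1 := by
    refine ⟨min (min (min (δ₁ / 2) (δ₂ / 2)) (min ((Y - r₀) / 2) ((t₀ - a) / 2))) 1, ?_, ?_, ?_,
      ?_, ?_, min_le_right _ _⟩
    · have h1 := hr.2
      have h2 := ht.1
      simp only [lt_min_iff]
      refine ⟨⟨⟨?_, ?_⟩, ?_, ?_⟩, ?_⟩ <;> linarith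
    · exact lt_of_le_of_lt ((min_le_left _ _).trans ((min_le_left _ _).trans (min_le_left _ _)))
        (by linarith)
    · exact lt_of_le_of_lt ((min_le_left _ _).trans ((min_le_left _ _).trans (min_le_right _ _)))
        (by linarith)
    · have : min (min (min (δ₁ / 2) (δ₂ / 2)) (min ((Y - r₀) / 2) ((t₀ - a) / 2))) 1
        ≤ (Y - r₀) / 2 := (min_le_left _ _).trans ((min_le_right _ _).trans (min_le_left _ _))
      linarith [hr.2]
    · exact lt_of_le_of_lt ((min_le_left _ _).trans ((min_le_right _ _).trans (min_le_right _ _)))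
        (by linarith [ht.1])
  have hr0 := hr.1
  have hgap : ∀ t ∈ Icc (t₀ - δ) t₀, ∀ r, 0 ≤ r → |r - r₀| ≤ δ →
      pot t r * v t r ≤ k t r - 3 * c := by
    intro t ht' r hr' hrr
    have h1 : ((t, r) : ℝ × ℝ) ∈ Icc a b ×ˢ Ico 0 Y :=
      ⟨⟨by linarith [ht'.1], by linarith [ht'.2, ht.2]⟩, hr', by linarith [(abs_le.1 hrr).2]⟩
    have := hcont h1 (by
      rw [Prod.dist_eq, max_lt_iff, Real.dist_eq, Real.dist_eq]
      refine ⟨?_, by simpa using hrr.trans_lt hd2⟩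
      show |t - t₀| < δ₂
      rw [abs_lt]; constructor <;> linarith [ht'.1, ht'.2])
    rw [Real.dist_eq] at this
    have := (abs_lt.1 this).1
    simp only [Pi.sub_apply, Pi.mul_apply] at this
    linarith
  obtain ⟨C, hC0, hC⟩ : ∃ C : ℝ, 0 < C ∧ ∀ t ∈ Icc (t₀ - δ) t₀, ∀ r, 0 ≤ r → |r - r₀| ≤ δ →
      -C ≤ 2 * (t - t₀) - (12 * r ^ 2 - 4 * r₀ ^ 2) - 4 * n * (r ^ 2 - r₀ ^ 2) := by
    refine ⟨2 + (12 + 4 * n) * (r₀ + 1) ^ 2, by positivity, fun t ht' r hr' hrr => ?_⟩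
    have h1 : r ≤ r₀ + 1 := by linarith [(abs_le.1 hrr).2]
    have h2 : r ^ 2 ≤ (r₀ + 1) ^ 2 := by gcongr
    have h3 : 4 * n * r ^ 2 ≤ 4 * n * (r₀ + 1) ^ 2 := by gcongr
    have h4 : 0 ≤ n * r₀ ^ 2 := by positivity
    nlinarith [ht'.1, sq_nonneg r₀]
  set κ := c / C with hκ
  have hκ0 : 0 < κ := by positivity
  set ε := min (κ * δ ^ 4 / 4) (c / 2) with hε
  have hε0 : 0 < ε := by rw [hε, lt_min_iff]; constructor <;> positivity
  obtain ⟨q, qr, qrr, qt, g, hq, hqc, -, -, happ⟩ := h ε hε0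
  have hsol := (hq.lin hφ 1 (-1)).lin (radSol_penalty n Y r₀ t₀ (Icc a b)) 1 (-κ)
  simp only [inter_self] at hsol
  set F : ℝ → ℝ → ℝ := fun t r => 1 * (1 * q t r + -1 * φ t r) +
    -κ * ((r ^ 2 - r₀ ^ 2) ^ 2 + (t - t₀) ^ 2) with hF
  have hbox : Icc (t₀ - δ) t₀ ×ˢ (Icc (r₀ - δ) (r₀ + δ) ∩ Ici 0) ⊆ Icc a b ×ˢ Ico 0 Y := by
    rintro ⟨t, r⟩ ⟨h1, h2, h3⟩
    exact ⟨⟨by linarith [h1.1], by linarith [h1.2, ht.2]⟩, h3, by linarith [h2.2]⟩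
  have hK : IsCompact (Icc (t₀ - δ) t₀ ×ˢ (Icc (r₀ - δ) (r₀ + δ) ∩ Ici 0)) :=
    isCompact_Icc.prod (isCompact_Icc.inter_right isClosed_Ici)
  have hFc : ContinuousOn (fun p : ℝ × ℝ => F p.1 p.2)
      (Icc (t₀ - δ) t₀ ×ˢ (Icc (r₀ - δ) (r₀ + δ) ∩ Ici 0)) := by
    have h1 := hqc.mono hbox
    have h2 := hφc.mono hbox
    simp only [hF]
    fun_prop
  have hstar : ((t₀, r₀) : ℝ × ℝ) ∈ Icc (t₀ - δ) t₀ ×ˢ (Icc (r₀ - δ) (r₀ + δ) ∩ Ici 0) :=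
    ⟨⟨by linarith, le_rfl⟩, ⟨by linarith, by linarith⟩, hr0⟩
  obtain ⟨⟨t, r⟩, hp0, hpmax⟩ := hK.exists_isMaxOn ⟨_, hstar⟩ hFc
  have hge : F t₀ r₀ ≤ F t r := hpmax hstar
  obtain ⟨ht', hr1, hr2⟩ := hp0
  simp only at ht' hr1 hr2
  have hr2 : 0 ≤ r := hr2
  have hpm : ((t, r) : ℝ × ℝ) ∈ Icc a b ×ˢ Ico 0 Y := hbox ⟨ht', hr1, hr2⟩
  have hpen : κ * ((r ^ 2 - r₀ ^ 2) ^ 2 + (t - t₀) ^ 2) ≤ 2 * ε := by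
    have h1 := (abs_le.1 (happ t hpm.1 r hpm.2).1).2
    have h2 := (abs_le.1 (happ t₀ hmem.1 r₀ hmem.2).1).1
    have h3 := hmax t ⟨by linarith [ht'.1], ht'.2⟩ r ⟨hr2, by linarith [hr1.2]⟩
      (by linarith [ht'.1]) (by rw [abs_lt]; constructor <;> linarith [hr1.1, hr1.2])
    simp only [hF] at hge
    nlinarith
  have hlt : (r ^ 2 - r₀ ^ 2) ^ 2 + (t - t₀) ^ 2 < δ ^ 4 := by
    have h1 : ε ≤ κ * δ ^ 4 / 4 := min_le_left _ _
    have h2 : 0 < κ * δ ^ 4 := by positivity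
    by_contra hh
    push Not at hh
    have := mul_le_mul_of_nonneg_left hh hκ0.le
    linarith
  have hrlt : |r - r₀| < δ := by
    by_contra hh
    push Not at hh
    have h1 : |r - r₀| ≤ r + r₀ := by rw [abs_le]; constructor <;> linarith
    have h2 : δ ^ 2 ≤ |r ^ 2 - r₀ ^ 2| := by
      rw [show r ^ 2 - r₀ ^ 2 = (r - r₀) * (r + r₀) by ring, abs_mul, abs_of_nonneg
        (show 0 ≤ r + r₀ by linarith), sq]
      exact mul_le_mul hh (hh.trans h1) hδ.le (abs_nonneg _)
    have h3 : (δ ^ 2) ^ 2 ≤ (r ^ 2 - r₀ ^ 2) ^ 2 := by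
      rw [← sq_abs (r ^ 2 - r₀ ^ 2)]; gcongr
    nlinarith [sq_nonneg (t - t₀)]
  have htlt : t₀ - δ < t := by
    by_contra hh
    push Not at hh
    have h1 : δ ^ 2 ≤ (t - t₀) ^ 2 := by nlinarith
    have h2 : δ ^ 4 ≤ δ ^ 2 := pow_le_pow_of_le_one hδ.le hd11 (by norm_num)
    nlinarith [sq_nonneg (r ^ 2 - r₀ ^ 2)]
  have hG := hsol.source_nonneg_of_max hn (t := t) (r := r) hpm.1
    hpm.2 (by
      filter_upwards [Ioo_mem_nhdsLT htlt] with s hs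
      exact hpmax (show ((s, r) : ℝ × ℝ) ∈ _ from ⟨⟨hs.1.le, hs.2.le.trans ht'.2⟩, hr1, hr2⟩)) (by
      rw [abs_lt] at hrlt
      filter_upwards [Ioo_mem_nhds (show r₀ - δ < r by linarith) (show r < r₀ + δ by linarith)]
        with s hs hs0
      exact hpmax (show ((t, s) : ℝ × ℝ) ∈ _ from ⟨ht', ⟨hs.1.le, hs.2.le⟩, hs0⟩))
  have h1 := (abs_le.1 (happ t hpm.1 r hpm.2).2).2
  have h2 := hgap t ht' r hr2 hrlt.le
  have h3 := mul_le_mul_of_nonneg_left (hC t ht' r hr2 hrlt.le) hκ0.le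
  have h4 : κ * C = c := by rw [hκ]; field_simp
  have h5 : ε ≤ c / 2 := min_le_right _ _
  nlinarith

/-- Bounded continuous functions solving `v_t = v_rr + (n / r) v_r + pot * v` in a generalised
sense where they do not vanish. -/
structure Good (n : ℝ) (v pot : ℝ → ℝ → ℝ) (a b P : ℝ) : Prop where
  cont : ContinuousOn (fun p : ℝ × ℝ => v p.1 p.2) (Icc a b ×ˢ Ici 0)
  bdd : ∃ M, ∀ t ∈ Icc a b, ∀ r, 0 ≤ r → |v t r| ≤ M
  pcont : ContinuousOn (fun p : ℝ × ℝ => pot p.1 p.2) (Icc a b ×ˢ Ici 0)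
  pbdd : ∀ t ∈ Icc a b, ∀ r, 0 ≤ r → |pot t r| ≤ P
  loc : ∀ t ∈ Icc a b, ∀ r, 0 ≤ r → v t r ≠ 0 → ∃ Y > r, ApproxSol n v pot a b Y

theorem Good.neg {n a b P : ℝ} {v pot : ℝ → ℝ → ℝ} (h : Good n v pot a b P) :
    Good n (fun t r => - v t r) pot a b P where
  cont := h.cont.neg
  bdd := by simpa using h.bdd
  pcont := h.pcont
  pbdd := h.pbdd
  loc t ht r hr hv := by
    obtain ⟨Y, hY, h1⟩ := h.loc t ht r hr (by simpa using hv)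
    exact ⟨Y, hY, h1.neg⟩

theorem ApproxSol.mono {n a b a' b' Y : ℝ} {v pot : ℝ → ℝ → ℝ} (h : ApproxSol n v pot a b Y)
    (ha : a ≤ a') (hb : b' ≤ b) : ApproxSol n v pot a' b' Y := by
  intro ε hε
  obtain ⟨q, qr, qrr, qt, g, h1, h2, h3, h4, h5⟩ := h ε hε
  have hs : Icc a' b' ⊆ Icc a b := Icc_subset_Icc ha hb
  have hs' : Icc a' b' ×ˢ Ico 0 Y ⊆ Icc a b ×ˢ Ico 0 Y := prod_mono hs le_rfl
  exact ⟨q, qr, qrr, qt, g, h1.mono hs le_rfl, h2.mono hs', h3.mono hs', h4.mono hs',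
    fun t ht => h5 t (hs ht)⟩

/-- The barrier used for tracing positivity backwards in time. -/
theorem radSol_barrier (n X a η lam c : ℝ) (I : Set ℝ) :
    RadSol n (fun t r => exp (lam * t) * (η * (r ^ 2 + 2 * (n + 1) * (t - a)) + c))
      (fun t r => exp (lam * t) * (η * (2 * r))) (fun t _ => exp (lam * t) * (η * 2))
      (fun t r => exp (lam * t) * lam * (η * (r ^ 2 + 2 * (n + 1) * (t - a)) + c) +
        exp (lam * t) * (η * (2 * (n + 1))))
      (fun t r => lam * (exp (lam * t) * (η * (r ^ 2 + 2 * (n + 1) * (t - a)) + c))) I X where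
  dr t _ r _ := by
    have h := (((((hasDerivAt_id r).pow 2).add_const (2 * (n + 1) * (t - a))).const_mul
      η).add_const c).const_mul (exp (lam * t))
    refine h.congr_deriv ?_
    simp
  drr t _ r _ := by
    have h := (((hasDerivAt_id r).const_mul 2).const_mul η).const_mul (exp (lam * t))
    exact h.congr_deriv (by ring)
  dt t _ r _ := by
    have h1 := ((hasDerivAt_id t).const_mul lam).exp
    have h2 := (((((hasDerivAt_id t).sub_const a).const_mul (2 * (n + 1))).const_add
      (r ^ 2)).const_mul η).add_const c
    refine (h1.mul h2).congr_deriv ?_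
    simp
  axis t _ := by simp
  eq_pos t _ r hr := by
    have := hr.1.ne'
    field_simp
    ring
  eq_zero t _ _ := by ring

/-- The points from which `(t₀, x₀)` can be reached along a curve inside `{v > 0}`. -/
def traceSet (v : ℝ → ℝ → ℝ) (a t₀ x₀ : ℝ) : Set (ℝ × ℝ) :=
  {p | p.1 ∈ Icc a t₀ ∧ 0 ≤ p.2 ∧ ∃ γ : ℝ → ℝ, Continuous γ ∧ γ p.1 = p.2 ∧ γ t₀ = x₀ ∧
    ∀ s ∈ Icc p.1 t₀, 0 ≤ γ s ∧ 0 < v s (γ s)}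

theorem traceSet_extend {v : ℝ → ℝ → ℝ} {a t₀ x₀ s y s₁ y₁ t r δ : ℝ}
    (h : (s, y) ∈ traceSet v a t₀ x₀) (ha : a ≤ s₁) (hs : s₁ < s) (hy₁ : 0 ≤ y₁)
    (hpos : ∀ s' ∈ Icc a t₀, ∀ y', 0 ≤ y' → |s' - t| < δ → |y' - r| < δ → 0 < v s' y')
    (h1 : |s - t| < δ) (h2 : |y - r| < δ) (h3 : |s₁ - t| < δ) (h4 : |y₁ - r| < δ) :
    (s₁, y₁) ∈ traceSet v a t₀ x₀ := by
  obtain ⟨hst, hy, γ, hγ, hγ1, hγ2, hγ3⟩ := h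
  simp only at hst hy hγ1 hγ3
  refine ⟨⟨ha, hs.le.trans hst.2⟩, hy₁,
    fun σ => if σ ≤ s then y + (s - σ) / (s - s₁) * (y₁ - y) else γ σ, ?_, ?_, ?_, ?_⟩
  · refine Continuous.if_le (by fun_prop) hγ continuous_id continuous_const ?_
    intro σ hσ
    have : σ = s := hσ
    simp [this, hγ1]
  · simp only [hs.le, if_true]
    rw [div_self (by linarith)]; ring
  · rcases hst.2.eq_or_lt with h | h
    · simp only [h, le_refl, if_true, sub_self, zero_div, zero_mul, add_zero]
      rw [← hγ1, h, hγ2]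
    · simp only [not_le.2 h, if_false, hγ2]
  · intro σ hσ
    simp only at hσ
    by_cases hc : σ ≤ s
    · simp only [hc, if_true]
      set θ := (s - σ) / (s - s₁) with hθ
      have hd : 0 < s - s₁ := by linarith
      have h0 : 0 ≤ θ := div_nonneg (by linarith) hd.le
      have h01 : θ ≤ 1 := by rw [hθ, div_le_one hd]; linarith [hσ.1]
      rw [abs_lt] at h1 h2 h3 h4
      have hp : 0 ≤ y + θ * (y₁ - y) := by nlinarith
      refine ⟨hp, hpos σ ⟨ha.trans hσ.1, hσ.2⟩ _ hp ?_ ?_⟩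
      · rw [abs_lt]; constructor <;> linarith [hσ.1]
      · have := (convex_Ioo (-δ) δ) (show y - r ∈ _ from h2) (show y₁ - r ∈ _ from h4)
          (sub_nonneg.2 h01) h0 (by ring)
        simp only [smul_eq_mul] at this
        rw [abs_lt]; constructor <;> nlinarith [this.1, this.2]
    · simp only [hc, if_false]
      exact hγ3 σ ⟨(not_le.1 hc).le, hσ.2⟩

/-- Positivity can be traced back in time along a curve. -/
theorem Good.trace {n a b P t₀ x₀ : ℝ} {v pot : ℝ → ℝ → ℝ} (hn : 0 ≤ n) (h : Good n v pot a b P)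
    (ht : t₀ ∈ Icc a b) (hx : 0 ≤ x₀) (hv : 0 < v t₀ x₀) :
    ∃ γ : ℝ → ℝ, Continuous γ ∧ γ t₀ = x₀ ∧ ∀ s ∈ Icc a t₀, 0 ≤ γ s ∧ 0 < v s (γ s) := by
  by_contra hcon
  have hno : ∀ y, (a, y) ∉ traceSet v a t₀ x₀ := by
    rintro y ⟨-, -, γ, h1, -, h2, h3⟩
    exact hcon ⟨γ, h1, h2, h3⟩
  set A := traceSet v a t₀ x₀ with hA
  have hA0 : (t₀, x₀) ∈ A := by
    refine ⟨⟨ht.1, le_rfl⟩, hx, fun _ => x₀, continuous_const, rfl, rfl, fun s hs => ?_⟩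
    have : s = t₀ := le_antisymm hs.2 hs.1
    subst this
    exact ⟨hx, hv⟩
  have hAsub : closure A ⊆ Icc a t₀ ×ˢ Ici 0 :=
    closure_minimal (fun p hp => ⟨hp.1, hp.2.1⟩) (isClosed_Icc.prod isClosed_Ici)
  obtain ⟨M, hM⟩ := h.bdd
  set lam := |P| + 1 with hlam
  have hlam0 : 0 < lam := by positivity
  set Φ : ℝ → ℝ → ℝ → ℝ := fun η t r =>
    exp (-(lam * t)) * v t r - η * (r ^ 2 + 2 * (n + 1) * (t - a)) with hΦ
  obtain ⟨η, hη, hηΦ⟩ : ∃ η > 0, 0 < Φ η t₀ x₀ := by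
    have h1 : 0 < exp (-(lam * t₀)) * v t₀ x₀ := by positivity
    have h2 : 0 ≤ x₀ ^ 2 + 2 * (n + 1) * (t₀ - a) := by
      have := sub_nonneg.2 ht.1
      positivity
    refine ⟨exp (-(lam * t₀)) * v t₀ x₀ / (2 * (x₀ ^ 2 + 2 * (n + 1) * (t₀ - a) + 1)),
      by positivity, ?_⟩
    simp only [hΦ]
    rw [sub_pos, div_mul_eq_mul_div, div_lt_iff₀ (by positivity)]
    nlinarith
  have hbig : ∃ ρ, ∀ t ∈ Icc a b, ∀ r, 0 ≤ r → 0 < Φ η t r → r ≤ ρ := by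
    refine ⟨exp (-(lam * a)) * |M| / η + 1, fun t ht' r hr hpos => ?_⟩
    simp only [hΦ] at hpos
    have h1 : exp (-(lam * t)) * v t r ≤ exp (-(lam * a)) * |M| := by
      have h2 : exp (-(lam * t)) ≤ exp (-(lam * a)) :=
        exp_le_exp.2 (by nlinarith [ht'.1])
      have h3 : v t r ≤ |M| := (le_abs_self _).trans ((hM t ht' r hr).trans (le_abs_self _))
      calc exp (-(lam * t)) * v t r ≤ exp (-(lam * t)) * |M| := by gcongr
        _ ≤ _ := by gcongr
    have h4 : 0 ≤ 2 * (n + 1) * (t - a) := by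
      have := sub_nonneg.2 ht'.1
      positivity
    have h5 : r ^ 2 < exp (-(lam * a)) * |M| / η := by
      rw [lt_div_iff₀ hη]
      nlinarith
    nlinarith [sq_nonneg (r - 1)]
  obtain ⟨ρ, hρ⟩ := hbig
  have hsubIcc : Icc a t₀ ⊆ Icc a b := Icc_subset_Icc le_rfl ht.2
  have hK : IsCompact (closure A ∩ Icc a t₀ ×ˢ Icc 0 ρ) :=
    (isCompact_Icc.prod isCompact_Icc).inter_left isClosed_closure
  have hΦc : ContinuousOn (fun p : ℝ × ℝ => Φ η p.1 p.2) (closure A ∩ Icc a t₀ ×ˢ Icc 0 ρ) := by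
    have h1 : ContinuousOn (fun p : ℝ × ℝ => v p.1 p.2) (closure A ∩ Icc a t₀ ×ˢ Icc 0 ρ) :=
      h.cont.mono (fun p hp => ⟨hsubIcc hp.2.1, hp.2.2.1⟩)
    simp only [hΦ]
    fun_prop
  obtain ⟨⟨t, r⟩, ⟨hcl, ht', hr'⟩, hmax⟩ := hK.exists_isMaxOn
    ⟨(t₀, x₀), subset_closure hA0, ⟨ht.1, le_rfl⟩, hx, hρ t₀ ht x₀ hx hηΦ⟩ hΦc
  simp only at ht' hr'
  have hstar : 0 < Φ η t r := hηΦ.trans_le (hmax (show ((t₀, x₀) : ℝ × ℝ) ∈ _ from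
    ⟨subset_closure hA0, ⟨ht.1, le_rfl⟩, hx, hρ t₀ ht x₀ hx hηΦ⟩))
  have hmax' : ∀ p ∈ closure A, Φ η p.1 p.2 ≤ Φ η t r := by
    intro p hp
    by_cases h0 : 0 < Φ η p.1 p.2
    · exact hmax (show p ∈ _ from ⟨hp, (hAsub hp).1, (hAsub hp).2,
        hρ _ (hsubIcc (hAsub hp).1) _ (hAsub hp).2 h0⟩)
    · exact (not_lt.1 h0).trans hstar.le
  have hvpos : 0 < v t r := by
    simp only [hΦ] at hstar
    have h4 : 0 ≤ η * (r ^ 2 + 2 * (n + 1) * (t - a)) := by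
      have := sub_nonneg.2 ht'.1
      positivity
    exact pos_of_mul_pos_right (by linarith : 0 < exp (-(lam * t)) * v t r) (exp_pos _).le
  obtain ⟨δ, hδ, hball⟩ : ∃ δ > 0, ∀ s' ∈ Icc a t₀, ∀ y', 0 ≤ y' → |s' - t| < δ → |y' - r| < δ →
      0 < v s' y' := by
    have := h.cont (t, r) ⟨hsubIcc ht', hr'.1⟩
    rw [Metric.continuousWithinAt_iff] at this
    obtain ⟨δ, hδ, h1⟩ := this (v t r) hvpos
    refine ⟨δ, hδ, fun s' hs' y' hy' h2 h3 => ?_⟩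
    have := h1 (x := (s', y')) ⟨hsubIcc hs', hy'⟩ (by
      rw [Prod.dist_eq, max_lt_iff, Real.dist_eq, Real.dist_eq]; exact ⟨h2, h3⟩)
    rw [Real.dist_eq] at this
    linarith [(abs_lt.1 this).1]
  have hnear : ∀ δ' > 0, ∃ s y, (s, y) ∈ A ∧ |s - t| < δ' ∧ |y - r| < δ' := by
    intro δ' hδ'
    obtain ⟨⟨s, y⟩, h1, h2⟩ := Metric.mem_closure_iff.1 hcl δ' hδ'
    rw [dist_comm, Prod.dist_eq, max_lt_iff, Real.dist_eq, Real.dist_eq] at h2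
    exact ⟨s, y, h1, h2⟩
  have hat : a < t := by
    rcases ht'.1.eq_or_lt with h0 | h0
    · exfalso
      obtain ⟨s, y, h1, h2, h3⟩ := hnear δ hδ
      have h4 : a < s := lt_of_le_of_ne h1.1.1 (by rintro rfl; exact hno _ h1)
      refine hno r (traceSet_extend h1 le_rfl h4 hr'.1 hball h2 h3 ?_ ?_) <;> simp [h0, hδ]
    · exact h0
  have hlow : ∀ s ∈ Icc a t, ∀ y, 0 ≤ y → s < t → t - s < δ → |y - r| < δ → (s, y) ∈ A := by
    intro s hs y hy h1 h2 h3
    obtain ⟨s', y', h4, h5, h6⟩ := hnear (min δ (t - s)) (lt_min hδ (by linarith))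
    rw [lt_min_iff] at h5 h6
    refine traceSet_extend h4 hs.1 ?_ hy hball h5.1 h6.1 ?_ h3
    · linarith [(abs_lt.1 h5.2).1]
    · rw [abs_lt]; constructor <;> linarith
  have hlow' : ∀ s ∈ Icc a t, ∀ y, 0 ≤ y → t - s < δ → |y - r| < δ → (s, y) ∈ closure A := by
    intro s hs y hy h2 h3
    rcases hs.2.eq_or_lt with h0 | h0
    · subst h0
      have : Tendsto (fun σ => (σ, y)) (𝓝[<] s) (𝓝 (s, y)) :=
        ((continuous_id.prodMk continuous_const).tendsto s).mono_left nhdsWithin_le_nhds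
      refine mem_closure_of_tendsto this ?_
      filter_upwards [Ioo_mem_nhdsLT (show max a (s - δ) < s from max_lt hat (by linarith))]
        with σ hσ
      exact hlow σ ⟨(le_max_left _ _).trans hσ.1.le, hσ.2.le⟩ y hy hσ.2
        (by linarith [(le_max_right a (s - δ)).trans_lt hσ.1]) h3
    · exact subset_closure (hlow s hs y hy h0 h2 h3)
  obtain ⟨Y, hY, happ⟩ := h.loc t (hsubIcc ht') r hr'.1 hvpos.ne'
  have hYs : Icc a b ×ˢ Ico 0 Y ⊆ Icc a b ×ˢ Ici 0 := prod_mono le_rfl (fun x hx => hx.1)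
  have hkey : ∀ s y, v s y - exp (lam * s) * (η * (y ^ 2 + 2 * (n + 1) * (s - a)) + Φ η t r) =
      exp (lam * s) * (Φ η s y - Φ η t r) := by
    intro s y
    have : exp (lam * s) * exp (-(lam * s)) = 1 := by rw [← exp_add]; simp
    have h1 : v s y = exp (lam * s) * (exp (-(lam * s)) * v s y) := by
      rw [← mul_assoc, this, one_mul]
    nth_rewrite 1 [h1]
    nth_rewrite 2 [hΦ]
    ring
  have hvisc := happ.viscosity hn (radSol_barrier n Y a η lam (Φ η t r) (Icc a b))
    (by fun_prop) (by fun_prop) (h.cont.mono hYs) (h.pcont.mono hYs) (t₀ := t) (r₀ := r)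
    ⟨hat, (hsubIcc ht').2⟩ ⟨hr'.1, hY⟩ ⟨δ, hδ, fun s hs y hy h1 h2 => by
      have h3 := hmax' (s, y) (hlow' s hs y hy.1 h1 h2)
      rw [hkey, hkey, sub_self, mul_zero]
      exact mul_nonpos_of_nonneg_of_nonpos (exp_pos _).le (by linarith)⟩
  have h5 : exp (lam * t) * (η * (r ^ 2 + 2 * (n + 1) * (t - a)) + Φ η t r) = v t r := by
    have := hkey t r
    rw [sub_self, mul_zero] at this
    linarith
  rw [h5] at hvisc
  have h6 : pot t r ≤ |P| := (le_abs_self _).trans ((h.pbdd t (hsubIcc ht') r hr'.1).trans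
    (le_abs_self _))
  nlinarith

/-- `v t` has `K` increasing nonnegative points at which its sign alternates. -/
def HasChain (v : ℝ → ℝ → ℝ) (t : ℝ) (K : ℕ) : Prop :=
  ∃ σ : ℝ, ∃ x : ℕ → ℝ, (∀ i < K, 0 ≤ x i) ∧ (∀ i, i + 1 < K → x i < x (i + 1)) ∧
    ∀ i < K, 0 < σ * (-1) ^ i * v t (x i)

theorem curves_ordered {γ₁ γ₂ : ℝ → ℝ} {a b c : ℝ} (h₁ : Continuous γ₁) (h₂ : Continuous γ₂)
    (hne : ∀ s ∈ Icc a b, γ₁ s ≠ γ₂ s) (hc : c ∈ Icc a b) (hlt : γ₁ c < γ₂ c) :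
    ∀ s ∈ Icc a b, γ₁ s < γ₂ s := by
  intro s hs
  by_contra hcon
  push Not at hcon
  obtain ⟨x, hx, hx'⟩ := isPreconnected_Icc.intermediate_value hc hs
    (f := fun s => γ₁ s - γ₂ s) (h₁.sub h₂).continuousOn
    (show (0 : ℝ) ∈ Icc _ _ from ⟨by linarith, by linarith⟩)
  exact hne x hx (by simpa [sub_eq_zero] using hx')

theorem Good.trace_sign {n a b P t₀ x₀ τ : ℝ} {v pot : ℝ → ℝ → ℝ} (hn : 0 ≤ n)
    (h : Good n v pot a b P) (ht : t₀ ∈ Icc a b) (hx : 0 ≤ x₀) (hv : 0 < τ * v t₀ x₀) :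
    ∃ γ : ℝ → ℝ, Continuous γ ∧ γ t₀ = x₀ ∧ ∀ s ∈ Icc a t₀, 0 ≤ γ s ∧ 0 < τ * v s (γ s) := by
  rcases lt_trichotomy τ 0 with h0 | h0 | h0
  · obtain ⟨γ, h1, h2, h3⟩ := h.neg.trace hn ht hx (by nlinarith)
    exact ⟨γ, h1, h2, fun s hs => ⟨(h3 s hs).1, by nlinarith [(h3 s hs).2]⟩⟩
  · simp [h0] at hv
  · obtain ⟨γ, h1, h2, h3⟩ := h.trace hn ht hx (pos_of_mul_pos_right hv h0.le)
    exact ⟨γ, h1, h2, fun s hs => ⟨(h3 s hs).1, mul_pos h0 (h3 s hs).2⟩⟩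

/-- A chain at the final time extends to ordered curves. -/
theorem Good.chain_curves {n a b P : ℝ} {v pot : ℝ → ℝ → ℝ} {K : ℕ} (hn : 0 ≤ n)
    (h : Good n v pot a b P) (hab : a ≤ b) (hK : HasChain v b K) :
    ∃ σ : ℝ, ∃ γ : ℕ → ℝ → ℝ, (∀ i < K, Continuous (γ i)) ∧
      (∀ i < K, ∀ s ∈ Icc a b, 0 ≤ γ i s ∧ 0 < σ * (-1) ^ i * v s (γ i s)) ∧
      ∀ i, i + 1 < K → ∀ s ∈ Icc a b, γ i s < γ (i + 1) s := by
  obtain ⟨σ, x, h1, h2, h3⟩ := hK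
  have : ∀ i, ∃ γ : ℝ → ℝ, i < K → Continuous γ ∧ γ b = x i ∧
      ∀ s ∈ Icc a b, 0 ≤ γ s ∧ 0 < σ * (-1) ^ i * v s (γ s) := by
    intro i
    by_cases hi : i < K
    · obtain ⟨γ, hγ⟩ := h.trace_sign hn ⟨hab, le_rfl⟩ (h1 i hi) (h3 i hi)
      exact ⟨γ, fun _ => hγ⟩
    · exact ⟨0, fun h => absurd h hi⟩
  choose γ hγ using this
  refine ⟨σ, γ, fun i hi => (hγ i hi).1, fun i hi => (hγ i hi).2.2, fun i hi => ?_⟩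
  obtain ⟨c1, e1, s1⟩ := hγ i (by omega)
  obtain ⟨c2, e2, s2⟩ := hγ (i + 1) hi
  refine curves_ordered c1 c2 (fun s hs heq => ?_) ⟨hab, le_rfl⟩ (by rw [e1, e2]; exact h2 i hi)
  have p1 := (s1 s hs).2
  have p2 := (s2 s hs).2
  rw [heq] at p1
  rw [pow_succ] at p2
  linarith

theorem Good.chain_back {n a b P : ℝ} {v pot : ℝ → ℝ → ℝ} {K : ℕ} (hn : 0 ≤ n)
    (h : Good n v pot a b P) (hab : a ≤ b) (hK : HasChain v b K) : HasChain v a K := by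
  obtain ⟨σ, γ, -, h2, h3⟩ := h.chain_curves hn hab hK
  exact ⟨σ, fun i => γ i a, fun i hi => (h2 i hi a ⟨le_rfl, hab⟩).1,
    fun i hi => h3 i hi a ⟨le_rfl, hab⟩, fun i hi => (h2 i hi a ⟨le_rfl, hab⟩).2⟩

/-- Alternation of sign on the axis produces a chain at an earlier time. -/
theorem Good.chain_of_axis {n a b P σ : ℝ} {v pot : ℝ → ℝ → ℝ} {K : ℕ} {s : ℕ → ℝ} (hn : 0 ≤ n)
    (h : Good n v pot a b P) (hs : ∀ i < K, s i ∈ Icc a b) (hmono : ∀ i, i + 1 < K → s i ≤ s (i + 1))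
    (hsgn : ∀ i < K, 0 < σ * (-1) ^ i * v (s i) 0) : HasChain v a K := by
  have : ∀ i, ∃ γ : ℝ → ℝ, i < K → Continuous γ ∧ γ (s i) = 0 ∧
      ∀ t ∈ Icc a (s i), 0 ≤ γ t ∧ 0 < σ * (-1) ^ i * v t (γ t) := by
    intro i
    by_cases hi : i < K
    · obtain ⟨γ, hγ⟩ := h.trace_sign hn (hs i hi) le_rfl (hsgn i hi)
      exact ⟨γ, fun _ => hγ⟩
    · exact ⟨0, fun h => absurd h hi⟩
  choose γ hγ using this
  refine ⟨σ, fun i => γ i a, fun i hi => ((hγ i hi).2.2 a ⟨le_rfl, (hs i hi).1⟩).1, fun i hi => ?_,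
    fun i hi => ((hγ i hi).2.2 a ⟨le_rfl, (hs i hi).1⟩).2⟩
  have hi' : i < K := by omega
  obtain ⟨c1, e1, s1⟩ := hγ i hi'
  obtain ⟨c2, e2, s2⟩ := hγ (i + 1) hi
  have hsub : Icc a (s i) ⊆ Icc a (s (i + 1)) := Icc_subset_Icc le_rfl (hmono i hi)
  have hne : ∀ t ∈ Icc a (s i), γ i t ≠ γ (i + 1) t := by
    intro t ht heq
    have p1 := (s1 t ht).2
    have p2 := (s2 t (hsub ht)).2
    rw [heq] at p1
    rw [pow_succ] at p2
    linarith
  have hend : s i ∈ Icc a (s i) := ⟨(hs i hi').1, le_rfl⟩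
  refine curves_ordered c1 c2 hne hend (lt_of_le_of_ne ?_ (hne _ hend)) a ⟨le_rfl, (hs i hi').1⟩
  rw [e1]
  exact (s2 _ (hsub hend)).1

theorem Good.chain_below {n a b P : ℝ} {v pot : ℝ → ℝ → ℝ} (hn : 0 ≤ n)
    (h : Good n v pot a b P) (h0 : ∀ t ∈ Icc a b, v t 0 = 0)
    (hboth : ∀ t ∈ Ioc a b, ∀ ρ > 0, ∀ τ : ℝ, τ = 1 ∨ τ = -1 →
      ∃ s ∈ Ioo a t, ∃ r ∈ Ioo 0 ρ, 0 < τ * v s r) (K : ℕ) :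
    ∀ t ∈ Ioc a b, ∀ τ : ℝ, τ = 1 ∨ τ = -1 → ∀ c : ℝ → ℝ, Continuous c →
      (∀ s ∈ Icc a t, 0 < c s ∧ 0 < τ * v s (c s)) →
      ∃ x : ℕ → ℝ, (∀ i < K, 0 ≤ x i ∧ x i < c a) ∧ (∀ i, i + 1 < K → x i < x (i + 1)) ∧
        ∀ i < K, 0 < τ * (-1) ^ (K + i) * v a (x i) := by
  induction K with
  | zero => intro t _ τ _ c _ _; exact ⟨0, by simp, by simp, by simp⟩
  | succ K ih =>
    intro t ht τ hτ c hc hcs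
    obtain ⟨s₁, hs₁, hmin⟩ := isCompact_Icc.exists_isMinOn (nonempty_Icc.2 ht.1.le) hc.continuousOn
    obtain ⟨s, hs, r, hr, hv⟩ := hboth t ht (c s₁) (hcs s₁ hs₁).1 (-τ)
      (by rcases hτ with h | h <;> simp [h])
    obtain ⟨γ, hγ, hγs, hγv⟩ := h.trace_sign hn ⟨hs.1.le, hs.2.le.trans ht.2⟩ hr.1.le hv
    have hpos : ∀ σ ∈ Icc a s, 0 < γ σ ∧ 0 < -τ * v σ (γ σ) := by
      intro σ hσ
      refine ⟨lt_of_le_of_ne (hγv σ hσ).1 fun h1 => ?_, (hγv σ hσ).2⟩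
      have := (hγv σ hσ).2
      rw [← h1, h0 σ ⟨hσ.1, hσ.2.trans (hs.2.le.trans ht.2)⟩] at this
      simp at this
    have hlt : ∀ σ ∈ Icc a s, γ σ < c σ := by
      refine curves_ordered hγ hc (fun σ hσ heq => ?_) ⟨hs.1.le, le_rfl⟩ ?_
      · have h1 := (hpos σ hσ).2
        have h2 := (hcs σ ⟨hσ.1, hσ.2.trans hs.2.le⟩).2
        rw [heq] at h1
        linarith
      · rw [hγs]
        exact hr.2.trans_le (hmin (show s ∈ Icc a t from ⟨hs.1.le, hs.2.le⟩))
    obtain ⟨x, hx1, hx2, hx3⟩ := ih s ⟨hs.1, hs.2.le.trans ht.2⟩ (-τ)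
      (by rcases hτ with h | h <;> simp [h]) γ hγ hpos
    have ha : a ∈ Icc a s := ⟨le_rfl, hs.1.le⟩
    refine ⟨fun i => if i < K then x i else γ a, fun i hi => ?_, fun i hi => ?_, fun i hi => ?_⟩
    · by_cases h1 : i < K
      · simp only [h1, if_true]; exact ⟨(hx1 i h1).1, (hx1 i h1).2.trans (hlt a ha)⟩
      · simp only [h1, if_false]; exact ⟨(hpos a ha).1.le, hlt a ha⟩
    · have h1 : i < K := by omega
      by_cases h2 : i + 1 < K
      · simp only [h1, h2, if_true]; exact hx2 i h2
      · simp only [h1, h2, if_true, if_false]; exact (hx1 i h1).2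
    · by_cases h1 : i < K
      · simp only [h1, if_true]
        have := hx3 i h1
        rw [show K + 1 + i = K + i + 1 by ring, pow_succ]
        linarith
      · have h2 : i = K := by omega
        simp only [h1, if_false, h2]
        rw [show K + 1 + K = 2 * K + 1 by ring, pow_succ, pow_mul]
        have := (hpos a ha).2
        simpa using this

/-- If a solution vanishing on the axis takes both signs near it, it has arbitrarily long chains. -/
theorem Good.chain_of_both_signs {n a b P : ℝ} {v pot : ℝ → ℝ → ℝ} (hn : 0 ≤ n)
    (h : Good n v pot a b P) (hab : a < b) (h0 : ∀ t ∈ Icc a b, v t 0 = 0)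
    (hboth : ∀ t ∈ Ioc a b, ∀ ρ > 0, ∀ τ : ℝ, τ = 1 ∨ τ = -1 →
      ∃ s ∈ Ioo a t, ∃ r ∈ Ioo 0 ρ, 0 < τ * v s r) (K : ℕ) : HasChain v a K := by
  obtain ⟨s, hs, r, hr, hv⟩ := hboth b ⟨hab, le_rfl⟩ 1 one_pos 1 (Or.inl rfl)
  obtain ⟨γ, hγ, hγs, hγv⟩ := h.trace_sign hn ⟨hs.1.le, hs.2.le⟩ hr.1.le hv
  obtain ⟨x, h1, h2, h3⟩ := h.chain_below hn h0 hboth K s ⟨hs.1, hs.2.le⟩ 1 (Or.inl rfl) γ hγ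
    (fun σ hσ => by
      refine ⟨lt_of_le_of_ne (hγv σ hσ).1 fun h1 => ?_, (hγv σ hσ).2⟩
      have := (hγv σ hσ).2
      rw [← h1, h0 σ ⟨hσ.1, hσ.2.trans hs.2.le⟩] at this
      simp at this)
  refine ⟨(-1) ^ K, x, fun i hi => (h1 i hi).1, h2, fun i hi => ?_⟩
  have := h3 i hi
  rw [pow_add, one_mul] at this
  exact this

/-- A function of `(t, x)` with the continuous partial derivatives that are needed below. -/
structure PartialC2 (z zt zx zxx ztx : ℝ → ℝ → ℝ) : Prop where
  c : Continuous (fun p : ℝ × ℝ => z p.1 p.2)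
  ct : Continuous (fun p : ℝ × ℝ => zt p.1 p.2)
  cx : Continuous (fun p : ℝ × ℝ => zx p.1 p.2)
  cxx : Continuous (fun p : ℝ × ℝ => zxx p.1 p.2)
  ctx : Continuous (fun p : ℝ × ℝ => ztx p.1 p.2)
  dt : ∀ t x, HasDerivAt (fun s => z s x) (zt t x) t
  dx : ∀ t x, HasDerivAt (z t) (zx t x) x
  dxx : ∀ t x, HasDerivAt (zx t) (zxx t x) x
  dtx : ∀ t x, HasDerivAt (zt t) (ztx t x) x
  dxt : ∀ t x, HasDerivAt (fun s => zx s x) (ztx t x) t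

theorem integrableOn_box {f : ℝ × ℝ → ℝ} (hf : Continuous f) (α β c d : ℝ) :
    IntegrableOn f (Icc α β ×ˢ Icc c d) :=
  hf.continuousOn.integrableOn_compact (isCompact_Icc.prod isCompact_Icc)

theorem setIntegral_box {f : ℝ × ℝ → ℝ} (hf : Continuous f) {α β c d : ℝ} (h1 : α ≤ β)
    (h2 : c ≤ d) : ∫ p in Icc α β ×ˢ Icc c d, f p = ∫ t in α..β, ∫ x in c..d, f (t, x) := by
  rw [Measure.volume_eq_prod, setIntegral_prod _ (integrableOn_box hf α β c d),
    intervalIntegral.integral_of_le h1, integral_Icc_eq_integral_Ioc]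
  refine setIntegral_congr_fun measurableSet_Ioc fun t _ => ?_
  rw [intervalIntegral.integral_of_le h2, integral_Icc_eq_integral_Ioc]

theorem setIntegral_box' {f : ℝ × ℝ → ℝ} (hf : Continuous f) {α β c d : ℝ} (h1 : α ≤ β)
    (h2 : c ≤ d) : ∫ p in Icc α β ×ˢ Icc c d, f p = ∫ x in c..d, ∫ t in α..β, f (t, x) := by
  rw [Measure.volume_eq_prod, ← setIntegral_prod_swap, ← Measure.volume_eq_prod]
  exact setIntegral_box (hf.comp continuous_swap) h2 h1

/-- The divergence theorem on a box for fields vanishing on the boundary. -/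
theorem setIntegral_div_box {f g fx gt : ℝ → ℝ → ℝ} {α β c d : ℝ} (h1 : α ≤ β) (h2 : c ≤ d)
    (hfx : Continuous (fun p : ℝ × ℝ => fx p.1 p.2)) (hgt : Continuous (fun p : ℝ × ℝ => gt p.1 p.2))
    (hf : ∀ t x, HasDerivAt (f t) (fx t x) x) (hg : ∀ t x, HasDerivAt (fun s => g s x) (gt t x) t)
    (hbf : ∀ t ∈ Icc α β, f t c = 0 ∧ f t d = 0) (hbg : ∀ x ∈ Icc c d, g α x = 0 ∧ g β x = 0) :
    ∫ p in Icc α β ×ˢ Icc c d, (fx p.1 p.2 + gt p.1 p.2) = 0 := by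
  rw [integral_add (integrableOn_box hfx _ _ _ _) (integrableOn_box hgt _ _ _ _),
    setIntegral_box hfx h1 h2, setIntegral_box' hgt h1 h2]
  have e1 : ∫ t in α..β, ∫ x in c..d, fx t x = ∫ t in α..β, (0 : ℝ) := by
    refine intervalIntegral.integral_congr fun t ht => ?_
    rw [uIcc_of_le h1] at ht
    rw [intervalIntegral.integral_eq_sub_of_hasDerivAt (fun x _ => hf t x)
      ((hfx.comp (by fun_prop : Continuous fun x : ℝ => (t, x))).intervalIntegrable _ _),
      (hbf t ht).1, (hbf t ht).2, sub_zero]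
  have e2 : ∫ x in c..d, ∫ t in α..β, gt t x = ∫ x in c..d, (0 : ℝ) := by
    refine intervalIntegral.integral_congr fun x hx => ?_
    rw [uIcc_of_le h2] at hx
    rw [intervalIntegral.integral_eq_sub_of_hasDerivAt (fun t _ => hg t x)
      ((hgt.comp (by fun_prop : Continuous fun t : ℝ => (t, x))).intervalIntegrable _ _),
      (hbg x hx).1, (hbg x hx).2, sub_zero]
  simp only [e1, e2, intervalIntegral.integral_zero, add_zero]

/-- The Carleman inequality for the weight `exp (s (x - k t ^ 2))`, in conjugated form. -/
theorem carleman {z zt zx zxx ztx : ℝ → ℝ → ℝ} (h : PartialC2 z zt zx zxx ztx)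
    {α β c d ℓ k s : ℝ} (h1 : α ≤ β) (h2 : c ≤ d) (hs : 0 < s) (hℓ0 : 0 < ℓ)
    (hsk : 4 * k * ℓ ^ 2 ≤ s) (hℓ : ∀ x ∈ Icc c d, |x| ≤ ℓ)
    (hbx : ∀ t ∈ Icc α β, (z t c = 0 ∧ zx t c = 0) ∧ z t d = 0 ∧ zx t d = 0)
    (hbt : ∀ x ∈ Icc c d, (z α x = 0 ∧ zx α x = 0) ∧ z β x = 0 ∧ zx β x = 0) :
    s ^ 2 / 2 * ∫ p in Icc α β ×ˢ Icc c d, z p.1 p.2 ^ 2 ≤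
      ℓ ^ 2 * ∫ p in Icc α β ×ˢ Icc c d, (zt p.1 p.2 - zxx p.1 p.2 + 2 * s * zx p.1 p.2 -
        (s ^ 2 - 2 * s * k * p.1) * z p.1 p.2) ^ 2 := by
  have hc := h.c
  have hct := h.ct
  have hcx := h.cx
  have hcxx := h.cxx
  have hctx := h.ctx
  have hdiv := setIntegral_div_box h1 h2
    (f := fun t x => ℓ ^ 2 * (-2 * zt t x * zx t x - 2 * s * zx t x ^ 2 -
      2 * s * (s ^ 2 - 2 * s * k * t) * z t x ^ 2) - 2 * s ^ 2 * x * z t x ^ 2)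
    (g := fun t x => ℓ ^ 2 * (zx t x ^ 2 - (s ^ 2 - 2 * s * k * t) * z t x ^ 2) -
      s * x * z t x ^ 2)
    (fx := fun t x => ℓ ^ 2 * (-2 * (ztx t x * zx t x + zt t x * zxx t x) -
      2 * s * (2 * zx t x * zxx t x) -
      2 * s * (s ^ 2 - 2 * s * k * t) * (2 * z t x * zx t x)) -
      2 * s ^ 2 * (z t x ^ 2 + x * (2 * z t x * zx t x)))
    (gt := fun t x => ℓ ^ 2 * (2 * zx t x * ztx t x - ((s ^ 2 - 2 * s * k * t) *
      (2 * z t x * zt t x) - 2 * s * k * z t x ^ 2)) - s * x * (2 * z t x * zt t x))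
    (by fun_prop) (by fun_prop) ?_ ?_ ?_ ?_
  · have hint1 : IntegrableOn (fun p : ℝ × ℝ => s ^ 2 / 2 * z p.1 p.2 ^ 2)
        (Icc α β ×ˢ Icc c d) := integrableOn_box (by fun_prop) _ _ _ _
    have hint2 := integrableOn_box (f := fun p : ℝ × ℝ => (ℓ ^ 2 * (-2 * (ztx p.1 p.2 * zx p.1 p.2 +
      zt p.1 p.2 * zxx p.1 p.2) - 2 * s * (2 * zx p.1 p.2 * zxx p.1 p.2) -
      2 * s * (s ^ 2 - 2 * s * k * p.1) * (2 * z p.1 p.2 * zx p.1 p.2)) -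
      2 * s ^ 2 * (z p.1 p.2 ^ 2 + p.2 * (2 * z p.1 p.2 * zx p.1 p.2))) +
      (ℓ ^ 2 * (2 * zx p.1 p.2 * ztx p.1 p.2 - ((s ^ 2 - 2 * s * k * p.1) *
      (2 * z p.1 p.2 * zt p.1 p.2) - 2 * s * k * z p.1 p.2 ^ 2)) -
      s * p.2 * (2 * z p.1 p.2 * zt p.1 p.2))) (by fun_prop) α β c d
    rw [← integral_const_mul, ← integral_const_mul, ← add_zero (∫ p in _, s ^ 2 / 2 * _), ← hdiv,
      ← integral_add hint1 hint2]
    refine setIntegral_mono_on (hint1.add hint2) (integrableOn_box (by fun_prop) _ _ _ _)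
      (measurableSet_Icc.prod measurableSet_Icc) ?_
    rintro ⟨t, x⟩ ⟨-, hx⟩
    simp only
    have hx2 : x ^ 2 ≤ ℓ ^ 2 := sq_le_sq' (by linarith [(abs_le.1 (hℓ x hx)).1])
      (abs_le.1 (hℓ x hx)).2
    set A := zt t x + 2 * s * zx t x with hA
    have e1 : 0 ≤ ℓ ^ 2 * A ^ 2 + 2 * s * A * x * z t x + s ^ 2 * z t x ^ 2 := by
      have h3 : 0 ≤ (ℓ ^ 2 * A + s * x * z t x) ^ 2 + s ^ 2 * z t x ^ 2 * (ℓ ^ 2 - x ^ 2) := by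
        have := sub_nonneg.2 hx2
        positivity
      have h4 : (ℓ ^ 2 * A + s * x * z t x) ^ 2 + s ^ 2 * z t x ^ 2 * (ℓ ^ 2 - x ^ 2) =
        ℓ ^ 2 * (ℓ ^ 2 * A ^ 2 + 2 * s * A * x * z t x + s ^ 2 * z t x ^ 2) := by ring
      rw [h4] at h3
      exact nonneg_of_mul_nonneg_right h3 (by positivity)
    have e2 : 0 ≤ ℓ ^ 2 * (zxx t x + (s ^ 2 - 2 * s * k * t) * z t x) ^ 2 := by positivity
    have e3 : 0 ≤ (s - 4 * k * ℓ ^ 2) * s * z t x ^ 2 := by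
      have := sub_nonneg.2 hsk
      positivity
    rw [hA] at e1
    nlinarith
  · intro t x
    have a1 := h.dx t x
    have a2 := h.dxx t x
    have a3 := h.dtx t x
    have := ((((a3.const_mul (-2)).mul a2).sub ((a2.pow 2).const_mul (2 * s))).sub
      ((a1.pow 2).const_mul (2 * s * (s ^ 2 - 2 * s * k * t)))).const_mul (ℓ ^ 2) |>.sub
      (((hasDerivAt_id x).const_mul (2 * s ^ 2)).mul (a1.pow 2))
    refine this.congr_deriv ?_
    simp only [id_eq, Pi.pow_apply, Nat.cast_ofNat, Nat.add_one_sub_one, pow_one]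
    ring
  · intro t x
    have a1 := h.dt t x
    have a2 := h.dxt t x
    have := ((a2.pow 2).sub ((((hasDerivAt_id t).const_mul (2 * s * k)).const_sub (s ^ 2)).mul
      (a1.pow 2))).const_mul (ℓ ^ 2) |>.sub ((a1.pow 2).const_mul (s * x))
    refine this.congr_deriv ?_
    simp only [id_eq, Pi.pow_apply, Nat.cast_ofNat, Nat.add_one_sub_one, pow_one]
    ring
  · intro t ht
    obtain ⟨⟨p1, p2⟩, p3, p4⟩ := hbx t ht
    simp [p1, p2, p3, p4]
  · intro x hx
    obtain ⟨⟨p1, p2⟩, p3, p4⟩ := hbt x hx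
    simp [p1, p2, p3, p4]

theorem exists_cutoff (A : ℝ) {d : ℝ} (hd : 0 < d) : ∃ (φ φ1 φ2 : ℝ → ℝ) (C : ℝ), 0 ≤ C ∧
    (∀ y, HasDerivAt φ (φ1 y) y) ∧ (∀ y, HasDerivAt φ1 (φ2 y) y) ∧ Continuous φ2 ∧
    (∀ y, 0 ≤ φ y ∧ φ y ≤ 1) ∧ (∀ y ≤ A, φ y = 0 ∧ φ1 y = 0 ∧ φ2 y = 0) ∧
    (∀ y, A + d ≤ y → φ y = 1 ∧ φ1 y = 0 ∧ φ2 y = 0) ∧ ∀ y, |φ1 y| ≤ C ∧ |φ2 y| ≤ C := by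
  set φ : ℝ → ℝ := fun y => Real.smoothTransition ((y - A) / d) with hφ
  have hsm : ContDiff ℝ 2 φ := Real.smoothTransition.contDiff.comp (by fun_prop)
  have h1 : ContDiff ℝ 1 (deriv φ) := (contDiff_succ_iff_deriv (n := 1)).1 hsm |>.2.2
  have h2 : ContDiff ℝ 0 (deriv (deriv φ)) := (contDiff_succ_iff_deriv (n := 0)).1 h1 |>.2.2
  have hc1 : Continuous (deriv φ) := h1.continuous
  have hc2 : Continuous (deriv (deriv φ)) := h2.continuous
  have z0 : ∀ y ≤ A, φ y = 0 := fun y hy =>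
    Real.smoothTransition.zero_of_nonpos (div_nonpos_of_nonpos_of_nonneg (by linarith) hd.le)
  have o0 : ∀ y, A + d ≤ y → φ y = 1 := fun y hy =>
    Real.smoothTransition.one_of_one_le ((one_le_div hd).2 (by linarith))
  have key : ∀ (f : ℝ → ℝ) (c : ℝ), Continuous (deriv f) → (∀ y ≤ A, f y = 0) →
      (∀ y, A + d ≤ y → f y = c) → (∀ y ≤ A, deriv f y = 0) ∧ ∀ y, A + d ≤ y → deriv f y = 0 := by
    intro f c hf p q
    constructor
    · have : EqOn (deriv f) (fun _ => 0) (Iio A) := fun y hy => by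
        have : f =ᶠ[𝓝 y] fun _ => 0 := by
          filter_upwards [Iio_mem_nhds hy] with z hz using p z (le_of_lt hz)
        rw [this.deriv_eq, deriv_const]
      have := this.closure hf continuous_const
      rw [closure_Iio] at this
      exact fun y hy => this hy
    · have : EqOn (deriv f) (fun _ => 0) (Ioi (A + d)) := fun y hy => by
        have : f =ᶠ[𝓝 y] fun _ => c := by
          filter_upwards [Ioi_mem_nhds hy] with z hz using q z (le_of_lt hz)
        rw [this.deriv_eq, deriv_const]
      have := this.closure hf continuous_const
      rw [closure_Ioi] at this
      exact fun y hy => this hy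
  obtain ⟨k1, k2⟩ := key φ 1 hc1 z0 o0
  obtain ⟨k3, k4⟩ := key _ 0 hc2 k1 k2
  obtain ⟨C1, hC1⟩ := (isCompact_Icc (a := A) (b := A + d)).exists_bound_of_continuousOn
    hc1.continuousOn
  obtain ⟨C2, hC2⟩ := (isCompact_Icc (a := A) (b := A + d)).exists_bound_of_continuousOn
    hc2.continuousOn
  refine ⟨φ, deriv φ, deriv (deriv φ), max 0 (max C1 C2), le_max_left _ _,
    fun y => ((hsm.differentiable (by norm_num)) y).hasDerivAt,
    fun y => ((h1.differentiable (by norm_num)) y).hasDerivAt, hc2,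
    fun y => ⟨Real.smoothTransition.nonneg _, Real.smoothTransition.le_one _⟩,
    fun y hy => ⟨z0 y hy, k1 y hy, k3 y hy⟩, fun y hy => ⟨o0 y hy, k2 y hy, k4 y hy⟩, fun y => ?_⟩
  rcases le_or_gt y A with hy | hy
  · rw [k1 y hy, k3 y hy, abs_zero]
    exact ⟨le_max_left _ _, le_max_left _ _⟩
  rcases le_or_gt (A + d) y with hy' | hy'
  · rw [k2 y hy', k4 y hy', abs_zero]
    exact ⟨le_max_left _ _, le_max_left _ _⟩
  exact ⟨(hC1 y ⟨hy.le, hy'.le⟩).trans ((le_max_left _ _).trans (le_max_right _ _)),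
    (hC2 y ⟨hy.le, hy'.le⟩).trans ((le_max_right _ _).trans (le_max_right _ _))⟩

theorem hasDerivAt_parabola_t {φ : ℝ → ℝ} {φ' k t x : ℝ} (h : HasDerivAt φ φ' (x - k * t ^ 2)) :
    HasDerivAt (fun s => φ (x - k * s ^ 2)) (-2 * k * t * φ') t := by
  have h2 : HasDerivAt (fun s : ℝ => x - k * s ^ 2) (-(k * (2 * t))) t := by
    simpa using ((hasDerivAt_pow 2 t).const_mul k).const_sub x
  refine (h.comp t h2).congr_deriv ?_
  ring

theorem hasDerivAt_parabola_x {φ : ℝ → ℝ} {φ' k t x : ℝ} (h : HasDerivAt φ φ' (x - k * t ^ 2)) :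
    HasDerivAt (fun y => φ (y - k * t ^ 2)) φ' x := by
  have := h.comp x ((hasDerivAt_id x).sub_const (k * t ^ 2))
  rwa [mul_one] at this

theorem PartialC2.mul_parabola {H Ht Hx Hxx Htx : ℝ → ℝ → ℝ} (h : PartialC2 H Ht Hx Hxx Htx)
    (k : ℝ) {θ θ1 θ2 : ℝ → ℝ} (h1 : ∀ y, HasDerivAt θ (θ1 y) y) (h2 : ∀ y, HasDerivAt θ1 (θ2 y) y)
    (hc : Continuous θ2) :
    PartialC2 (fun t x => θ (x - k * t ^ 2) * H t x)
      (fun t x => -2 * k * t * θ1 (x - k * t ^ 2) * H t x + θ (x - k * t ^ 2) * Ht t x)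
      (fun t x => θ1 (x - k * t ^ 2) * H t x + θ (x - k * t ^ 2) * Hx t x)
      (fun t x => θ2 (x - k * t ^ 2) * H t x + 2 * θ1 (x - k * t ^ 2) * Hx t x +
        θ (x - k * t ^ 2) * Hxx t x)
      (fun t x => -2 * k * t * θ2 (x - k * t ^ 2) * H t x -2 * k * t * θ1 (x - k * t ^ 2) * Hx t x +
        θ1 (x - k * t ^ 2) * Ht t x + θ (x - k * t ^ 2) * Htx t x) := by
  have c0 : Continuous θ := continuous_iff_continuousAt.2 fun y => (h1 y).continuousAt
  have c1 : Continuous θ1 := continuous_iff_continuousAt.2 fun y => (h2 y).continuousAt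
  obtain ⟨hc', hct, hcx, hcxx, hctx, hdt, hdx, hdxx, hdtx, hdxt⟩ := h
  refine ⟨by fun_prop, by fun_prop, by fun_prop, by fun_prop, by fun_prop, fun t x => ?_,
    fun t x => ?_, fun t x => ?_, fun t x => ?_, fun t x => ?_⟩
  · exact (hasDerivAt_parabola_t (h1 _)).mul (hdt t x)
  · exact (hasDerivAt_parabola_x (h1 _)).mul (hdx t x)
  · refine (((hasDerivAt_parabola_x (h2 _)).mul (hdx t x)).add
      ((hasDerivAt_parabola_x (h1 _)).mul (hdxx t x))).congr_deriv ?_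
    ring
  · refine ((((hasDerivAt_parabola_x (h2 _)).const_mul (-2 * k * t)).mul (hdx t x)).add
      ((hasDerivAt_parabola_x (h1 _)).mul (hdtx t x))).congr_deriv ?_
    ring
  · refine (((hasDerivAt_parabola_t (h2 _)).mul (hdt t x)).add
      ((hasDerivAt_parabola_t (h1 _)).mul (hdxt t x))).congr_deriv ?_
    ring

theorem setIntegral_box_const (α β c d C : ℝ) (h1 : α ≤ β) (h2 : c ≤ d) :
    ∫ _ in Icc α β ×ˢ Icc c d, C = (β - α) * (d - c) * C := by
  rw [setIntegral_const, Measure.volume_eq_prod, measureReal_prod_prod]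
  simp [h1, h2]

theorem setIntegral_box_mono {f g : ℝ × ℝ → ℝ} (hf : Continuous f) (hg : Continuous g)
    {α β c d : ℝ} (h : ∀ t ∈ Icc α β, ∀ x ∈ Icc c d, f (t, x) ≤ g (t, x)) :
    ∫ p in Icc α β ×ˢ Icc c d, f p ≤ ∫ p in Icc α β ×ˢ Icc c d, g p :=
  setIntegral_mono_on (integrableOn_box hf _ _ _ _) (integrableOn_box hg _ _ _ _)
    (measurableSet_Icc.prod measurableSet_Icc) fun p hp => h p.1 hp.1 p.2 hp.2

theorem caccioppoli {A X d k τ P M : ℝ} (hd : 0 < d) (hk : 0 < k) (hτ : 0 < τ)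
    (hP : 0 ≤ P) (hM : 0 ≤ M) (hAX : A ≤ X) (hX : X - A ≤ k * τ ^ 2) :
    ∃ K0, 0 ≤ K0 ∧ ∀ κ ≤ 1, 0 < κ → ∀ H Ht Hx Hxx Htx : ℝ → ℝ → ℝ, PartialC2 H Ht Hx Hxx Htx →
      (∀ t ∈ Icc (-τ) τ, H t X = 0 ∧ Hx t X = 0) →
      (∀ t ∈ Icc (-τ) τ, ∀ x ∈ Icc A X, A ≤ x - k * t ^ 2 → |H t x| ≤ M ∧
        |Ht t x - Hxx t x| ≤ P * |H t x| + κ) →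
      ∃ η : ℝ → ℝ, Continuous η ∧ (∀ y, A + d ≤ y → η y = 1) ∧
        ∫ p in Icc (-τ) τ ×ˢ Icc A X, η (p.2 - k * p.1 ^ 2) ^ 2 * Hx p.1 p.2 ^ 2 ≤ K0 := by
  obtain ⟨η, η1, η2, C, hC, hη, hη1, hη2, h01, hz, ho, hb⟩ := exists_cutoff A hd
  have c0 : Continuous η := continuous_iff_continuousAt.2 fun y => (hη y).continuousAt
  have c1 : Continuous η1 := continuous_iff_continuousAt.2 fun y => (hη1 y).continuousAt
  set D := M * (P * M + 1) + 2 * C ^ 2 * M ^ 2 + 2 * k * τ * C * M ^ 2 with hD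
  have hD0 : 0 ≤ D := by positivity
  have hXA := sub_nonneg.2 hAX
  have hττ : 0 ≤ τ - -τ := by linarith
  refine ⟨2 * ((τ - -τ) * (X - A) * D), by positivity, ?_⟩
  intro κ hκ1 hκ H Ht Hx Hxx Htx h hbX hL
  refine ⟨η, c0, fun y hy => (ho y hy).1, ?_⟩
  obtain ⟨hc', hct, hcx, hcxx, hctx, hdt, hdx, hdxx, hdtx, hdxt⟩ := h
  have hτ' : -τ ≤ τ := by linarith
  have hdiv := setIntegral_div_box hτ' hAX
    (f := fun t x => -(η (x - k * t ^ 2) ^ 2) * (H t x * Hx t x))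
    (g := fun t x => 1 / 2 * (η (x - k * t ^ 2) ^ 2 * H t x ^ 2))
    (fx := fun t x => -(2 * η (x - k * t ^ 2) * η1 (x - k * t ^ 2)) * (H t x * Hx t x) -
      η (x - k * t ^ 2) ^ 2 * (Hx t x ^ 2 + H t x * Hxx t x))
    (gt := fun t x => η (x - k * t ^ 2) * (-2 * k * t * η1 (x - k * t ^ 2)) * H t x ^ 2 +
      η (x - k * t ^ 2) ^ 2 * (H t x * Ht t x))
    (by fun_prop) (by fun_prop) ?_ ?_ ?_ ?_
  · have : 1 / 2 * ∫ p in Icc (-τ) τ ×ˢ Icc A X, η (p.2 - k * p.1 ^ 2) ^ 2 * Hx p.1 p.2 ^ 2 ≤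
        (τ - -τ) * (X - A) * D := by
      rw [← setIntegral_box_const _ _ _ _ D hτ' hAX, ← add_zero (1 / 2 * ∫ _ in _, _), ← hdiv,
        ← integral_const_mul, ← integral_add (integrableOn_box (by fun_prop) _ _ _ _)
          (integrableOn_box (by fun_prop) _ _ _ _)]
      refine setIntegral_box_mono (by fun_prop) (by fun_prop) fun t ht x hx => ?_
      simp only
      set y := x - k * t ^ 2
      obtain ⟨e0, e1⟩ := h01 y
      rcases le_or_gt A y with hy | hy
      · obtain ⟨q1, q2⟩ := hL t ht x hx hy
        have b1 := (hb y).1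
        have t1 : |t| ≤ τ := abs_le.2 ht
        have f1 : η y ^ 2 * (H t x * (Ht t x - Hxx t x)) ≤ M * (P * M + 1) := by
          have r1 : |H t x * (Ht t x - Hxx t x)| ≤ M * (P * M + 1) := by
            rw [abs_mul]
            have : P * |H t x| ≤ P * M := mul_le_mul_of_nonneg_left q1 hP
            exact mul_le_mul q1 (by linarith) (abs_nonneg _) hM
          have r2 : η y ^ 2 ≤ 1 := pow_le_one₀ e0 e1
          calc η y ^ 2 * (H t x * (Ht t x - Hxx t x)) ≤ η y ^ 2 * (M * (P * M + 1)) :=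
                mul_le_mul_of_nonneg_left ((le_abs_self _).trans r1) (sq_nonneg _)
            _ ≤ 1 * (M * (P * M + 1)) := mul_le_mul_of_nonneg_right r2 (by positivity)
            _ = _ := one_mul _
        have hH2 : H t x ^ 2 ≤ M ^ 2 := sq_le_sq' (by linarith [(abs_le.1 q1).1]) (abs_le.1 q1).2
        have f2 : 2 * η1 y ^ 2 * H t x ^ 2 ≤ 2 * C ^ 2 * M ^ 2 := by
          have : η1 y ^ 2 ≤ C ^ 2 := sq_le_sq' (by linarith [(abs_le.1 b1).1]) (abs_le.1 b1).2
          gcongr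
        have f3 : η y * (-2 * k * t * η1 y) * H t x ^ 2 ≤ 2 * k * τ * C * M ^ 2 := by
          have : |η y * (-2 * k * t * η1 y)| ≤ 2 * k * τ * C := by
            rw [abs_mul, abs_of_nonneg e0, abs_mul, abs_mul, abs_mul, abs_neg, abs_two,
              abs_of_pos hk]
            calc η y * (2 * k * |t| * |η1 y|) ≤ 1 * (2 * k * τ * C) := by gcongr
              _ = _ := one_mul _
          have := (le_abs_self _).trans this
          gcongr
        have f4 : 0 ≤ (η y * Hx t x + 2 * η1 y * H t x) ^ 2 := sq_nonneg _
        nlinarith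
      · obtain ⟨p1, p2, -⟩ := hz y hy.le
        simp only [p1, p2]
        simpa using hD0
    linarith
  · intro t x
    refine (((hasDerivAt_parabola_x (hη _)).fun_pow 2).fun_neg.mul
      ((hdx t x).mul (hdxx t x))).congr_deriv ?_
    simp only [Pi.mul_apply]
    push_cast
    ring
  · intro t x
    refine ((((hasDerivAt_parabola_t (hη _)).fun_pow 2).mul ((hdt t x).fun_pow 2)).const_mul
      (1 / 2)).congr_deriv ?_
    push_cast
    ring
  · intro t ht
    have : η (A - k * t ^ 2) = 0 := (hz _ (by nlinarith [sq_nonneg t])).1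
    simp [this, (hbX t ht).1]
  · intro x hx
    have : η (x - k * τ ^ 2) = 0 := (hz _ (by linarith [hx.2])).1
    simp [this]

set_option maxHeartbeats 1600000 in
/-- Quantitative unique continuation across parabolas. -/
theorem unique_continuation {A X d k τ P M δ : ℝ} (hd : 0 < d) (hk : 0 < k) (hτ : 0 < τ)
    (hP : 0 ≤ P) (hM : 0 ≤ M) (hAX : A ≤ X) (hX : X - A ≤ k * τ ^ 2) (hδ : 0 < δ) :
    ∃ κ, 0 < κ ∧ ∀ H Ht Hx Hxx Htx : ℝ → ℝ → ℝ, PartialC2 H Ht Hx Hxx Htx →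
      (∀ t ∈ Icc (-τ) τ, H t X = 0 ∧ Hx t X = 0) →
      (∀ t ∈ Icc (-τ) τ, ∀ x ∈ Icc A X, A ≤ x - k * t ^ 2 → |H t x| ≤ M ∧
        |Ht t x - Hxx t x| ≤ P * |H t x| + κ) →
      ∀ α β a b, Icc α β ⊆ Icc (-τ) τ → Icc a b ⊆ Icc A X →
        (∀ t ∈ Icc α β, ∀ x ∈ Icc a b, A + 2 * d ≤ x - k * t ^ 2) →
        ∫ p in Icc α β ×ˢ Icc a b, H p.1 p.2 ^ 2 ≤ δ := by
  obtain ⟨K0, hK0, hcac⟩ := caccioppoli hd hk hτ hP hM hAX hX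
  obtain ⟨φ, φ1, φ2, C, hC, hφ, hφ1, hφ2, h01, hz, ho, hb⟩ := exists_cutoff (A + d) hd
  have hXA := sub_nonneg.2 hAX
  have hτ' : -τ ≤ τ := by linarith
  have hττ : 0 ≤ τ - -τ := by linarith
  set ℓ := |A| + |X| + 1 with hℓ
  have hℓ0 : 0 < ℓ := by positivity
  set V := (τ - -τ) * (X - A) with hV
  have hV0 : 0 ≤ V := by positivity
  set C1 := (2 * k * τ * C + C) ^ 2 with hC1
  set K1 := 4 * C1 * (V * M ^ 2) + 16 * C ^ 2 * K0 with hK1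
  have hK10 : 0 ≤ K1 := by positivity
  obtain ⟨s, hs1, hs2, hs3, hs4⟩ : ∃ s, 1 ≤ s ∧ 4 * k * ℓ ^ 2 ≤ s ∧ 4 * P * ℓ ≤ s ∧
      8 * ℓ ^ 2 * K1 / δ ≤ s :=
    ⟨max (max 1 (4 * k * ℓ ^ 2)) (max (4 * P * ℓ) (8 * ℓ ^ 2 * K1 / δ)),
      (le_max_left _ _).trans (le_max_left _ _), (le_max_right _ _).trans (le_max_left _ _),
      (le_max_left _ _).trans (le_max_right _ _), (le_max_right _ _).trans (le_max_right _ _)⟩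
  have hs0 : 0 < s := by linarith
  set E := exp (2 * s * (A + 2 * d)) with hE
  have hE0 : 0 < E := exp_pos _
  set C2 := 16 * ℓ ^ 2 * (V * exp (2 * s * X)) / E with hC2
  have hC20 : 0 ≤ C2 := by positivity
  refine ⟨min 1 (δ / (2 * (C2 + 1))), lt_min one_pos (by positivity), ?_⟩
  set κ := min 1 (δ / (2 * (C2 + 1))) with hκ
  have hκ0 : 0 < κ := lt_min one_pos (by positivity)
  have hκ1 : κ ≤ 1 := min_le_left _ _
  have hκ2 : C2 * κ ^ 2 ≤ δ / 2 := by
    have : κ ≤ δ / (2 * (C2 + 1)) := min_le_right _ _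
    rw [le_div_iff₀ (by positivity)] at this
    have h3 : κ ^ 2 ≤ κ := by
      rw [sq]
      exact mul_le_of_le_one_left hκ0.le hκ1
    have := mul_le_mul_of_nonneg_left h3 hC20
    linarith
  intro H Ht Hx Hxx Htx h hbX hL α β a b hαβ hab hsub
  obtain ⟨η, c0, hη1, hη⟩ := hcac κ hκ1 hκ0 H Ht Hx Hxx Htx h hbX hL
  rcases lt_or_ge β α with h' | hαβ'
  · simp [Icc_eq_empty (not_le.2 h'), hδ.le]
  rcases lt_or_ge b a with h' | hab'
  · simp [Icc_eq_empty (not_le.2 h'), hδ.le]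
  -- the weight
  have e0 : ∀ y, HasDerivAt (fun y => exp (s * y)) (s * exp (s * y)) y := fun y => by
    have := ((hasDerivAt_id y).const_mul s).exp
    simpa [mul_comm] using this
  have e1 : ∀ y, HasDerivAt (fun y => exp (s * y) * φ y)
      (exp (s * y) * (s * φ y + φ1 y)) y := fun y =>
    ((e0 y).mul (hφ y)).congr_deriv (by ring)
  have e2 : ∀ y, HasDerivAt (fun y => exp (s * y) * (s * φ y + φ1 y))
      (exp (s * y) * (s ^ 2 * φ y + 2 * s * φ1 y + φ2 y)) y := fun y =>
    ((e0 y).mul (((hφ y).const_mul s).fun_add (hφ1 y))).congr_deriv (by ring)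
  have cφ : Continuous φ := continuous_iff_continuousAt.2 fun y => (hφ y).continuousAt
  have cφ1 : Continuous φ1 := continuous_iff_continuousAt.2 fun y => (hφ1 y).continuousAt
  have hzz := h.mul_parabola k e1 e2 (by fun_prop)
  have hcar := carleman hzz hτ' hAX hs0 hℓ0 hs2 (fun x hx => ?_) ?_ ?_
  · obtain ⟨hc', hct, hcx, hcxx, hctx, -⟩ := h
    set J := ∫ p in Icc (-τ) τ ×ˢ Icc A X,
      (exp (s * (p.2 - k * p.1 ^ 2)) * φ (p.2 - k * p.1 ^ 2) * H p.1 p.2) ^ 2 with hJ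
    have hJ0 : 0 ≤ J := integral_nonneg fun p => sq_nonneg _
    set G := ∫ p in Icc (-τ) τ ×ˢ Icc A X,
      η (p.2 - k * p.1 ^ 2) ^ 2 * Hx p.1 p.2 ^ 2 with hG
    -- the conjugated operator
    have hbound := hcar.trans (mul_le_mul_of_nonneg_left
      (setIntegral_box_mono (g := fun p : ℝ × ℝ => 4 * P ^ 2 *
        (exp (s * (p.2 - k * p.1 ^ 2)) * φ (p.2 - k * p.1 ^ 2) * H p.1 p.2) ^ 2 +
        (4 * κ ^ 2 * exp (2 * s * X) + E * (4 * C1 * M ^ 2) + E * (16 * C ^ 2) *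
          (η (p.2 - k * p.1 ^ 2) ^ 2 * Hx p.1 p.2 ^ 2)))
        (by fun_prop) (by fun_prop) fun t ht x hx => ?_) (sq_nonneg ℓ))
    · rw [integral_add (integrableOn_box (by fun_prop) _ _ _ _)
        (integrableOn_box (by fun_prop) _ _ _ _), integral_add
        (integrableOn_box (by fun_prop) _ _ _ _) (integrableOn_box (by fun_prop) _ _ _ _),
        integral_const_mul, integral_const_mul, setIntegral_box_const _ _ _ _ _ hτ' hAX, ← hJ, ← hG,
        ← hV] at hbound
      have hlow : E * ∫ p in Icc α β ×ˢ Icc a b, H p.1 p.2 ^ 2 ≤ J := by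
        rw [← integral_const_mul]
        refine (setIntegral_box_mono (g := fun p : ℝ × ℝ =>
          (exp (s * (p.2 - k * p.1 ^ 2)) * φ (p.2 - k * p.1 ^ 2) * H p.1 p.2) ^ 2)
          (by fun_prop) (by fun_prop) fun t ht x hx => ?_).trans ?_
        · have hy := hsub t ht x hx
          simp only
          rw [(ho _ (by linarith)).1, mul_one, mul_pow, ← exp_nat_mul]
          refine mul_le_mul_of_nonneg_right (exp_le_exp.2 ?_) (sq_nonneg _)
          have := mul_le_mul_of_nonneg_left hy hs0.le
          push_cast
          linarith
        · exact setIntegral_mono_set (integrableOn_box (by fun_prop) _ _ _ _)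
            (Eventually.of_forall fun p => sq_nonneg _) (prod_mono hαβ hab).eventuallyLE
      set I := ∫ p in Icc α β ×ˢ Icc a b, H p.1 p.2 ^ 2 with hI
      have hsP : 16 * P ^ 2 * ℓ ^ 2 ≤ s ^ 2 := by
        have : (4 * P * ℓ) ^ 2 ≤ s ^ 2 := pow_le_pow_left₀ (by positivity) hs3 2
        linarith
      have b1 : s ^ 2 / 4 * J ≤ ℓ ^ 2 * (V * (4 * κ ^ 2 * exp (2 * s * X)) + E * K1) := by
        have r1 : ℓ ^ 2 * (E * (16 * C ^ 2) * G) ≤ ℓ ^ 2 * (E * (16 * C ^ 2) * K0) := by gcongr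
        have r2 : ℓ ^ 2 * (4 * P ^ 2 * J) ≤ s ^ 2 / 4 * J := by
          have := mul_le_mul_of_nonneg_right hsP hJ0
          linarith
        rw [hK1]
        linarith
      have hs2' : s ≤ s ^ 2 := by
        rw [sq]
        exact le_mul_of_one_le_left hs0.le hs1
      have b2 : s ^ 2 * I ≤ s ^ 2 * (C2 * κ ^ 2) + 4 * ℓ ^ 2 * K1 := by
        have r1 : E * (s ^ 2 * I) ≤ 4 * (ℓ ^ 2 * (V * (4 * κ ^ 2 * exp (2 * s * X)) + E * K1)) := by
          have := mul_le_mul_of_nonneg_left hlow (sq_nonneg s)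
          linarith
        have r2 : C2 * E = 16 * ℓ ^ 2 * (V * exp (2 * s * X)) := by
          rw [hC2]
          field_simp
        have r3 : E * (s ^ 2 * I) ≤ E * (1 * (C2 * κ ^ 2) + 4 * ℓ ^ 2 * K1) := by
          calc _ ≤ _ := r1
            _ = κ ^ 2 * (16 * ℓ ^ 2 * (V * exp (2 * s * X))) + E * (4 * ℓ ^ 2 * K1) := by ring
            _ = _ := by rw [← r2]; ring
        have r4 := le_of_mul_le_mul_left r3 hE0
        have r5 : 1 * (C2 * κ ^ 2) ≤ s ^ 2 * (C2 * κ ^ 2) := by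
          gcongr
          linarith
        linarith
      have b3 : 4 * ℓ ^ 2 * K1 ≤ s ^ 2 * (δ / 2) := by
        rw [div_le_iff₀ hδ] at hs4
        have := mul_le_mul_of_nonneg_right hs2' hδ.le
        linarith
      have b4 : s ^ 2 * I ≤ s ^ 2 * δ := by
        have := mul_le_mul_of_nonneg_left hκ2 (sq_nonneg s)
        linarith
      exact le_of_mul_le_mul_left b4 (by positivity)
    · simp only
      set y := x - k * t ^ 2 with hy
      have hyX : y ≤ X := by
        have : 0 ≤ k * t ^ 2 := by positivity
        linarith [hx.2]
      have hform : -2 * k * t * (exp (s * y) * (s * φ y + φ1 y)) * H t x +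
          exp (s * y) * φ y * Ht t x - (exp (s * y) * (s ^ 2 * φ y + 2 * s * φ1 y + φ2 y) * H t x +
          2 * (exp (s * y) * (s * φ y + φ1 y)) * Hx t x + exp (s * y) * φ y * Hxx t x) +
          2 * s * (exp (s * y) * (s * φ y + φ1 y) * H t x + exp (s * y) * φ y * Hx t x) -
          (s ^ 2 - 2 * s * k * t) * (exp (s * y) * φ y * H t x) =
          exp (s * y) * φ y * (Ht t x - Hxx t x) -
          exp (s * y) * ((2 * k * t * φ1 y + φ2 y) * H t x + 2 * φ1 y * Hx t x) := by ring
      rw [hform]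
      set Q := exp (s * y) * ((2 * k * t * φ1 y + φ2 y) * H t x + 2 * φ1 y * Hx t x) with hQ
      have hsplit : (exp (s * y) * φ y * (Ht t x - Hxx t x) - Q) ^ 2 ≤
          2 * (exp (s * y) * φ y * (Ht t x - Hxx t x)) ^ 2 + 2 * Q ^ 2 := by
        linarith [sq_nonneg (exp (s * y) * φ y * (Ht t x - Hxx t x) + Q)]
      have hexp2 : ∀ z, exp (s * z) ^ 2 = exp (2 * s * z) := fun z => by
        rw [← exp_nat_mul]
        congr 1
        push_cast
        ring
      obtain ⟨f0, f1⟩ := h01 y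
      have part1 : (exp (s * y) * φ y * (Ht t x - Hxx t x)) ^ 2 ≤
          2 * P ^ 2 * (exp (s * y) * φ y * H t x) ^ 2 + 2 * κ ^ 2 * exp (2 * s * X) := by
        rcases le_or_gt A y with hAy | hAy
        · obtain ⟨-, q2⟩ := hL t ht x hx hAy
          have r1 : (Ht t x - Hxx t x) ^ 2 ≤ 2 * P ^ 2 * H t x ^ 2 + 2 * κ ^ 2 := by
            have : |Ht t x - Hxx t x| ^ 2 ≤ (P * |H t x| + κ) ^ 2 :=
              pow_le_pow_left₀ (abs_nonneg _) q2 2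
            rw [sq_abs] at this
            have h2 := sq_nonneg (P * |H t x| - κ)
            calc _ ≤ _ := this
              _ ≤ 2 * P ^ 2 * |H t x| ^ 2 + 2 * κ ^ 2 := by linarith
              _ = _ := by rw [sq_abs]
          have r2 : exp (s * y) ^ 2 * φ y ^ 2 ≤ exp (2 * s * X) := by
            rw [hexp2]
            calc exp (2 * s * y) * φ y ^ 2 ≤ exp (2 * s * X) * 1 :=
                  mul_le_mul (exp_le_exp.2 (mul_le_mul_of_nonneg_left (by linarith) (by linarith))) (pow_le_one₀ f0 f1) (sq_nonneg _)
                    (exp_pos _).le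
              _ = _ := mul_one _
          calc (exp (s * y) * φ y * (Ht t x - Hxx t x)) ^ 2 =
                exp (s * y) ^ 2 * φ y ^ 2 * (Ht t x - Hxx t x) ^ 2 := by ring
            _ ≤ exp (s * y) ^ 2 * φ y ^ 2 * (2 * P ^ 2 * H t x ^ 2 + 2 * κ ^ 2) := by gcongr
            _ = 2 * P ^ 2 * (exp (s * y) * φ y * H t x) ^ 2 +
                2 * κ ^ 2 * (exp (s * y) ^ 2 * φ y ^ 2) := by ring
            _ ≤ _ := by gcongr
        · rw [(hz y (by linarith)).1]
          simp only [mul_zero, zero_mul, ne_eq, OfNat.ofNat_ne_zero, not_false_eq_true, zero_pow,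
            zero_add]
          positivity
      have part2 : Q ^ 2 ≤ E * (2 * C1 * M ^ 2) + E * (8 * C ^ 2) * (η y ^ 2 * Hx t x ^ 2) := by
        have hnn : 0 ≤ E * (2 * C1 * M ^ 2) + E * (8 * C ^ 2) * (η y ^ 2 * Hx t x ^ 2) := by
          positivity
        rcases le_or_gt (A + d) y with hAy | hAy
        · rcases le_or_gt (A + d + d) y with hAy' | hAy'
          · obtain ⟨-, g1, g2⟩ := ho y hAy'
            rw [hQ, g1, g2]
            simpa using hnn
          · obtain ⟨q1, -⟩ := hL t ht x hx (by linarith)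
            obtain ⟨b1, b2⟩ := hb y
            have t1 : |t| ≤ τ := abs_le.2 ht
            have r0 : exp (s * y) ^ 2 ≤ E := by
              rw [hexp2]
              exact exp_le_exp.2 (mul_le_mul_of_nonneg_left (by linarith) (by linarith))
            have r1 : (2 * k * t * φ1 y + φ2 y) ^ 2 ≤ C1 := by
              rw [hC1, ← sq_abs (2 * k * t * φ1 y + φ2 y)]
              refine pow_le_pow_left₀ (abs_nonneg _) ((abs_add_le _ _).trans ?_) 2
              rw [abs_mul, abs_mul, abs_mul, abs_two, abs_of_pos hk]
              gcongr
            have r2 : H t x ^ 2 ≤ M ^ 2 :=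
              sq_le_sq' (by linarith [(abs_le.1 q1).1]) (abs_le.1 q1).2
            have r3 : φ1 y ^ 2 ≤ C ^ 2 :=
              sq_le_sq' (by linarith [(abs_le.1 b1).1]) (abs_le.1 b1).2
            rw [hη1 y hAy, hQ, mul_pow]
            have r4 : ((2 * k * t * φ1 y + φ2 y) * H t x + 2 * φ1 y * Hx t x) ^ 2 ≤
                2 * C1 * M ^ 2 + 8 * C ^ 2 * (1 ^ 2 * Hx t x ^ 2) := by
              calc _ ≤ 2 * ((2 * k * t * φ1 y + φ2 y) ^ 2 * H t x ^ 2) +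
                    8 * (φ1 y ^ 2 * Hx t x ^ 2) := by
                    linarith [sq_nonneg ((2 * k * t * φ1 y + φ2 y) * H t x - 2 * φ1 y * Hx t x)]
                _ ≤ 2 * (C1 * M ^ 2) + 8 * (C ^ 2 * Hx t x ^ 2) := by gcongr
                _ = _ := by ring
            calc _ ≤ E * (2 * C1 * M ^ 2 + 8 * C ^ 2 * (1 ^ 2 * Hx t x ^ 2)) := by gcongr
              _ = _ := by ring
        · obtain ⟨-, g1, g2⟩ := hz y hAy.le
          rw [hQ, g1, g2]
          simpa using hnn
      linarith
  · rw [abs_le, hℓ]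
    constructor
    · linarith [neg_abs_le A, hx.1, abs_nonneg X]
    · linarith [le_abs_self X, hx.2, abs_nonneg A]
  · intro t ht
    obtain ⟨g1, g2, -⟩ := hz (A - k * t ^ 2) (by linarith [mul_nonneg hk.le (sq_nonneg t)])
    obtain ⟨p1, p2⟩ := hbX t ht
    simp [g1, g2, p1, p2]
  · intro x hx
    obtain ⟨g1, g2, -⟩ := hz (x - k * τ ^ 2) (by linarith [hx.2])
    simp [g1, g2]

/-- Convolution of a function of two variables with a product kernel. -/
def conv2 (h : ℝ → ℝ → ℝ) (α β : ℝ → ℝ) (t x : ℝ) : ℝ :=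
  convolution (fun p : ℝ × ℝ => h p.1 p.2) (fun p : ℝ × ℝ => α p.1 * β p.2)
    (ContinuousLinearMap.mul ℝ ℝ) volume (t, x)

theorem conv2_eq (h : ℝ → ℝ → ℝ) (α β : ℝ → ℝ) (t x : ℝ) :
    conv2 h α β t x = ∫ p : ℝ × ℝ, h p.1 p.2 * (α (t - p.1) * β (x - p.2)) := rfl

theorem hasCompactSupport_prod_mul {α β : ℝ → ℝ} (hα : HasCompactSupport α)
    (hβ : HasCompactSupport β) : HasCompactSupport (fun p : ℝ × ℝ => α p.1 * β p.2) := by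
  refine HasCompactSupport.intro (IsCompact.prod hα hβ) fun p hp => ?_
  by_contra hne
  exact hp ⟨subset_tsupport _ (left_ne_zero_of_mul hne),
    subset_tsupport _ (right_ne_zero_of_mul hne)⟩

theorem conv2_continuous {h : ℝ → ℝ → ℝ} (hc : Continuous (fun p : ℝ × ℝ => h p.1 p.2))
    {α β : ℝ → ℝ} (hα : HasCompactSupport α) (hβ : HasCompactSupport β) (cα : Continuous α)
    (cβ : Continuous β) : Continuous (fun p : ℝ × ℝ => conv2 h α β p.1 p.2) :=
  (hasCompactSupport_prod_mul hα hβ).continuous_convolution_right _ hc.locallyIntegrable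
    (by fun_prop)

theorem conv2_hasDerivAt {h : ℝ → ℝ → ℝ} (hc : Continuous (fun p : ℝ × ℝ => h p.1 p.2))
    {α β : ℝ → ℝ} (hα : HasCompactSupport α) (hβ : HasCompactSupport β) (cα : ContDiff ℝ 1 α)
    (cβ : ContDiff ℝ 1 β) (t x : ℝ) :
    HasDerivAt (fun y => conv2 h α β t y) (conv2 h α (deriv β) t x) x ∧
    HasDerivAt (fun s => conv2 h α β s x) (conv2 h (deriv α) β t x) t := by
  set g : ℝ × ℝ → ℝ := fun p => α p.1 * β p.2 with hg
  have hgs : HasCompactSupport g := hasCompactSupport_prod_mul hα hβ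
  have hgd : ContDiff ℝ 1 g := (cα.comp contDiff_fst).mul (cβ.comp contDiff_snd)
  have hli := hc.locallyIntegrable (μ := volume)
  have hF := hgs.hasFDerivAt_convolution_right (ContinuousLinearMap.mul ℝ ℝ) hli hgd (t, x)
  have happ : ∀ v : ℝ × ℝ, (convolution (fun p : ℝ × ℝ => h p.1 p.2) (fderiv ℝ g)
      (ContinuousLinearMap.precompR (ℝ × ℝ) (ContinuousLinearMap.mul ℝ ℝ)) volume (t, x)) v =
      convolution (fun p : ℝ × ℝ => h p.1 p.2) (fun p => fderiv ℝ g p v)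
        (ContinuousLinearMap.mul ℝ ℝ) volume (t, x) := fun v =>
    convolution_precompR_apply (ContinuousLinearMap.mul ℝ ℝ) hli (hgs.fderiv ℝ)
      (hgd.continuous_fderiv (by norm_num)) (t, x) v
  have dx : ∀ p : ℝ × ℝ, fderiv ℝ g p (0, 1) = α p.1 * deriv β p.2 := fun p => by
    have h1 := ((hgd.differentiable (by norm_num)) p).hasFDerivAt.comp_hasDerivAt p.2
      (f := fun y : ℝ => (p.1, y)) ((hasDerivAt_const _ _).prodMk (hasDerivAt_id _))
    exact h1.unique (((cβ.differentiable (by norm_num)) p.2).hasDerivAt.const_mul (α p.1))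
  have dt : ∀ p : ℝ × ℝ, fderiv ℝ g p (1, 0) = deriv α p.1 * β p.2 := fun p => by
    have h1 := ((hgd.differentiable (by norm_num)) p).hasFDerivAt.comp_hasDerivAt p.1
      (f := fun y : ℝ => (y, p.2)) ((hasDerivAt_id _).prodMk (hasDerivAt_const _ _))
    exact h1.unique (((cα.differentiable (by norm_num)) p.1).hasDerivAt.mul_const (β p.2))
  constructor
  · have h1 := hF.comp_hasDerivAt x (f := fun y : ℝ => (t, y))
      ((hasDerivAt_const _ _).prodMk (hasDerivAt_id _))
    rw [happ] at h1
    simp only [dx] at h1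
    exact h1
  · have h1 := hF.comp_hasDerivAt t (f := fun y : ℝ => (y, x))
      ((hasDerivAt_id _).prodMk (hasDerivAt_const _ _))
    rw [happ] at h1
    simp only [dt] at h1
    exact h1

theorem conv2_partialC2 {h : ℝ → ℝ → ℝ} (hc : Continuous (fun p : ℝ × ℝ => h p.1 p.2))
    {κ : ℝ → ℝ} (hκ : HasCompactSupport κ) (cκ : ContDiff ℝ 2 κ) :
    PartialC2 (conv2 h κ κ) (conv2 h (deriv κ) κ) (conv2 h κ (deriv κ))
      (conv2 h κ (deriv (deriv κ))) (conv2 h (deriv κ) (deriv κ)) := by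
  have c1 : ContDiff ℝ 1 (deriv κ) := (contDiff_succ_iff_deriv (n := 1)).1 cκ |>.2.2
  have c2 : ContDiff ℝ 0 (deriv (deriv κ)) := (contDiff_succ_iff_deriv (n := 0)).1 c1 |>.2.2
  have c0 : ContDiff ℝ 1 κ := cκ.of_le (by norm_num)
  have h1 := hκ.deriv
  have h2 := h1.deriv
  exact ⟨conv2_continuous hc hκ hκ c0.continuous c0.continuous,
    conv2_continuous hc h1 hκ c1.continuous c0.continuous,
    conv2_continuous hc hκ h1 c0.continuous c1.continuous,
    conv2_continuous hc hκ h2 c0.continuous c2.continuous,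
    conv2_continuous hc h1 h1 c1.continuous c1.continuous,
    fun t x => (conv2_hasDerivAt hc hκ hκ c0 c0 t x).2,
    fun t x => (conv2_hasDerivAt hc hκ hκ c0 c0 t x).1,
    fun t x => (conv2_hasDerivAt hc hκ h1 c0 c1 t x).1,
    fun t x => (conv2_hasDerivAt hc h1 hκ c1 c0 t x).1,
    fun t x => (conv2_hasDerivAt hc hκ h1 c0 c1 t x).2⟩

/-- A mollifying kernel with support in `[-η, η]`. -/
theorem exists_kernel {η : ℝ} (hη : 0 < η) : ∃ κ : ℝ → ℝ, HasCompactSupport κ ∧ ContDiff ℝ 2 κ ∧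
    (∀ y, 0 ≤ κ y) ∧ (∀ y, η ≤ |y| → κ y = 0 ∧ deriv κ y = 0) ∧ ∫ y, κ y = 1 := by
  let f : ContDiffBump (0 : ℝ) := ⟨η / 4, η / 2, by positivity, by linarith⟩
  have hz : ∀ y, η / 2 < |y| → f.normed volume y = 0 := fun y hy => by
    by_contra hne
    have : y ∈ Function.support (f.normed volume) := hne
    rw [f.support_normed_eq, mem_ball, dist_zero_right] at this
    exact absurd this (not_lt.2 hy.le)
  refine ⟨f.normed volume, f.hasCompactSupport_normed, f.contDiff_normed (n := 2),
    f.nonneg_normed, fun y hy => ⟨hz y (by linarith), ?_⟩, f.integral_normed⟩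
  have : f.normed volume =ᶠ[𝓝 y] fun _ => 0 := by
    filter_upwards [continuous_abs.continuousAt.eventually
      (lt_mem_nhds (show η / 2 < |y| by linarith))] with z hz' using hz z hz'
  rw [this.deriv_eq, deriv_const]

/-- Nonnegative test functions with support in `(a, b)`. -/
structure IsTest (β β1 β2 : ℝ → ℝ) (a b : ℝ) : Prop where
  d1 : ∀ y, HasDerivAt β (β1 y) y
  d2 : ∀ y, HasDerivAt β1 (β2 y) y
  c2 : Continuous β2
  nn : ∀ y, 0 ≤ β y
  zero : ∀ y ∉ Ioo a b, β y = 0 ∧ β1 y = 0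

theorem IsTest.c0 {β β1 β2 : ℝ → ℝ} {a b : ℝ} (h : IsTest β β1 β2 a b) : Continuous β :=
  continuous_iff_continuousAt.2 fun y => (h.d1 y).continuousAt

theorem IsTest.c1 {β β1 β2 : ℝ → ℝ} {a b : ℝ} (h : IsTest β β1 β2 a b) : Continuous β1 :=
  continuous_iff_continuousAt.2 fun y => (h.d2 y).continuousAt

/-- The defect of `h` as a weak solution of `h_t = h_xx + p h` on a box is at most `ε`. -/
def WeakSol (h p : ℝ → ℝ → ℝ) (a b c d ε : ℝ) : Prop :=
  ∀ α α1 α2 β β1 β2 : ℝ → ℝ, IsTest α α1 α2 a b → IsTest β β1 β2 c d →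
    ∀ Q, 0 ≤ Q → (∀ y, |α y| ≤ Q ∧ |α1 y| ≤ Q ∧ |β y| ≤ Q ∧ |β2 y| ≤ Q) →
    |∫ q in Icc a b ×ˢ Icc c d, h q.1 q.2 * (α1 q.1 * β q.2 + α q.1 * β2 q.2 +
      p q.1 q.2 * (α q.1 * β q.2))| ≤ ε * Q ^ 2

theorem isTest_kernel {κ : ℝ → ℝ} {η x a b : ℝ} (cκ : ContDiff ℝ 2 κ) (h0 : ∀ y, 0 ≤ κ y)
    (hz : ∀ y, η ≤ |y| → κ y = 0 ∧ deriv κ y = 0) (ha : a + η ≤ x) (hb : x + η ≤ b) :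
    IsTest (fun y => κ (x - y)) (fun y => - deriv κ (x - y)) (fun y => deriv (deriv κ) (x - y))
      a b := by
  have c1 : ContDiff ℝ 1 (deriv κ) := (contDiff_succ_iff_deriv (n := 1)).1 cκ |>.2.2
  have c2 : ContDiff ℝ 0 (deriv (deriv κ)) := (contDiff_succ_iff_deriv (n := 0)).1 c1 |>.2.2
  have key : ∀ (f : ℝ → ℝ), Differentiable ℝ f → ∀ y,
      HasDerivAt (fun y => f (x - y)) (- deriv f (x - y)) y := fun f hf y => by
    have := (hf (x - y)).hasDerivAt.comp y ((hasDerivAt_id y).const_sub x)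
    rw [mul_neg_one] at this
    exact this
  refine ⟨key κ (cκ.differentiable (by norm_num)), fun y => ?_, c2.continuous.comp (by fun_prop),
    fun y => h0 _, fun y hy => ?_⟩
  · exact (key _ (c1.differentiable (by norm_num)) y).neg.congr_deriv (neg_neg _)
  · have : η ≤ |x - y| := by
      by_contra hcon
      rw [not_le, abs_lt] at hcon
      exact hy ⟨by linarith, by linarith⟩
    simp [hz _ this]

theorem IsTest.zero2 {β β1 β2 : ℝ → ℝ} {a b : ℝ} (h : IsTest β β1 β2 a b) (y : ℝ)
    (hy : y ∉ Ioo a b) : β2 y = 0 := by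
  rcases lt_or_ge a y with h' | h'
  · have hb : b ≤ y := by
      by_contra hcon
      exact hy ⟨h', not_le.1 hcon⟩
    have e : HasDerivWithinAt β1 0 (Ici y) y :=
      (hasDerivWithinAt_const y (Ici y) (0 : ℝ)).congr
        (fun z hz => (h.zero z fun hz' => absurd hz'.2 (not_lt.2 (hb.trans hz))).2)
        (h.zero y hy).2
    exact (uniqueDiffWithinAt_Ici y).eq_deriv _ (h.d2 y).hasDerivWithinAt e
  · have e : HasDerivWithinAt β1 0 (Iic y) y :=
      (hasDerivWithinAt_const y (Iic y) (0 : ℝ)).congr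
        (fun z hz => (h.zero z fun hz' => absurd hz'.1 (not_lt.2 (le_trans hz h'))).2)
        (h.zero y hy).2
    exact (uniqueDiffWithinAt_Iic y).eq_deriv _ (h.d2 y).hasDerivWithinAt e

theorem kernel_weight {κ : ℝ → ℝ} (hκ : HasCompactSupport κ) (cκ : Continuous κ)
    (h1 : ∫ y, κ y = 1) (t x : ℝ) {f : ℝ × ℝ → ℝ} (hf : Continuous f) :
    Integrable (fun p : ℝ × ℝ => f p * (κ (t - p.1) * κ (x - p.2))) ∧
      ∫ p : ℝ × ℝ, κ (t - p.1) * κ (x - p.2) = 1 := by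
  constructor
  · refine Continuous.integrable_of_hasCompactSupport (by fun_prop) ?_
    have k1 : HasCompactSupport fun s => κ (t - s) := hκ.comp_homeomorph (Homeomorph.subLeft t)
    have k2 : HasCompactSupport fun s => κ (x - s) := hκ.comp_homeomorph (Homeomorph.subLeft x)
    exact (hasCompactSupport_prod_mul k1 k2).mul_left (f := f)
  · rw [Measure.volume_eq_prod, integral_prod_mul (fun s => κ (t - s)) (fun s => κ (x - s)),
      integral_sub_left_eq_self, integral_sub_left_eq_self, h1, one_mul]

theorem kernel_average_le {κ : ℝ → ℝ} {η : ℝ} (hκ : HasCompactSupport κ) (cκ : Continuous κ)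
    (h0 : ∀ y, 0 ≤ κ y) (hz : ∀ y, η ≤ |y| → κ y = 0) (h1 : ∫ y, κ y = 1) (t x C : ℝ)
    {f : ℝ × ℝ → ℝ} (hf : Continuous f)
    (hC : ∀ s y, |t - s| < η → |x - y| < η → f (s, y) ≤ C) :
    ∫ p : ℝ × ℝ, f p * (κ (t - p.1) * κ (x - p.2)) ≤ C := by
  have e : C = ∫ p : ℝ × ℝ, C * (κ (t - p.1) * κ (x - p.2)) := by
    rw [integral_const_mul, (kernel_weight hκ cκ h1 t x hf).2, mul_one]
  rw [e]
  refine integral_mono (kernel_weight hκ cκ h1 t x hf).1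
    (kernel_weight hκ cκ h1 t x continuous_const).1 fun p => ?_
  simp only
  rcases le_or_gt η |t - p.1| with h | h
  · simp [hz _ h]
  rcases le_or_gt η |x - p.2| with h' | h'
  · simp [hz _ h']
  exact mul_le_mul_of_nonneg_right (hC p.1 p.2 h h') (mul_nonneg (h0 _) (h0 _))

theorem kernel_average_abs_le {κ : ℝ → ℝ} {η : ℝ} (hκ : HasCompactSupport κ) (cκ : Continuous κ)
    (h0 : ∀ y, 0 ≤ κ y) (hz : ∀ y, η ≤ |y| → κ y = 0) (h1 : ∫ y, κ y = 1) (t x C : ℝ)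
    {f : ℝ × ℝ → ℝ} (hf : Continuous f)
    (hC : ∀ s y, |t - s| < η → |x - y| < η → |f (s, y)| ≤ C) :
    |∫ p : ℝ × ℝ, f p * (κ (t - p.1) * κ (x - p.2))| ≤ C := by
  refine abs_le.2 ⟨?_, kernel_average_le hκ cκ h0 hz h1 t x C hf
    fun s y p q => (le_abs_self _).trans (hC s y p q)⟩
  have := kernel_average_le hκ cκ h0 hz h1 t x C (f := fun p => -f p) hf.neg
    fun s y p q => (neg_le_abs _).trans (hC s y p q)
  simp only [neg_mul, integral_neg] at this
  linarith

theorem mollify_split {h p : ℝ → ℝ → ℝ} {κ : ℝ → ℝ}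
    (hc : Continuous (fun q : ℝ × ℝ => h q.1 q.2)) (pc : Continuous (fun q : ℝ × ℝ => p q.1 q.2))
    (hκ : HasCompactSupport κ) (cκ : ContDiff ℝ 2 κ) (t x : ℝ) :
    ∫ q : ℝ × ℝ, h q.1 q.2 * (-deriv κ (t - q.1) * κ (x - q.2) +
      κ (t - q.1) * deriv (deriv κ) (x - q.2) + p q.1 q.2 * (κ (t - q.1) * κ (x - q.2))) =
      (conv2 h κ (deriv (deriv κ)) t x - conv2 h (deriv κ) κ t x) + (p t x * conv2 h κ κ t x +
      ∫ q : ℝ × ℝ, h q.1 q.2 * (p q.1 q.2 - p t x) * (κ (t - q.1) * κ (x - q.2))) := by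
  have c1 : ContDiff ℝ 1 (deriv κ) := (contDiff_succ_iff_deriv (n := 1)).1 cκ |>.2.2
  have c2 : ContDiff ℝ 0 (deriv (deriv κ)) := (contDiff_succ_iff_deriv (n := 0)).1 c1 |>.2.2
  have cc0 := cκ.continuous
  have cc1 := c1.continuous
  have cc2 := c2.continuous
  have key : ∀ (f : ℝ × ℝ → ℝ) (α β : ℝ → ℝ), Continuous f → Continuous α → Continuous β →
      HasCompactSupport α → HasCompactSupport β →
      Integrable fun q : ℝ × ℝ => f q * (α (t - q.1) * β (x - q.2)) := by
    intro f α β hf cα cβ hα hβ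
    have k1 : HasCompactSupport fun s => α (t - s) := hα.comp_homeomorph (Homeomorph.subLeft t)
    have k2 : HasCompactSupport fun s => β (x - s) := hβ.comp_homeomorph (Homeomorph.subLeft x)
    exact Continuous.integrable_of_hasCompactSupport (by fun_prop)
      (hasCompactSupport_prod_mul k1 k2).mul_left
  have i1 := key _ _ _ hc cc1 cc0 hκ.deriv hκ
  have i2 := key _ _ _ hc cc0 cc2 hκ hκ.deriv.deriv
  have i3 := key _ _ _ hc cc0 cc0 hκ hκ
  have i4 := key (fun q => h q.1 q.2 * (p q.1 q.2 - p t x)) _ _ (by fun_prop) cc0 cc0 hκ hκ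
  simp only [conv2_eq]
  rw [← integral_sub i2 i1, ← integral_const_mul, ← integral_add (i3.const_mul _) i4]
  refine Eq.trans ?_ (integral_add (i2.sub i1) ((i3.const_mul (p t x)).add i4))
  congr 1
  funext q
  ring

/-- The mollification of a weak solution is a pointwise approximate solution. -/
theorem WeakSol.mollify {h p : ℝ → ℝ → ℝ} {a b c d ε M Q ω η t x : ℝ} {κ : ℝ → ℝ}
    (hw : WeakSol h p a b c d ε) (hc : Continuous (fun q : ℝ × ℝ => h q.1 q.2))
    (pc : Continuous (fun q : ℝ × ℝ => p q.1 q.2)) (hM : ∀ s y, |h s y| ≤ M)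
    (hκ : HasCompactSupport κ) (cκ : ContDiff ℝ 2 κ) (h0 : ∀ y, 0 ≤ κ y)
    (hz : ∀ y, η ≤ |y| → κ y = 0 ∧ deriv κ y = 0) (h1 : ∫ y, κ y = 1) (hQ : 0 ≤ Q)
    (hQκ : ∀ y, |κ y| ≤ Q ∧ |deriv κ y| ≤ Q ∧ |deriv (deriv κ) y| ≤ Q)
    (hω : ∀ s y, |t - s| < η → |x - y| < η → |p s y - p t x| ≤ ω)
    (ht1 : a + η ≤ t) (ht2 : t + η ≤ b) (hx1 : c + η ≤ x) (hx2 : x + η ≤ d) :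
    |conv2 h (deriv κ) κ t x - conv2 h κ (deriv (deriv κ)) t x| ≤
      |p t x| * |conv2 h κ κ t x| + (M * ω + ε * Q ^ 2) := by
  have c1 : ContDiff ℝ 1 (deriv κ) := (contDiff_succ_iff_deriv (n := 1)).1 cκ |>.2.2
  have c2 : ContDiff ℝ 0 (deriv (deriv κ)) := (contDiff_succ_iff_deriv (n := 0)).1 c1 |>.2.2
  have cc0 := cκ.continuous
  have cc1 := c1.continuous
  have cc2 := c2.continuous
  have hM0 : 0 ≤ M := (abs_nonneg _).trans (hM 0 0)
  have T1 := isTest_kernel cκ h0 hz ht1 ht2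
  have T2 := isTest_kernel cκ h0 hz hx1 hx2
  have hbox := hw _ _ _ _ _ _ T1 T2 Q hQ fun y =>
    ⟨(hQκ _).1, by rw [abs_neg]; exact (hQκ _).2.1, (hQκ _).1, (hQκ _).2.2⟩
  rw [setIntegral_eq_integral_of_forall_compl_eq_zero] at hbox
  swap
  · intro q hq
    have : q.1 ∉ Ioo a b ∨ q.2 ∉ Ioo c d := by
      by_contra hcon
      push Not at hcon
      exact hq ⟨Ioo_subset_Icc_self hcon.1, Ioo_subset_Icc_self hcon.2⟩
    rcases this with h' | h'
    · obtain ⟨e1, e2⟩ := T1.zero _ h'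
      rw [e1, e2]
      ring
    · obtain ⟨e1, e2⟩ := T2.zero _ h'
      have e3 := T2.zero2 _ h'
      rw [e1, e3]
      ring
  have hsmall := kernel_average_abs_le hκ cc0 h0 (fun y hy => (hz y hy).1) h1 t x (M * ω)
    (f := fun q => h q.1 q.2 * (p q.1 q.2 - p t x)) (by fun_prop) fun s y p1 p2 => by
      rw [abs_mul]
      exact mul_le_mul (hM s y) (hω s y p1 p2) (abs_nonneg _) hM0
  have hsum := mollify_split hc pc hκ cκ t x
  rw [hsum] at hbox
  set S := ∫ q : ℝ × ℝ, h q.1 q.2 * (p q.1 q.2 - p t x) * (κ (t - q.1) * κ (x - q.2))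
  rw [← abs_mul]
  obtain ⟨u1, u2⟩ := abs_le.1 hbox
  obtain ⟨u3, u4⟩ := abs_le.1 hsmall
  refine abs_le.2 ⟨?_, ?_⟩
  · linarith [neg_abs_le (p t x * conv2 h κ κ t x), le_abs_self (p t x * conv2 h κ κ t x)]
  · linarith [neg_abs_le (p t x * conv2 h κ κ t x), le_abs_self (p t x * conv2 h κ κ t x)]

theorem PartialC2.shift {H Ht Hx Hxx Htx : ℝ → ℝ → ℝ} (h : PartialC2 H Ht Hx Hxx Htx) (k : ℝ) :
    PartialC2 (fun t => H (k + t)) (fun t => Ht (k + t)) (fun t => Hx (k + t))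
      (fun t => Hxx (k + t)) (fun t => Htx (k + t)) := by
  have cs : Continuous fun p : ℝ × ℝ => (k + p.1, p.2) := by fun_prop
  refine ⟨h.c.comp cs, h.ct.comp cs, h.cx.comp cs, h.cxx.comp cs, h.ctx.comp cs, fun t x => ?_,
    fun t x => h.dx _ x, fun t x => h.dxx _ x, fun t x => h.dtx _ x, fun t x => ?_⟩
  · exact (h.dt (k + t) x).comp_const_add k t
  · exact (h.dxt (k + t) x).comp_const_add k t

/-- Unique continuation for approximate weak solutions. -/
theorem weak_unique_continuation {a b c d X t₁ ξ ρ m M P : ℝ} {p : ℝ → ℝ → ℝ}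
    (ht : t₁ ∈ Ioo a b) (hξ : ξ ∈ Ioo c X) (hX : X < d) (hρ : 0 < ρ) (hm : 0 < m) (hM : 0 ≤ M)
    (pc : Continuous (fun q : ℝ × ℝ => p q.1 q.2)) (hP : ∀ s y, |p s y| ≤ P) :
    ∃ ε > 0, ∀ h : ℝ → ℝ → ℝ, Continuous (fun q : ℝ × ℝ => h q.1 q.2) → (∀ s y, |h s y| ≤ M) →
      (∀ s, ∀ y ≥ X, h s y = 0) → WeakSol h p a b c d ε →
      ¬ ∀ s y, |s - t₁| ≤ ρ → |y - ξ| ≤ ρ → m ≤ h s y := by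
  have hP0 : 0 ≤ P := (abs_nonneg _).trans (hP 0 0)
  obtain ⟨hta, htb⟩ := ht
  obtain ⟨hξc, hξX⟩ := hξ
  obtain ⟨X', hX1, hX2⟩ := exists_between hX
  obtain ⟨A, hA1, hA2⟩ := exists_between hξc
  obtain ⟨τ, hτ, hτ'⟩ := exists_between (show 0 < min (t₁ - a) (b - t₁) by
    exact lt_min (by linarith) (by linarith))
  obtain ⟨hτa, hτb⟩ := lt_min_iff.1 hτ'
  set dd := (ξ - A) / 4 with hdd
  have hdd0 : 0 < dd := by rw [hdd]; linarith
  set k := (X' - A) / τ ^ 2 with hk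
  have hk0 : 0 < k := div_pos (by linarith) (by positivity)
  have hkτ : X' - A ≤ k * τ ^ 2 := by
    rw [hk]
    field_simp
    exact le_rfl
  obtain ⟨r, hr, hr'⟩ := exists_between (show 0 < min (min τ dd) (min (ρ / 2)
      (min (X' - ξ) (dd / (k * τ)))) by
    refine lt_min (lt_min hτ hdd0) (lt_min (by linarith) (lt_min (by linarith) (by positivity))))
  simp only [lt_min_iff] at hr'
  obtain ⟨⟨hr1, hr2⟩, hr3, hr4, hr5⟩ := hr'
  have hkr : k * r ^ 2 ≤ dd := by
    rw [lt_div_iff₀ (by positivity)] at hr5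
    have : k * (r * r) ≤ k * (r * τ) := by gcongr
    linarith
  set δ := m ^ 2 * (2 * r * (2 * r)) / 2 with hδ
  have hδ0 : 0 < δ := by positivity
  obtain ⟨κ₀, hκ₀, huc⟩ := unique_continuation hdd0 hk0 hτ hP0 hM (show A ≤ X' by linarith) hkτ hδ0
  have huni := (isCompact_Icc (a := a) (b := b)).prod (isCompact_Icc (a := c) (b := d))
    |>.uniformContinuousOn_of_continuous (f := fun q : ℝ × ℝ => p q.1 q.2) pc.continuousOn
  obtain ⟨η₁, hη₁, hunif⟩ := Metric.uniformContinuousOn_iff.1 huni (κ₀ / (2 * (M + 1)))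
    (by positivity)
  obtain ⟨η, hη, hη'⟩ := exists_between (show 0 < min (min (X' - X) (d - X')) (min (min (A - c) η₁)
      (min (ρ / 2) (min (t₁ - a - τ) (b - t₁ - τ)))) by
    refine lt_min (lt_min ?_ ?_) (lt_min (lt_min ?_ ?_) (lt_min ?_ (lt_min ?_ ?_))) <;> linarith)
  simp only [lt_min_iff] at hη'
  obtain ⟨⟨e1, e2⟩, ⟨e3, e4⟩, e5, e6, e7⟩ := hη'
  obtain ⟨κ, hκ, cκ, h0, hz, h1⟩ := exists_kernel hη
  have c1 : ContDiff ℝ 1 (deriv κ) := (contDiff_succ_iff_deriv (n := 1)).1 cκ |>.2.2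
  have c2 : ContDiff ℝ 0 (deriv (deriv κ)) := (contDiff_succ_iff_deriv (n := 0)).1 c1 |>.2.2
  obtain ⟨Q0, hQ0⟩ := hκ.exists_bound_of_continuous cκ.continuous
  obtain ⟨Q1, hQ1⟩ := hκ.deriv.exists_bound_of_continuous c1.continuous
  obtain ⟨Q2, hQ2⟩ := hκ.deriv.deriv.exists_bound_of_continuous c2.continuous
  set Q := max 0 (max Q0 (max Q1 Q2)) with hQ
  have hQn : 0 ≤ Q := le_max_left _ _
  have hQκ : ∀ y, |κ y| ≤ Q ∧ |deriv κ y| ≤ Q ∧ |deriv (deriv κ) y| ≤ Q := fun y =>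
    ⟨(hQ0 y).trans (by simp [hQ]), (hQ1 y).trans (by simp [hQ]), (hQ2 y).trans (by simp [hQ])⟩
  refine ⟨κ₀ / (2 * (Q ^ 2 + 1)), by positivity, fun h hc hb hz' hw hcon => ?_⟩
  have hsh := (conv2_partialC2 hc hκ cκ).shift t₁
  have hbd : ∀ t x, |conv2 h κ κ t x| ≤ M := fun t x =>
    kernel_average_abs_le hκ cκ.continuous h0 (fun y hy => (hz y hy).1) h1 t x M hc
      fun s y _ _ => hb s y
  have hzero : ∀ κ' : ℝ → ℝ, (∀ y, η ≤ |y| → κ' y = 0) → ∀ t, conv2 h κ κ' t X' = 0 :=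
    fun κ' hκ' t => by
      rw [conv2_eq]
      refine integral_eq_zero_of_ae (Eventually.of_forall fun q => ?_)
      simp only [Pi.zero_apply]
      rcases le_or_gt X q.2 with h' | h'
      · rw [hz' _ _ h', zero_mul]
      · rw [hκ' (X' - q.2) (by rw [abs_of_pos (by linarith)]; linarith), mul_zero, mul_zero]
  have hfin := huc _ _ _ _ _ hsh
    (fun t _ => ⟨hzero κ (fun y hy => (hz y hy).1) _, hzero _ (fun y hy => (hz y hy).2) _⟩) ?_
    (-r) r (ξ - r) (ξ + r) (Icc_subset_Icc (by linarith) (by linarith))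
    (Icc_subset_Icc (by linarith) (by linarith)) ?_
  · have hlow : m ^ 2 * (2 * r * (2 * r)) ≤ ∫ q in Icc (-r) r ×ˢ Icc (ξ - r) (ξ + r),
        conv2 h κ κ (t₁ + q.1) q.2 ^ 2 := by
      have e : m ^ 2 * (2 * r * (2 * r)) = ∫ q in Icc (-r) r ×ˢ Icc (ξ - r) (ξ + r), m ^ 2 := by
        rw [setIntegral_box_const _ _ _ _ _ (by linarith) (by linarith)]
        ring
      rw [e]
      refine setIntegral_box_mono continuous_const (hsh.c.pow 2) fun t ht x hx => ?_
      have : m ≤ conv2 h κ κ (t₁ + t) x := by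
        have := kernel_average_le hκ cκ.continuous h0 (fun y hy => (hz y hy).1) h1 (t₁ + t) x (-m)
          (f := fun q => -h q.1 q.2) hc.neg fun s y q1 q2 => ?_
        · rw [conv2_eq]
          simp only [neg_mul, integral_neg] at this
          linarith
        · have := hcon s y ?_ ?_
          · simpa using this
          · rw [abs_lt] at q1
            rw [abs_le]
            constructor <;> linarith [ht.1, ht.2]
          · rw [abs_lt] at q2
            rw [abs_le]
            constructor <;> linarith [hx.1, hx.2]
      exact pow_le_pow_left₀ hm.le this 2
    linarith
  · intro t ht x hx _
    refine ⟨hbd _ _, ?_⟩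
    have hmol := hw.mollify (t := t₁ + t) (x := x) (ω := κ₀ / (2 * (M + 1))) hc pc hb hκ cκ h0 hz h1
      hQn hQκ (fun s y q1 q2 => ?_) (by linarith [ht.1]) (by linarith [ht.2]) (by linarith [hx.1])
      (by linarith [hx.2])
    · refine hmol.trans (add_le_add (mul_le_mul_of_nonneg_right (hP _ _) (abs_nonneg _)) ?_)
      have f1 : M * (κ₀ / (2 * (M + 1))) ≤ κ₀ / 2 := by
        rw [mul_div_assoc', div_le_div_iff₀ (by positivity) (by positivity)]
        linarith
      have f2 : κ₀ / (2 * (Q ^ 2 + 1)) * Q ^ 2 ≤ κ₀ / 2 := by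
        rw [div_mul_eq_mul_div, div_le_div_iff₀ (by positivity) (by positivity)]
        linarith
      linarith
    · rw [abs_lt] at q1 q2
      have := hunif (s, y) ⟨⟨by linarith [ht.1], by linarith [ht.2]⟩,
        by linarith [hx.1], by linarith [hx.2]⟩ (t₁ + t, x) ⟨⟨by linarith [ht.1], by linarith [ht.2]⟩,
        by linarith [hx.1], by linarith [hx.2]⟩ ?_
      · rw [Real.dist_eq] at this
        exact this.le
      · rw [Prod.dist_eq, Real.dist_eq, Real.dist_eq]
        refine max_lt ?_ ?_ <;> rw [abs_lt] <;> constructor <;> linarith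
  · intro t ht x hx
    have : t ^ 2 ≤ r ^ 2 := sq_le_sq' ht.1 ht.2
    have : k * t ^ 2 ≤ k * r ^ 2 := by gcongr
    linarith [hx.1]

theorem WeakSol.congr {h h' p p' : ℝ → ℝ → ℝ} {a b c d ε : ℝ} (hw : WeakSol h p a b c d ε)
    (hh : ∀ t ∈ Icc a b, ∀ x ∈ Icc c d, h' t x = h t x)
    (hp : ∀ t ∈ Icc a b, ∀ x ∈ Icc c d, p' t x = p t x) : WeakSol h' p' a b c d ε := by
  intro α α1 α2 β β1 β2 hα hβ Q hQ hb
  rw [setIntegral_congr_fun (g := fun q : ℝ × ℝ => h q.1 q.2 * (α1 q.1 * β q.2 + α q.1 * β2 q.2 +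
      p q.1 q.2 * (α q.1 * β q.2))) (measurableSet_Icc.prod measurableSet_Icc)]
  · exact hw α α1 α2 β β1 β2 hα hβ Q hQ hb
  · rintro ⟨t, x⟩ ⟨ht, hx⟩
    simp only [hh t ht x hx, hp t ht x hx]

theorem WeakSol.neg {h p : ℝ → ℝ → ℝ} {a b c d ε : ℝ} (hw : WeakSol h p a b c d ε) :
    WeakSol (fun t x => - h t x) p a b c d ε := by
  intro α α1 α2 β β1 β2 hα hβ Q hQ hb
  simp only [neg_mul, integral_neg, abs_neg]
  exact hw α α1 α2 β β1 β2 hα hβ Q hQ hb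

/-- Unique continuation for approximate weak solutions on a box. -/
theorem box_unique_continuation {a b c d X t₁ ξ ρ m M P : ℝ} {p : ℝ → ℝ → ℝ}
    (ht : t₁ ∈ Ioo a b) (hξ : ξ ∈ Ioo c X) (hX : X < d) (hρ : 0 < ρ) (hm : 0 < m) (hM : 0 ≤ M)
    (pc : ContinuousOn (fun q : ℝ × ℝ => p q.1 q.2) (Icc a b ×ˢ Icc c d))
    (hP : ∀ s ∈ Icc a b, ∀ y ∈ Icc c d, |p s y| ≤ P) :
    ∃ ε > 0, ∀ h : ℝ → ℝ → ℝ,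
      ContinuousOn (fun q : ℝ × ℝ => h q.1 q.2) (Icc a b ×ˢ Icc c d) →
      (∀ s ∈ Icc a b, ∀ y ∈ Icc c d, |h s y| ≤ M) →
      (∀ s ∈ Icc a b, ∀ y ∈ Icc X d, h s y = 0) → WeakSol h p a b c d ε →
      ¬ ∀ s ∈ Icc a b, ∀ y ∈ Icc c d, |s - t₁| ≤ ρ → |y - ξ| ≤ ρ → m ≤ h s y := by
  have hab : a ≤ b := (ht.1.trans ht.2).le
  have hcd : c ≤ d := by linarith [hξ.1, hξ.2]
  let k : ℝ → ℝ := fun s => max a (min b s)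
  let l : ℝ → ℝ := fun y => max c (min d y)
  have hk : ∀ s, k s ∈ Icc a b := fun s => ⟨le_max_left _ _, max_le hab (min_le_left _ _)⟩
  have hl : ∀ s, l s ∈ Icc c d := fun s => ⟨le_max_left _ _, max_le hcd (min_le_left _ _)⟩
  have hk' : ∀ s ∈ Icc a b, k s = s := fun s hs => by simp [k, hs.1, hs.2]
  have hl' : ∀ s ∈ Icc c d, l s = s := fun s hs => by simp [l, hs.1, hs.2]
  have hcont : ∀ f : ℝ → ℝ → ℝ, ContinuousOn (fun q : ℝ × ℝ => f q.1 q.2) (Icc a b ×ˢ Icc c d) →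
      Continuous fun q : ℝ × ℝ => f (k q.1) (l q.2) := fun f hf =>
    hf.comp_continuous (f := fun q : ℝ × ℝ => (k q.1, l q.2)) (by fun_prop) fun q => ⟨hk _, hl _⟩
  obtain ⟨ε, hε, huc⟩ := weak_unique_continuation ht hξ hX hρ hm hM (hcont p pc)
    (fun s y => hP _ (hk s) _ (hl y))
  refine ⟨ε, hε, fun h hc hb hz hw hcon => ?_⟩
  refine huc (fun s y => h (k s) (l y)) (hcont h hc) (fun s y => hb _ (hk s) _ (hl y))
    (fun s y hy => hz _ (hk s) _ ⟨?_, (hl y).2⟩)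
    (hw.congr (fun t ht x hx => by rw [hk' t ht, hl' x hx]) fun t ht x hx => by
      rw [hk' t ht, hl' x hx]) ?_
  · exact le_max_of_le_right (le_min hX.le hy)
  · have key : ∀ {a b t s : ℝ}, t ∈ Ioo a b → |max a (min b s) - t| ≤ |s - t| := by
      intro a b t s ht
      have h1 : max a (min b t) = t := by simp [ht.1.le, ht.2.le]
      calc |max a (min b s) - t| = |max a (min b s) - max a (min b t)| := by rw [h1]
        _ ≤ |min b s - min b t| := by
          rw [max_comm a, max_comm a]
          exact abs_max_sub_max_le_abs _ _ _
        _ ≤ |s - t| := by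
          rw [min_comm b s, min_comm b t]
          exact abs_min_sub_min_le_max s b t b |>.trans (by simp)
    intro s y hs hy
    exact hcon _ (hk s) _ (hl y) ((key ht).trans hs)
      ((key ⟨hξ.1, hξ.2.trans hX⟩).trans hy)

structure HeatBox (Z Zt Zx Zxx G : ℝ → ℝ → ℝ) (a b c d : ℝ) : Prop where
  dt : ∀ t ∈ Icc a b, ∀ x ∈ Icc c d, HasDerivAt (fun s => Z s x) (Zt t x) t
  dx : ∀ t ∈ Icc a b, ∀ x ∈ Icc c d, HasDerivAt (Z t) (Zx t x) x
  dxx : ∀ t ∈ Icc a b, ∀ x ∈ Icc c d, HasDerivAt (Zx t) (Zxx t x) x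
  eq : ∀ t ∈ Icc a b, ∀ x ∈ Icc c d, Zt t x = Zxx t x + G t x
  cZ : ContinuousOn (fun q : ℝ × ℝ => Z q.1 q.2) (Icc a b ×ˢ Icc c d)
  ct : ContinuousOn (fun q : ℝ × ℝ => Zt q.1 q.2) (Icc a b ×ˢ Icc c d)
  cG : ContinuousOn (fun q : ℝ × ℝ => G q.1 q.2) (Icc a b ×ˢ Icc c d)

theorem setIntegral_boxOn {f : ℝ × ℝ → ℝ} {α β c d : ℝ} (hf : ContinuousOn f (Icc α β ×ˢ Icc c d))
    (h1 : α ≤ β) (h2 : c ≤ d) :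
    ∫ p in Icc α β ×ˢ Icc c d, f p = ∫ t in α..β, ∫ x in c..d, f (t, x) := by
  rw [Measure.volume_eq_prod, setIntegral_prod _
    (hf.integrableOn_compact (isCompact_Icc.prod isCompact_Icc)),
    intervalIntegral.integral_of_le h1, integral_Icc_eq_integral_Ioc]
  refine setIntegral_congr_fun measurableSet_Ioc fun t _ => ?_
  rw [intervalIntegral.integral_of_le h2, integral_Icc_eq_integral_Ioc]

theorem setIntegral_boxOn' {f : ℝ × ℝ → ℝ} {α β c d : ℝ} (hf : ContinuousOn f (Icc α β ×ˢ Icc c d))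
    (h1 : α ≤ β) (h2 : c ≤ d) :
    ∫ p in Icc α β ×ˢ Icc c d, f p = ∫ x in c..d, ∫ t in α..β, f (t, x) := by
  rw [Measure.volume_eq_prod, ← setIntegral_prod_swap, ← Measure.volume_eq_prod]
  exact setIntegral_boxOn (hf.comp continuous_swap.continuousOn fun q hq => ⟨hq.2, hq.1⟩) h2 h1

/-- Local concave functions of a solution are weak subsolutions. -/
theorem HeatBox.subsolution {Z Zt Zx Zxx G J m : ℝ → ℝ → ℝ} {α α1 α2 β β1 β2 : ℝ → ℝ}
    {a b c d : ℝ} (hab : a ≤ b) (hcd : c ≤ d) (h : HeatBox Z Zt Zx Zxx G a b c d)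
    (hJ : ∀ t ∈ Icc a b, ∀ x ∈ Icc c d, ∃ Φ Φ1 Φ2 : ℝ → ℝ, (∀ y, HasDerivAt Φ (Φ1 y) y) ∧
      (∀ y, HasDerivAt Φ1 (Φ2 y) y) ∧ (∀ y, Φ2 y ≤ 0) ∧
      ∀ᶠ q in 𝓝[Icc a b ×ˢ Icc c d] (t, x), J q.1 q.2 = Φ (Z q.1 q.2) ∧ m q.1 q.2 = Φ1 (Z q.1 q.2))
    (hα : IsTest α α1 α2 a b) (hβ : IsTest β β1 β2 c d) :
    ContinuousOn (fun q : ℝ × ℝ => J q.1 q.2) (Icc a b ×ˢ Icc c d) ∧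
    ContinuousOn (fun q : ℝ × ℝ => m q.1 q.2) (Icc a b ×ˢ Icc c d) ∧
    ∫ q in Icc a b ×ˢ Icc c d, (J q.1 q.2 * (α1 q.1 * β q.2 + α q.1 * β2 q.2) +
      α q.1 * β q.2 * (m q.1 q.2 * G q.1 q.2)) ≤ 0 := by
  have cJ : ContinuousOn (fun q : ℝ × ℝ => J q.1 q.2) (Icc a b ×ˢ Icc c d) := by
    rintro ⟨t, x⟩ ⟨ht, hx⟩
    obtain ⟨Φ, Φ1, Φ2, e1, e2, -, e4⟩ := hJ t ht x hx
    refine ContinuousWithinAt.congr_of_eventuallyEq ?_ (e4.mono fun q hq => hq.1)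
      (e4.self_of_nhdsWithin ⟨ht, hx⟩).1
    exact (e1 _).continuousAt.comp_continuousWithinAt (f := fun q : ℝ × ℝ => Z q.1 q.2)
      (h.cZ (t, x) ⟨ht, hx⟩)
  have cm : ContinuousOn (fun q : ℝ × ℝ => m q.1 q.2) (Icc a b ×ˢ Icc c d) := by
    rintro ⟨t, x⟩ ⟨ht, hx⟩
    obtain ⟨Φ, Φ1, Φ2, e1, e2, -, e4⟩ := hJ t ht x hx
    refine ContinuousWithinAt.congr_of_eventuallyEq ?_ (e4.mono fun q hq => hq.2)
      (e4.self_of_nhdsWithin ⟨ht, hx⟩).2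
    exact (e2 _).continuousAt.comp_continuousWithinAt (f := fun q : ℝ × ℝ => Z q.1 q.2)
      (h.cZ (t, x) ⟨ht, hx⟩)
  refine ⟨cJ, cm, ?_⟩
  have sx : ∀ {f : ℝ → ℝ → ℝ}, ContinuousOn (fun q : ℝ × ℝ => f q.1 q.2) (Icc a b ×ˢ Icc c d) →
      ∀ t ∈ Icc a b, ContinuousOn (f t) (Icc c d) := fun hf t ht =>
    hf.comp (f := fun x : ℝ => (t, x)) (by fun_prop) fun x hx => ⟨ht, hx⟩
  have st : ∀ {f : ℝ → ℝ → ℝ}, ContinuousOn (fun q : ℝ × ℝ => f q.1 q.2) (Icc a b ×ˢ Icc c d) →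
      ∀ x ∈ Icc c d, ContinuousOn (fun t => f t x) (Icc a b) := fun hf x hx =>
    hf.comp (f := fun t : ℝ => (t, x)) (by fun_prop) fun t ht => ⟨ht, hx⟩
  have cα0 := hα.c0
  have cα1 := hα.c1
  have cβ0 := hβ.c0
  have cβ1 := hβ.c1
  have cβ2 := hβ.c2
  have cZt := h.ct
  have cG := h.cG
  have cxx : ContinuousOn (fun q : ℝ × ℝ => Zxx q.1 q.2) (Icc a b ×ˢ Icc c d) :=
    (h.ct.sub h.cG).congr fun q hq =>
      (sub_eq_of_eq_add (h.eq q.1 hq.1 q.2 hq.2)).symm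
  have hα0 : α a = 0 ∧ α b = 0 :=
    ⟨(hα.zero a (by simp)).1, (hα.zero b (by simp)).1⟩
  have hβ0 : β c = 0 ∧ β d = 0 ∧ β1 c = 0 ∧ β1 d = 0 :=
    ⟨(hβ.zero c (by simp)).1, (hβ.zero d (by simp)).1, (hβ.zero c (by simp)).2,
      (hβ.zero d (by simp)).2⟩
  have i1 : ∫ q in Icc a b ×ˢ Icc c d, (β q.2 * (α1 q.1 * J q.1 q.2 +
      α q.1 * (m q.1 q.2 * Zt q.1 q.2))) = 0 := by
    rw [setIntegral_boxOn' (by fun_prop) hab hcd, intervalIntegral.integral_congr (g := fun _ => 0)]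
    · simp
    intro x hx
    rw [uIcc_of_le hcd] at hx
    simp only
    rw [intervalIntegral.integral_const_mul]
    have := intervalIntegral.integral_eq_sub_of_hasDerivAt_of_le hab (f := fun t => α t * J t x)
      (f' := fun t => α1 t * J t x + α t * (m t x * Zt t x))
      (cα0.continuousOn.mul (st cJ x hx)) (fun t ht => ?_) ?_
    · rw [this, hα0.1, hα0.2]
      ring
    · have ht' := Ioo_subset_Icc_self ht
      obtain ⟨Φ, Φ1, Φ2, e1, e2, -, e4⟩ := hJ t ht' x hx
      have e5 := (e4.self_of_nhdsWithin ⟨ht', hx⟩)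
      refine (hα.d1 t).fun_mul ?_
      have : HasDerivAt (fun s => Φ (Z s x)) (Φ1 (Z t x) * Zt t x) t :=
        (e1 (Z t x)).comp t (h.dt t ht' x hx)
      simp only at e5
      rw [e5.2]
      refine this.congr_of_eventuallyEq ?_
      have htend : Tendsto (fun s : ℝ => (s, x)) (𝓝 t) (𝓝[Icc a b ×ˢ Icc c d] (t, x)) := by
        refine tendsto_nhdsWithin_iff.2 ⟨(by fun_prop : Continuous fun s : ℝ => (s, x)).continuousAt,
          ?_⟩
        filter_upwards [Ioo_mem_nhds ht.1 ht.2] with s hs using ⟨Ioo_subset_Icc_self hs, hx⟩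
      filter_upwards [htend.eventually e4] with s hs using hs.1
    · refine ContinuousOn.intervalIntegrable ?_
      rw [uIcc_of_le hab]
      exact (cα1.continuousOn.mul (st cJ x hx)).add
        (cα0.continuousOn.mul ((st cm x hx).mul (st cZt x hx)))
  have i2 : ∫ q in Icc a b ×ˢ Icc c d, (α q.1 * (β2 q.2 * J q.1 q.2 -
      β q.2 * (m q.1 q.2 * Zxx q.1 q.2))) ≤ 0 := by
    rw [setIntegral_boxOn (by fun_prop) hab hcd]
    rw [← neg_nonneg, ← intervalIntegral.integral_neg]
    refine intervalIntegral.integral_nonneg hab fun t ht => ?_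
    simp only [neg_nonneg, intervalIntegral.integral_const_mul]
    refine mul_nonpos_of_nonneg_of_nonpos (hα.nn t) ?_
    have hcz : ContinuousOn (fun x => Zx t x) (Icc c d) := fun x hx =>
      (h.dxx t ht x hx).continuousAt.continuousWithinAt
    have hkey : ∀ x ∈ Ioo c d, ∃ D, HasDerivAt (fun x => β1 x * J t x - β x * (m t x * Zx t x)) D x ∧
        β2 x * J t x - β x * (m t x * Zxx t x) ≤ D := by
      intro x hx
      have hx' := Ioo_subset_Icc_self hx
      obtain ⟨Φ, Φ1, Φ2, e1, e2, e3, e4⟩ := hJ t ht x hx'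
      have e5 := (e4.self_of_nhdsWithin ⟨ht, hx'⟩)
      simp only at e5
      have htend : Tendsto (fun s : ℝ => (t, s)) (𝓝 x) (𝓝[Icc a b ×ˢ Icc c d] (t, x)) := by
        refine tendsto_nhdsWithin_iff.2 ⟨(by fun_prop : Continuous fun s : ℝ => (t, s)).continuousAt,
          ?_⟩
        filter_upwards [Ioo_mem_nhds hx.1 hx.2] with s hs using ⟨ht, Ioo_subset_Icc_self hs⟩
      have d1 : HasDerivAt (fun y => J t y) (Φ1 (Z t x) * Zx t x) x := by
        have : HasDerivAt (fun y => Φ (Z t y)) (Φ1 (Z t x) * Zx t x) x :=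
          (e1 (Z t x)).comp x (h.dx t ht x hx')
        exact this.congr_of_eventuallyEq ((htend.eventually e4).mono fun s hs => hs.1)
      have d2 : HasDerivAt (fun y => m t y) (Φ2 (Z t x) * Zx t x) x := by
        have : HasDerivAt (fun y => Φ1 (Z t y)) (Φ2 (Z t x) * Zx t x) x :=
          (e2 (Z t x)).comp x (h.dx t ht x hx')
        exact this.congr_of_eventuallyEq ((htend.eventually e4).mono fun s hs => hs.2)
      refine ⟨_, ((hβ.d2 x).fun_mul d1).fun_sub ((hβ.d1 x).fun_mul (d2.fun_mul (h.dxx t ht x hx'))),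
        ?_⟩
      rw [e5.2]
      have : 0 ≤ β x * (-Φ2 (Z t x) * Zx t x ^ 2) :=
        mul_nonneg (hβ.nn x) (mul_nonneg (neg_nonneg.2 (e3 _)) (sq_nonneg _))
      nlinarith
    have := intervalIntegral.integral_le_sub_of_hasDeriv_right_of_le hcd
      (g := fun x => β1 x * J t x - β x * (m t x * Zx t x))
      (g' := deriv (fun x => β1 x * J t x - β x * (m t x * Zx t x)))
      (φ := fun x => β2 x * J t x - β x * (m t x * Zxx t x))
      ((cβ1.continuousOn.mul (sx cJ t ht)).sub
        (cβ0.continuousOn.mul ((sx cm t ht).mul hcz))) (fun x hx => ?_) ?_ (fun x hx => ?_)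
    · rw [hβ0.1, hβ0.2.1, hβ0.2.2.1, hβ0.2.2.2] at this
      linarith
    · obtain ⟨D, hD, -⟩ := hkey x hx
      exact hD.differentiableAt.hasDerivAt.hasDerivWithinAt
    · exact ContinuousOn.integrableOn_compact isCompact_Icc
        ((cβ2.continuousOn.mul (sx cJ t ht)).sub
          (cβ0.continuousOn.mul ((sx cm t ht).mul (sx cxx t ht))))
    · obtain ⟨D, hD, hD'⟩ := hkey x hx
      rw [hD.deriv]
      exact hD'
  have i3 := add_nonpos i1.le i2
  rw [← integral_add] at i3
  · refine le_of_eq_of_le (setIntegral_congr_fun (measurableSet_Icc.prod measurableSet_Icc) ?_) i3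
    rintro ⟨t, x⟩ ⟨ht, hx⟩
    simp only
    rw [h.eq t ht x hx]
    ring
  · exact ContinuousOn.integrableOn_compact (isCompact_Icc.prod isCompact_Icc) (by fun_prop)
  · exact ContinuousOn.integrableOn_compact (isCompact_Icc.prod isCompact_Icc) (by fun_prop)

/-- A smooth increasing concave approximation of `min y 0`. -/
theorem exists_concave_cut {δ : ℝ} (hδ : 0 < δ) : ∃ (Φ Φ1 Φ2 : ℝ → ℝ) (c : ℝ),
    (∀ y, HasDerivAt Φ (Φ1 y) y) ∧ (∀ y, HasDerivAt Φ1 (Φ2 y) y) ∧ (∀ y, Φ2 y ≤ 0) ∧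
    (∀ y ≤ -δ, Φ y = y + c ∧ Φ1 y = 1) ∧ (∀ y, 0 ≤ y → Φ y = 0 ∧ Φ1 y = 0) ∧
    (∀ y, 0 ≤ Φ1 y ∧ Φ1 y ≤ 1) ∧ (∀ y, |Φ y - min y 0| ≤ δ) ∧ |c| ≤ δ := by
  set k : ℝ → ℝ := fun y => max 0 (-y * (y + δ)) with hk
  have ck : Continuous k := by fun_prop
  have k0 : ∀ y, 0 ≤ k y := fun y => le_max_left _ _
  have kr : ∀ y, 0 ≤ y → k y = 0 := fun y hy => max_eq_left (by nlinarith)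
  have kl : ∀ y ≤ -δ, k y = 0 := fun y hy => max_eq_left (by nlinarith)
  set S := ∫ y in (-δ)..0, k y with hS
  have hS0 : 0 < S := by
    refine intervalIntegral.intervalIntegral_pos_of_pos_on (ck.intervalIntegrable _ _)
      (fun y hy => ?_) (by linarith)
    exact lt_max_of_lt_right (mul_pos (by linarith [hy.2]) (by linarith [hy.1]))
  set Φ1 : ℝ → ℝ := fun y => -(∫ s in (0 : ℝ)..y, k s) / S with hΦ1
  have d1 : ∀ y, HasDerivAt Φ1 (-k y / S) y := fun y =>
    ((ck.integral_hasStrictDerivAt 0 y).hasDerivAt.neg).div_const S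
  have cΦ1 : Continuous Φ1 := continuous_iff_continuousAt.2 fun y => (d1 y).continuousAt
  have r1 : ∀ y, 0 ≤ y → Φ1 y = 0 := fun y hy => by
    have : ∫ s in (0 : ℝ)..y, k s = ∫ s in (0 : ℝ)..y, (0 : ℝ) := by
      refine intervalIntegral.integral_congr fun s hs => ?_
      rw [uIcc_of_le hy] at hs
      exact kr s hs.1
    simp [hΦ1, this]
  have l1 : ∀ y ≤ -δ, Φ1 y = 1 := fun y hy => by
    have e1 : ∫ s in y..(-δ), k s = ∫ s in y..(-δ), (0 : ℝ) := by
      refine intervalIntegral.integral_congr fun s hs => ?_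
      rw [uIcc_of_le hy] at hs
      exact kl s hs.2
    have e2 := intervalIntegral.integral_add_adjacent_intervals (μ := volume)
      (ck.intervalIntegrable y (-δ)) (ck.intervalIntegrable (-δ) 0)
    rw [e1, intervalIntegral.integral_zero, zero_add] at e2
    simp only [hΦ1]
    rw [intervalIntegral.integral_symm, ← e2, neg_neg, div_self hS0.ne']
  have anti : Antitone Φ1 := antitone_of_deriv_nonpos (fun y => (d1 y).differentiableAt) fun y => by
    rw [(d1 y).deriv]
    exact div_nonpos_of_nonpos_of_nonneg (neg_nonpos.2 (k0 y)) hS0.le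
  have b1 : ∀ y, 0 ≤ Φ1 y ∧ Φ1 y ≤ 1 := fun y =>
    ⟨by rw [← r1 (max y 0) (le_max_right _ _)]; exact anti (le_max_left _ _),
      by rw [← l1 (min y (-δ)) (min_le_right _ _)]; exact anti (min_le_left _ _)⟩
  set Φ : ℝ → ℝ := fun y => ∫ s in (0 : ℝ)..y, Φ1 s with hΦ
  have d0 : ∀ y, HasDerivAt Φ (Φ1 y) y := fun y => (cΦ1.integral_hasStrictDerivAt 0 y).hasDerivAt
  have r0 : ∀ y, 0 ≤ y → Φ y = 0 := fun y hy => by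
    have : ∫ s in (0 : ℝ)..y, Φ1 s = ∫ s in (0 : ℝ)..y, (0 : ℝ) := by
      refine intervalIntegral.integral_congr fun s hs => ?_
      rw [uIcc_of_le hy] at hs
      exact r1 s hs.1
    simp [hΦ, this]
  have l0 : ∀ y ≤ -δ, Φ y = y + (Φ (-δ) + δ) := fun y hy => by
    have e1 : ∫ s in y..(-δ), Φ1 s = ∫ s in y..(-δ), (1 : ℝ) := by
      refine intervalIntegral.integral_congr fun s hs => ?_
      rw [uIcc_of_le hy] at hs
      exact l1 s hs.2
    have e2 := intervalIntegral.integral_add_adjacent_intervals (μ := volume)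
      (cΦ1.intervalIntegrable 0 (-δ)) (cΦ1.intervalIntegrable (-δ) y)
    rw [intervalIntegral.integral_symm y, e1] at e2
    simp only [intervalIntegral.integral_const, smul_eq_mul, mul_one] at e2
    simp only [hΦ]
    linarith
  have mono : Monotone Φ := monotone_of_deriv_nonneg (fun y => (d0 y).differentiableAt) fun y => by
    rw [(d0 y).deriv]
    exact (b1 y).1
  have antiD : Antitone fun y => Φ y - y :=
    antitone_of_deriv_nonpos (fun y => ((d0 y).sub (hasDerivAt_id y)).differentiableAt) fun y => by
      rw [((d0 y).fun_sub (hasDerivAt_id' y)).deriv]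
      linarith [(b1 y).2]
  have c0 : 0 ≤ Φ (-δ) + δ := by
    have := antiD (show -δ ≤ 0 by linarith)
    simp only [r0 0 le_rfl] at this
    linarith
  have c1 : Φ (-δ) + δ ≤ δ := by
    have := mono (show -δ ≤ 0 by linarith)
    rw [r0 0 le_rfl] at this
    linarith
  refine ⟨Φ, Φ1, _, Φ (-δ) + δ, d0, d1, fun y =>
    div_nonpos_of_nonpos_of_nonneg (neg_nonpos.2 (k0 y)) hS0.le, fun y hy => ⟨l0 y hy, l1 y hy⟩,
    fun y hy => ⟨r0 y hy, r1 y hy⟩, b1, fun y => ?_, by rw [abs_of_nonneg c0]; exact c1⟩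
  rcases le_total 0 y with hy | hy
  · rw [min_eq_right hy, r0 y hy]
    simpa using hδ.le
  · rw [min_eq_left hy, abs_le]
    have h1 := antiD hy
    have h2 := antiD (min_le_left y (-δ))
    simp only [r0 0 le_rfl] at h1
    simp only [l0 _ (min_le_right y (-δ))] at h2
    constructor <;> linarith

def ApproxBox (z p : ℝ → ℝ → ℝ) (a b c d : ℝ) : Prop :=
  ∀ ε > 0, ∃ Z Zt Zx Zxx G : ℝ → ℝ → ℝ, HeatBox Z Zt Zx Zxx G a b c d ∧
    ∀ t ∈ Icc a b, ∀ x ∈ Icc c d, |Z t x - z t x| ≤ ε ∧ |G t x - p t x * z t x| ≤ ε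

theorem HeatBox.neg {Z Zt Zx Zxx G : ℝ → ℝ → ℝ} {a b c d : ℝ} (h : HeatBox Z Zt Zx Zxx G a b c d) :
    HeatBox (fun t x => - Z t x) (fun t x => - Zt t x) (fun t x => - Zx t x)
      (fun t x => - Zxx t x) (fun t x => - G t x) a b c d where
  dt t ht x hx := (h.dt t ht x hx).neg
  dx t ht x hx := (h.dx t ht x hx).neg
  dxx t ht x hx := (h.dxx t ht x hx).neg
  eq t ht x hx := by rw [h.eq t ht x hx]; ring
  cZ := h.cZ.neg
  ct := h.ct.neg
  cG := h.cG.neg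

theorem ApproxBox.neg {z p : ℝ → ℝ → ℝ} {a b c d : ℝ} (h : ApproxBox z p a b c d) :
    ApproxBox (fun t x => - z t x) p a b c d := by
  intro ε hε
  obtain ⟨Z, Zt, Zx, Zxx, G, h1, h2⟩ := h ε hε
  refine ⟨_, _, _, _, _, h1.neg, fun t ht x hx => ?_⟩
  obtain ⟨h3, h4⟩ := h2 t ht x hx
  constructor
  · rwa [← abs_neg, show -(-Z t x - -z t x) = Z t x - z t x by ring]
  · rwa [← abs_neg, show -(-G t x - p t x * -z t x) = G t x - p t x * z t x by ring]

/-- Limits of local concave functions of approximate solutions are weak subsolutions. -/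
theorem weak_subsolution_of_approx {h1 p : ℝ → ℝ → ℝ} {a b c d : ℝ} (hab : a ≤ b) (hcd : c ≤ d)
    (pc : ContinuousOn (fun q : ℝ × ℝ => p q.1 q.2) (Icc a b ×ˢ Icc c d))
    (happ : ∀ η > 0, ∃ Z Zt Zx Zxx G J m : ℝ → ℝ → ℝ, HeatBox Z Zt Zx Zxx G a b c d ∧
      (∀ t ∈ Icc a b, ∀ x ∈ Icc c d, ∃ Φ Φ1 Φ2 : ℝ → ℝ, (∀ y, HasDerivAt Φ (Φ1 y) y) ∧
      (∀ y, HasDerivAt Φ1 (Φ2 y) y) ∧ (∀ y, Φ2 y ≤ 0) ∧ ∀ᶠ q in 𝓝[Icc a b ×ˢ Icc c d] (t, x),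
        J q.1 q.2 = Φ (Z q.1 q.2) ∧ m q.1 q.2 = Φ1 (Z q.1 q.2)) ∧
      ∀ t ∈ Icc a b, ∀ x ∈ Icc c d, |J t x - h1 t x| ≤ η ∧ |m t x * G t x - p t x * h1 t x| ≤ η) :
    ContinuousOn (fun q : ℝ × ℝ => h1 q.1 q.2) (Icc a b ×ˢ Icc c d) ∧
    ∀ α α1 α2 β β1 β2 : ℝ → ℝ, IsTest α α1 α2 a b → IsTest β β1 β2 c d →
      ∫ q in Icc a b ×ˢ Icc c d, h1 q.1 q.2 * (α1 q.1 * β q.2 + α q.1 * β2 q.2 +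
        p q.1 q.2 * (α q.1 * β q.2)) ≤ 0 := by
  have hcomp : IsCompact (Icc a b ×ˢ Icc c d) := isCompact_Icc.prod isCompact_Icc
  have hmeas : MeasurableSet (Icc a b ×ˢ Icc c d) := measurableSet_Icc.prod measurableSet_Icc
  have z0 : ∀ x y : ℝ, IsTest (fun _ => 0) (fun _ => 0) (fun _ => 0) x y := fun x y =>
    ⟨fun z => hasDerivAt_const z _, fun z => hasDerivAt_const z _, continuous_const, fun _ => le_rfl,
      fun _ _ => ⟨rfl, rfl⟩⟩
  have hcont : ContinuousOn (fun q : ℝ × ℝ => h1 q.1 q.2) (Icc a b ×ˢ Icc c d) := by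
    refine continuousOn_of_uniform_approx_of_continuousOn fun u hu => ?_
    obtain ⟨η, hη, hηu⟩ := Metric.mem_uniformity_dist.1 hu
    obtain ⟨Z, Zt, Zx, Zxx, G, J, m, hZ, hJ, hb⟩ := happ (η / 2) (by positivity)
    refine ⟨fun q => J q.1 q.2, (hZ.subsolution hab hcd hJ (z0 _ _) (z0 _ _)).1, fun q hq => ?_⟩
    refine hηu ?_
    rw [Real.dist_eq, abs_sub_comm]
    linarith [(hb q.1 hq.1 q.2 hq.2).1]
  refine ⟨hcont, fun α α1 α2 β β1 β2 hα hβ => ?_⟩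
  have cα0 := hα.c0
  have cα1 := hα.c1
  have cβ0 := hβ.c0
  have cβ2 := hβ.c2
  obtain ⟨Q, hQ⟩ := hcomp.exists_bound_of_continuousOn
    (f := fun q : ℝ × ℝ => |α1 q.1 * β q.2 + α q.1 * β2 q.2| + |α q.1 * β q.2|) (by fun_prop)
  have hQ' : ∀ q ∈ Icc a b ×ˢ Icc c d,
      |α1 q.1 * β q.2 + α q.1 * β2 q.2| + |α q.1 * β q.2| ≤ Q := fun q hq => by
    have := hQ q hq
    rw [Real.norm_of_nonneg (by positivity)] at this
    exact this
  have hQ0 : 0 ≤ Q := le_trans (by positivity) (hQ' (a, c) ⟨⟨le_rfl, hab⟩, ⟨le_rfl, hcd⟩⟩)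
  refine le_of_forall_pos_le_add fun e he => ?_
  rw [zero_add]
  set V := (b - a) * (d - c) with hV
  have hV0 : 0 ≤ V := mul_nonneg (sub_nonneg.2 hab) (sub_nonneg.2 hcd)
  obtain ⟨Z, Zt, Zx, Zxx, G, J, m, hZ, hJ, hb⟩ := happ (e / (V * Q + 1)) (by positivity)
  obtain ⟨cJ, cm, hle⟩ := hZ.subsolution hab hcd hJ hα hβ
  have cG := hZ.cG
  set η := e / (V * Q + 1) with hη
  have hη0 : 0 ≤ η := by positivity
  have hintegral : ∫ q in Icc a b ×ˢ Icc c d, h1 q.1 q.2 * (α1 q.1 * β q.2 + α q.1 * β2 q.2 +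
      p q.1 q.2 * (α q.1 * β q.2)) ≤ ∫ q in Icc a b ×ˢ Icc c d,
      ((J q.1 q.2 * (α1 q.1 * β q.2 + α q.1 * β2 q.2) +
      α q.1 * β q.2 * (m q.1 q.2 * G q.1 q.2)) + η * Q) := by
    refine setIntegral_mono_on (ContinuousOn.integrableOn_compact hcomp (by fun_prop))
      (ContinuousOn.integrableOn_compact hcomp (by fun_prop)) hmeas fun q hq => ?_
    obtain ⟨f1, f2⟩ := hb q.1 hq.1 q.2 hq.2
    have f3 := hQ' q hq
    have g1 : (h1 q.1 q.2 - J q.1 q.2) * (α1 q.1 * β q.2 + α q.1 * β2 q.2) ≤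
        η * |α1 q.1 * β q.2 + α q.1 * β2 q.2| := by
      refine (le_abs_self _).trans ?_
      rw [abs_mul, abs_sub_comm]
      exact mul_le_mul_of_nonneg_right f1 (abs_nonneg _)
    have g2 : (p q.1 q.2 * h1 q.1 q.2 - m q.1 q.2 * G q.1 q.2) * (α q.1 * β q.2) ≤
        η * |α q.1 * β q.2| := by
      refine (le_abs_self _).trans ?_
      rw [abs_mul, abs_sub_comm]
      exact mul_le_mul_of_nonneg_right f2 (abs_nonneg _)
    have g3 := mul_le_mul_of_nonneg_left f3 hη0
    linarith
  rw [integral_add (ContinuousOn.integrableOn_compact hcomp (by fun_prop))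
    (ContinuousOn.integrableOn_compact hcomp (by fun_prop)),
    setIntegral_box_const _ _ _ _ _ hab hcd] at hintegral
  have : (b - a) * (d - c) * (η * Q) ≤ e := by
    rw [← hV, show V * (η * Q) = e * (V * Q) / (V * Q + 1) by rw [hη]; ring,
      div_le_iff₀ (by positivity)]
    linarith
  linarith

theorem ApproxBox.weakSol {z p : ℝ → ℝ → ℝ} {a b c d : ℝ} (hab : a ≤ b) (hcd : c ≤ d)
    (h : ApproxBox z p a b c d)
    (pc : ContinuousOn (fun q : ℝ × ℝ => p q.1 q.2) (Icc a b ×ˢ Icc c d)) {ε : ℝ} (hε : 0 ≤ ε) :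
    WeakSol z p a b c d ε := by
  have key : ∀ z : ℝ → ℝ → ℝ, ApproxBox z p a b c d →
      ∀ α α1 α2 β β1 β2 : ℝ → ℝ, IsTest α α1 α2 a b → IsTest β β1 β2 c d →
      ∫ q in Icc a b ×ˢ Icc c d, z q.1 q.2 * (α1 q.1 * β q.2 + α q.1 * β2 q.2 +
        p q.1 q.2 * (α q.1 * β q.2)) ≤ 0 := fun z h => by
    refine (weak_subsolution_of_approx hab hcd pc fun η hη => ?_).2
    obtain ⟨Z, Zt, Zx, Zxx, G, h1, h2⟩ := h η hη
    refine ⟨Z, Zt, Zx, Zxx, G, Z, fun _ _ => 1, h1, fun t ht x hx => ⟨fun y => y, fun _ => 1,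
      fun _ => 0, fun y => hasDerivAt_id' y, fun y => hasDerivAt_const y 1, fun _ => le_rfl,
      Eventually.of_forall fun q => ⟨rfl, rfl⟩⟩, fun t ht x hx => ?_⟩
    rw [one_mul]
    exact h2 t ht x hx
  intro α α1 α2 β β1 β2 hα hβ Q hQ _
  have e1 := key z h α α1 α2 β β1 β2 hα hβ
  have e2 := key _ h.neg α α1 α2 β β1 β2 hα hβ
  simp only [neg_mul, integral_neg] at e2
  rw [le_antisymm e1 (by linarith), abs_zero]
  positivity

/-- The function equal to `z` left of the first curve, its negative part between the curves and
zero right of the second curve. -/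
def cutBelow (z : ℝ → ℝ → ℝ) (γ₁ γ₂ : ℝ → ℝ) (t x : ℝ) : ℝ :=
  if x ≤ γ₁ t then z t x else if x < γ₂ t then min (z t x) 0 else 0

theorem curve_bound {z : ℝ → ℝ → ℝ} {γ : ℝ → ℝ} {a b c d : ℝ} (hγ : Continuous γ)
    (cz : ContinuousOn (fun q : ℝ × ℝ => z q.1 q.2) (Icc a b ×ˢ Icc c d))
    (h : ∀ t ∈ Icc a b, γ t ∈ Icc c d → 0 < z t (γ t)) :
    ∃ η > 0, ∀ t ∈ Icc a b, γ t ∈ Icc c d → η ≤ z t (γ t) := by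
  have hK : IsCompact (Icc a b ∩ γ ⁻¹' Icc c d) :=
    isCompact_Icc.inter_right (isClosed_Icc.preimage hγ)
  obtain ⟨η, h1, h2⟩ := hK.exists_forall_le' (f := fun t => z t (γ t)) (a := 0)
    (cz.comp (f := fun t => (t, γ t)) (by fun_prop) fun t ht => ⟨ht.1, ht.2⟩)
    fun t ht => h t ht.1 ht.2
  exact ⟨η, h1, fun t ht ht' => h2 t ⟨ht, ht'⟩⟩

theorem cut_subsolution {z p : ℝ → ℝ → ℝ} {γ₁ γ₂ : ℝ → ℝ} {a b c d P : ℝ} (hab : a ≤ b)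
    (hcd : c ≤ d) (h : ApproxBox z p a b c d)
    (cz : ContinuousOn (fun q : ℝ × ℝ => z q.1 q.2) (Icc a b ×ˢ Icc c d))
    (pc : ContinuousOn (fun q : ℝ × ℝ => p q.1 q.2) (Icc a b ×ˢ Icc c d))
    (hP : ∀ t ∈ Icc a b, ∀ x ∈ Icc c d, |p t x| ≤ P) (hγ₁ : Continuous γ₁) (hγ₂ : Continuous γ₂)
    (hlt : ∀ t ∈ Icc a b, γ₁ t < γ₂ t) (h1 : ∀ t ∈ Icc a b, γ₁ t ∈ Icc c d → z t (γ₁ t) < 0)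
    (h2 : ∀ t ∈ Icc a b, γ₂ t ∈ Icc c d → 0 < z t (γ₂ t)) :
    ContinuousOn (fun q : ℝ × ℝ => cutBelow z γ₁ γ₂ q.1 q.2) (Icc a b ×ˢ Icc c d) ∧
    ∀ α α1 α2 β β1 β2 : ℝ → ℝ, IsTest α α1 α2 a b → IsTest β β1 β2 c d →
      ∫ q in Icc a b ×ˢ Icc c d, cutBelow z γ₁ γ₂ q.1 q.2 * (α1 q.1 * β q.2 + α q.1 * β2 q.2 +
        p q.1 q.2 * (α q.1 * β q.2)) ≤ 0 := by
  have hP0 : 0 ≤ P := (abs_nonneg _).trans (hP a ⟨le_rfl, hab⟩ c ⟨le_rfl, hcd⟩)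
  obtain ⟨η₁, hη₁, hb₁⟩ := curve_bound hγ₁ (z := fun t x => - z t x) cz.neg
    fun t ht ht' => neg_pos.2 (h1 t ht ht')
  obtain ⟨η₂, hη₂, hb₂⟩ := curve_bound hγ₂ cz h2
  refine weak_subsolution_of_approx hab hcd pc fun η hη => ?_
  obtain ⟨δ, hδ, hδ'⟩ : ∃ δ > 0, 2 * δ < η₁ ∧ 2 * δ < η₂ ∧ δ + P * (2 * δ) ≤ η ∧ 2 * δ ≤ η := by
    refine ⟨min η (min η₁ η₂) / (4 * (P + 1)), by positivity, ?_⟩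
    have key : min η (min η₁ η₂) / (4 * (P + 1)) * (4 * (P + 1)) = min η (min η₁ η₂) := by
      field_simp
    have m0 : 0 < min η (min η₁ η₂) / (4 * (P + 1)) := by positivity
    set δ := min η (min η₁ η₂) / (4 * (P + 1))
    have m1 : min η (min η₁ η₂) ≤ η := min_le_left _ _
    have m2 : min η (min η₁ η₂) ≤ η₁ := (min_le_right _ _).trans (min_le_left _ _)
    have m3 : min η (min η₁ η₂) ≤ η₂ := (min_le_right _ _).trans (min_le_right _ _)
    have m4 : 0 ≤ δ * P := by positivity
    refine ⟨?_, ?_, ?_, ?_⟩ <;> linarith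
  obtain ⟨k1, k2, k3, k4⟩ := hδ'
  obtain ⟨Φ, Φ1, Φ2, C, d0, d1, d2, dl, dr, db, dm, hC⟩ := exists_concave_cut hδ
  obtain ⟨Z, Zt, Zx, Zxx, G, hZ, hb⟩ := h δ hδ
  refine ⟨Z, Zt, Zx, Zxx, G,
    fun t x => if x ≤ γ₁ t then Z t x + C else if x < γ₂ t then Φ (Z t x) else 0,
    fun t x => if x ≤ γ₁ t then 1 else if x < γ₂ t then Φ1 (Z t x) else 0, hZ, ?_, ?_⟩
  · intro t ht x hx
    have cγ₁ : ContinuousAt (fun q : ℝ × ℝ => γ₁ q.1 - q.2) (t, x) := by fun_prop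
    have cγ₂ : ContinuousAt (fun q : ℝ × ℝ => γ₂ q.1 - q.2) (t, x) := by fun_prop
    have cZ : ContinuousWithinAt (fun q : ℝ × ℝ => Z q.1 q.2) (Icc a b ×ˢ Icc c d) (t, x) :=
      hZ.cZ (t, x) ⟨ht, hx⟩
    have hL := hlt t ht
    have affine : ∀ y, HasDerivAt (fun y => y + C) 1 y := fun y => (hasDerivAt_id' y).add_const C
    rcases lt_trichotomy x (γ₁ t) with hlt1 | heq1 | hgt1
    · refine ⟨fun y => y + C, fun _ => 1, fun _ => 0, affine, fun y => hasDerivAt_const y 1,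
        fun _ => le_rfl, ?_⟩
      filter_upwards [mem_nhdsWithin_of_mem_nhds (cγ₁.eventually (lt_mem_nhds
        (show 0 < γ₁ t - x by linarith)))] with q hq
      rw [if_pos (sub_pos.1 hq).le, if_pos (sub_pos.1 hq).le]
      exact ⟨rfl, rfl⟩
    · refine ⟨fun y => y + C, fun _ => 1, fun _ => 0, affine, fun y => hasDerivAt_const y 1,
        fun _ => le_rfl, ?_⟩
      have hz : Z t x < -δ := by
        have := hb₁ t ht (by rw [← heq1]; exact hx)
        rw [← heq1] at this
        linarith [(abs_le.1 (hb t ht x hx).1).2]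
      filter_upwards [mem_nhdsWithin_of_mem_nhds (cγ₂.eventually (lt_mem_nhds
        (show 0 < γ₂ t - x by linarith))), cZ.eventually (gt_mem_nhds hz)] with q hq hq'
      rw [if_pos (sub_pos.1 hq), if_pos (sub_pos.1 hq), (dl _ hq'.le).1, (dl _ hq'.le).2]
      simp
    rcases lt_trichotomy x (γ₂ t) with hlt2 | heq2 | hgt2
    · refine ⟨Φ, Φ1, Φ2, d0, d1, d2, ?_⟩
      filter_upwards [mem_nhdsWithin_of_mem_nhds (cγ₁.eventually (gt_mem_nhds
        (show γ₁ t - x < 0 by linarith))), mem_nhdsWithin_of_mem_nhds (cγ₂.eventually (lt_mem_nhds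
        (show 0 < γ₂ t - x by linarith)))] with q hq hq'
      rw [if_neg (not_le.2 (sub_neg.1 hq)), if_neg (not_le.2 (sub_neg.1 hq)), if_pos (sub_pos.1 hq'),
        if_pos (sub_pos.1 hq')]
      exact ⟨rfl, rfl⟩
    · refine ⟨fun _ => 0, fun _ => 0, fun _ => 0, fun y => hasDerivAt_const y 0,
        fun y => hasDerivAt_const y 0, fun _ => le_rfl, ?_⟩
      have hz : 0 < Z t x := by
        have := hb₂ t ht (by rw [← heq2]; exact hx)
        rw [← heq2] at this
        linarith [(abs_le.1 (hb t ht x hx).1).1]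
      filter_upwards [mem_nhdsWithin_of_mem_nhds (cγ₁.eventually (gt_mem_nhds
        (show γ₁ t - x < 0 by linarith))), cZ.eventually (lt_mem_nhds hz)] with q hq hq'
      rw [if_neg (not_le.2 (sub_neg.1 hq)), if_neg (not_le.2 (sub_neg.1 hq)), (dr _ hq'.le).1,
        (dr _ hq'.le).2]
      simp
    · refine ⟨fun _ => 0, fun _ => 0, fun _ => 0, fun y => hasDerivAt_const y 0,
        fun y => hasDerivAt_const y 0, fun _ => le_rfl, ?_⟩
      filter_upwards [mem_nhdsWithin_of_mem_nhds (cγ₁.eventually (gt_mem_nhds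
        (show γ₁ t - x < 0 by linarith))), mem_nhdsWithin_of_mem_nhds (cγ₂.eventually (gt_mem_nhds
        (show γ₂ t - x < 0 by linarith)))] with q hq hq'
      rw [if_neg (not_le.2 (sub_neg.1 hq)), if_neg (not_le.2 (sub_neg.1 hq)),
        if_neg (not_lt.2 (sub_neg.1 hq').le), if_neg (not_lt.2 (sub_neg.1 hq').le)]
      exact ⟨rfl, rfl⟩
  · intro t ht x hx
    obtain ⟨f1, f2⟩ := hb t ht x hx
    have f3 := hP t ht x hx
    unfold cutBelow
    beta_reduce
    split_ifs with g1 g2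
    · refine ⟨?_, by rw [one_mul]; nlinarith⟩
      rw [abs_le] at f1 hC ⊢
      constructor <;> linarith
    · constructor
      · have e1 := dm (Z t x)
        have e2 : |min (Z t x) 0 - min (z t x) 0| ≤ δ :=
          (abs_min_sub_min_le_max _ _ _ _).trans (by simpa using f1)
        have e3 := abs_sub_le (Φ (Z t x)) (min (Z t x) 0) (min (z t x) 0)
        linarith
      · obtain ⟨b0, b1⟩ := db (Z t x)
        have e1 : |Φ1 (Z t x) * (G t x - p t x * z t x)| ≤ δ := by
          rw [abs_mul, abs_of_nonneg b0]
          calc _ ≤ 1 * δ := mul_le_mul b1 f2 (abs_nonneg _) zero_le_one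
            _ = δ := one_mul δ
        have e2 : |Φ1 (Z t x) * z t x - min (z t x) 0| ≤ 2 * δ := by
          rw [abs_le] at f1
          rcases le_or_gt (Z t x) (-δ) with u | u
          · rw [(dl _ u).2, one_mul, min_eq_left (by linarith)]
            simp [hδ.le]
          rcases le_or_gt 0 (Z t x) with u' | u'
          · rw [(dr _ u').2, zero_mul, zero_sub, abs_neg, abs_le]
            refine ⟨le_min (by linarith) (by linarith), (min_le_right _ _).trans (by linarith)⟩
          rcases le_total 0 (z t x) with v | v
          · rw [min_eq_right v, sub_zero, abs_of_nonneg (mul_nonneg b0 v)]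
            nlinarith
          · rw [min_eq_left v, abs_le]
            constructor <;> nlinarith
        have e3 : Φ1 (Z t x) * G t x - p t x * min (z t x) 0 =
          Φ1 (Z t x) * (G t x - p t x * z t x) + p t x * (Φ1 (Z t x) * z t x - min (z t x) 0) := by
          ring
        rw [e3]
        refine (abs_add_le _ _).trans ?_
        rw [abs_mul (p t x)]
        have := mul_le_mul f3 e2 (abs_nonneg _) hP0
        linarith
    · simp [hη.le]

theorem ApproxSol.approxBox {n a b c d Y : ℝ} {v pot : ℝ → ℝ → ℝ} (hc : 0 < c) (hd : d < Y)
    (h : ApproxSol n v pot a b Y) :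
    ApproxBox (fun t x => x ^ (n / 2) * v t x)
      (fun t x => pot t x - n / 2 * (n / 2 - 1) / x ^ 2) a b c d := by
  intro ε hε
  have hpos : ∀ x ∈ Icc c d, x ≠ 0 := fun x hx => (hc.trans_le hx.1).ne'
  have cφ : ContinuousOn (fun x : ℝ => x ^ (n / 2)) (Icc c d) := fun x hx =>
    (continuousAt_rpow_const x _ (Or.inl (hpos x hx))).continuousWithinAt
  have cψ : ContinuousOn (fun x : ℝ => n / 2 * (n / 2 - 1) / x ^ 2) (Icc c d) :=
    ContinuousOn.div (by fun_prop) (by fun_prop) fun x hx => pow_ne_zero 2 (hpos x hx)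
  obtain ⟨M₁, hM₁⟩ := isCompact_Icc.exists_bound_of_continuousOn cφ
  obtain ⟨M₂, hM₂⟩ := isCompact_Icc.exists_bound_of_continuousOn cψ
  set A := max M₁ 0 with hA
  set B := max M₂ 0 with hB
  have hA0 : 0 ≤ A := le_max_right _ _
  have hB0 : 0 ≤ B := le_max_right _ _
  obtain ⟨q, qr, qrr, qt, g, hq, cq, cqt, cg, hb⟩ := h (ε / (A * (1 + B) + 1)) (by positivity)
  have hsub : Icc a b ×ˢ Icc c d ⊆ Icc a b ×ˢ Ico 0 Y := fun p hp =>
    ⟨hp.1, hc.le.trans hp.2.1, hp.2.2.trans_lt hd⟩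
  have cφ2 : ContinuousOn (fun p : ℝ × ℝ => p.2 ^ (n / 2)) (Icc a b ×ˢ Icc c d) :=
    cφ.comp continuousOn_snd fun p hp => hp.2
  have cψ2 : ContinuousOn (fun p : ℝ × ℝ => n / 2 * (n / 2 - 1) / p.2 ^ 2) (Icc a b ×ˢ Icc c d) :=
    cψ.comp continuousOn_snd fun p hp => hp.2
  refine ⟨fun t x => x ^ (n / 2) * q t x, fun t x => x ^ (n / 2) * qt t x,
    fun t x => n / 2 * x ^ (n / 2 - 1) * q t x + x ^ (n / 2) * qr t x,
    fun t x => n / 2 * (n / 2 - 1) / x ^ 2 * x ^ (n / 2) * q t x +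
      n / x * x ^ (n / 2) * qr t x + x ^ (n / 2) * qrr t x,
    fun t x => x ^ (n / 2) * g t x - n / 2 * (n / 2 - 1) / x ^ 2 * x ^ (n / 2) * q t x,
    ⟨?_, ?_, ?_, ?_, ?_, ?_, ?_⟩, ?_⟩
  · intro t ht x hx
    exact (hq.dt t ht x ⟨hc.le.trans hx.1, hx.2.trans_lt hd⟩).const_mul _
  · intro t ht x hx
    exact (hasDerivAt_rpow_const (p := n / 2) (Or.inl (hpos x hx))).mul
      (hq.dr t ht x ⟨by linarith [hx.1, hx.2], hx.2.trans_lt hd⟩)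
  · intro t ht x hx
    have hx0 := hpos x hx
    have e1 := hq.dr t ht x ⟨by linarith [hx.1, hx.2], hx.2.trans_lt hd⟩
    have e2 := hq.drr t ht x ⟨by linarith [hx.1, hx.2], hx.2.trans_lt hd⟩
    have e3 := hasDerivAt_rpow_const (x := x) (p := n / 2) (Or.inl hx0)
    have e4 := (hasDerivAt_rpow_const (x := x) (p := n / 2 - 1) (Or.inl hx0)).const_mul (n / 2)
    refine ((e4.fun_mul e1).fun_add (e3.fun_mul e2)).congr_deriv ?_
    rw [rpow_sub_one hx0, rpow_sub_one hx0]
    field_simp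
    ring
  · intro t ht x hx
    rw [hq.eq_pos t ht x ⟨hc.trans_le hx.1, hx.2.trans_lt hd⟩]
    ring
  · exact cφ2.mul (cq.mono hsub)
  · exact cφ2.mul (cqt.mono hsub)
  · exact (cφ2.mul (cg.mono hsub)).sub ((cψ2.mul cφ2).mul (cq.mono hsub))
  · intro t ht x hx
    obtain ⟨b1, b2⟩ := hb t ht x ⟨hc.le.trans hx.1, hx.2.trans_lt hd⟩
    have a1 : |x ^ (n / 2)| ≤ A := (hM₁ x hx).trans (le_max_left _ _)
    have a2 : |n / 2 * (n / 2 - 1) / x ^ 2| ≤ B := (hM₂ x hx).trans (le_max_left _ _)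
    set ε' := ε / (A * (1 + B) + 1) with hε'
    have hε0 : 0 ≤ ε' := by positivity
    have key : ε' * (A * (1 + B) + 1) = ε := by rw [hε']; field_simp
    have f1 : |x ^ (n / 2) * q t x - x ^ (n / 2) * v t x| ≤ A * ε' := by
      rw [← mul_sub, abs_mul]
      exact mul_le_mul a1 b1 (abs_nonneg _) hA0
    have f2 : |x ^ (n / 2) * (g t x - pot t x * v t x)| ≤ A * ε' := by
      rw [abs_mul]
      exact mul_le_mul a1 b2 (abs_nonneg _) hA0
    have f3 : |n / 2 * (n / 2 - 1) / x ^ 2 * (x ^ (n / 2) * q t x - x ^ (n / 2) * v t x)| ≤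
        B * (A * ε') := by
      rw [abs_mul]
      exact mul_le_mul a2 f1 (abs_nonneg _) hB0
    have h0 : 0 ≤ B * (A * ε') := by positivity
    refine ⟨f1.trans (by linarith), ?_⟩
    rw [show x ^ (n / 2) * g t x - n / 2 * (n / 2 - 1) / x ^ 2 * x ^ (n / 2) * q t x -
      (pot t x - n / 2 * (n / 2 - 1) / x ^ 2) * (x ^ (n / 2) * v t x) =
      x ^ (n / 2) * (g t x - pot t x * v t x) -
      n / 2 * (n / 2 - 1) / x ^ 2 * (x ^ (n / 2) * q t x - x ^ (n / 2) * v t x) by ring]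
    refine (abs_sub _ _).trans ?_
    linarith

theorem ApproxBox.reflect {z p : ℝ → ℝ → ℝ} {a b c d : ℝ} (h : ApproxBox z p a b c d) :
    ApproxBox (fun t x => z t (-x)) (fun t x => p t (-x)) a b (-d) (-c) := by
  intro ε hε
  obtain ⟨Z, Zt, Zx, Zxx, G, hZ, hb⟩ := h ε hε
  have hm : ∀ {x}, x ∈ Icc (-d) (-c) → -x ∈ Icc c d := fun {x} hx =>
    ⟨by linarith [hx.2], by linarith [hx.1]⟩
  have hmap : MapsTo (fun q : ℝ × ℝ => (q.1, -q.2)) (Icc a b ×ˢ Icc (-d) (-c))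
    (Icc a b ×ˢ Icc c d) := fun q hq => ⟨hq.1, hm hq.2⟩
  have hcts : ContinuousOn (fun q : ℝ × ℝ => (q.1, -q.2)) (Icc a b ×ˢ Icc (-d) (-c)) := by fun_prop
  have hd : ∀ {f : ℝ → ℝ} {f' x : ℝ}, HasDerivAt f f' (-x) →
      HasDerivAt (fun y => f (-y)) (-f') x := fun {f f' x} hf => by
    have := hf.comp x (hasDerivAt_neg x)
    rw [mul_neg_one] at this
    exact this
  refine ⟨fun t x => Z t (-x), fun t x => Zt t (-x), fun t x => - Zx t (-x),
    fun t x => Zxx t (-x), fun t x => G t (-x), ⟨fun t ht x hx => hZ.dt t ht _ (hm hx),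
    fun t ht x hx => hd (hZ.dx t ht _ (hm hx)), fun t ht x hx => ?_,
    fun t ht x hx => hZ.eq t ht _ (hm hx), hZ.cZ.comp hcts hmap, hZ.ct.comp hcts hmap,
    hZ.cG.comp hcts hmap⟩, fun t ht x hx => hb t ht _ (hm hx)⟩
  exact (hd (hZ.dxx t ht _ (hm hx))).neg.congr_deriv (neg_neg _)

theorem IsTest.cutoff {β β1 β2 : ℝ → ℝ} {c d X Y : ℝ} (h : IsTest β β1 β2 c d) (hXY : X < Y) :
    ∃ η η1 η2, IsTest η η1 η2 c Y ∧ ∀ x < X, η x = β x ∧ η2 x = β2 x := by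
  set χ : ℝ → ℝ := fun y => Real.smoothTransition ((Y - y) / (Y - X)) with hχ
  have cχ : ContDiff ℝ 2 χ := Real.smoothTransition.contDiff.comp (by fun_prop)
  have c1 : ContDiff ℝ 1 (deriv χ) := (contDiff_succ_iff_deriv (n := 1)).1 cχ |>.2.2
  have c2 : ContDiff ℝ 0 (deriv (deriv χ)) := (contDiff_succ_iff_deriv (n := 0)).1 c1 |>.2.2
  have d1 : ∀ y, HasDerivAt χ (deriv χ y) y := fun y =>
    (cχ.differentiable (by simp) y).hasDerivAt
  have d2 : ∀ y, HasDerivAt (deriv χ) (deriv (deriv χ) y) y := fun y =>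
    (c1.differentiable (by simp) y).hasDerivAt
  have hpos : 0 < Y - X := sub_pos.2 hXY
  have hone : ∀ y ≤ X, χ y = 1 := fun y hy => Real.smoothTransition.one_of_one_le
    ((one_le_div hpos).2 (by linarith))
  have hzero : ∀ y, Y ≤ y → χ y = 0 := fun y hy => Real.smoothTransition.zero_of_nonpos
    (div_nonpos_of_nonpos_of_nonneg (by linarith) hpos.le)
  have hnn : ∀ y, 0 ≤ χ y := fun y => Real.smoothTransition.nonneg _
  refine ⟨fun y => β y * χ y, fun y => β1 y * χ y + β y * deriv χ y,
    fun y => (β2 y * χ y + β1 y * deriv χ y) + (β1 y * deriv χ y + β y * deriv (deriv χ) y),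
    ⟨fun y => (h.d1 y).mul (d1 y), fun y => ((h.d2 y).fun_mul (d1 y)).fun_add
      ((h.d1 y).fun_mul (d2 y)), ?_, fun y => mul_nonneg (h.nn y) (hnn y), fun y hy => ?_⟩,
    fun x hx => ?_⟩
  · have := h.c0
    have := h.c1
    have := h.c2
    have := cχ.continuous
    have := c1.continuous
    have := c2.continuous
    fun_prop
  · by_cases hy' : Y ≤ y
    · have : deriv χ y = 0 := IsLocalMin.deriv_eq_zero
        (Eventually.of_forall fun x => by rw [hzero y hy']; exact hnn x)
      simp [hzero y hy', this]
    · have := h.zero y (fun h' => hy ⟨h'.1, not_le.1 hy'⟩)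
      simp [this.1, this.2]
  · have ev : χ =ᶠ[𝓝 x] fun _ => 1 := by
      filter_upwards [Iio_mem_nhds hx] with y hy using hone y (le_of_lt hy)
    have e1 : deriv χ =ᶠ[𝓝 x] fun _ => 0 := by
      have := ev.deriv
      simpa using this
    have e2 : deriv (deriv χ) x = 0 := by
      have := e1.deriv_eq
      simpa using this
    simp [hone x hx.le, e1.eq_of_nhds, e2]

theorem cut_subsolution_extend {z p : ℝ → ℝ → ℝ} {γ₁ γ₂ : ℝ → ℝ} {a b c d P X Y : ℝ} (hab : a ≤ b)
    (hcY : c ≤ Y) (hYd : Y ≤ d) (hXY : X < Y) (h : ApproxBox z p a b c Y)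
    (cz : ContinuousOn (fun q : ℝ × ℝ => z q.1 q.2) (Icc a b ×ˢ Icc c d))
    (pc : ContinuousOn (fun q : ℝ × ℝ => p q.1 q.2) (Icc a b ×ˢ Icc c d))
    (hP : ∀ t ∈ Icc a b, ∀ x ∈ Icc c d, |p t x| ≤ P) (hγ₁ : Continuous γ₁) (hγ₂ : Continuous γ₂)
    (hlt : ∀ t ∈ Icc a b, γ₁ t < γ₂ t) (hX : ∀ t ∈ Icc a b, γ₂ t ≤ X)
    (h1 : ∀ t ∈ Icc a b, γ₁ t ∈ Icc c d → z t (γ₁ t) < 0)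
    (h2 : ∀ t ∈ Icc a b, γ₂ t ∈ Icc c d → 0 < z t (γ₂ t)) :
    ContinuousOn (fun q : ℝ × ℝ => cutBelow z γ₁ γ₂ q.1 q.2) (Icc a b ×ˢ Icc c d) ∧
    ∀ α α1 α2 β β1 β2 : ℝ → ℝ, IsTest α α1 α2 a b → IsTest β β1 β2 c d →
      ∫ q in Icc a b ×ˢ Icc c d, cutBelow z γ₁ γ₂ q.1 q.2 * (α1 q.1 * β q.2 + α q.1 * β2 q.2 +
        p q.1 q.2 * (α q.1 * β q.2)) ≤ 0 := by
  have hsub : Icc c Y ⊆ Icc c d := Icc_subset_Icc_right hYd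
  have hsub' : Icc a b ×ˢ Icc c Y ⊆ Icc a b ×ˢ Icc c d := prod_mono le_rfl hsub
  obtain ⟨c1, i1⟩ := cut_subsolution hab hcY h (cz.mono hsub') (pc.mono hsub')
    (fun t ht x hx => hP t ht x (hsub hx)) hγ₁ hγ₂ hlt (fun t ht hx => h1 t ht (hsub hx))
    (fun t ht hx => h2 t ht (hsub hx))
  have hz : ∀ t ∈ Icc a b, ∀ x, X ≤ x → cutBelow z γ₁ γ₂ t x = 0 := by
    intro t ht x hx
    have := hlt t ht
    have := hX t ht
    unfold cutBelow
    rw [if_neg (by linarith), if_neg (by linarith)]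
  refine ⟨?_, fun α α1 α2 β β1 β2 hα hβ => ?_⟩
  · have hcover : Icc a b ×ˢ Icc c d ⊆ Icc a b ×ˢ Icc c Y ∪ Icc a b ×ˢ Icc X d := by
      rintro q ⟨q1, q2⟩
      rcases le_total q.2 Y with h' | h'
      · exact Or.inl ⟨q1, q2.1, h'⟩
      · exact Or.inr ⟨q1, by linarith, q2.2⟩
    refine ContinuousOn.mono (ContinuousOn.union_of_isClosed c1 ?_
      (isClosed_Icc.prod isClosed_Icc) (isClosed_Icc.prod isClosed_Icc)) hcover
    exact continuousOn_const.congr fun q hq => hz q.1 hq.1 q.2 hq.2.1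
  · obtain ⟨η, η1, η2, hη, he⟩ := hβ.cutoff hXY
    refine (le_of_eq ?_).trans (i1 α α1 α2 η η1 η2 hα hη)
    rw [← setIntegral_eq_of_subset_of_forall_diff_eq_zero (measurableSet_Icc.prod measurableSet_Icc)
      hsub']
    · refine setIntegral_congr_fun (measurableSet_Icc.prod measurableSet_Icc) fun q hq => ?_
      beta_reduce
      rcases lt_or_ge q.2 X with h' | h'
      · rw [(he q.2 h').1, (he q.2 h').2]
      · rw [hz q.1 hq.1 q.2 h', zero_mul, zero_mul]
    · rintro q ⟨⟨q1, q2⟩, q3⟩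
      have : X ≤ q.2 := by
        by_contra hcon
        exact q3 ⟨q1, q2.1, by linarith⟩
      rw [hz q.1 q1 q.2 this, zero_mul]

theorem cut_weakSol {u p : ℝ → ℝ → ℝ} {γ₀ γ₁ γ₂ : ℝ → ℝ} {a b c d P ε X Y : ℝ}
    (hab : a ≤ b) (hcY : c ≤ Y) (hYd : Y ≤ d) (hXY : X < Y) (h : ApproxBox u p a b c Y) (hε : 0 ≤ ε)
    (cu : ContinuousOn (fun q : ℝ × ℝ => u q.1 q.2) (Icc a b ×ˢ Icc c d))
    (pc : ContinuousOn (fun q : ℝ × ℝ => p q.1 q.2) (Icc a b ×ˢ Icc c d))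
    (hP : ∀ t ∈ Icc a b, ∀ x ∈ Icc c d, |p t x| ≤ P)
    (hγ₀ : Continuous γ₀) (hγ₁ : Continuous γ₁) (hγ₂ : Continuous γ₂)
    (h01 : ∀ t ∈ Icc a b, γ₀ t < γ₁ t) (h12 : ∀ t ∈ Icc a b, γ₁ t < γ₂ t)
    (hX : ∀ t ∈ Icc a b, γ₂ t ≤ X)
    (h0 : ∀ t ∈ Icc a b, γ₀ t ∈ Icc c d → u t (γ₀ t) < 0)
    (h1 : ∀ t ∈ Icc a b, γ₁ t ∈ Icc c d → 0 < u t (γ₁ t))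
    (h2 : ∀ t ∈ Icc a b, γ₂ t ∈ Icc c d → u t (γ₂ t) < 0)
    (hsmall : ∀ t ∈ Icc a b, ∀ x ∈ Icc c d, γ₀ t < x → x < γ₂ t → u t x ≤ ε) :
    ContinuousOn (fun q : ℝ × ℝ => cutBelow u γ₀ γ₁ q.1 q.2) (Icc a b ×ˢ Icc c d) ∧
    WeakSol (cutBelow u γ₀ γ₁) p a b c d ((b - a) * (d - c) * ((2 + P) * ε)) := by
  have hcd := hcY.trans hYd
  obtain ⟨c1, i1⟩ := cut_subsolution_extend hab hcY hYd hXY h cu pc hP hγ₀ hγ₁ h01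
    (fun t ht => (h12 t ht).le.trans (hX t ht)) h0 h1
  obtain ⟨c2, i2⟩ := cut_subsolution_extend hab hcY hYd hXY h.neg cu.neg pc hP hγ₁ hγ₂ h12 hX
    (fun t ht hx => neg_neg_iff_pos.2 (h1 t ht hx)) (fun t ht hx => neg_pos.2 (h2 t ht hx))
  refine ⟨c1, fun α α1 α2 β β1 β2 hα hβ Q hQ hb => ?_⟩
  have e1 := i1 α α1 α2 β β1 β2 hα hβ
  have e2 := i2 α α1 α2 β β1 β2 hα hβ
  have hdiff : ∀ t ∈ Icc a b, ∀ x ∈ Icc c d,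
      |cutBelow u γ₀ γ₁ t x + cutBelow (fun t x => - u t x) γ₁ γ₂ t x| ≤ ε := by
    intro t ht x hx
    have l1 := h01 t ht
    have l2 := h12 t ht
    have hs := hsmall t ht x hx
    unfold cutBelow
    rcases le_or_gt x (γ₀ t) with g | g
    · rw [if_pos g, if_pos (by linarith)]
      simpa using hε
    rw [if_neg (not_le.2 g)]
    rcases lt_trichotomy x (γ₁ t) with g1 | g1 | g1
    · rw [if_pos g1, if_pos g1.le]
      have := hs g (by linarith)
      rcases le_total (u t x) 0 with v | v
      · rw [min_eq_left v]
        simpa using hε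
      · rw [min_eq_right v, zero_add, abs_neg, abs_of_nonneg v]
        exact this
    · rw [if_neg (by linarith), if_pos g1.le, zero_add, abs_neg]
      have h3 := h1 t ht (by rw [← g1]; exact hx)
      rw [← g1] at h3
      rw [abs_of_pos h3]
      exact hs g (by linarith)
    · rw [if_neg (by linarith), if_neg (by linarith), zero_add]
      split_ifs with g2
      · have := hs g g2
        rw [abs_le]
        exact ⟨le_min (by linarith) (by linarith), (min_le_right _ _).trans hε⟩
      · simpa using hε
  have cα0 := hα.c0
  have cα1 := hα.c1
  have cβ0 := hβ.c0
  have cβ2 := hβ.c2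
  have hcomp : IsCompact (Icc a b ×ˢ Icc c d) := isCompact_Icc.prod isCompact_Icc
  have e3 : -((b - a) * (d - c) * ((2 + P) * ε * Q ^ 2)) ≤
      (∫ q in Icc a b ×ˢ Icc c d, cutBelow u γ₀ γ₁ q.1 q.2 * (α1 q.1 * β q.2 + α q.1 * β2 q.2 +
        p q.1 q.2 * (α q.1 * β q.2))) + ∫ q in Icc a b ×ˢ Icc c d,
        cutBelow (fun t x => - u t x) γ₁ γ₂ q.1 q.2 * (α1 q.1 * β q.2 + α q.1 * β2 q.2 +
        p q.1 q.2 * (α q.1 * β q.2)) := by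
    rw [← integral_add (ContinuousOn.integrableOn_compact hcomp (by fun_prop))
      (ContinuousOn.integrableOn_compact hcomp (by fun_prop)), ← mul_neg,
      ← setIntegral_box_const _ _ _ _ _ hab hcd]
    refine setIntegral_mono_on (ContinuousOn.integrableOn_compact hcomp (by fun_prop))
      (ContinuousOn.integrableOn_compact hcomp (by fun_prop))
      (measurableSet_Icc.prod measurableSet_Icc) fun q hq => ?_
    have f1 := hdiff q.1 hq.1 q.2 hq.2
    obtain ⟨-, b2, -, -⟩ := hb q.1
    obtain ⟨b1, -, -, -⟩ := hb q.1
    obtain ⟨-, -, b3, b4⟩ := hb q.2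
    have f2 : |α1 q.1 * β q.2 + α q.1 * β2 q.2 + p q.1 q.2 * (α q.1 * β q.2)| ≤ (2 + P) * Q ^ 2 := by
      have g1 : |α1 q.1 * β q.2| ≤ Q ^ 2 := by
        rw [abs_mul, sq]
        exact mul_le_mul b2 b3 (abs_nonneg _) hQ
      have g2 : |α q.1 * β2 q.2| ≤ Q ^ 2 := by
        rw [abs_mul, sq]
        exact mul_le_mul b1 b4 (abs_nonneg _) hQ
      have g3 : |p q.1 q.2 * (α q.1 * β q.2)| ≤ P * Q ^ 2 := by
        rw [abs_mul, abs_mul, sq]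
        exact mul_le_mul (hP q.1 hq.1 q.2 hq.2) (mul_le_mul b1 b3 (abs_nonneg _) hQ) (by positivity)
          ((abs_nonneg _).trans (hP q.1 hq.1 q.2 hq.2))
      refine (abs_add_three _ _ _).trans ?_
      linarith
    rw [← add_mul]
    have f3 : |(cutBelow u γ₀ γ₁ q.1 q.2 + cutBelow (fun t x => - u t x) γ₁ γ₂ q.1 q.2) *
        (α1 q.1 * β q.2 + α q.1 * β2 q.2 + p q.1 q.2 * (α q.1 * β q.2))| ≤
        ε * ((2 + P) * Q ^ 2) := by
      rw [abs_mul]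
      exact mul_le_mul f1 f2 (abs_nonneg _) hε
    have := (abs_le.1 f3).1
    linarith
  rw [abs_le]
  have : 0 ≤ (b - a) * (d - c) * ((2 + P) * ε) * Q ^ 2 := by
    have : 0 ≤ P := (abs_nonneg _).trans (hP a ⟨le_rfl, hab⟩ c ⟨le_rfl, hcd⟩)
    have := sub_nonneg.2 hab
    have := sub_nonneg.2 hcd
    positivity
  constructor <;> linarith

theorem curves_pigeonhole {u : ℝ → ℝ → ℝ} {a b c d ε : ℝ} (hε : 0 < ε)
    (cu : ContinuousOn (fun q : ℝ × ℝ => u q.1 q.2) (Icc a b ×ˢ Icc c d)) :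
    ∃ N : ℕ, ∀ τ : ℝ, |τ| = 1 → ∀ γ : ℕ → ℝ → ℝ, (∀ i ≤ N + 1, Continuous (γ i)) →
      (∀ i ≤ N, ∀ s ∈ Icc a b, γ i s < γ (i + 1) s) →
      (∀ i ≤ N + 1, ∀ s ∈ Icc a b, γ i s ∈ Icc c d → τ * u s (γ i s) ≤ 0) →
      ∃ j ≤ N, ∀ t ∈ Icc a b, ∀ x ∈ Icc c d, γ j t < x → x < γ (j + 1) t → τ * u t x ≤ ε := by
  have hS : IsCompact (Icc a b ×ˢ Icc c d) := isCompact_Icc.prod isCompact_Icc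
  obtain ⟨δ, hδ, hu⟩ := Metric.uniformContinuousOn_iff.1 (hS.uniformContinuousOn_of_continuous cu)
    ε hε
  obtain ⟨A, hAS, hAf, hcov⟩ := hS.finite_cover_balls (half_pos hδ)
  refine ⟨hAf.toFinset.card, fun τ hτ γ hγ hord hsg => ?_⟩
  set N := hAf.toFinset.card
  by_contra! hcon
  have hpick : ∀ j ∈ Finset.range (N + 1), ∃ q : (ℝ × ℝ) × ℝ × ℝ, (q.1 ∈ Icc a b ×ˢ Icc c d ∧
      γ j q.1.1 < q.1.2 ∧ q.1.2 < γ (j + 1) q.1.1 ∧ ε < τ * u q.1.1 q.1.2) ∧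
      q.2 ∈ hAf.toFinset ∧ dist q.1 q.2 < δ / 2 := by
    intro j hj
    obtain ⟨t, ht, x, hx, h⟩ := hcon j (Nat.lt_succ_iff.1 (Finset.mem_range.1 hj))
    obtain ⟨q, hq, hd⟩ := mem_iUnion₂.1 (hcov (show (t, x) ∈ _ from ⟨ht, hx⟩))
    exact ⟨((t, x), q), ⟨⟨ht, hx⟩, h⟩, hAf.mem_toFinset.2 hq, hd⟩
  choose! q hq using hpick
  obtain ⟨i, hi, j, hj, hij, he⟩ := Finset.exists_ne_map_eq_of_card_lt_of_maps_to
    (s := Finset.range (N + 1)) (t := hAf.toFinset) (by simp [N]) (f := fun j => (q j).2)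
    fun j hj => (hq j hj).2.1
  wlog hlt : i < j generalizing i j
  · exact this j hj i hi hij.symm he.symm (lt_of_le_of_ne (not_lt.1 hlt) hij.symm)
  obtain ⟨⟨i1, i2, i3, i4⟩, -, i5⟩ := hq i hi
  obtain ⟨⟨j1, j2, j3, j4⟩, -, j5⟩ := hq j hj
  rw [he] at i5
  have hd : dist (q i).1 (q j).1 < δ := by
    refine (dist_triangle_right _ _ (q j).2).trans_lt ?_
    linarith
  set y := (q i).1
  set z := (q j).1
  have hiN : i ≤ N := Nat.lt_succ_iff.1 (Finset.mem_range.1 hi)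
  have hjN : j ≤ N := Nat.lt_succ_iff.1 (Finset.mem_range.1 hj)
  have hord' : ∀ k, i + 1 + k ≤ N + 1 → γ (i + 1) z.1 ≤ γ (i + 1 + k) z.1 := by
    intro k
    induction k with
    | zero => intro; rfl
    | succ k ih =>
      intro hk
      exact (ih (by omega)).trans (hord (i + 1 + k) (by omega) z.1 j1.1).le
  have h1 := hord' (j - (i + 1)) (by omega)
  rw [show i + 1 + (j - (i + 1)) = j by omega] at h1
  set F : ℝ → ℝ × ℝ := fun s => y + s • (z - y) with hF
  have cF : Continuous F := by fun_prop
  have cg : Continuous fun s => γ (i + 1) (F s).1 - (F s).2 :=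
    ((hγ (i + 1) (by omega)).comp cF.fst).sub cF.snd
  have F0 : F 0 = y := by simp [hF]
  have F1 : F 1 = z := by simp [hF]
  obtain ⟨s, hs, hs0⟩ := isPreconnected_Icc.intermediate_value (s := Icc (0 : ℝ) 1)
    (a := 1) (b := 0) (by simp) (by simp) cg.continuousOn
    (show (0 : ℝ) ∈ Icc _ _ from ⟨by rw [F1]; linarith, by rw [F0]; linarith⟩)
  have hmem : F s ∈ Icc a b ×ˢ Icc c d :=
    ((convex_Icc a b).prod (convex_Icc c d)).add_smul_sub_mem i1 j1 hs
  have hdist : dist (F s) y < δ := by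
    rw [dist_eq_norm, hF]
    simp only [add_sub_cancel_left, norm_smul, Real.norm_eq_abs, abs_of_nonneg hs.1]
    rw [dist_comm, dist_eq_norm] at hd
    nlinarith [hs.2, norm_nonneg (z - y)]
  have h2 := hu _ hmem _ i1 hdist
  rw [Real.dist_eq, ← one_mul |_|, ← hτ, ← abs_mul, mul_sub] at h2
  have h3 : γ (i + 1) (F s).1 = (F s).2 := sub_eq_zero.1 hs0
  have h4 := hsg (i + 1) (by omega) _ hmem.1 (by rw [h3]; exact hmem.2)
  rw [h3] at h4
  have := (abs_lt.1 h2).1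
  linarith

theorem HasChain.neg {v : ℝ → ℝ → ℝ} {t : ℝ} {K : ℕ} (h : HasChain v t K) :
    HasChain (fun t r => - v t r) t K := by
  obtain ⟨σ, x, h1, h2, h3⟩ := h
  exact ⟨-σ, x, h1, h2, fun i hi => by have := h3 i hi; linarith⟩

theorem Good.exists_axis_bound {n a b P : ℝ} {v pot : ℝ → ℝ → ℝ} (h : Good n v pot a b P)
    (hab : a ≤ b) (h0 : ∀ t ∈ Icc a b, v t 0 ≠ 0) :
    ∃ τ : ℝ, |τ| = 1 ∧ ∃ m > 0, ∃ r > 0, ∀ t ∈ Icc a b, ∀ x ∈ Icc 0 r, m ≤ τ * v t x := by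
  have hc0 : ContinuousOn (fun t => v t 0) (Icc a b) :=
    h.cont.comp (f := fun t : ℝ => (t, (0 : ℝ))) (by fun_prop) fun t ht => ⟨ht, self_mem_Ici⟩
  obtain ⟨τ, hτ, hpos⟩ : ∃ τ : ℝ, |τ| = 1 ∧ ∀ t ∈ Icc a b, 0 < τ * v t 0 := by
    by_cases hs : 0 < v a 0
    · refine ⟨1, by simp, fun t ht => ?_⟩
      by_contra hcon
      obtain ⟨s, hs1, hs2⟩ := isPreconnected_Icc.intermediate_value ht (left_mem_Icc.2 hab) hc0
        (show (0 : ℝ) ∈ Icc _ _ from ⟨by linarith, hs.le⟩)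
      exact h0 s hs1 hs2
    · refine ⟨-1, by simp, fun t ht => ?_⟩
      by_contra hcon
      obtain ⟨s, hs1, hs2⟩ := isPreconnected_Icc.intermediate_value (left_mem_Icc.2 hab) ht hc0
        (show (0 : ℝ) ∈ Icc _ _ from ⟨not_lt.1 hs, by linarith⟩)
      exact h0 s hs1 hs2
  obtain ⟨t₀, ht₀, hmin⟩ := isCompact_Icc.exists_isMinOn (nonempty_Icc.2 hab)
    (continuousOn_const.mul hc0 : ContinuousOn (fun t => τ * v t 0) (Icc a b))
  have hm := hpos t₀ ht₀
  set m := τ * v t₀ 0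
  have cS : ContinuousOn (fun p : ℝ × ℝ => v p.1 p.2) (Icc a b ×ˢ Icc 0 1) :=
    h.cont.mono (prod_mono le_rfl fun x hx => hx.1)
  obtain ⟨δ, hδ, hu⟩ := Metric.uniformContinuousOn_iff.1
    ((isCompact_Icc.prod isCompact_Icc).uniformContinuousOn_of_continuous cS) (m / 2) (half_pos hm)
  refine ⟨τ, hτ, m / 2, half_pos hm, min 1 (δ / 2), by positivity, fun t ht x hx => ?_⟩
  have hx1 := hx.2.trans (min_le_left _ _)
  have hx2 := hx.2.trans (min_le_right _ _)
  have h1 := hu (t, x) ⟨ht, hx.1, hx1⟩ (t, 0) ⟨ht, by simp⟩ (by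
    rw [Prod.dist_eq, dist_self, Real.dist_eq, sub_zero, abs_of_nonneg hx.1]
    exact max_lt hδ (by linarith))
  rw [Real.dist_eq, ← one_mul |_|, ← hτ, ← abs_mul, mul_sub] at h1
  have := (abs_lt.1 h1).1
  have h2 : m ≤ τ * v t 0 := hmin ht
  beta_reduce at this
  linarith

theorem mul_cutBelow_le {u : ℝ → ℝ → ℝ} {γ₁ γ₂ : ℝ → ℝ} (t x : ℝ) :
    |cutBelow u γ₁ γ₂ t x| ≤ |u t x| := by
  unfold cutBelow
  split_ifs
  · rfl
  · rcases le_total (u t x) 0 with h | h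
    · rw [min_eq_left h]
    · rw [min_eq_right h, abs_zero]
      exact abs_nonneg _
  · rw [abs_zero]
    exact abs_nonneg _

/-- A solution that does not vanish on the axis has boundedly many sign changes. -/
theorem Good.exists_not_hasChain {n a b P R : ℝ} {v pot : ℝ → ℝ → ℝ} (hn : 0 ≤ n) (hab : a < b)
    (h : Good n v pot a b P) (hR : ∀ t ∈ Icc a b, ∀ r, R ≤ r → v t r = 0)
    (hA : ApproxSol n v pot a b R) (h0 : ∀ t ∈ Icc a b, v t 0 ≠ 0) : ∃ K, ¬ HasChain v b K := by
  obtain ⟨τ, hτ, hax⟩ := h.exists_axis_bound hab.le h0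
  wlog hτ1 : τ = 1 generalizing v τ
  · have hτ2 : τ = -1 := by
      rcases eq_or_eq_neg_of_abs_eq hτ with h | h
      · exact absurd h hτ1
      · exact h
    obtain ⟨K, hK⟩ := this h.neg (fun t ht r hr => by rw [hR t ht r hr, neg_zero]) hA.neg
      (fun t ht => neg_ne_zero.2 (h0 t ht)) 1 (by simp) (by
        obtain ⟨m, hm, r, hr, hb⟩ := hax
        refine ⟨m, hm, r, hr, fun t ht x hx => ?_⟩
        have := hb t ht x hx
        rw [hτ2] at this
        linarith) rfl
    exact ⟨K, fun hc => hK hc.neg⟩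
  subst hτ1
  obtain ⟨m, hm, r, hr, hb⟩ := hax
  simp only [one_mul] at hb
  have hrR : r < R := by
    by_contra hcon
    have h1 := hb a ⟨le_rfl, hab.le⟩ r ⟨hr.le, le_rfl⟩
    rw [hR a ⟨le_rfl, hab.le⟩ r (not_lt.1 hcon)] at h1
    linarith
  set c := r / 2 with hc
  have hc0 : 0 < c := half_pos hr
  set z : ℝ → ℝ → ℝ := fun t x => x ^ (n / 2) * v t x with hz
  set p : ℝ → ℝ → ℝ := fun t x => pot t x - n / 2 * (n / 2 - 1) / x ^ 2 with hp
  have hpos : ∀ x, c ≤ x → 0 < x := fun x hx => hc0.trans_le hx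
  have hsub : Icc a b ×ˢ Icc c (R + 1) ⊆ Icc a b ×ˢ Ici (0 : ℝ) :=
    prod_mono le_rfl fun x hx => (hpos x hx.1).le
  have hcomp : IsCompact (Icc a b ×ˢ Icc c (R + 1)) := isCompact_Icc.prod isCompact_Icc
  have cz : ContinuousOn (fun q : ℝ × ℝ => z q.1 q.2) (Icc a b ×ˢ Icc c (R + 1)) :=
    (continuousOn_snd.rpow_const fun q hq => Or.inl (hpos _ hq.2.1).ne').mul (h.cont.mono hsub)
  have cp : ContinuousOn (fun q : ℝ × ℝ => p q.1 q.2) (Icc a b ×ˢ Icc c (R + 1)) :=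
    (h.pcont.mono hsub).sub (continuousOn_const.div (by fun_prop)
      fun q hq => pow_ne_zero _ (hpos _ hq.2.1).ne')
  obtain ⟨M, hM⟩ := hcomp.exists_bound_of_continuousOn cz
  obtain ⟨P', hP'⟩ := hcomp.exists_bound_of_continuousOn cp
  simp only [Real.norm_eq_abs, Prod.forall] at hM hP'
  have hM0 : 0 ≤ M := (abs_nonneg _).trans (hM a c ⟨⟨le_rfl, hab.le⟩, le_rfl, by linarith⟩)
  have hP0 : 0 ≤ P' := (abs_nonneg _).trans (hP' a c ⟨⟨le_rfl, hab.le⟩, le_rfl, by linarith⟩)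
  set m' := c ^ (n / 2) * m with hm'
  have hm0 : 0 < m' := by positivity
  have hzm : ∀ t ∈ Icc a b, ∀ x ∈ Icc c r, m' ≤ z t x := fun t ht x hx =>
    mul_le_mul (Real.rpow_le_rpow hc0.le hx.1 (by positivity))
      (hb t ht x ⟨(hpos x hx.1).le, hx.2⟩) hm.le (Real.rpow_nonneg (hpos x hx.1).le _)
  obtain ⟨ε₀, hε₀, huc⟩ := box_unique_continuation (a := a) (b := b) (c := c) (d := R + 1)
    (X := R) (t₁ := (a + b) / 2) (ξ := 3 * r / 4) (ρ := r / 4) (m := m') (M := M)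
    ⟨by linarith, by linarith⟩ ⟨by linarith, by linarith⟩ (by linarith) (by linarith) hm0 hM0 cp
    (fun s hs y hy => hP' s y ⟨hs, hy⟩)
  have hD : 0 < (b - a) * (R + 1 - c) * (2 + P') :=
    mul_pos (mul_pos (by linarith) (by linarith)) (by linarith)
  obtain ⟨ε, hε, hεm, hεe⟩ : ∃ ε > 0, ε < m' ∧ (b - a) * (R + 1 - c) * ((2 + P') * ε) ≤ ε₀ := by
    refine ⟨min (m' / 2) (ε₀ / ((b - a) * (R + 1 - c) * (2 + P'))), by positivity,
      (min_le_left _ _).trans_lt (by linarith), ?_⟩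
    rw [← mul_assoc]
    refine (mul_le_mul_of_nonneg_left (min_le_right _ _) hD.le).trans (le_of_eq ?_)
    rw [mul_comm, div_mul_cancel₀ _ hD.ne']
  obtain ⟨N, hN⟩ := curves_pigeonhole hε cz
  refine ⟨2 * N + 3, fun hK => ?_⟩
  obtain ⟨σ, γ, hγ, hγs, hγo⟩ := h.chain_curves hn hab.le hK
  have hσ : σ ≠ 0 := by
    rintro rfl
    have := (hγs 0 (by omega) a ⟨le_rfl, hab.le⟩).2
    simp at this
  obtain ⟨τ, hτ, hτσ⟩ : ∃ τ : ℝ, |τ| = 1 ∧ ∀ y, 0 < σ * y → τ * y < 0 := by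
    rcases lt_or_gt_of_ne hσ with h' | h'
    · refine ⟨1, by simp, fun y hy => ?_⟩
      by_contra hcon
      nlinarith [mul_nonneg (neg_nonneg.2 h'.le) (not_lt.1 hcon)]
    · refine ⟨-1, by simp, fun y hy => ?_⟩
      linarith [(mul_pos_iff_of_pos_left h').1 hy]
  have heven : ∀ j, 2 * j < 2 * N + 3 → ∀ s ∈ Icc a b, τ * v s (γ (2 * j) s) < 0 := by
    intro j hj s hs
    have := (hγs _ hj s hs).2
    rw [pow_mul] at this
    exact hτσ _ (by simpa using this)
  have hodd : ∀ j, 2 * j + 1 < 2 * N + 3 → ∀ s ∈ Icc a b, 0 < τ * v s (γ (2 * j + 1) s) := by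
    intro j hj s hs
    have := (hγs _ hj s hs).2
    rw [pow_succ, pow_mul] at this
    have := hτσ (- v s (γ (2 * j + 1) s)) (by simpa using this)
    linarith
  have hzv : ∀ t x, c ≤ x → ∃ k > 0, z t x = k * v t x := fun t x hx =>
    ⟨_, Real.rpow_pos_of_pos (hpos x hx) _, rfl⟩
  have hneg : ∀ t x, c ≤ x → τ * v t x < 0 → τ * z t x < 0 := by
    intro t x hx h1
    obtain ⟨k, hk, he⟩ := hzv t x hx
    rw [he, mul_left_comm]
    exact mul_neg_of_pos_of_neg hk h1
  have hposz : ∀ t x, c ≤ x → 0 < τ * v t x → 0 < τ * z t x := by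
    intro t x hx h1
    obtain ⟨k, hk, he⟩ := hzv t x hx
    rw [he, mul_left_comm]
    exact mul_pos hk h1
  obtain ⟨j, hj, hsmall⟩ := hN τ hτ (fun j => γ (2 * j)) (fun i hi => hγ _ (by omega))
    (fun i hi s hs => (hγo (2 * i) (by omega) s hs).trans (hγo (2 * i + 1) (by omega) s hs))
    (fun i hi s hs hx => (hneg _ _ hx.1 (heven i (by omega) s hs)).le)
  obtain ⟨tm, htm, hmax⟩ := isCompact_Icc.exists_isMaxOn (nonempty_Icc.2 hab.le)
    (hγ (2 * (j + 1)) (by omega)).continuousOn (s := Icc a b)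
  have hlast : γ (2 * (j + 1)) tm < R := by
    by_contra hcon
    have := heven (j + 1) (by omega) tm htm
    rw [hR tm htm _ (not_lt.1 hcon)] at this
    simp at this
  set X := max c (γ (2 * (j + 1)) tm) with hX
  have hXR : X < R := max_lt (by linarith) hlast
  have hbox : ApproxBox (fun t x => τ * z t x) p a b c ((X + R) / 2) := by
    have h1 := hA.approxBox hc0 (d := (X + R) / 2) (by linarith)
    rcases eq_or_eq_neg_of_abs_eq hτ with h' | h'
    · simpa [h'] using h1
    · simpa [h'] using h1.neg
  have hcX : c ≤ X := le_max_left _ _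
  obtain ⟨ch, wh⟩ := cut_weakSol hab.le (by linarith : c ≤ (X + R) / 2) (by linarith : (X + R) / 2 ≤ R + 1)
    (by linarith : X < (X + R) / 2) hbox hε.le (continuousOn_const.mul cz) cp
    (fun t ht x hx => hP' t x ⟨ht, hx⟩) (hγ (2 * j) (by omega)) (hγ (2 * j + 1) (by omega))
    (hγ (2 * (j + 1)) (by omega)) (hγo _ (by omega)) (hγo (2 * j + 1) (by omega))
    (fun t ht => (hmax ht).trans (le_max_right _ _))
    (fun t ht hx => hneg _ _ hx.1 (heven j (by omega) t ht))
    (fun t ht hx => hposz _ _ hx.1 (hodd j (by omega) t ht))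
    (fun t ht hx => hneg _ _ hx.1 (heven (j + 1) (by omega) t ht)) hsmall
  have wh' : WeakSol (cutBelow (fun t x => τ * z t x) (γ (2 * j)) (γ (2 * j + 1))) p a b c (R + 1)
      ε₀ := fun α α1 α2 β β1 β2 hα hβ Q hQ hb => (wh α α1 α2 β β1 β2 hα hβ Q hQ hb).trans
    (mul_le_mul_of_nonneg_right hεe (sq_nonneg Q))
  have hbd : ∀ s ∈ Icc a b, ∀ y ∈ Icc c (R + 1),
      |cutBelow (fun t x => τ * z t x) (γ (2 * j)) (γ (2 * j + 1)) s y| ≤ M := fun s hs y hy => by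
    refine (mul_cutBelow_le s y).trans ?_
    rw [abs_mul, hτ, one_mul]
    exact hM s y ⟨hs, hy⟩
  have hzero : ∀ s ∈ Icc a b, ∀ y ∈ Icc R (R + 1),
      cutBelow (fun t x => τ * z t x) (γ (2 * j)) (γ (2 * j + 1)) s y = 0 := by
    intro s hs y hy
    have h1 : γ (2 * (j + 1)) s ≤ γ (2 * (j + 1)) tm := hmax hs
    have h2 := hγo _ (by omega : 2 * j + 1 < _) s hs
    have h3 := hγo _ (by omega : 2 * j + 1 + 1 < _) s hs
    rw [show 2 * j + 1 + 1 = 2 * (j + 1) by ring] at h3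
    unfold cutBelow
    rw [if_neg (by linarith [hy.1]), if_neg (by linarith [hy.1])]
  have hpt : ∀ s ∈ Icc a b, ∀ i < 2 * N + 3, τ * v s (γ i s) < 0 → τ = 1 → r < γ i s := by
    intro s hs i hi h1 h2
    by_contra hcon
    have := hb s hs _ ⟨(hγs i hi s hs).1, not_lt.1 hcon⟩
    rw [h2] at h1
    linarith
  have hpt' : ∀ s ∈ Icc a b, ∀ i < 2 * N + 3, 0 < τ * v s (γ i s) → τ = -1 → r < γ i s := by
    intro s hs i hi h1 h2
    by_contra hcon
    have := hb s hs _ ⟨(hγs i hi s hs).1, not_lt.1 hcon⟩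
    rw [h2] at h1
    linarith
  rcases eq_or_eq_neg_of_abs_eq hτ with h' | h'
  · refine huc _ ch hbd hzero wh' fun s hs y hy _ hyr => ?_
    have hyr' : y ≤ r := by linarith [(abs_le.1 hyr).2]
    have h1 := hzm s hs y ⟨hy.1, hyr'⟩
    have h2 := hpt s hs _ (by omega) (heven j (by omega) s hs) h'
    unfold cutBelow
    rw [if_pos (by linarith), h']
    linarith
  · refine huc _ ch.neg (fun s hs y hy => by rw [abs_neg]; exact hbd s hs y hy)
      (fun s hs y hy => by rw [hzero s hs y hy, neg_zero]) wh'.neg fun s hs y hy _ hyr => ?_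
    have hyr' : y ≤ r := by linarith [(abs_le.1 hyr).2]
    have h1 := hzm s hs y ⟨hy.1, hyr'⟩
    have h2 := hpt' s hs _ (by omega) (hodd j (by omega) s hs) h'
    unfold cutBelow
    rw [h', min_eq_left (by linarith)]
    split_ifs
    · linarith
    · linarith
    · linarith

theorem fderiv_fderiv_eq_deriv {N : ℕ} {f : Euc N → ℝ} {R : ℝ} {x v : Euc N}
    (hf : ContDiffOn ℝ 2 f (ball 0 R)) (hx : x ∈ ball 0 R) :
    fderiv ℝ (fun y => fderiv ℝ f y v) x v = deriv (deriv fun s : ℝ => f (x + s • v)) 0 := by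
  have hline : ∀ s : ℝ, HasDerivAt (fun s : ℝ => x + s • v) v s := fun s => by
    simpa using ((hasDerivAt_id s).smul_const v).const_add x
  have hat : ∀ y ∈ ball (0 : Euc N) R, ContDiffAt ℝ 2 f y := fun y hy =>
    hf.contDiffAt (isOpen_ball.mem_nhds hy)
  have hev : ∀ᶠ s : ℝ in 𝓝 0, x + s • v ∈ ball (0 : Euc N) R := by
    have := (hline 0).continuousAt
    refine this.eventually (isOpen_ball.mem_nhds ?_)
    simpa using hx
  have h1 : deriv (fun s : ℝ => f (x + s • v)) =ᶠ[𝓝 0] fun s => fderiv ℝ f (x + s • v) v := by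
    filter_upwards [hev] with s hs
    exact (((hat _ hs).differentiableAt (by simp)).hasFDerivAt.comp_hasDerivAt s (hline s)).deriv
  rw [h1.deriv_eq]
  have h2 : DifferentiableAt ℝ (fderiv ℝ f) x :=
    ((hat x hx).fderiv_right (m := 1) (by norm_num)).differentiableAt (by simp)
  have h3 : DifferentiableAt ℝ (fun y => fderiv ℝ f y v) (x + (0 : ℝ) • v) := by
    rw [zero_smul, add_zero]
    fun_prop
  have h4 := h3.hasFDerivAt.comp_hasDerivAt 0 (hline 0)
  rw [zero_smul, add_zero] at h4
  exact h4.deriv.symm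

theorem deriv_deriv_sqrt_comp {φ : ℝ → ℝ} {r R : ℝ} (hr : 0 < r) (hrR : r < R)
    (h1 : ∀ y ∈ Ioo 0 R, HasDerivAt φ (deriv φ y) y) (hc : ContinuousAt (deriv φ) r) :
    deriv (deriv fun s => φ √(r ^ 2 + s ^ 2)) 0 = deriv φ r / r := by
  have hpos : ∀ s : ℝ, 0 < r ^ 2 + s ^ 2 := fun s => by positivity
  have hsq : ∀ s : ℝ, HasDerivAt (fun s => √(r ^ 2 + s ^ 2)) (s / √(r ^ 2 + s ^ 2)) s := by
    intro s
    have := (((hasDerivAt_id' s).fun_pow 2).const_add (r ^ 2)).sqrt (hpos s).ne'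
    refine this.congr_deriv ?_
    field_simp
    simp
  have h0 : √(r ^ 2 + (0 : ℝ) ^ 2) = r := by simp [Real.sqrt_sq hr.le]
  have hcq : ContinuousAt (fun s => √(r ^ 2 + s ^ 2)) 0 := (hsq 0).continuousAt
  have hev : ∀ᶠ s in 𝓝 (0 : ℝ), √(r ^ 2 + s ^ 2) ∈ Ioo 0 R :=
    hcq.eventually (isOpen_Ioo.mem_nhds (by beta_reduce; rw [h0]; exact ⟨hr, hrR⟩))
  have h2 : (deriv fun s => φ √(r ^ 2 + s ^ 2)) =ᶠ[𝓝 0]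
      fun s => s * (deriv φ √(r ^ 2 + s ^ 2) / √(r ^ 2 + s ^ 2)) := by
    filter_upwards [hev] with s hs
    refine ((h1 _ hs).comp s (hsq s)).deriv.trans ?_
    ring
  rw [h2.deriv_eq]
  have hk : ContinuousAt (fun s => deriv φ √(r ^ 2 + s ^ 2) / √(r ^ 2 + s ^ 2)) 0 := by
    refine ContinuousAt.div ?_ hcq (by rw [h0]; exact hr.ne')
    exact ContinuousAt.comp (by simpa only [h0] using hc) hcq
  have h3 : HasDerivAt (fun s => s * (deriv φ √(r ^ 2 + s ^ 2) / √(r ^ 2 + s ^ 2)))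
      (deriv φ r / r) 0 := by
    rw [hasDerivAt_iff_tendsto_slope_zero]
    have := hk.tendsto
    rw [h0] at this
    refine (this.mono_left nhdsWithin_le_nhds).congr' ?_
    filter_upwards [self_mem_nhdsWithin] with s hs
    have hs' : s ≠ 0 := hs
    simp [hs']
  exact h3.deriv

section

variable {N : ℕ} {f : Euc N → ℝ} {R : ℝ}

theorem contDiffOn_ray (i₀ : Fin N) (hf : ContDiffOn ℝ 2 f (ball 0 R)) :
    ContDiffOn ℝ 2 (fun r : ℝ => f (r • EuclideanSpace.single i₀ 1)) (Ioo (-R) R) :=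
  hf.comp (f := fun r : ℝ => r • (EuclideanSpace.single i₀ 1 : Euc N)) (by fun_prop) fun r hr => by
    simpa [norm_smul, abs_lt] using hr

theorem hasDerivAt_ray (i₀ : Fin N) (hf : ContDiffOn ℝ 2 f (ball 0 R)) {r : ℝ}
    (hr : r ∈ Ioo (-R) R) :
    HasDerivAt (fun r : ℝ => f (r • EuclideanSpace.single i₀ 1))
      (deriv (fun r : ℝ => f (r • EuclideanSpace.single i₀ 1)) r) r ∧
    HasDerivAt (deriv fun r : ℝ => f (r • EuclideanSpace.single i₀ 1))
      (deriv (deriv fun r : ℝ => f (r • EuclideanSpace.single i₀ 1)) r) r := by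
  have h := contDiffOn_ray i₀ hf
  have h' := ((contDiffOn_succ_iff_deriv_of_isOpen (n := 1) isOpen_Ioo).1 h).2.2
  exact ⟨((h.contDiffAt (isOpen_Ioo.mem_nhds hr)).differentiableAt (by simp)).hasDerivAt,
    ((h'.contDiffAt (isOpen_Ioo.mem_nhds hr)).differentiableAt (by simp)).hasDerivAt⟩

theorem lap_ray (i₀ : Fin N) (hf : ContDiffOn ℝ 2 f (ball 0 R)) (hs : RadiallySymmetric f)
    {r : ℝ} (hr : r ∈ Ioo 0 R) :
    lap f (r • EuclideanSpace.single i₀ 1) =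
      deriv (deriv fun r : ℝ => f (r • EuclideanSpace.single i₀ 1)) r +
      ((N : ℝ) - 1) / r * deriv (fun r : ℝ => f (r • EuclideanSpace.single i₀ 1)) r := by
  set φ : ℝ → ℝ := fun r : ℝ => f (r • EuclideanSpace.single i₀ 1) with hφ
  have hx : r • (EuclideanSpace.single i₀ 1 : Euc N) ∈ ball (0 : Euc N) R := by
    simpa [norm_smul, abs_of_pos hr.1] using hr.2
  have hN : 1 ≤ N := i₀.pos
  unfold lap
  rw [← Finset.add_sum_erase _ _ (Finset.mem_univ i₀)]
  congr 1
  · rw [fderiv_fderiv_eq_deriv hf hx]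
    have h1 : (fun s : ℝ => f (r • EuclideanSpace.single i₀ 1 + s • EuclideanSpace.single i₀ 1)) =
        fun s => φ (r + s) := by
      ext s
      simp only [hφ, add_smul]
    rw [h1]
    have h2 : (deriv fun s => φ (r + s)) = fun s => deriv φ (r + s) := by
      ext s
      rw [deriv_comp_const_add]
    rw [h2, deriv_comp_const_add, add_zero]
  · rw [Finset.sum_congr rfl (g := fun _ => deriv φ r / r)]
    · rw [Finset.sum_const, Finset.card_erase_of_mem (Finset.mem_univ _), Finset.card_univ,
        Fintype.card_fin, nsmul_eq_mul, Nat.cast_sub hN, Nat.cast_one]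
      ring
    · intro i hi
      have hne : i ≠ i₀ := Finset.ne_of_mem_erase hi
      rw [fderiv_fderiv_eq_deriv hf hx]
      have h1 : (fun s : ℝ => f (r • EuclideanSpace.single i₀ 1 + s • EuclideanSpace.single i 1)) =
          fun s => φ √(r ^ 2 + s ^ 2) := by
        ext s
        refine hs _ _ ?_
        rw [norm_smul, Real.norm_eq_abs, abs_of_nonneg (Real.sqrt_nonneg _), PiLp.norm_single,
          norm_one, mul_one]
        symm
        rw [Real.sqrt_eq_iff_mul_self_eq (by positivity) (norm_nonneg _), ← sq,
          norm_add_sq_real]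
        have : inner ℝ (EuclideanSpace.single i₀ (1 : ℝ)) (EuclideanSpace.single i (1 : ℝ)) = 0 := by
          rw [EuclideanSpace.inner_single_left]
          simp [hne.symm]
        simp [norm_smul, inner_smul_left, inner_smul_right, this]
      rw [h1]
      exact deriv_deriv_sqrt_comp hr.1 hr.2
        (fun y hy => (hasDerivAt_ray i₀ hf ⟨by linarith [hy.1, hy.2], hy.2⟩).1)
        (hasDerivAt_ray i₀ hf ⟨by linarith [hr.1, hr.2], hr.2⟩).2.continuousAt

theorem lap_zero (i₀ : Fin N) (hR : 0 < R) (hf : ContDiffOn ℝ 2 f (ball 0 R))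
    (hs : RadiallySymmetric f) :
    lap f 0 = N * deriv (deriv fun r : ℝ => f (r • EuclideanSpace.single i₀ 1)) 0 := by
  unfold lap
  rw [Finset.sum_congr rfl
    (g := fun _ => deriv (deriv fun r : ℝ => f (r • EuclideanSpace.single i₀ 1)) 0)]
  · simp
  · intro i _
    rw [fderiv_fderiv_eq_deriv hf (mem_ball_self hR)]
    congr 2
    ext s
    exact hs _ _ (by simp [norm_smul])

end

/-- Radial profiles of solutions of `u_t = Δu + e^u` that peak at the origin and blow up at `T`
with a rate that is not of type I. -/
structure RadialBlowUp (n R T L₀ : ℝ) (w wr wrr wt : ℝ → ℝ → ℝ) : Prop where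
  hn : 0 ≤ n
  hR : 0 < R
  hT : 0 < T
  sol : RadSol n w wr wrr wt (fun t r => exp (w t r)) (Ioo 0 T) R
  cont : ContinuousOn (fun p : ℝ × ℝ => w p.1 p.2) (Ico 0 T ×ˢ Icc 0 R)
  sym : ∀ t r, w t (-r) = w t r
  nonneg : ∀ t ∈ Ico 0 T, ∀ r ∈ Icc 0 R, 0 ≤ w t r
  bdry : ∀ t ∈ Ico 0 T, w t R = 0
  peak : ∀ t ∈ Ico 0 T, ∀ r ∈ Icc 0 R, w t r ≤ w t 0
  init : ∀ r ∈ Icc 0 R, ∀ s ∈ Icc 0 R, |w 0 r - w 0 s| ≤ L₀ * |r - s|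
  unbounded : ∀ M, ∀ t₀ < T, ∃ t ∈ Ioo t₀ T, 0 < t ∧ M < w t 0
  rate : ¬ ∃ C₁ C₂ : ℝ, ∀ t ∈ Ioo 0 T, C₁ ≤ log (T - t) + w t 0 ∧ log (T - t) + w t 0 ≤ C₂

theorem RadSol.nonneg {n X T : ℝ} {w wr wrr wt : ℝ → ℝ → ℝ} (hn : 0 ≤ n)
    (h : RadSol n w wr wrr wt (fun t r => exp (w t r)) (Ioo 0 T) X)
    (hc : ContinuousOn (fun p : ℝ × ℝ => w p.1 p.2) (Ico 0 T ×ˢ Icc 0 X))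
    (h0 : ∀ r ∈ Icc 0 X, 0 ≤ w 0 r) (hX : ∀ t ∈ Ico 0 T, w t X = 0) :
    ∀ t ∈ Ico 0 T, ∀ r ∈ Icc 0 X, 0 ≤ w t r := by
  intro b hb r hr
  obtain ⟨⟨t, x⟩, ⟨ht, hx⟩, hmin⟩ := (isCompact_Icc.prod isCompact_Icc).exists_isMinOn
    (s := Icc 0 b ×ˢ Icc 0 X) ⟨(b, r), ⟨hb.1, le_rfl⟩, hr⟩
    (hc.mono (prod_mono (fun s hs => ⟨hs.1, hs.2.trans_lt hb.2⟩) le_rfl))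
  by_contra hcon
  have h1 : ∀ s ∈ Icc 0 b, ∀ y ∈ Icc 0 X, w t x ≤ w s y := fun s hs y hy => hmin (a := (s, y)) ⟨hs, hy⟩
  have hneg : w t x < 0 := (h1 b ⟨hb.1, le_rfl⟩ r hr).trans_lt (not_le.1 hcon)
  have ht0 : 0 < t := ht.1.lt_of_ne fun h' => by
    subst h'
    linarith [h0 x hx]
  have hxX : x < X := hx.2.lt_of_ne fun h' => by
    subst h'
    linarith [hX t ⟨ht.1, ht.2.trans_lt hb.2⟩]
  have := h.neg.source_nonneg_of_max hn (t := t) (r := x) ⟨ht0, ht.2.trans_lt hb.2⟩ ⟨hx.1, hxX⟩ (by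
    filter_upwards [Ioo_mem_nhdsLT ht0] with s hs
    exact neg_le_neg (h1 s ⟨hs.1.le, hs.2.le.trans ht.2⟩ x hx)) (by
    filter_upwards [Iio_mem_nhds hxX] with y hy hy0
    exact neg_le_neg (h1 t ht y ⟨hy0, le_of_lt hy⟩))
  linarith [exp_pos (w t x)]

theorem IsClassicalSol.radialBlowUp {N : ℕ} {R T : ℝ} (i₀ : Fin N) (hR : 0 < R) (hT : 0 < T)
    {u : ℝ → Euc N → ℝ} {u₀ : Euc N → ℝ}
    (hu₀C1 : ContDiffOn ℝ 1 u₀ (closure (ball (0:Euc N) R)))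
    (hu₀pos : ∀ x ∈ closure (ball (0:Euc N) R), 0 ≤ u₀ x)
    (hsol : IsClassicalSol (ball (0:Euc N) R) u u₀ (Ico 0 T))
    (hrad : ∀ t, RadiallySymmetric (u t))
    (hmax : ∀ t ∈ Ioo (0:ℝ) T, ∀ x ∈ ball (0:Euc N) R, u t x ≤ u t 0)
    (hbu : BlowsUpAt (ball (0:Euc N) R) u T)
    (htypeII : ¬ TypeIRate (ball (0:Euc N) R) u T) :
    ∃ L₀ wr wrr wt, RadialBlowUp ((N : ℝ) - 1) R T L₀
      (fun t r => u t (r • EuclideanSpace.single i₀ 1)) wr wrr wt := by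
  have hN : 1 ≤ N := i₀.pos
  have hn : (0 : ℝ) ≤ (N : ℝ) - 1 := sub_nonneg.2 (by exact_mod_cast hN)
  set e : Euc N := EuclideanSpace.single i₀ 1 with he
  have hnorm : ∀ r : ℝ, ‖r • e‖ = |r| := fun r => by simp [norm_smul, he]
  have hcl : closure (ball (0 : Euc N) R) = closedBall 0 R := closure_ball _ hR.ne'
  have hball : ∀ r : ℝ, |r| < R → r • e ∈ ball (0 : Euc N) R := fun r hr => by simpa [hnorm] using hr
  have hcball : ∀ r ∈ Icc 0 R, r • e ∈ closure (ball (0 : Euc N) R) := fun r hr => by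
    rw [hcl, mem_closedBall_zero_iff, hnorm, abs_of_nonneg hr.1]
    exact hr.2
  obtain ⟨K, hK⟩ := hu₀C1.exists_lipschitzOnWith (by simp)
    (by rw [hcl]; exact convex_closedBall _ _) (by rw [hcl]; exact isCompact_closedBall _ _)
  have hreg : ∀ t ∈ Ioo 0 T, ContDiffOn ℝ 2 (u t) (ball 0 R) := fun t ht =>
    hsol.space_reg t ⟨ht.1.le, ht.2⟩ ht.1
  have sol : RadSol ((N : ℝ) - 1) (fun t r => u t (r • e)) (fun t => deriv fun r : ℝ => u t (r • e))
      (fun t => deriv (deriv fun r : ℝ => u t (r • e)))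
      (fun t r => lap (u t) (r • e) + exp (u t (r • e))) (fun t r => exp (u t (r • e))) (Ioo 0 T) R := by
    refine ⟨fun t ht r hr => (hasDerivAt_ray i₀ (hreg t ht) hr).1,
      fun t ht r hr => (hasDerivAt_ray i₀ (hreg t ht) hr).2,
      fun t ht r hr => hsol.eq t ⟨ht.1.le, ht.2⟩ ht.1 _ (hball r ?_), fun t ht => ?_,
      fun t ht r hr => ?_, fun t ht _ => ?_⟩
    · rw [abs_of_nonneg hr.1]
      exact hr.2
    · have h1 := (hasDerivAt_ray i₀ (hreg t ht) (r := 0) ⟨by linarith, hR⟩).1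
      have h1' : HasDerivAt (fun r : ℝ => u t (r • EuclideanSpace.single i₀ 1))
          (deriv (fun r : ℝ => u t (r • EuclideanSpace.single i₀ 1)) 0) (-(0 : ℝ)) := by
        rw [neg_zero]
        exact h1
      have h2 := h1'.comp (0 : ℝ) (hasDerivAt_neg (0 : ℝ))
      have h3 : ((fun r : ℝ => u t (r • EuclideanSpace.single i₀ 1)) ∘ Neg.neg) =
          fun r : ℝ => u t (r • EuclideanSpace.single i₀ 1) := by
        ext x
        exact hrad t _ _ (by simp)
      rw [h3] at h2
      have := h1.unique h2
      rw [← he] at this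
      linarith
    · beta_reduce
      rw [lap_ray i₀ (hreg t ht) (hrad t) hr]
    · beta_reduce
      rw [zero_smul, lap_zero i₀ hR (hreg t ht) (hrad t), sub_add_cancel]
  have cont : ContinuousOn (fun p : ℝ × ℝ => u p.1 (p.2 • e)) (Ico 0 T ×ˢ Icc 0 R) :=
    hsol.cont.comp (f := fun p : ℝ × ℝ => (p.1, p.2 • e)) (by fun_prop)
      fun p hp => ⟨hp.1, hcball _ hp.2⟩
  have bdry : ∀ t ∈ Ico 0 T, u t (R • e) = 0 := fun t ht => hsol.bc t ht _ (by
    rw [frontier_ball _ hR.ne', mem_sphere_zero_iff_norm, hnorm, abs_of_pos hR])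
  have nonneg := sol.nonneg hn cont (fun r hr => by
    rw [hsol.ic _ (hcball r hr)]
    exact hu₀pos _ (hcball r hr)) bdry
  have peak0 : ∀ t ∈ Ioo 0 T, ∀ r ∈ Icc 0 R, u t (r • e) ≤ u t ((0 : ℝ) • e) := by
    intro t ht r hr
    rw [zero_smul]
    rcases hr.2.eq_or_lt with h' | h'
    · rw [h', bdry t ⟨ht.1.le, ht.2⟩]
      simpa using nonneg t ⟨ht.1.le, ht.2⟩ 0 ⟨le_rfl, hR.le⟩
    · exact hmax t ht _ (hball r (by rwa [abs_of_nonneg hr.1]))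
  have cslice : ∀ r ∈ Icc 0 R, ContinuousOn (fun t => u t (r • e)) (Ico 0 T) := fun r hr =>
    cont.comp (f := fun t : ℝ => (t, r)) (by fun_prop) fun t ht => ⟨ht, hr⟩
  have hsup : ∀ t ∈ Ioo 0 T, supAbs (ball (0 : Euc N) R) (u t) = ENNReal.ofReal (u t ((0 : ℝ) • e)) := by
    intro t ht
    have h0 := nonneg t ⟨ht.1.le, ht.2⟩ 0 ⟨le_rfl, hR.le⟩
    refine le_antisymm (iSup₂_le fun x hx => ENNReal.ofReal_le_ofReal ?_) ?_
    · have hx' : ‖x‖ < R := by simpa using hx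
      have h1 : u t x = u t (‖x‖ • e) := hrad t _ _ (by rw [hnorm, abs_norm])
      rw [h1, abs_of_nonneg (nonneg t ⟨ht.1.le, ht.2⟩ _ ⟨norm_nonneg _, hx'.le⟩)]
      exact peak0 t ht _ ⟨norm_nonneg _, hx'.le⟩
    · refine le_trans ?_ (le_iSup₂ (0 : Euc N) (mem_ball_self hR))
      rw [zero_smul] at h0 ⊢
      rw [abs_of_nonneg h0]
  have hsup' : ∀ t ∈ Ioo 0 T, (supAbs (ball (0 : Euc N) R) (u t)).toReal = u t ((0 : ℝ) • e) :=
    fun t ht => by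
      rw [hsup t ht, ENNReal.toReal_ofReal (nonneg t ⟨ht.1.le, ht.2⟩ 0 ⟨le_rfl, hR.le⟩)]
  refine ⟨K, _, _, _, hn, hR, hT, sol, cont, fun t r => hrad t _ _ (by simp), nonneg, bdry,
    fun t ht r hr => ?_, fun r hr s hs => ?_, fun M t₀ ht₀ => ?_, fun ⟨C₁, C₂, hC⟩ => ?_⟩
  · rcases ht.1.eq_or_lt with h' | h'
    · subst h'
      have hmem : Ioo 0 T ∈ 𝓝[>] (0 : ℝ) := Ioo_mem_nhdsGT hT
      have hlim : ∀ r ∈ Icc 0 R, Tendsto (fun t => u t (r • e)) (𝓝[>] 0) (𝓝 (u 0 (r • e))) :=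
        fun r hr => (cslice r hr 0 ⟨le_rfl, hT⟩).mono_left
          (nhdsWithin_le_iff.2 (mem_of_superset hmem Ioo_subset_Ico_self))
      refine le_of_tendsto_of_tendsto (hlim r hr) (hlim 0 ⟨le_rfl, hR.le⟩) ?_
      filter_upwards [hmem] with t ht using peak0 t ht r hr
    · exact peak0 t ⟨h', ht.2⟩ r hr
  · have := hK.dist_le_mul _ (hcball r hr) _ (hcball s hs)
    rw [Real.dist_eq, dist_eq_norm, ← sub_smul, hnorm, ← hsol.ic _ (hcball r hr),
      ← hsol.ic _ (hcball s hs)] at this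
    exact this
  · have hfreq : ∃ᶠ t in 𝓝[<] T, ENNReal.ofReal M < supAbs (ball (0 : Euc N) R) (u t) :=
      frequently_lt_of_lt_limsup (by isBoundedDefault) (by rw [hbu.2.2]; exact ENNReal.ofReal_lt_top)
    obtain ⟨t, h1, h2⟩ := (hfreq.and_eventually
      (Ioo_mem_nhdsLT (max_lt ht₀ hT))).exists
    have h3 : t ∈ Ioo 0 T := ⟨(le_max_right _ _).trans_lt h2.1, h2.2⟩
    rw [hsup t h3] at h1
    exact ⟨t, ⟨(le_max_left _ _).trans_lt h2.1, h2.2⟩, h3.1, ENNReal.ofReal_lt_ofReal_iff'.1 h1 |>.1⟩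
  · exact htypeII ⟨C₁, C₂, fun t ht => by rw [hsup' t ht]; exact hC t ht⟩

namespace RadialBlowUp

variable {n R T L₀ : ℝ} {w wr wrr wt : ℝ → ℝ → ℝ}

theorem wt_axis_le (h : RadialBlowUp n R T L₀ w wr wrr wt) {t : ℝ} (ht : t ∈ Ioo 0 T) :
    wt t 0 ≤ exp (w t 0) := by
  have hR := h.hR
  have h1 : wrr t 0 ≤ 0 := by
    refine second_deriv_nonpos_of_max_right (f := w t) (f1 := wr t) ?_
      (h.sol.dr t ht 0 ⟨by linarith, hR⟩) (h.sol.drr t ht 0 ⟨by linarith, hR⟩) (h.sol.axis t ht) ?_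
    · filter_upwards [Ioo_mem_nhdsGT hR] with s hs
      exact h.sol.dr t ht s ⟨by linarith [hs.1], hs.2⟩
    · filter_upwards [Ioo_mem_nhdsGT hR] with s hs
      exact h.peak t ⟨ht.1.le, ht.2⟩ s ⟨hs.1.le, hs.2.le⟩
  rw [h.sol.eq_zero t ht hR]
  have := h.hn
  nlinarith

theorem hasDerivAt_scale (h : RadialBlowUp n R T L₀ w wr wrr wt) {t : ℝ} (ht : t ∈ Ioo 0 T) :
    HasDerivAt (fun s => exp (-w s 0)) (-(exp (-w t 0) * wt t 0)) t := by
  have := ((h.sol.dt t ht 0 ⟨le_rfl, h.hR⟩).fun_neg).exp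
  convert this using 1
  ring

theorem continuousOn_axis (h : RadialBlowUp n R T L₀ w wr wrr wt) :
    ContinuousOn (fun t => w t 0) (Ico 0 T) :=
  h.cont.comp (f := fun t : ℝ => (t, (0 : ℝ))) (by fun_prop) fun _ ht => ⟨ht, le_rfl, h.hR.le⟩

theorem scale_le (h : RadialBlowUp n R T L₀ w wr wrr wt) {t : ℝ} (ht : t ∈ Ioo 0 T) :
    exp (-w t 0) ≤ T - t := by
  have hmono : MonotoneOn (fun s => exp (-w s 0) + s) (Ioo 0 T) := by
    refine monotoneOn_of_deriv_nonneg (convex_Ioo _ _) (fun s hs => ?_) (fun s hs => ?_) fun s hs => ?_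
    · exact ((h.hasDerivAt_scale hs).continuousAt.add continuousAt_id).continuousWithinAt
    · rw [interior_Ioo] at hs
      exact ((h.hasDerivAt_scale hs).fun_add (hasDerivAt_id' s)).differentiableAt.differentiableWithinAt
    · rw [interior_Ioo] at hs
      rw [((h.hasDerivAt_scale hs).fun_add (hasDerivAt_id' s)).deriv]
      have h1 := mul_le_mul_of_nonneg_left (h.wt_axis_le hs) (exp_pos (-w s 0)).le
      rw [← exp_add, neg_add_cancel, exp_zero] at h1
      linarith
  by_contra hcon
  push Not at hcon
  set δ := exp (-w t 0) - (T - t) with hδ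
  obtain ⟨s, hs, hs0, hM⟩ := h.unbounded (-log δ) t ht.2
  have h1 := hmono ht ⟨hs0, hs.2⟩ hs.1.le
  beta_reduce at h1
  have h2 : exp (-w s 0) < δ := by
    rw [← exp_log (by linarith : 0 < δ)]
    exact exp_lt_exp.2 (by linarith)
  linarith [hs.2]

/-- The blow-up is faster than the self-similar rate along some sequence of times. -/
theorem exists_fast (h : RadialBlowUp n R T L₀ w wr wrr wt) {K t₀ : ℝ} (hK : 0 < K) (ht₀ : t₀ < T) :
    ∃ t ∈ Ioo 0 T, t₀ < t ∧ K * exp (-w t 0) ≤ T - t := by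
  by_contra! hcon
  set c := max t₀ 0 with hc
  have hcT : c < T := max_lt ht₀ h.hT
  have hc0 : 0 ≤ c := le_max_right _ _
  have hcont : ContinuousOn (fun t => log (T - t) + w t 0) (Icc 0 c) := by
    refine ContinuousOn.add (ContinuousOn.log (by fun_prop) fun t ht => ?_)
      (h.continuousOn_axis.mono fun t ht => ⟨ht.1, ht.2.trans_lt hcT⟩)
    linarith [ht.2]
  obtain ⟨B, hB⟩ := (isCompact_Icc.bddAbove_image hcont)
  refine h.rate ⟨0, max B (log K), fun t ht => ⟨?_, ?_⟩⟩
  · have h1 := log_le_log (exp_pos _) (h.scale_le ht)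
    rw [log_exp] at h1
    linarith
  · rcases le_or_gt t c with htc | htc
    · exact (hB ⟨t, ⟨ht.1.le, htc⟩, rfl⟩).trans (le_max_left _ _)
    · have h1 := hcon t ht ((le_max_left _ _).trans_lt htc)
      have h2 := log_le_log (by linarith [ht.2]) h1.le
      rw [log_mul hK.ne' (exp_pos _).ne', log_exp] at h2
      exact le_trans (by linarith) (le_max_right _ _)

theorem lip (h : RadialBlowUp n R T L₀ w wr wrr wt) {b μ : ℝ} (hb : b ∈ Ioo 0 T)
    (hμ : ∀ t ∈ Icc 0 b, w t 0 ≤ μ - 1) (hL : L₀ ≤ exp (μ / 2)) :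
    ∀ t ∈ Icc 0 b, ∀ r ∈ Icc 0 R, ∀ s ∈ Icc 0 R,
      |w t r - w t s| ≤ 2 * exp (μ / 2) * |r - s| := by
  have hI : ∀ t ∈ Icc 0 b, t ∈ Ico 0 T := fun t ht => ⟨ht.1, ht.2.trans_lt hb.2⟩
  refine h.sol.lipschitz (I := Ioo 0 T) h.hn h.hR hb.1 (fun t ht => ⟨ht.1, ht.2.trans_lt hb.2⟩)
    (h.cont.mono (prod_mono hI le_rfl)) h.sym (fun t ht => h.nonneg t (hI t ht))
    (fun t ht => h.bdry t (hI t ht)) (fun t ht r hr => (h.peak t (hI t ht) r hr).trans (hμ t ht)) ?_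
  exact fun r hr s hs => (h.init r hr s hs).trans (by gcongr)

theorem timeReg (h : RadialBlowUp n R T L₀ w wr wrr wt) {a b : ℝ} (ha : 0 < a) (hab : a ≤ b) (hb : b < T) :
    ∃ K h₀, 0 < K ∧ 0 < h₀ ∧ TimeReg w wt K h₀ R a b := by
  set b' := (b + T) / 2 with hb'
  have hbT : b' ∈ Ioo 0 T := ⟨by linarith, by linarith⟩
  have hsub : ∀ t ∈ Icc 0 b', t ∈ Ico 0 T := fun t ht => ⟨ht.1, ht.2.trans_lt hbT.2⟩
  have hsub' : Icc (a / 2) b' ⊆ Icc 0 b' := Icc_subset_Icc_left (by linarith)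
  obtain ⟨M, hM⟩ := isCompact_Icc.bddAbove_image (h.continuousOn_axis.mono hsub)
  obtain ⟨μ, hμ1, hμ2⟩ : ∃ μ, M ≤ μ - 1 ∧ L₀ ≤ exp (μ / 2) := by
    refine ⟨max (M + 1) (2 * log (max L₀ 1)), by linarith [le_max_left (M + 1) (2 * log (max L₀ 1))], ?_⟩
    calc L₀ ≤ max L₀ 1 := le_max_left _ _
      _ = exp (log (max L₀ 1)) := (exp_log (by positivity)).symm
      _ ≤ _ := exp_le_exp.2 (by linarith [le_max_right (M + 1) (2 * log (max L₀ 1))])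
  have hM' : ∀ t ∈ Icc 0 b', w t 0 ≤ M := fun t ht => hM ⟨t, ht, rfl⟩
  refine exists_timeReg (a' := a / 2) (b' := b') (M := M) (L := 2 * exp (μ / 2)) h.hn h.hR
    (by positivity) (by linarith) (by linarith)
    (h.sol.mono (fun t ht => ⟨by linarith [ht.1], ht.2.trans_lt hbT.2⟩) le_rfl)
    (h.cont.mono (prod_mono (fun t ht => hsub t (hsub' ht)) le_rfl))
    (fun t ht r hr => (h.peak t (hsub t (hsub' ht)) r hr).trans (hM' t (hsub' ht)))
    (fun t ht s hs => by rw [h.bdry t (hsub t (hsub' ht)), h.bdry s (hsub s (hsub' hs))])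
    fun t ht => h.lip hbT (fun t ht => (hM' t ht).trans hμ1) hμ2 t (hsub' ht)

end RadialBlowUp

/-- Extension by zero outside `[0, X)`. -/
def ext (X : ℝ) (v : ℝ → ℝ → ℝ) (t r : ℝ) : ℝ := if r < X then v t r else 0

theorem TimeReg.ext_sub_le {w wt : ℝ → ℝ → ℝ} {K h₀ X a b : ℝ} (h : TimeReg w wt K h₀ X a b)
    (hK : 0 < K) {t s r x : ℝ} (ht : t ∈ Icc a b) (hs : s ∈ Icc a b) (hts : |t - s| ≤ h₀)
    (hr : 0 ≤ r) (hx : 0 ≤ x) :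
    |ext X wt t r - ext X wt s x| ≤ K * √|t - s| + K * |r - x| := by
  have h0 : 0 ≤ K * √|t - s| := by positivity
  unfold ext
  split_ifs with h1 h2 h2
  · calc |wt t r - wt s x| = |(wt t r - wt s r) + (wt s r - wt s x)| := by ring_nf
      _ ≤ _ := (abs_add_le _ _).trans (add_le_add (h.holder t ht s hs hts r ⟨hr, h1⟩)
        (h.lip s hs r ⟨hr, h1⟩ x ⟨hx, h2⟩))
  · rw [sub_zero]
    have := h.bdry t ht r ⟨hr, h1⟩
    rw [abs_sub_comm r x, abs_of_nonneg (by linarith : 0 ≤ x - r)]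
    nlinarith
  · rw [zero_sub, abs_neg]
    have := h.bdry s hs x ⟨hx, h2⟩
    rw [abs_of_nonneg (by linarith : 0 ≤ r - x)]
    nlinarith
  · simp only [sub_zero, abs_zero]
    positivity

theorem continuousOn_of_modulus {f : ℝ × ℝ → ℝ} {S : Set (ℝ × ℝ)} {K h₀ : ℝ} (hh : 0 < h₀)
    (h : ∀ p ∈ S, ∀ q ∈ S, |p.1 - q.1| ≤ h₀ →
      |f p - f q| ≤ K * √|p.1 - q.1| + K * |p.2 - q.2|) : ContinuousOn f S := by
  intro q hq
  rw [ContinuousWithinAt, tendsto_iff_dist_tendsto_zero]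
  have hlim : Tendsto (fun p : ℝ × ℝ => K * √|p.1 - q.1| + K * |p.2 - q.2|) (𝓝[S] q) (𝓝 0) := by
    have : Continuous fun p : ℝ × ℝ => K * √|p.1 - q.1| + K * |p.2 - q.2| := by fun_prop
    simpa using (this.tendsto q).mono_left nhdsWithin_le_nhds
  refine squeeze_zero' (Eventually.of_forall fun _ => dist_nonneg) ?_ hlim
  have hc : Continuous fun p : ℝ × ℝ => |p.1 - q.1| := by fun_prop
  have : ∀ᶠ p in 𝓝[S] q, |p.1 - q.1| < h₀ :=
    nhdsWithin_le_nhds (hc.tendsto q |>.eventually_lt_const (by simpa using hh))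
  filter_upwards [self_mem_nhdsWithin, this] with p hp hp'
  exact h p hp q hq hp'.le

theorem TimeReg.continuousOn_ext {w wt : ℝ → ℝ → ℝ} {K h₀ X a b : ℝ} (h : TimeReg w wt K h₀ X a b)
    (hK : 0 < K) (hh : 0 < h₀) :
    ContinuousOn (fun p : ℝ × ℝ => ext X wt p.1 p.2) (Icc a b ×ˢ Ici 0) :=
  continuousOn_of_modulus hh fun _ hp _ hq hpq => h.ext_sub_le hK hp.1 hq.1 hpq hp.2 hq.2

theorem TimeReg.continuousOn {w wt : ℝ → ℝ → ℝ} {K h₀ X a b : ℝ} (h : TimeReg w wt K h₀ X a b)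
    (hK : 0 < K) (hh : 0 < h₀) :
    ContinuousOn (fun p : ℝ × ℝ => wt p.1 p.2) (Icc a b ×ˢ Ico 0 X) := by
  refine ((h.continuousOn_ext hK hh).mono (prod_mono le_rfl Ico_subset_Ici_self)).congr fun p hp => ?_
  simp only [ext, if_pos hp.2.2]

theorem ApproxSol.congr {n a b Y : ℝ} {v pot v' pot' : ℝ → ℝ → ℝ} (h : ApproxSol n v pot a b Y)
    (hv : ∀ t ∈ Icc a b, ∀ r ∈ Ico 0 Y, v' t r = v t r)
    (hp : ∀ t ∈ Icc a b, ∀ r ∈ Ico 0 Y, pot' t r = pot t r) : ApproxSol n v' pot' a b Y := by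
  intro ε hε
  obtain ⟨q, qr, qrr, qt, g, h1, h2, h3, h4, h5⟩ := h ε hε
  refine ⟨q, qr, qrr, qt, g, h1, h2, h3, h4, fun t ht r hr => ?_⟩
  rw [hv t ht r hr, hp t ht r hr]
  exact h5 t ht r hr

theorem ApproxSol.of_limit {n a b Y : ℝ} {v pot : ℝ → ℝ → ℝ}
    (h : ∀ ε > 0, ∃ v' pot' : ℝ → ℝ → ℝ, ApproxSol n v' pot' a b Y ∧ ∀ t ∈ Icc a b, ∀ r ∈ Ico 0 Y,
      |v' t r - v t r| ≤ ε ∧ |pot' t r * v' t r - pot t r * v t r| ≤ ε) :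
    ApproxSol n v pot a b Y := by
  intro ε hε
  obtain ⟨v', pot', h0, hlim⟩ := h (ε / 2) (half_pos hε)
  obtain ⟨q, qr, qrr, qt, g, h1, h2, h3, h4, h5⟩ := h0 (ε / 2) (half_pos hε)
  refine ⟨q, qr, qrr, qt, g, h1, h2, h3, h4, fun t ht r hr => ⟨?_, ?_⟩⟩
  · linarith [abs_sub_le (q t r) (v' t r) (v t r), (h5 t ht r hr).1, (hlim t ht r hr).1]
  · linarith [abs_sub_le (g t r) (pot' t r * v' t r) (pot t r * v t r), (h5 t ht r hr).2,
      (hlim t ht r hr).2]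

theorem abs_exp_diff_quotient_le {x q v δ h B : ℝ} (hh : 0 < h) (hq : |q - v| ≤ δ) (hB : |q| ≤ B)
    (hhB : h * B ≤ 1) :
    |(exp (x + h * q) - exp x) / h - exp x * v| ≤ exp x * (h * B ^ 2 + δ) := by
  have h0 : |h * q| ≤ 1 := by
    rw [abs_mul, abs_of_pos hh]
    exact (mul_le_mul_of_nonneg_left hB hh.le).trans hhB
  have h1 := abs_exp_sub_one_sub_id_le h0
  have h2 : (exp (x + h * q) - exp x) / h - exp x * v =
      exp x * ((exp (h * q) - 1 - h * q) / h + (q - v)) := by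
    rw [exp_add]
    field_simp
    ring
  rw [h2, abs_mul, abs_of_pos (exp_pos x)]
  refine mul_le_mul_of_nonneg_left ((abs_add_le _ _).trans (add_le_add ?_ hq)) (exp_pos x).le
  rw [abs_div, abs_of_pos hh, div_le_iff₀ hh]
  refine h1.trans ?_
  have h3 : q ^ 2 ≤ B ^ 2 := sq_le_sq' (by linarith [(abs_le.1 hB).1]) (abs_le.1 hB).2
  calc (h * q) ^ 2 = h * h * q ^ 2 := by ring
    _ ≤ h * h * B ^ 2 := by gcongr
    _ = _ := by ring

/-- Difference quotients in time approximate the time derivative by solutions. -/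
theorem TimeReg.approxSol {n X a b b' K h₀ M : ℝ} {w wr wrr wt : ℝ → ℝ → ℝ}
    (sol : RadSol n w wr wrr wt (fun t r => exp (w t r)) (Icc a b') X)
    (cont : ContinuousOn (fun p : ℝ × ℝ => w p.1 p.2) (Icc a b' ×ˢ Icc 0 X))
    (hM : ∀ t ∈ Icc a b', ∀ r ∈ Icc 0 X, w t r ≤ M) (hbb : b < b') (hK : 0 < K) (hh : 0 < h₀)
    (reg : TimeReg w wt K h₀ X a b') :
    ApproxSol n wt (fun t r => exp (w t r)) a b X := by
  intro ε hε
  have hlim : Tendsto (fun h : ℝ => exp M * (h * (2 * K) ^ 2 + K * √h)) (𝓝[>] 0) (𝓝 0) := by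
    have : Continuous fun h : ℝ => exp M * (h * (2 * K) ^ 2 + K * √h) := by fun_prop
    simpa using (this.tendsto 0).mono_left nhdsWithin_le_nhds
  have hlim2 : Tendsto (fun h : ℝ => K * √h) (𝓝[>] 0) (𝓝 0) := by
    have : Continuous fun h : ℝ => K * √h := by fun_prop
    simpa using (this.tendsto 0).mono_left nhdsWithin_le_nhds
  have hpos : 0 < min (min h₀ (b' - b)) (1 / (2 * K)) := by
    refine lt_min (lt_min hh (by linarith)) (by positivity)
  obtain ⟨h, ⟨⟨⟨h1, h2⟩, h3⟩, h4⟩⟩ := ((((hlim.eventually_lt_const hε).and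
    (hlim2.eventually_lt_const (lt_min hε hK))).and (Ioo_mem_nhdsGT hpos)).and
    self_mem_nhdsWithin).exists
  have hh0 : (0 : ℝ) < h := h4
  have hhh : h ≤ h₀ := h3.2.le.trans ((min_le_left _ _).trans (min_le_left _ _))
  have hhb : h ≤ b' - b := h3.2.le.trans ((min_le_left _ _).trans (min_le_right _ _))
  have hhK : h * (2 * K) ≤ 1 := by
    have := h3.2.le.trans (min_le_right _ _)
    rwa [le_div_iff₀ (by positivity)] at this
  have hsub : ∀ t ∈ Icc a b, t ∈ Icc a b' := fun t ht => ⟨ht.1, ht.2.trans hbb.le⟩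
  have hadd : ∀ t ∈ Icc a b, t + h ∈ Icc a b' := fun t ht => ⟨by linarith [ht.1], by linarith [ht.2]⟩
  have hmap : ∀ p ∈ Icc a b ×ˢ Ico 0 X, ((p.1 + h, p.2) : ℝ × ℝ) ∈ Icc a b' ×ˢ Ico 0 X :=
    fun p hp => ⟨hadd _ hp.1, hp.2⟩
  have hsubp : Icc a b ×ˢ Ico 0 X ⊆ Icc a b' ×ˢ Ico 0 X := prod_mono hsub le_rfl
  have cont' := cont.mono (prod_mono (le_refl (Icc a b')) Ico_subset_Icc_self)
  have contt := reg.continuousOn hK hh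
  have c1 : ContinuousOn (fun p : ℝ × ℝ => w (p.1 + h) p.2) (Icc a b ×ˢ Ico 0 X) :=
    cont'.comp (f := fun p : ℝ × ℝ => (p.1 + h, p.2)) (by fun_prop) hmap
  have c2 : ContinuousOn (fun p : ℝ × ℝ => wt (p.1 + h) p.2) (Icc a b ×ˢ Ico 0 X) :=
    contt.comp (f := fun p : ℝ × ℝ => (p.1 + h, p.2)) (by fun_prop) hmap
  have key := ((sol.shift h).lin sol h⁻¹ (-h⁻¹)).mono (J := Icc a b)
    (fun t ht => ⟨hadd t ht, hsub t ht⟩) (le_refl X)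
  refine ⟨_, _, _, _, _, key, ?_, ?_, ?_, fun t ht r hr => ?_⟩
  · exact (c1.const_mul _).add ((cont'.mono hsubp).const_mul _)
  · exact (c2.const_mul _).add ((contt.mono hsubp).const_mul _)
  · exact (c1.rexp.const_mul _).add ((cont'.mono hsubp).rexp.const_mul _)
  · have h5 := reg.approx t (hsub t ht) h hh0 hhh r hr
    have h6 := reg.bound t (hsub t ht) r hr
    set q := (w (t + h) r - w t r) / h with hq
    have h7 : w (t + h) r = w t r + h * q := by rw [hq]; field_simp; ring
    have h8 : |q| ≤ 2 * K := by
      have := abs_sub_le q (wt t r) 0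
      simp only [sub_zero] at this
      linarith [h2.trans_le (min_le_right _ _)]
    have h9 := abs_exp_diff_quotient_le (x := w t r) hh0 h5 h8 hhK
    constructor
    · have : h⁻¹ * w (t + h) r + -h⁻¹ * w t r = q := by rw [hq]; field_simp; ring
      rw [this]
      exact h5.trans (h2.le.trans (min_le_left _ _))
    · have : h⁻¹ * exp (w (t + h) r) + -h⁻¹ * exp (w t r) = (exp (w t r + h * q) - exp (w t r)) / h := by
        rw [← h7]
        field_simp
        ring
      rw [this]
      refine h9.trans (le_trans ?_ h1.le)
      gcongr
      exact hM t (hsub t ht) r ⟨hr.1, hr.2.le⟩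

/-- The potential `e^w`, extended as a constant outside `[0, X]`. -/
def expPot (X : ℝ) (w : ℝ → ℝ → ℝ) (t r : ℝ) : ℝ := exp (w t (min r X))

theorem TimeReg.good {n X a b b' K h₀ M : ℝ} {w wr wrr wt : ℝ → ℝ → ℝ} (hX : 0 < X)
    (sol : RadSol n w wr wrr wt (fun t r => exp (w t r)) (Icc a b') X)
    (cont : ContinuousOn (fun p : ℝ × ℝ => w p.1 p.2) (Icc a b' ×ˢ Icc 0 X))
    (hM : ∀ t ∈ Icc a b', ∀ r ∈ Icc 0 X, w t r ≤ M) (hbb : b < b') (hK : 0 < K) (hh : 0 < h₀)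
    (reg : TimeReg w wt K h₀ X a b') :
    Good n (ext X wt) (expPot X w) a b (exp M) ∧ ApproxSol n (ext X wt) (expPot X w) a b X := by
  have hsub : Icc a b ⊆ Icc a b' := Icc_subset_Icc_right hbb.le
  have hmin : ∀ r : ℝ, 0 ≤ r → min r X ∈ Icc 0 X := fun r hr => ⟨le_min hr hX.le, min_le_right _ _⟩
  have hA : ApproxSol n (ext X wt) (expPot X w) a b X :=
    (TimeReg.approxSol sol cont hM hbb hK hh reg).congr (fun t _ r hr => by simp [ext, hr.2])
      fun t _ r hr => by simp [expPot, min_eq_left hr.2.le]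
  refine ⟨⟨(reg.continuousOn_ext hK hh).mono (prod_mono hsub le_rfl), ⟨K, fun t ht r hr => ?_⟩, ?_,
    fun t ht r hr => ?_, fun t ht r hr hv => ⟨X, ?_, hA⟩⟩, hA⟩
  · unfold ext
    split_ifs with h1
    · exact reg.bound t (hsub ht) r ⟨hr, h1⟩
    · simpa using hK.le
  · exact (cont.comp (f := fun p : ℝ × ℝ => (p.1, min p.2 X)) (by fun_prop)
      fun p hp => ⟨hsub hp.1, hmin _ hp.2⟩).rexp
  · rw [expPot, abs_of_pos (exp_pos _)]
    exact exp_le_exp.2 (hM t (hsub ht) _ (hmin r hr))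
  · by_contra hcon
    exact hv (if_neg (by simpa using hcon))

namespace RadialBlowUp

variable {n R T L₀ : ℝ} {w wr wrr wt : ℝ → ℝ → ℝ}

theorem exists_good (h : RadialBlowUp n R T L₀ w wr wrr wt) {a b : ℝ} (ha : 0 < a) (hab : a ≤ b)
    (hb : b < T) : ∃ P, Good n (ext R wt) (expPot R w) a b P ∧
      ApproxSol n (ext R wt) (expPot R w) a b R := by
  set b' := (b + T) / 2 with hb'
  have hsub : ∀ t ∈ Icc a b', t ∈ Ico 0 T := fun t ht => ⟨by linarith [ht.1], by linarith [ht.2]⟩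
  obtain ⟨K, h₀, hK, hh, reg⟩ := h.timeReg (a := a) (b := b') ha (by linarith) (by linarith)
  obtain ⟨M, hM⟩ := isCompact_Icc.bddAbove_image (h.continuousOn_axis.mono hsub)
  exact ⟨exp M, TimeReg.good h.hR
    (h.sol.mono (fun t ht => ⟨by linarith [ht.1], (hsub t ht).2⟩) le_rfl)
    (h.cont.mono (prod_mono hsub le_rfl))
    (fun t ht r hr => (h.peak t (hsub t ht) r hr).trans (hM ⟨t, ht, rfl⟩)) (by linarith) hK hh reg⟩

theorem continuousOn_wt_axis (h : RadialBlowUp n R T L₀ w wr wrr wt) :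
    ContinuousOn (fun t => wt t 0) (Ioo 0 T) := by
  refine fun t ht => ContinuousAt.continuousWithinAt ?_
  obtain ⟨P, hP, -⟩ := h.exists_good (a := t / 2) (b := (t + T) / 2) (by linarith [ht.1])
    (by linarith [ht.1, ht.2]) (by linarith [ht.2])
  have h1 : ContinuousOn (fun t => ext R wt t 0) (Icc (t / 2) ((t + T) / 2)) :=
    hP.cont.comp (f := fun t : ℝ => (t, (0 : ℝ))) (by fun_prop) fun s hs => ⟨hs, le_refl (0 : ℝ)⟩
  have h2 := h1.continuousAt (x := t) (Icc_mem_nhds (by linarith [ht.1]) (by linarith [ht.2]))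
  simpa only [ext, if_pos h.hR] using h2

theorem exists_wt_pos (h : RadialBlowUp n R T L₀ w wr wrr wt) {c : ℝ} (hc0 : 0 < c) (hc : c < T) :
    ∃ t ∈ Ioo c T, 0 < wt t 0 := by
  by_contra! hcon
  have hI : ∀ t ∈ Ioo c T, t ∈ Ioo 0 T := fun t ht => ⟨by linarith [ht.1], ht.2⟩
  have hanti : AntitoneOn (fun s => w s 0) (Ioo c T) := by
    refine antitoneOn_of_deriv_nonpos (convex_Ioo _ _) (fun s hs => ?_) (fun s hs => ?_) fun s hs => ?_
    · exact (h.sol.dt s (hI s hs) 0 ⟨le_rfl, h.hR⟩).continuousAt.continuousWithinAt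
    · rw [interior_Ioo] at hs
      exact (h.sol.dt s (hI s hs) 0 ⟨le_rfl, h.hR⟩).differentiableAt.differentiableWithinAt
    · rw [interior_Ioo] at hs
      rw [(h.sol.dt s (hI s hs) 0 ⟨le_rfl, h.hR⟩).deriv]
      exact hcon s hs
  obtain ⟨t, ht, -, hM⟩ := h.unbounded (w ((c + T) / 2) 0) ((c + T) / 2) (by linarith)
  have := hanti (a := (c + T) / 2) ⟨by linarith, by linarith⟩ (b := t) ⟨by linarith [ht.1], ht.2⟩ ht.1.le
  beta_reduce at this
  linarith

/-- The peak value is eventually nondecreasing, and the number of sign changes of the time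
derivative is eventually bounded. -/
theorem eventually_wt_nonneg (h : RadialBlowUp n R T L₀ w wr wrr wt) :
    ∃ b ∈ Ioo 0 T, ∃ K, (∀ t ∈ Ico b T, 0 ≤ wt t 0) ∧ ∀ t ∈ Ico b T, ¬ HasChain (ext R wt) t K := by
  have hT := h.hT
  obtain ⟨t₁, ht₁, hpos⟩ := h.exists_wt_pos (c := T / 2) (by linarith) (by linarith)
  have ht₁' : t₁ ∈ Ioo 0 T := ⟨by linarith [ht₁.1], ht₁.2⟩
  have hev : ∀ᶠ t in 𝓝 t₁, 0 < wt t 0 :=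
    ((h.continuousOn_wt_axis.continuousAt (Ioo_mem_nhds ht₁'.1 ht₁'.2)).eventually_const_lt hpos)
  obtain ⟨δ, hδ, hball⟩ := Metric.eventually_nhds_iff.1 hev
  set b := min (t₁ + δ / 2) ((t₁ + T) / 2) with hb
  have hb1 : t₁ < b := lt_min (by linarith) (by linarith [ht₁.2])
  have hb2 : b < T := (min_le_right _ _).trans_lt (by linarith [ht₁.2])
  have hb3 : b ≤ t₁ + δ / 2 := min_le_left _ _
  have hvax : ∀ t, ext R wt t 0 = wt t 0 := fun t => if_pos h.hR
  obtain ⟨P, hG, hA⟩ := h.exists_good ht₁'.1 hb1.le hb2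
  obtain ⟨K, hK⟩ := hG.exists_not_hasChain h.hn hb1
    (fun t _ r hr => if_neg (not_lt.2 hr)) hA (fun t ht => by
      rw [hvax]
      refine (hball ?_).ne'
      rw [Real.dist_eq, abs_lt]
      exact ⟨by linarith [ht.1], by linarith [ht.2]⟩)
  have hchain : ∀ t ∈ Ico b T, ¬ HasChain (ext R wt) t K := fun t ht hc => by
    obtain ⟨P', hG', -⟩ := h.exists_good (by linarith [ht₁'.1] : 0 < b) ht.1 ht.2
    exact hK (hG'.chain_back h.hn ht.1 hc)
  have hex : ∃ c ∈ Ico b T, ∀ t ∈ Ioo c T, 0 ≤ wt t 0 := by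
    by_contra! hcon
    have hF : ∀ (i : ℕ) (c : {c // c ∈ Ico b T}), ∃ t ∈ Ioo c.1 T, 0 < (-1 : ℝ) ^ i * wt t 0 := by
      intro i c
      rcases neg_one_pow_eq_or ℝ i with h1 | h1
      · obtain ⟨t, ht, h2⟩ := h.exists_wt_pos (by linarith [c.2.1, ht₁'.1]) c.2.2
        exact ⟨t, ht, by rw [h1]; linarith⟩
      · obtain ⟨t, ht, h2⟩ := hcon c.1 c.2
        exact ⟨t, ht, by rw [h1]; linarith⟩
    choose F hF1 hF2 using hF
    let s : ℕ → {c // c ∈ Ico b T} := fun i => Nat.rec ⟨b, le_rfl, hb2⟩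
      (fun i c => ⟨F i c, c.2.1.trans (hF1 i c).1.le, (hF1 i c).2⟩) i
    have hs : Monotone fun i : ℕ => (s i).1 :=
      monotone_nat_of_le_succ (f := fun i : ℕ => (s i).1) fun i => (hF1 i (s i)).1.le
    obtain ⟨P', hG', -⟩ := h.exists_good (by linarith [ht₁'.1] : 0 < b) (s (K + 1)).2.1 (s (K + 1)).2.2
    refine hK (hG'.chain_of_axis (σ := 1) (s := fun i : ℕ => (s (i + 1)).1) h.hn (fun i hi => ?_)
      (fun i _ => hs (show i + 1 ≤ i + 1 + 1 from Nat.le_succ _)) fun i _ => ?_)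
    · exact ⟨(s (i + 1)).2.1, hs (show i + 1 ≤ K + 1 by omega)⟩
    · rw [hvax, one_mul]
      exact hF2 i (s i)
  obtain ⟨c, hc, hc'⟩ := hex
  have hcT : (c + T) / 2 < T := by linarith [hc.2]
  refine ⟨(c + T) / 2, ⟨by linarith [hc.1, ht₁'.1], hcT⟩, K, fun t ht => hc' t ⟨?_, ht.2⟩,
    fun t ht => hchain t ⟨?_, ht.2⟩⟩
  · linarith [ht.1, hc.2]
  · linarith [ht.1, hc.1, hc.2]

/-- Times around which the peak value is almost constant on a long intrinsic time scale. -/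
theorem exists_center (h : RadialBlowUp n R T L₀ w wr wrr wt) {b : ℝ} (hb : b ∈ Ioo 0 T)
    (hpos : ∀ t ∈ Ico b T, 0 ≤ wt t 0) {k θ t₀ : ℝ} (hk : 0 < k) (hθ : θ ∈ Ioo 0 1) (ht₀ : t₀ < T) :
    ∃ t, max b t₀ < t - k * exp (-w t 0) ∧ t + k * exp (-w t 0) < T ∧
      (∀ s ∈ Icc 0 (t + k * exp (-w t 0)), (1 - θ) * exp (-w t 0) ≤ exp (-w s 0)) ∧
      ∀ s ∈ Icc (t - k * exp (-w t 0)) (t + k * exp (-w t 0)),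
        (1 - θ) * exp (-w s 0) ≤ exp (-w t 0) := by
  set c := max b t₀ with hc
  have hcT : c < T := max_lt hb.2 ht₀
  have hbc : b ≤ c := le_max_left _ _
  have hT := h.hT
  have hmono : MonotoneOn (fun t => w t 0) (Ico b T) := by
    refine monotoneOn_of_deriv_nonneg (convex_Ico _ _)
      (h.continuousOn_axis.mono (Ico_subset_Ico_left hb.1.le)) (fun s hs => ?_) fun s hs => ?_
    all_goals
      rw [interior_Ico] at hs
      have := h.sol.dt s ⟨hb.1.trans hs.1, hs.2⟩ 0 ⟨le_rfl, h.hR⟩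
    · exact this.differentiableAt.differentiableWithinAt
    · rw [this.deriv]
      exact hpos s ⟨hs.1.le, hs.2⟩
  obtain ⟨B, hB⟩ := isCompact_Icc.bddAbove_image
    (h.continuousOn_axis.mono (t := Icc 0 c) fun t ht => ⟨ht.1, ht.2.trans_lt hcT⟩)
  set η := min (θ / (2 * k)) (exp (-B) / T) with hη
  have hη0 : 0 < η := lt_min (div_pos hθ.1 (by positivity)) (by positivity)
  obtain ⟨s, hs, -, hfast⟩ := h.exists_fast (K := 2 / η) (t₀ := 0) (by positivity) hT
  have hfs : exp (-w s 0) < η * (T - s) := by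
    have h1 : 2 * exp (-w s 0) ≤ η * (T - s) := by
      have := mul_le_mul_of_nonneg_left hfast hη0.le
      have e1 : η * (2 / η * exp (-w s 0)) = 2 * exp (-w s 0) := by field_simp
      linarith
    linarith [exp_pos (-w s 0)]
  obtain ⟨T', hT'1, hT'2⟩ := exists_between (show s + exp (-w s 0) / η < T by
    have : exp (-w s 0) / η < T - s := by
      rw [div_lt_iff₀ hη0]
      linarith
    linarith)
  have hfs' : exp (-w s 0) < η * (T' - s) := by
    have : exp (-w s 0) / η < T' - s := by linarith
    rw [div_lt_iff₀ hη0] at this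
    linarith
  have hsT' : s < T' := by
    have : 0 < exp (-w s 0) / η := by positivity
    linarith
  obtain ⟨t, ht, hmax⟩ := isCompact_Icc.exists_isMaxOn (s := Icc 0 T')
    (f := fun t => (T' - t) * exp (w t 0)) ⟨s, hs.1.le, hsT'.le⟩
    (ContinuousOn.mul (by fun_prop) (h.continuousOn_axis.mono fun t ht => ⟨ht.1, ht.2.trans_lt hT'2⟩).rexp)
  have hmax' : ∀ x ∈ Icc 0 T', (T' - x) * exp (w x 0) ≤ (T' - t) * exp (w t 0) := fun x hx => hmax hx
  have hcross : ∀ x ∈ Icc 0 T', (T' - x) * exp (-w t 0) ≤ (T' - t) * exp (-w x 0) := by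
    intro x hx
    have h1 := mul_le_mul_of_nonneg_right (hmax' x hx) (mul_pos (exp_pos (-w x 0)) (exp_pos (-w t 0))).le
    have e1 : (T' - x) * exp (w x 0) * (exp (-w x 0) * exp (-w t 0)) = (T' - x) * exp (-w t 0) *
        (exp (w x 0) * exp (-w x 0)) := by ring
    have e2 : (T' - t) * exp (w t 0) * (exp (-w x 0) * exp (-w t 0)) = (T' - t) * exp (-w x 0) *
        (exp (w t 0) * exp (-w t 0)) := by ring
    rw [e1, e2, ← exp_add, ← exp_add, add_neg_cancel, add_neg_cancel, exp_zero, mul_one, mul_one] at h1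
    exact h1
  set f := exp (-w t 0) with hf
  have hf0 : 0 < f := exp_pos _
  have hft : f < η * (T' - t) := by
    have h1 := hcross s ⟨hs.1.le, hsT'.le⟩
    have hle : 0 ≤ T' - t := by linarith [ht.2]
    have h2 : 0 < T' - t := hle.lt_of_ne fun h0 => by
      rw [← h0, zero_mul] at h1
      nlinarith
    have h3 : (T' - s) * f < (T' - s) * (η * (T' - t)) := by nlinarith
    exact lt_of_mul_lt_mul_left h3 (by linarith)
  have hct : c < t := by
    by_contra! hcon
    have h1 : exp (-B) ≤ f := exp_le_exp.2 (neg_le_neg (hB ⟨t, ⟨ht.1, hcon⟩, rfl⟩))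
    have h2 : η * (T' - t) ≤ exp (-B) / T * T :=
      mul_le_mul (min_le_right _ _) (by linarith [ht.1]) (by linarith [ht.2]) (by positivity)
    rw [div_mul_cancel₀ _ hT.ne'] at h2
    linarith
  have h2k : 2 * k * f < θ * (T' - t) := by
    have h1 : η * (T' - t) ≤ θ / (2 * k) * (T' - t) :=
      mul_le_mul_of_nonneg_right (min_le_left _ _) (by linarith [ht.2])
    have h2 : 2 * k * f < 2 * k * (θ / (2 * k) * (T' - t)) :=
      mul_lt_mul_of_pos_left (hft.trans_le h1) (by positivity)
    have h3 : 2 * k * (θ / (2 * k) * (T' - t)) = θ * (T' - t) := by field_simp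
    linarith
  have htT' : 0 < T' - t := by nlinarith [ht.2]
  have hend : t + 2 * k * f < T' := by nlinarith [hθ.2]
  have hlow : ∀ x ∈ Icc 0 (t + 2 * k * f), (1 - θ) * f ≤ exp (-w x 0) := by
    intro x hx
    have h1 := hcross x ⟨hx.1, by linarith [hx.2]⟩
    have h2 : (T' - t) * ((1 - θ) * f) ≤ (T' - x) * f := by nlinarith [hx.2]
    exact le_of_mul_le_mul_left (h2.trans h1) htT'
  have hup : ∀ x ∈ Ico t T, exp (-w x 0) ≤ f := fun x hx => exp_le_exp.2 (neg_le_neg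
    (hmono ⟨hbc.trans hct.le, by linarith⟩ ⟨hbc.trans (hct.le.trans hx.1), hx.2⟩ hx.1))
  have hkf : 0 < k * f := by positivity
  have hF := hup (t + k * f) ⟨by linarith, by linarith⟩
  have hF' := hlow (t + k * f) ⟨by linarith [ht.1], by linarith⟩
  have hkF := mul_le_mul_of_nonneg_left hF hk.le
  refine ⟨t + k * f, by linarith, by linarith, fun x hx => ?_, fun x hx => ?_⟩
  · exact (mul_le_mul_of_nonneg_left hF (by linarith [hθ.2])).trans (hlow x ⟨hx.1, by linarith [hx.2]⟩)
  · exact (mul_le_mul_of_nonneg_left (hup x ⟨by linarith [hx.1], by linarith [hx.2]⟩)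
      (by linarith [hθ.2])).trans hF'

end RadialBlowUp

/-- Intrinsic rescaling of `w` around the time `t`. -/
def resc (w : ℝ → ℝ → ℝ) (t τ ρ : ℝ) : ℝ :=
  w (t + exp (-w t 0) * τ) (exp (-w t 0 / 2) * ρ) - w t 0

/-- A sequence of solutions on expanding space-time domains with almost vanishing axis values and
uniformly bounded number of sign changes of the time derivative. -/
structure RescaledSeq (n L : ℝ) (K : ℕ) (X : ℕ → ℝ) (W Wr Wrr Wt : ℕ → ℝ → ℝ → ℝ) : Prop where
  core : ∀ i : ℕ, CoreSol n L (W i) (Wr i) (Wrr i) (Wt i) (-((i : ℝ) + 1)) ((i : ℝ) + 1) (X i)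
  width : ∀ i : ℕ, (i : ℝ) + 1 ≤ X i
  axis : ∀ i : ℕ, ∀ τ ∈ Icc (-((i : ℝ) + 1)) (i + 1), |W i τ 0| ≤ 1 / (i + 1)
  chain : ∀ i : ℕ, ∀ τ ∈ Icc (-((i : ℝ) + 1)) (i + 1), ¬ HasChain (ext (X i) (Wt i)) τ K

namespace RadialBlowUp

variable {n R T L₀ : ℝ} {w wr wrr wt : ℝ → ℝ → ℝ}

theorem exists_rescaled (h : RadialBlowUp n R T L₀ w wr wrr wt) {b : ℝ} (hb : b ∈ Ioo 0 T) {K : ℕ}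
    (hpos : ∀ t ∈ Ico b T, 0 ≤ wt t 0) (hK : ∀ t ∈ Ico b T, ¬ HasChain (ext R wt) t K)
    (k : ℝ) (hk : 1 ≤ k) (t₀ : ℝ) (ht₀ : t₀ < T) :
    ∃ t ∈ Ioo t₀ T, 0 < t ∧ ∃ X Wr Wrr Wt, k ≤ X ∧ CoreSol n (2 * exp 1) (resc w t) Wr Wrr Wt (-k) k X ∧
      (∀ τ ∈ Icc (-k) k, |resc w t τ 0| ≤ 1 / k) ∧
      ∀ τ ∈ Icc (-k) k, ¬ HasChain (ext X Wt) τ K := by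
  have hk0 : 0 < k := by linarith
  have hR := h.hR
  set σ := min ((R / k) ^ 2) ((1 / max L₀ 1) ^ 2) with hσ
  have hσ0 : 0 < σ := by
    have : 0 < max L₀ 1 := lt_max_of_lt_right one_pos
    exact lt_min (by positivity) (by positivity)
  obtain ⟨t, h1, h2, h3, h4⟩ := h.exists_center hb hpos (k := k) (θ := 1 - exp (-(1 / k)))
    (t₀ := max t₀ (T - σ)) hk0 ⟨by
      have h1k : 0 < 1 / k := by positivity
      have := exp_lt_one_iff.2 (neg_lt_zero.2 h1k)
      linarith, by linarith [exp_pos (-(1 / k))]⟩ (max_lt ht₀ (by linarith))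
  simp only [sub_sub_cancel] at h3 h4
  set μ := w t 0 with hμ
  set l := exp (-μ / 2) with hl
  have hl0 : 0 < l := exp_pos _
  have hl2 : exp (-μ) = l ^ 2 := by rw [hl, ← exp_nat_mul]; congr 1; push_cast; ring
  have hkf : 0 < k * exp (-μ) := by positivity
  have hbt : b < t - k * exp (-μ) := (le_max_left _ _).trans_lt h1
  have htt : max t₀ (T - σ) < t - k * exp (-μ) := (le_max_right _ _).trans_lt h1
  have ht0 : t₀ < t - k * exp (-μ) := (le_max_left _ _).trans_lt htt
  have htσ : T - σ < t - k * exp (-μ) := (le_max_right _ _).trans_lt htt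
  have hb0 := hb.1
  have htI : t ∈ Ioo 0 T := ⟨by linarith, by linarith⟩
  have hlσ : l ^ 2 < σ := by
    have := h.scale_le htI
    rw [← hμ, hl2] at this
    linarith
  have hlR : l ≤ R / k := by
    refine le_of_lt (lt_of_pow_lt_pow_left₀ 2 (by positivity) (hlσ.trans_le (min_le_left _ _)))
  have hlL : l ≤ 1 / max L₀ 1 := by
    have : 0 < max L₀ 1 := lt_max_of_lt_right one_pos
    refine le_of_lt (lt_of_pow_lt_pow_left₀ 2 (by positivity) (hlσ.trans_le (min_le_right _ _)))
  have hL₀ : L₀ ≤ exp (μ / 2) := by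
    have h5 : 0 < max L₀ 1 := lt_max_of_lt_right one_pos
    have h6 : exp (μ / 2) = 1 / l := by
      rw [hl, one_div, ← exp_neg]; congr 1; ring
    rw [le_div_iff₀ h5] at hlL
    rw [h6, le_div_iff₀ hl0]
    nlinarith [le_max_left L₀ 1]
  have htime : ∀ τ ∈ Icc (-k) k, t + l ^ 2 * τ ∈ Icc (t - k * exp (-μ)) (t + k * exp (-μ)) := by
    intro τ hτ
    rw [hl2]
    constructor <;> nlinarith [hτ.1, hτ.2, sq_nonneg l]
  have htime' : ∀ τ ∈ Icc (-k) k, t + l ^ 2 * τ ∈ Ioo 0 T := fun τ hτ =>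
    ⟨by linarith [(htime τ hτ).1], by linarith [(htime τ hτ).2]⟩
  have hspace : ∀ ρ ∈ Icc 0 (R / l), l * ρ ∈ Icc 0 R := by
    intro ρ hρ
    have := hρ.2
    rw [le_div_iff₀ hl0] at this
    exact ⟨mul_nonneg hl0.le hρ.1, by linarith⟩
  have hup : ∀ s ∈ Icc 0 (t + k * exp (-μ)), w s 0 ≤ μ + 1 / k := by
    intro s hs
    have := h3 s hs
    rw [← exp_add, exp_le_exp] at this
    linarith
  have hlow : ∀ s ∈ Icc (t - k * exp (-μ)) (t + k * exp (-μ)), μ - 1 / k ≤ w s 0 := by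
    intro s hs
    have := h4 s hs
    rw [← exp_add, exp_le_exp] at this
    linarith
  have hk1 : 1 / k ≤ 1 := by rw [div_le_one hk0]; exact hk
  have hW : ∀ τ ρ, resc w t τ ρ = w (t + l ^ 2 * τ) (l * ρ) - μ := fun τ ρ => by
    rw [resc, ← hμ, hl2, hl]
  have hle : ∀ τ ∈ Icc (-k) k, t + l ^ 2 * τ ∈ Icc 0 (t + k * exp (-μ)) := fun τ hτ =>
    ⟨(htime' τ hτ).1.le, (htime τ hτ).2⟩
  have hlip := h.lip (b := t + k * exp (-μ)) (μ := μ + 2) ⟨by linarith [htI.1], h2⟩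
    (fun s hs => by linarith [hup s hs]) (hL₀.trans (exp_le_exp.2 (by linarith)))
  have hsol := (h.sol.rescale hl0 t μ).mono (J := Icc (-k) k) (fun τ hτ => htime' τ hτ) le_rfl
  refine ⟨t, ⟨by linarith, htI.2⟩, htI.1, R / l, (fun τ ρ => l * wr (t + l ^ 2 * τ) (l * ρ)),
    (fun τ ρ => l ^ 2 * wrr (t + l ^ 2 * τ) (l * ρ)), (fun τ ρ => l ^ 2 * wt (t + l ^ 2 * τ) (l * ρ)), ?_,
    ⟨?_, ?_, ?_, ?_, ?_⟩, ?_, ?_⟩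
  rotate_left 1
  · have e1 : resc w t = fun τ ρ => w (t + l ^ 2 * τ) (l * ρ) - μ := by
      ext τ ρ
      exact hW τ ρ
    have e2 : (fun τ ρ => exp (resc w t τ ρ)) = fun τ ρ => l ^ 2 * exp (w (t + l ^ 2 * τ) (l * ρ)) := by
      ext τ ρ
      rw [hW, ← hl2, ← exp_add]
      congr 1
      ring
    rw [e2, e1]
    exact hsol
  · simp only [hW]
    refine ContinuousOn.sub ?_ continuousOn_const
    exact h.cont.comp (f := fun p : ℝ × ℝ => (t + l ^ 2 * p.1, l * p.2)) (by fun_prop)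
      fun p hp => ⟨Ioo_subset_Ico_self (htime' _ hp.1), hspace _ hp.2⟩
  · intro τ hτ ρ hρ
    rw [hW]
    have := h.peak _ (Ioo_subset_Ico_self (htime' τ hτ)) _ (hspace ρ hρ)
    linarith [hup _ (hle τ hτ)]
  · intro τ hτ s hs
    rw [hW, hW, mul_div_cancel₀ _ hl0.ne', h.bdry _ (Ioo_subset_Ico_self (htime' τ hτ)),
      h.bdry _ (Ioo_subset_Ico_self (htime' s hs))]
  · intro τ hτ ρ hρ s hs
    rw [hW, hW, sub_sub_sub_cancel_right]
    refine (hlip _ (hle τ hτ) _ (hspace ρ hρ) _ (hspace s hs)).trans (le_of_eq ?_)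
    rw [← mul_sub, abs_mul, abs_of_pos hl0]
    have : exp ((μ + 2) / 2) * l = exp 1 := by
      rw [hl, ← exp_add]; congr 1; ring
    rw [← this]
    ring
  · intro τ hτ
    rw [hW, mul_zero, abs_le]
    constructor
    · linarith [hlow _ (htime τ hτ)]
    · linarith [hup _ (hle τ hτ)]
  · rintro τ hτ ⟨σ, x, hx1, hx2, hx3⟩
    refine hK (t + l ^ 2 * τ) ⟨by linarith [(htime τ hτ).1], (htime' τ hτ).2⟩
      ⟨σ, fun i => l * x i, fun i hi => mul_nonneg hl0.le (hx1 i hi),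
        fun i hi => mul_lt_mul_of_pos_left (hx2 i hi) hl0, fun i hi => ?_⟩
    have e : ext (R / l) (fun τ ρ => l ^ 2 * wt (t + l ^ 2 * τ) (l * ρ)) τ (x i) =
        l ^ 2 * ext R wt (t + l ^ 2 * τ) (l * x i) := by
      simp only [ext, lt_div_iff₀ hl0, mul_comm (x i) l]
      split_ifs <;> simp
    have := hx3 i hi
    rw [e] at this
    have h8 : 0 < l ^ 2 := by positivity
    have h9 : σ * (-1) ^ i * (l ^ 2 * ext R wt (t + l ^ 2 * τ) (l * x i)) =
      l ^ 2 * (σ * (-1) ^ i * ext R wt (t + l ^ 2 * τ) (l * x i)) := by ring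
    rw [h9] at this
    exact (mul_pos_iff_of_pos_left h8).1 this
  · rw [le_div_iff₀ hl0]
    rw [le_div_iff₀ hk0] at hlR
    linarith

theorem exists_rescaledSeq (h : RadialBlowUp n R T L₀ w wr wrr wt) :
    ∃ ts : ℕ → ℝ, StrictMono ts ∧ (∀ i, ts i ∈ Ioo 0 T) ∧ Tendsto ts atTop (𝓝 T) ∧
      ∃ K X Wr Wrr Wt, RescaledSeq n (2 * exp 1) K X (fun i => resc w (ts i)) Wr Wrr Wt := by
  obtain ⟨b, hb, K, hpos, hK⟩ := h.eventually_wt_nonneg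
  have hex : ∀ (i : ℕ) (c : {c // c < T}), ∃ t, max c.1 (T - 1 / (i + 1)) < t ∧ t < T ∧ 0 < t ∧
      ∃ X Wr Wrr Wt, (i : ℝ) + 1 ≤ X ∧
        CoreSol n (2 * exp 1) (resc w t) Wr Wrr Wt (-((i : ℝ) + 1)) (i + 1) X ∧
      (∀ τ ∈ Icc (-((i : ℝ) + 1)) (i + 1), |resc w t τ 0| ≤ 1 / (i + 1)) ∧
      ∀ τ ∈ Icc (-((i : ℝ) + 1)) (i + 1), ¬ HasChain (ext X Wt) τ K := by
    intro i c
    have hi : (0 : ℝ) < 1 / (i + 1) := by positivity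
    obtain ⟨t, ht, ht', H⟩ := h.exists_rescaled hb hpos hK (i + 1) (by linarith [i.cast_nonneg (α := ℝ)])
      (max c.1 (T - 1 / (i + 1))) (max_lt c.2 (by linarith))
    exact ⟨t, ht.1, ht.2, ht', H⟩
  choose F hF1 hF2 hF3 hF4 using hex
  let s : ℕ → {c // c < T} := fun i => Nat.rec ⟨0, h.hT⟩ (fun i c => ⟨F i c, hF2 i c⟩) i
  choose X Wr Wrr Wt H1 H2 H3 H4 using fun i => hF4 i (s i)
  refine ⟨fun i => F i (s i), strictMono_nat_of_lt_succ fun i => ?_,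
    fun i => ⟨hF3 i _, hF2 i _⟩, ?_, K, X, Wr, Wrr, Wt, ⟨H2, H1, H3, H4⟩⟩
  · exact (le_max_left _ _).trans_lt (hF1 (i + 1) (s (i + 1)))
  · have hlim : Tendsto (fun i : ℕ => T - 1 / ((i : ℝ) + 1)) atTop (𝓝 (T - 0)) :=
      tendsto_const_nhds.sub tendsto_one_div_add_atTop_nhds_zero_nat
    rw [sub_zero] at hlim
    exact tendsto_of_tendsto_of_tendsto_of_le_of_le hlim tendsto_const_nhds
      (fun i => ((le_max_right _ _).trans_lt (hF1 i (s i))).le) fun i => (hF2 i _).le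

end RadialBlowUp

/-- Local bounds and a local parabolic modulus of continuity, uniform along the tail. -/
def LocEquicont (f : ℕ → ℝ → ℝ → ℝ) : Prop :=
  ∀ M : ℝ, ∃ K > 0, ∀ᶠ i in atTop, ∀ t s r x : ℝ, |t| ≤ M → |s| ≤ M → |r| ≤ M → |x| ≤ M →
    |f i t r| ≤ K ∧ (|t - s| ≤ 1 → |f i t r - f i s x| ≤ K * √|t - s| + K * |r - x|)

def LocUnif (f : ℕ → ℝ → ℝ → ℝ) (g : ℝ → ℝ → ℝ) : Prop :=
  ∀ M : ℝ, ∀ ε > 0, ∀ᶠ i in atTop, ∀ t r : ℝ, |t| ≤ M → |r| ≤ M → |f i t r - g t r| ≤ ε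

theorem LocEquicont.comp {f : ℕ → ℝ → ℝ → ℝ} (h : LocEquicont f) {φ : ℕ → ℕ} (hφ : StrictMono φ) :
    LocEquicont (fun i => f (φ i)) := fun M => by
  obtain ⟨K, hK, H⟩ := h M
  exact ⟨K, hK, hφ.tendsto_atTop.eventually H⟩

theorem LocUnif.comp {f : ℕ → ℝ → ℝ → ℝ} {g : ℝ → ℝ → ℝ} (h : LocUnif f g) {φ : ℕ → ℕ}
    (hφ : StrictMono φ) : LocUnif (fun i => f (φ i)) g := fun M ε hε =>
  hφ.tendsto_atTop.eventually (h M ε hε)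

theorem LocUnif.tendsto {f : ℕ → ℝ → ℝ → ℝ} {g : ℝ → ℝ → ℝ} (h : LocUnif f g) (t r : ℝ) :
    Tendsto (fun i => f i t r) atTop (𝓝 (g t r)) := by
  rw [Metric.tendsto_atTop']
  intro ε hε
  obtain ⟨N, hN⟩ := eventually_atTop.1 (h (max |t| |r|) (ε / 2) (half_pos hε))
  refine ⟨N, fun i hi => ?_⟩
  rw [Real.dist_eq]
  exact (hN i hi.le t r (le_max_left _ _) (le_max_right _ _)).trans_lt (half_lt_self hε)

theorem LocEquicont.limit_modulus {f : ℕ → ℝ → ℝ → ℝ} {g : ℝ → ℝ → ℝ} (h : LocEquicont f)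
    (hg : LocUnif f g) (M : ℝ) : ∃ K > 0, ∀ t s r x : ℝ, |t| ≤ M → |s| ≤ M → |r| ≤ M → |x| ≤ M →
    |g t r| ≤ K ∧ (|t - s| ≤ 1 → |g t r - g s x| ≤ K * √|t - s| + K * |r - x|) := by
  obtain ⟨K, hK, H⟩ := h M
  refine ⟨K, hK, fun t s r x ht hs hr hx => ⟨?_, fun hts => ?_⟩⟩
  · exact le_of_tendsto (hg.tendsto t r).abs (H.mono fun i hi => (hi t s r x ht hs hr hx).1)
  · exact le_of_tendsto ((hg.tendsto t r).sub (hg.tendsto s x)).abs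
      (H.mono fun i hi => (hi t s r x ht hs hr hx).2 hts)

theorem LocEquicont.continuous_limit {f : ℕ → ℝ → ℝ → ℝ} {g : ℝ → ℝ → ℝ} (h : LocEquicont f)
    (hg : LocUnif f g) : Continuous fun p : ℝ × ℝ => g p.1 p.2 := by
  rw [continuous_iff_continuousAt]
  intro p
  obtain ⟨K, hK, H⟩ := h.limit_modulus hg (max |p.1| |p.2| + 1)
  have h1 : ContinuousOn (fun p : ℝ × ℝ => g p.1 p.2) {q : ℝ × ℝ | |q.1| ≤ max |p.1| |p.2| + 1 ∧
      |q.2| ≤ max |p.1| |p.2| + 1} :=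
    continuousOn_of_modulus one_pos fun q hq q' hq' hqq =>
      (H _ _ _ _ hq.1 hq'.1 hq.2 hq'.2).2 hqq
  refine h1.continuousAt (mem_of_superset (IsOpen.mem_nhds (s := {q : ℝ × ℝ |
    |q.1| < max |p.1| |p.2| + 1 ∧ |q.2| < max |p.1| |p.2| + 1}) ?_ ?_) fun q hq => ⟨hq.1.le, hq.2.le⟩)
  · exact (isOpen_lt continuous_fst.abs continuous_const).inter
      (isOpen_lt continuous_snd.abs continuous_const)
  · exact ⟨(le_max_left _ _).trans_lt (lt_add_one _), (le_max_right _ _).trans_lt (lt_add_one _)⟩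

theorem LocEquicont.exists_limit {f : ℕ → ℝ → ℝ → ℝ} (h : LocEquicont f) :
    ∃ φ : ℕ → ℕ, StrictMono φ ∧ ∃ g, LocUnif (fun i => f (φ i)) g := by
  let D := ℕ × ℤ × ℤ
  let P : D → ℝ × ℝ := fun d => ((d.2.1 : ℝ) / (d.1 + 1), (d.2.2 : ℝ) / (d.1 + 1))
  have hb : ∀ d : D, ∃ B, ∀ i, |f i (P d).1 (P d).2| ≤ B := by
    intro d
    obtain ⟨K, hK, H⟩ := h (max |(P d).1| |(P d).2|)
    have h1 : IsBoundedUnder (· ≤ ·) atTop fun i => |f i (P d).1 (P d).2| :=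
      ⟨K, eventually_map.2 (H.mono fun i hi => (hi _ 0 _ 0 (le_max_left _ _) (by simp)
        (le_max_right _ _) (by simp)).1)⟩
    obtain ⟨B, hB⟩ := h1.bddAbove_range
    exact ⟨B, fun i => hB ⟨i, rfl⟩⟩
  choose B hB using hb
  obtain ⟨l, -, φ, hφ, hl⟩ := (isCompact_univ_pi fun d => isCompact_Icc (a := -B d) (b := B d)).tendsto_subseq
    (x := fun i d => f i (P d).1 (P d).2) fun i d _ => abs_le.1 (hB d i)
  rw [tendsto_pi_nhds] at hl
  have key : ∀ M : ℝ, 0 ≤ M → ∀ ε > 0, ∃ i₀, ∀ i ≥ i₀, ∀ j ≥ i₀, ∀ t r : ℝ, |t| ≤ M → |r| ≤ M →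
      |f (φ i) t r - f (φ j) t r| ≤ ε := by
    intro M hM ε hε
    obtain ⟨K, hK, H⟩ := h (M + 1)
    have hlim : Tendsto (fun h : ℝ => K * √h + K * h) (𝓝[>] 0) (𝓝 0) := by
      have : Continuous fun h : ℝ => K * √h + K * h := by fun_prop
      simpa using (this.tendsto 0).mono_left nhdsWithin_le_nhds
    have hlim2 : Tendsto (fun k : ℕ => 1 / ((k : ℝ) + 1)) atTop (𝓝[>] 0) :=
      tendsto_nhdsWithin_iff.2 ⟨tendsto_one_div_add_atTop_nhds_zero_nat,
        Eventually.of_forall fun k => by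
          show (0 : ℝ) < _
          positivity⟩
    obtain ⟨k, hk⟩ := ((hlim.comp hlim2).eventually_lt_const (by positivity : 0 < ε / 4)).exists
    simp only [Function.comp] at hk
    set δ := 1 / ((k : ℝ) + 1) with hδ
    have hδ0 : 0 < δ := by positivity
    have hδ1 : δ ≤ 1 := by
      rw [hδ, div_le_one (by positivity)]
      linarith [k.cast_nonneg (α := ℝ)]
    set m : ℤ := ⌈(M + 1) * (k + 1)⌉ with hm
    have hfin : ∀ᶠ i in atTop, ∀ a ∈ Finset.Icc (-m) m, ∀ b ∈ Finset.Icc (-m) m,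
        |f (φ i) (P (k, a, b)).1 (P (k, a, b)).2 - l (k, a, b)| < ε / 8 := by
      rw [eventually_all_finset]
      intro a _
      rw [eventually_all_finset]
      intro b _
      have := (hl (k, a, b))
      rw [Metric.tendsto_nhds] at this
      exact this (ε / 8) (by positivity)
    obtain ⟨i₀, hi₀⟩ := eventually_atTop.1 (hfin.and (hφ.tendsto_atTop.eventually H))
    have hgrid : ∀ t : ℝ, |t| ≤ M → ∃ a ∈ Finset.Icc (-m) m, |t - (a : ℝ) / (k + 1)| ≤ δ ∧
        |(a : ℝ) / (k + 1)| ≤ M + 1 := by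
      intro t ht
      have hk1 : (0 : ℝ) < k + 1 := by positivity
      have h1 := Int.floor_le (t * (k + 1))
      have h2 := Int.lt_floor_add_one (t * (k + 1))
      have h3 : |t - (⌊t * (k + 1)⌋ : ℝ) / (k + 1)| ≤ δ := by
        have : t - (⌊t * (k + 1)⌋ : ℝ) / (k + 1) = (t * (k + 1) - ⌊t * (k + 1)⌋) / (k + 1) := by
          field_simp
        rw [this, abs_of_nonneg (div_nonneg (by linarith) hk1.le), hδ]
        exact div_le_div_of_nonneg_right (by linarith) hk1.le
      have h4 : |(⌊t * (k + 1)⌋ : ℝ) / (k + 1)| ≤ M + 1 := by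
        have := abs_sub_abs_le_abs_sub ((⌊t * (k + 1)⌋ : ℝ) / (k + 1)) t
        rw [abs_sub_comm] at this
        linarith
      refine ⟨⌊t * (k + 1)⌋, ?_, h3, h4⟩
      rw [abs_div, abs_of_pos hk1, div_le_iff₀ hk1] at h4
      have h5 : |((⌊t * (k + 1)⌋ : ℤ) : ℝ)| ≤ (m : ℝ) := h4.trans (Int.le_ceil _)
      rw [abs_le] at h5
      rw [Finset.mem_Icc]
      constructor
      · have := h5.1
        exact_mod_cast this
      · exact_mod_cast h5.2
    refine ⟨i₀, fun i hi j hj t r ht hr => ?_⟩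
    obtain ⟨a, ha, ha1, ha2⟩ := hgrid t ht
    obtain ⟨b, hb, hb1, hb2⟩ := hgrid r hr
    have hmod : ∀ i ≥ i₀, |f (φ i) t r - f (φ i) (P (k, a, b)).1 (P (k, a, b)).2| ≤ ε / 4 := by
      intro i hi
      refine (((hi₀ i hi).2 t _ r _ (by linarith) ha2 (by linarith) hb2).2 (ha1.trans hδ1)).trans ?_
      refine le_trans ?_ hk.le
      gcongr
    have h1 := hmod i hi
    have h2 := hmod j hj
    have h3 := ((hi₀ i hi).1 a ha b hb).le
    have h4 := ((hi₀ j hj).1 a ha b hb).le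
    rw [abs_le] at h1 h2 h3 h4 ⊢
    constructor <;> linarith
  have hlim : ∀ t r : ℝ, ∃ y, Tendsto (fun i => f (φ i) t r) atTop (𝓝 y) := by
    intro t r
    apply cauchySeq_tendsto_of_complete
    rw [Metric.cauchySeq_iff]
    intro ε hε
    obtain ⟨i₀, hi₀⟩ := key (max |t| |r|) ((abs_nonneg t).trans (le_max_left _ _)) (ε / 2) (half_pos hε)
    exact ⟨i₀, fun i hi j hj => (hi₀ i hi j hj t r (le_max_left _ _) (le_max_right _ _)).trans_lt
      (half_lt_self hε)⟩
  choose g hg using hlim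
  refine ⟨φ, hφ, g, fun M ε hε => ?_⟩
  obtain ⟨i₀, hi₀⟩ := key (max M 0) (le_max_right _ _) ε hε
  refine eventually_atTop.2 ⟨i₀, fun i hi t r ht hr => ?_⟩
  exact le_of_tendsto (tendsto_const_nhds.sub (hg t r)).abs (eventually_atTop.2 ⟨i₀, fun j hj =>
    hi₀ i hi j hj t r (ht.trans (le_max_left _ _)) (hr.trans (le_max_left _ _))⟩)

theorem ApproxSol.mono_width {n a b X Y : ℝ} {v pot : ℝ → ℝ → ℝ} (h : ApproxSol n v pot a b X)
    (hY : Y ≤ X) : ApproxSol n v pot a b Y := by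
  intro ε hε
  obtain ⟨q, qr, qrr, qt, g, h1, h2, h3, h4, h5⟩ := h ε hε
  have hsub : Ico 0 Y ⊆ Ico 0 X := Ico_subset_Ico_right hY
  have hsub2 : Icc a b ×ˢ Ico 0 Y ⊆ Icc a b ×ˢ Ico 0 X := prod_mono le_rfl hsub
  exact ⟨q, qr, qrr, qt, g, h1.mono le_rfl hY, h2.mono hsub2, h3.mono hsub2, h4.mono hsub2,
    fun t ht r hr => h5 t ht r (hsub hr)⟩

theorem le_sqrt_of_le_one {x : ℝ} (h0 : 0 ≤ x) (h1 : x ≤ 1) : x ≤ √x :=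
  Real.le_sqrt_of_sq_le (by nlinarith)

/-- Limits of rescaled solutions `w` together with their time derivatives `v`. -/
structure EntireLimit (n : ℝ) (K : ℕ) (w v : ℝ → ℝ → ℝ) : Prop where
  cw : Continuous fun p : ℝ × ℝ => w p.1 p.2
  cv : Continuous fun p : ℝ × ℝ => v p.1 p.2
  w0 : ∀ t, w t 0 = 0
  v0 : ∀ t, v t 0 = 0
  vb : ∃ B, ∀ t r, |v t r| ≤ B
  wle : ∀ t r, w t r ≤ 1
  approx : ∀ a b Y, ApproxSol n v (fun t r => exp (w t r)) a b Y
  deriv : ∃ B > 0, ∀ t r h, 0 ≤ r → 0 < h → h ≤ 1 → |(w (t + h) r - w t r) / h - v t r| ≤ B * √h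
  chain : ∀ t, ¬ HasChain v t K

theorem EntireLimit.good {n : ℝ} {K : ℕ} {w v : ℝ → ℝ → ℝ} (h : EntireLimit n K w v) (a b : ℝ) :
    Good n v (fun t r => exp (w t r)) a b (exp 1) where
  cont := h.cv.continuousOn
  bdd := by
    obtain ⟨B, hB⟩ := h.vb
    exact ⟨B, fun t _ r _ => hB t r⟩
  pcont := (continuous_exp.comp h.cw).continuousOn
  pbdd t _ r _ := by
    rw [abs_of_pos (exp_pos _)]
    exact exp_le_exp.2 (h.wle t r)
  loc t _ r _ _ := ⟨r + 1, lt_add_one r, h.approx a b _⟩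

theorem RescaledSeq.exists_entireLimit {n L : ℝ} {K : ℕ} {X : ℕ → ℝ} {W Wr Wrr Wt : ℕ → ℝ → ℝ → ℝ}
    (hn : 0 ≤ n) (hL : 0 ≤ L) (h : RescaledSeq n L K X W Wr Wrr Wt) :
    ∃ φ : ℕ → ℕ, StrictMono φ ∧ ∃ w v, EntireLimit n K w v ∧
      LocUnif (fun i t r => W (φ i) t |r|) w ∧
      LocUnif (fun i t r => ext (X (φ i)) (Wt (φ i)) t |r|) v := by
  obtain ⟨B, hB, hreg⟩ := CoreSol.timeReg n L hn hL
  have reg : ∀ i : ℕ, TimeReg (W i) (Wt i) B 1 (X i) (-((i : ℝ) + 1) + 3) ((i : ℝ) + 1 - 4) := fun i =>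
    hreg (by linarith [h.width i, i.cast_nonneg (α := ℝ)]) (h.core i)
  have hlarge : ∀ M : ℝ, ∀ᶠ i : ℕ in atTop, M + 6 ≤ i := fun M =>
    tendsto_natCast_atTop_atTop.eventually_ge_atTop _
  have hI : ∀ {M : ℝ} {i : ℕ} {t : ℝ}, M + 6 ≤ i → |t| ≤ M →
      t ∈ Icc (-((i : ℝ) + 1) + 3) ((i : ℝ) + 1 - 4) := fun hi ht =>
    ⟨by linarith [(abs_le.1 ht).1], by linarith [(abs_le.1 ht).2]⟩
  have hJ : ∀ {M : ℝ} {i : ℕ} {t : ℝ}, M + 6 ≤ i → |t| ≤ M →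
      t ∈ Icc (-((i : ℝ) + 1)) ((i : ℝ) + 1) := fun hi ht =>
    ⟨by linarith [(abs_le.1 ht).1], by linarith [(abs_le.1 ht).2]⟩
  have hR : ∀ {M : ℝ} {i : ℕ} {r : ℝ}, M + 6 ≤ i → |r| ≤ M → |r| ∈ Ico 0 (X i) := fun {M i r} hi hr =>
    ⟨abs_nonneg r, by linarith [h.width i]⟩
  have vbd : ∀ {M : ℝ} {i : ℕ} {t : ℝ}, M + 6 ≤ i → |t| ≤ M → ∀ r : ℝ, |ext (X i) (Wt i) t (|r|)| ≤ B := by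
    intro M i t hi ht r
    unfold ext
    split_ifs with hr
    · exact (reg i).bound t (hI hi ht) _ ⟨abs_nonneg r, hr⟩
    · simpa using hB.le
  have eV : LocEquicont fun i t r => ext (X i) (Wt i) t |r| := by
    intro M
    refine ⟨B, hB, (hlarge M).mono fun i hi t s r x ht hs hr hx => ⟨vbd hi ht r, fun hts => ?_⟩⟩
    refine ((reg i).ext_sub_le hB (hI hi ht) (hI hi hs) hts (abs_nonneg r) (abs_nonneg x)).trans ?_
    have := mul_le_mul_of_nonneg_left (abs_abs_sub_abs_le_abs_sub r x) hB.le
    linarith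
  have eW : LocEquicont fun i t r => W i t |r| := by
    intro M
    refine ⟨B + L + 1 + L * |M|, by positivity, (hlarge M).mono fun i hi t s r x ht hs hr hx =>
      ⟨?_, fun hts => ?_⟩⟩
    · have h1 := (h.core i).lip t (hJ hi ht) _ (Ico_subset_Icc_self (hR hi hr)) 0
        ⟨le_rfl, (abs_nonneg r).trans (hR hi hr).2.le⟩
      have h2 := h.axis i t (hJ hi ht)
      have h3 : 1 / ((i : ℝ) + 1) ≤ 1 := by
        rw [div_le_one (by positivity)]
        linarith [i.cast_nonneg (α := ℝ)]
      rw [sub_zero, abs_abs] at h1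
      have h4 := mul_le_mul_of_nonneg_left (hr.trans (le_abs_self M)) hL
      have h5 := abs_sub_abs_le_abs_sub (W i t |r|) (W i t 0)
      linarith
    · have h1 := (h.core i).lip s (hJ hi hs) _ (Ico_subset_Icc_self (hR hi hr)) _
        (Ico_subset_Icc_self (hR hi hx))
      have h2 := (convex_Icc (-((i : ℝ) + 1) + 3) ((i : ℝ) + 1 - 4)).norm_image_sub_le_of_norm_hasDerivWithin_le
        (f := fun t => W i t |r|) (f' := fun t => Wt i t |r|) (C := B)
        (fun y hy => ((h.core i).sol.dt y ⟨by linarith [hy.1], by linarith [hy.2]⟩ _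
          (hR hi hr)).hasDerivWithinAt) (fun y hy => (reg i).bound y hy _ (hR hi hr))
        (hI hi hs) (hI hi ht)
      rw [Real.norm_eq_abs, Real.norm_eq_abs] at h2
      have h3 := mul_le_mul_of_nonneg_left (le_sqrt_of_le_one (abs_nonneg _) hts) hB.le
      have h4 := mul_le_mul_of_nonneg_left (abs_abs_sub_abs_le_abs_sub r x) hL
      have h5 := abs_sub_le (W i t |r|) (W i s |r|) (W i s |x|)
      have h6 : 0 ≤ (L + 1 + L * |M|) * √|t - s| := by positivity
      have h7 : 0 ≤ (B + 1 + L * |M|) * |r - x| := by positivity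
      linarith
  obtain ⟨φ₁, hφ₁, w, hw⟩ := eW.exists_limit
  obtain ⟨φ₂, hφ₂, v, hv⟩ := (eV.comp hφ₁).exists_limit
  have hφ : StrictMono fun i => φ₁ (φ₂ i) := hφ₁.comp hφ₂
  have hlw : LocUnif (fun i t r => W (φ₁ (φ₂ i)) t |r|) w := hw.comp hφ₂
  have hlarge' : ∀ M : ℝ, ∀ᶠ i : ℕ in atTop, M + 6 ≤ (φ₁ (φ₂ i) : ℕ) := fun M =>
    hφ.tendsto_atTop.eventually (hlarge M)
  have cw := (eW.comp hφ).continuous_limit hlw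
  have cv := (eV.comp hφ).continuous_limit hv
  have vb : ∀ t r, |v t r| ≤ B := fun t r =>
    le_of_tendsto (hv.tendsto t r).abs ((hlarge' |t|).mono fun i hi => vbd hi le_rfl r)
  have wle : ∀ t r, w t r ≤ 1 := fun t r =>
    le_of_tendsto (hlw.tendsto t r) ((hlarge' (max |t| |r|)).mono fun i hi =>
      (h.core _).le_one t (hJ hi (le_max_left _ _)) _
        (Ico_subset_Icc_self (hR hi (le_max_right _ _))))
  have w0 : ∀ t, w t 0 = 0 := by
    intro t
    have h1 : Tendsto (fun i => 1 / (((φ₁ (φ₂ i) : ℕ) : ℝ) + 1)) atTop (𝓝 0) :=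
      tendsto_one_div_add_atTop_nhds_zero_nat.comp hφ.tendsto_atTop
    have h2 : Tendsto (fun i => W (φ₁ (φ₂ i)) t |0|) atTop (𝓝 0) :=
      squeeze_zero_norm' ((hlarge' |t|).mono fun i hi => by
        rw [abs_zero]
        exact h.axis _ t (hJ hi le_rfl)) h1
    exact tendsto_nhds_unique (hlw.tendsto t 0) h2
  have hder : ∀ t r k, 0 ≤ r → 0 < k → k ≤ 1 → |(w (t + k) r - w t r) / k - v t r| ≤ B * √k := by
    intro t r k hr hk hk1
    refine le_of_tendsto ((((hlw.tendsto (t + k) r).sub (hlw.tendsto t r)).div_const k).sub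
      (hv.tendsto t r)).abs ((hlarge' (max |t| |r|)).mono fun i hi => ?_)
    have h1 := hR hi (le_max_right |t| |r|)
    have h2 := (reg _).approx t (hI hi (le_max_left _ _)) k hk hk1 _ h1
    rw [ext, if_pos h1.2]
    exact h2
  refine ⟨_, hφ, w, v, ⟨cw, cv, w0, fun t => ?_, ⟨B, vb⟩, wle, fun a b Y => ?_, ⟨B, hB, hder⟩,
    fun t ht => ?_⟩, hlw, hv⟩
  · have h1 : ∀ᶠ k in 𝓝[>] (0 : ℝ), |v t 0| ≤ B * √k := by
      filter_upwards [Ioo_mem_nhdsGT one_pos] with k hk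
      have := hder t 0 k le_rfl hk.1 hk.2.le
      simpa [w0] using this
    have h2 : Tendsto (fun k : ℝ => B * √k) (𝓝[>] 0) (𝓝 0) := by
      have : Continuous fun k : ℝ => B * √k := by fun_prop
      simpa using (this.tendsto 0).mono_left nhdsWithin_le_nhds
    exact abs_nonpos_iff.1 (ge_of_tendsto h2 h1)
  · refine ApproxSol.of_limit fun ε hε => ?_
    set M := max (max |a| |b|) |Y| with hM
    set η := ε / (3 * B + exp 1 + 1) with hη
    have he := exp_pos 1
    have hη0 : 0 < η := by positivity
    have hηε : (3 * B + exp 1 + 1) * η = ε := by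
      rw [hη]
      field_simp
    obtain ⟨i, ⟨hi1, hi2⟩, hi3⟩ := (((hlw M η hη0).and (hv M η hη0)).and (hlarge' M)).exists
    set k := φ₁ (φ₂ i) with hk
    have hab : ∀ t ∈ Icc a b, |t| ≤ M := fun t ht =>
      (abs_le_max_abs_abs ht.1 ht.2).trans (le_max_left _ _)
    have hYr : ∀ r ∈ Ico 0 Y, |r| ≤ M := fun r hr => by
      rw [abs_of_nonneg hr.1]
      exact hr.2.le.trans ((le_abs_self Y).trans (le_max_right _ _))
    have hYX : Y ≤ X k := by
      linarith [h.width k, le_abs_self Y, le_max_right (max |a| |b|) |Y|]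
    have hMk : 0 ≤ M := (abs_nonneg Y).trans (le_max_right _ _)
    have hsub : Icc (-((k : ℝ) + 1) + 3) ((k : ℝ) + 1 - 4) ⊆ Icc (-((k : ℝ) + 1)) ((k : ℝ) + 1) :=
      Icc_subset_Icc (by linarith) (by linarith)
    have hA : ApproxSol n (Wt k) (fun t r => exp (W k t r)) (-((k : ℝ) + 1) + 3) ((k : ℝ) + 1 - 5) (X k) :=
      TimeReg.approxSol ((h.core k).sol.mono hsub le_rfl) ((h.core k).cont.mono (prod_mono hsub le_rfl))
        (fun t ht r hr => (h.core k).le_one t (hsub ht) r hr) (by linarith) hB one_pos (reg k)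
    have haM : |a| ≤ M := (le_max_left _ _).trans (le_max_left _ _)
    have hbM : |b| ≤ M := (le_max_right _ _).trans (le_max_left _ _)
    refine ⟨_, _, (hA.mono (by linarith [(abs_le.1 haM).1]) (by linarith [(abs_le.1 hbM).2])).mono_width hYX,
      fun t ht r hr => ?_⟩
    have h1 := hi1 t r (hab t ht) (hYr r hr)
    have h2 := hi2 t r (hab t ht) (hYr r hr)
    have h3 := (reg k).bound t (hI hi3 (hab t ht)) r ⟨hr.1, hr.2.trans_le hYX⟩
    have h4 := (h.core k).le_one t (hJ hi3 (hab t ht)) r ⟨hr.1, hr.2.le.trans hYX⟩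
    beta_reduce at h1 h2
    rw [abs_of_nonneg hr.1] at h1 h2
    rw [ext, if_pos (hr.2.trans_le hYX)] at h2
    constructor
    · refine h2.trans ?_
      rw [← hηε]
      nlinarith
    · have h5 := exp_lipschitz_of_le_one h4 (wle t r)
      have h6 : exp (w t r) ≤ exp 1 := exp_le_exp.2 (wle t r)
      rw [show exp (W k t r) * Wt k t r - exp (w t r) * v t r =
        (exp (W k t r) - exp (w t r)) * Wt k t r + exp (w t r) * (Wt k t r - v t r) by ring]
      refine (abs_add_le _ _).trans ?_
      rw [abs_mul, abs_mul, abs_of_pos (exp_pos (w t r))]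
      have h7 : |exp (W k t r) - exp (w t r)| * |Wt k t r| ≤ 3 * η * B :=
        mul_le_mul (h5.trans (by linarith)) h3 (abs_nonneg _) (by positivity)
      have h8 : exp (w t r) * |Wt k t r - v t r| ≤ exp 1 * η :=
        mul_le_mul h6 h2 (abs_nonneg _) he.le
      linarith
  · obtain ⟨σ, x, hx1, hx2, hx3⟩ := ht
    have h1 : ∀ᶠ i in atTop, ∀ j ∈ Finset.range K,
        0 < σ * (-1) ^ j * ext (X (φ₁ (φ₂ i))) (Wt (φ₁ (φ₂ i))) t (x j) := by
      rw [eventually_all_finset]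
      intro j hj
      have h2 := (hv.tendsto t (x j)).const_mul (σ * (-1) ^ j)
      rw [abs_of_nonneg (hx1 j (Finset.mem_range.1 hj))] at h2
      exact h2.eventually_const_lt (hx3 j (Finset.mem_range.1 hj))
    obtain ⟨i, hi1, hi2⟩ := (h1.and (hlarge' |t|)).exists
    exact h.chain _ t (hJ hi2 le_rfl) ⟨σ, x, hx1, hx2, fun j hj => hi1 j (Finset.mem_range.2 hj)⟩

/-- A bump supported in an annulus shrinking to a ball. -/
theorem radSol_bump (n X c α d lam : ℝ) (I : Set ℝ) :
    RadSol n (fun t r => c * (exp (-lam * t) * (α - (r ^ 2 - 2 * (n + 1) * (d - t)) ^ 2) ^ 2))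
      (fun t r => c * (exp (-lam * t) * (-8 * (r * ((r ^ 2 - 2 * (n + 1) * (d - t)) *
        (α - (r ^ 2 - 2 * (n + 1) * (d - t)) ^ 2))))))
      (fun t r => c * (exp (-lam * t) * (-8 * ((r ^ 2 - 2 * (n + 1) * (d - t)) *
        (α - (r ^ 2 - 2 * (n + 1) * (d - t)) ^ 2) +
        2 * r ^ 2 * (α - (r ^ 2 - 2 * (n + 1) * (d - t)) ^ 2) -
        4 * r ^ 2 * (r ^ 2 - 2 * (n + 1) * (d - t)) ^ 2))))
      (fun t r => c * (exp (-lam * t) * (-lam * (α - (r ^ 2 - 2 * (n + 1) * (d - t)) ^ 2) ^ 2 -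
        8 * (n + 1) * (r ^ 2 - 2 * (n + 1) * (d - t)) *
        (α - (r ^ 2 - 2 * (n + 1) * (d - t)) ^ 2))))
      (fun t r => c * (exp (-lam * t) * (-lam * (α - (r ^ 2 - 2 * (n + 1) * (d - t)) ^ 2) ^ 2 +
        16 * r ^ 2 * (α - (r ^ 2 - 2 * (n + 1) * (d - t)) ^ 2) -
        32 * r ^ 2 * (r ^ 2 - 2 * (n + 1) * (d - t)) ^ 2))) I X where
  dr t _ r _ := by
    have h1 := ((hasDerivAt_id' r).fun_pow 2).sub_const (2 * (n + 1) * (d - t))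
    have h2 := (((h1.fun_pow 2).const_sub α).fun_pow 2).const_mul (exp (-lam * t))
    refine (h2.const_mul c).congr_deriv ?_
    push_cast
    ring
  drr t _ r _ := by
    have h1 := ((hasDerivAt_id' r).fun_pow 2).sub_const (2 * (n + 1) * (d - t))
    have h2 := (h1.fun_pow 2).const_sub α
    have h3 := (((hasDerivAt_id' r).fun_mul (h1.fun_mul h2)).const_mul (-8)).const_mul (exp (-lam * t))
    refine (h3.const_mul c).congr_deriv ?_
    push_cast
    ring
  dt t _ r _ := by
    have h1 := (((hasDerivAt_id' t).const_sub d).const_mul (2 * (n + 1))).const_sub (r ^ 2)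
    have h2 := ((h1.fun_pow 2).const_sub α).fun_pow 2
    have h3 := ((hasDerivAt_id' t).const_mul (-lam)).exp
    refine ((h3.fun_mul h2).const_mul c).congr_deriv ?_
    push_cast
    ring
  axis t _ := by simp
  eq_pos t _ r hr := by
    have := hr.1.ne'
    field_simp
    ring
  eq_zero t _ _ := by ring

theorem bump_rate_neg {q α lam x X : ℝ} (hq : 0 < q) (hlam : 0 < lam) (hx : 0 ≤ x) (hxX : x ≤ X)
    (hα : 0 < α) (h : lam * α = 96 * X + α) :
    -lam * q ^ 2 + 16 * x * q - 32 * x * (α - q) < 0 := by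
  have h1 := mul_pos hlam (pow_pos hq 2)
  rcases le_total q (α / 2) with h' | h'
  · nlinarith [mul_nonneg hx (sub_nonneg.2 h')]
  · have h2 : 48 * X < lam * q := by nlinarith [mul_nonneg hlam.le (sub_nonneg.2 h')]
    have h3 := mul_lt_mul_of_pos_right h2 hq
    nlinarith [mul_nonneg (sub_nonneg.2 hxX) hq.le, mul_nonneg hx hα.le]

set_option maxHeartbeats 1000000 in
/-- A nonnegative solution vanishing on the axis vanishes near the axis at earlier times. -/
theorem eq_zero_near_axis {n a b ρ : ℝ} {v pot : ℝ → ℝ → ℝ} (hn : 0 ≤ n)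
    (cv : Continuous fun p : ℝ × ℝ => v p.1 p.2) (cp : Continuous fun p : ℝ × ℝ => pot p.1 p.2)
    (hp : ∀ t r, 0 ≤ pot t r) (hA : ∀ a b Y, ApproxSol n v pot a b Y) (h0 : ∀ t, v t 0 = 0)
    (hv : ∀ s ∈ Ioo a b, ∀ r ∈ Ioo 0 ρ, 0 ≤ v s r) {t₁ r₁ : ℝ} (ht₁ : a < t₁)
    (hr₁ : r₁ ∈ Ioo 0 ρ) (hb : t₁ + r₁ ^ 2 / (2 * (n + 1)) < b) : v t₁ r₁ = 0 := by
  have hr0 := hr₁.1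
  set t₂ := t₁ + r₁ ^ 2 / (2 * (n + 1)) with ht₂
  have ht12 : t₁ < t₂ := by
    have : 0 < r₁ ^ 2 / (2 * (n + 1)) := by positivity
    linarith
  have hd : 2 * (n + 1) * (t₂ - t₁) = r₁ ^ 2 := by
    rw [ht₂]
    field_simp
    ring
  refine le_antisymm ?_ (hv t₁ ⟨ht₁, ht12.trans hb⟩ r₁ hr₁)
  by_contra! hpos
  have cv1 : ContinuousAt (fun r => v t₁ r) r₁ := (cv.comp (Continuous.prodMk_right t₁)).continuousAt
  obtain ⟨η₀, hη₀, hball⟩ := Metric.eventually_nhds_iff.1 (cv1.eventually_const_lt (half_lt_self hpos))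
  set η := min (η₀ / 2) ((ρ - r₁) / 2) with hη
  have hη0 : 0 < η := lt_min (half_pos hη₀) (by linarith [hr₁.2])
  have hηρ : r₁ + η < ρ := by linarith [min_le_right (η₀ / 2) ((ρ - r₁) / 2), hr₁.2]
  have hm : ∀ r, |r - r₁| ≤ η → v t₁ r₁ / 2 < v t₁ r := fun r hr =>
    hball (by rw [Real.dist_eq]; linarith [min_le_left (η₀ / 2) ((ρ - r₁) / 2)])
  set α := (η * r₁) ^ 2 with hα
  have hα0 : 0 < α := by positivity
  set q : ℝ → ℝ → ℝ := fun t r => α - (r ^ 2 - 2 * (n + 1) * (t₂ - t)) ^ 2 with hq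
  have cq : Continuous fun p : ℝ × ℝ => q p.1 p.2 := by
    simp only [hq]
    fun_prop
  set lam := 96 * ρ ^ 2 / α + 1 with hlam
  have hρ0 : 0 < ρ := hr0.trans hr₁.2
  have hlam0 : 0 < lam := by positivity
  set c := v t₁ r₁ / 2 / (α ^ 2 * exp (-lam * t₁)) with hc
  have hc0 : 0 < c := by
    have := half_pos hpos
    have := exp_pos (-lam * t₁)
    positivity
  set φ : ℝ → ℝ → ℝ := fun t r => c * (exp (-lam * t) * q t r ^ 2) with hφ
  have cφ : Continuous fun p : ℝ × ℝ => φ p.1 p.2 := by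
    simp only [hφ]
    exact continuous_const.mul ((by fun_prop : Continuous fun p : ℝ × ℝ => exp (-lam * p.1)).mul
      (cq.pow 2))
  have hsmall : ∀ t ∈ Icc t₁ t₂, ∀ r, 0 ≤ r → 0 ≤ q t r → r ≤ r₁ + η := by
    intro t ht r hr hqr
    have h1 : (r ^ 2 - 2 * (n + 1) * (t₂ - t)) ^ 2 ≤ (η * r₁) ^ 2 := by
      simp only [hq] at hqr
      linarith
    have h2 := (abs_le_of_sq_le_sq' h1 (by positivity)).2
    have h3 : 2 * (n + 1) * (t₂ - t) ≤ r₁ ^ 2 := by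
      rw [← hd]
      exact mul_le_mul_of_nonneg_left (by linarith [ht.1]) (by linarith)
    refine le_of_sq_le_sq ?_ (by positivity)
    linarith [mul_pos hη0 hr0, sq_nonneg η]
  set Q : Set (ℝ × ℝ) := (Icc t₁ t₂ ×ˢ Icc 0 (r₁ + η)) ∩ {p | 0 ≤ q p.1 p.2} with hQ
  have hQc : IsCompact Q :=
    (isCompact_Icc.prod isCompact_Icc).inter_right (isClosed_le continuous_const cq)
  have hmem : (t₂, (0 : ℝ)) ∈ Q := by
    refine ⟨⟨⟨ht12.le, le_rfl⟩, ⟨le_rfl, by positivity⟩⟩, ?_⟩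
    show 0 ≤ α - ((0 : ℝ) ^ 2 - 2 * (n + 1) * (t₂ - t₂)) ^ 2
    simpa using hα0.le
  obtain ⟨⟨t₀, r₀⟩, hp₀, hmin⟩ := hQc.exists_isMinOn ⟨_, hmem⟩ (cv.sub cφ).continuousOn
  have hneg : v t₀ r₀ - φ t₀ r₀ < 0 := by
    have h1 : v t₀ r₀ - φ t₀ r₀ ≤ v t₂ 0 - φ t₂ 0 := hmin hmem
    have h2 : 0 < φ t₂ 0 := by
      simp only [hφ, hq]
      have := exp_pos (-lam * t₂)
      have : 0 < α - ((0 : ℝ) ^ 2 - 2 * (n + 1) * (t₂ - t₂)) ^ 2 := by simpa using hα0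
      positivity
    rw [h0] at h1
    linarith
  obtain ⟨⟨ht₀, hr₀⟩, hq₀⟩ := hp₀
  simp only at ht₀ hr₀
  replace hq₀ : 0 ≤ q t₀ r₀ := hq₀
  have hr₀ρ : r₀ < ρ := hr₀.2.trans_lt hηρ
  have hv₀ : 0 ≤ v t₀ r₀ := by
    rcases hr₀.1.eq_or_lt with h | h
    · rw [← h, h0]
    · exact hv t₀ ⟨by linarith [ht₀.1], by linarith [ht₀.2]⟩ r₀ ⟨h, hr₀ρ⟩
  have hqpos : 0 < q t₀ r₀ := by
    refine lt_of_le_of_ne hq₀ fun h => ?_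
    have : φ t₀ r₀ = 0 := by simp [hφ, ← h]
    linarith
  have ht₀1 : t₁ < t₀ := by
    refine lt_of_le_of_ne ht₀.1 fun h => ?_
    subst h
    have h1 : (r₀ ^ 2 - r₁ ^ 2) ^ 2 ≤ (η * r₁) ^ 2 := by
      simp only [hq, hd] at hqpos
      linarith
    have h2 := abs_le_of_sq_le_sq h1 (by positivity)
    have h3 : |r₀ - r₁| ≤ η := by
      have h4 : |r₀ ^ 2 - r₁ ^ 2| = |r₀ - r₁| * (r₀ + r₁) := by
        rw [show r₀ ^ 2 - r₁ ^ 2 = (r₀ - r₁) * (r₀ + r₁) by ring, abs_mul,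
          abs_of_nonneg (by linarith [hr₀.1] : 0 ≤ r₀ + r₁)]
      have h5 : |r₀ - r₁| * r₁ ≤ η * r₁ := by
        have := mul_nonneg (abs_nonneg (r₀ - r₁)) hr₀.1
        linarith
      exact le_of_mul_le_mul_right h5 hr0
    have h6 := hm r₀ h3
    have h7 : q t₁ r₀ ≤ α := by
      simp only [hq]
      linarith [sq_nonneg (r₀ ^ 2 - 2 * (n + 1) * (t₂ - t₁))]
    have h8 : φ t₁ r₀ ≤ v t₁ r₁ / 2 := by
      have he := exp_pos (-lam * t₁)
      calc φ t₁ r₀ = c * (exp (-lam * t₁) * q t₁ r₀ ^ 2) := rfl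
        _ ≤ c * (exp (-lam * t₁) * α ^ 2) := by gcongr
        _ = v t₁ r₁ / 2 := by
          rw [hc]
          field_simp
    linarith
  have hsub := (radSol_bump n ρ c α t₂ lam (Icc t₁ t₂)).neg
  have hvis := ApproxSol.viscosity (t₀ := t₀) (r₀ := r₀) hn (hA t₁ t₂ ρ).neg hsub
    (by fun_prop) (by fun_prop) cv.neg.continuousOn cp.continuousOn ⟨ht₀1, ht₀.2⟩ ⟨hr₀.1, hr₀ρ⟩ ?_
  · set s := r₀ ^ 2 - 2 * (n + 1) * (t₂ - t₀) with hs
    have hqs : q t₀ r₀ = α - s ^ 2 := rfl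
    have h1 : 0 ≤ pot t₀ r₀ * v t₀ r₀ := mul_nonneg (hp _ _) hv₀
    have h2 : 0 ≤ c * (exp (-lam * t₀) * (-lam * (α - s ^ 2) ^ 2 + 16 * r₀ ^ 2 * (α - s ^ 2) -
        32 * r₀ ^ 2 * s ^ 2)) := by linarith
    have h3 := nonneg_of_mul_nonneg_right (nonneg_of_mul_nonneg_right h2 hc0) (exp_pos _)
    have hs2 : s ^ 2 = α - q t₀ r₀ := by rw [hqs]; ring
    rw [← hqs, hs2] at h3
    have hrρ : r₀ ^ 2 ≤ ρ ^ 2 := pow_le_pow_left₀ hr₀.1 hr₀ρ.le 2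
    have hlα : lam * α = 96 * ρ ^ 2 + α := by
      rw [hlam]
      field_simp
    exact (bump_rate_neg hqpos hlam0 (sq_nonneg r₀) hrρ hα0 hlα).not_ge h3
  · obtain ⟨δ, hδ, hnear⟩ := Metric.eventually_nhds_iff.1
      ((cq.continuousAt (x := (t₀, r₀))).eventually_const_lt hqpos)
    refine ⟨δ, hδ, fun t ht r hr h1 h2 => ?_⟩
    have h3 : 0 < q t r := @hnear (t, r) (by
      rw [Prod.dist_eq, max_lt_iff, Real.dist_eq, Real.dist_eq]
      refine ⟨?_, h2⟩
      rw [abs_sub_comm, abs_of_nonneg (by linarith [ht.2])]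
      exact h1)
    have htI : t ∈ Icc t₁ t₂ := ⟨ht.1, ht.2.trans ht₀.2⟩
    have h4 : (t, r) ∈ Q := ⟨⟨htI, ⟨hr.1, hsmall t htI r hr.1 h3.le⟩⟩, h3.le⟩
    have h5 : v t₀ r₀ - φ t₀ r₀ ≤ v t r - φ t r := hmin h4
    simp only [hφ, hq] at h5
    linarith

/-- Solutions vanishing near the axis are nonpositive. -/
theorem nonpos_of_eq_zero_near_axis {n a b ρ : ℝ} {v pot : ℝ → ℝ → ℝ} (hρ : 0 < ρ)
    (cv : Continuous fun p : ℝ × ℝ => v p.1 p.2) (cp : Continuous fun p : ℝ × ℝ => pot p.1 p.2)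
    (hA : ∀ a b Y, ApproxSol n v pot a b Y)
    (hv : ∀ s ∈ Icc a b, ∀ r ∈ Icc 0 ρ, v s r = 0) {t₁ r₁ : ℝ} (ht₁ : t₁ ∈ Ioo a b)
    (hr₁ : 0 ≤ r₁) : v t₁ r₁ ≤ 0 := by
  by_contra! hpos
  have hρr : ρ < r₁ := by
    by_contra hcon
    rw [hv t₁ (Ioo_subset_Icc_self ht₁) r₁ ⟨hr₁, not_lt.1 hcon⟩] at hpos
    exact lt_irrefl _ hpos
  set c := ρ / 2 with hc
  set d := r₁ + 1 with hd
  have hc0 : 0 < c := half_pos hρ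
  set z : ℝ → ℝ → ℝ := fun t x => x ^ (n / 2) * v t x with hz
  set p : ℝ → ℝ → ℝ := fun t x => pot t x - n / 2 * (n / 2 - 1) / x ^ 2 with hp
  have hpos' : ∀ x, c ≤ x → 0 < x := fun x hx => hc0.trans_le hx
  have cz : ContinuousOn (fun q : ℝ × ℝ => z q.1 q.2) (Icc a b ×ˢ Icc c d) :=
    (continuousOn_snd.rpow_const fun q hq => Or.inl (hpos' _ hq.2.1).ne').mul cv.continuousOn
  have cp' : ContinuousOn (fun q : ℝ × ℝ => p q.1 q.2) (Icc a b ×ˢ Icc c d) :=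
    cp.continuousOn.sub (continuousOn_const.div (by fun_prop)
      fun q hq => pow_ne_zero _ (hpos' _ hq.2.1).ne')
  have hmap : MapsTo (fun q : ℝ × ℝ => (q.1, -q.2)) (Icc a b ×ˢ Icc (-d) (-c))
    (Icc a b ×ˢ Icc c d) := fun q hq =>
      ⟨hq.1, ⟨by linarith [hq.2.2], by linarith [hq.2.1]⟩⟩
  have hcts : ContinuousOn (fun q : ℝ × ℝ => (q.1, -q.2)) (Icc a b ×ˢ Icc (-d) (-c)) := by fun_prop
  have cz2 := cz.comp hcts hmap
  have cp2 := cp'.comp hcts hmap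
  have hcomp : IsCompact (Icc a b ×ˢ Icc (-d) (-c)) := isCompact_Icc.prod isCompact_Icc
  obtain ⟨M, hM⟩ := hcomp.exists_bound_of_continuousOn cz2
  obtain ⟨P, hP⟩ := hcomp.exists_bound_of_continuousOn cp2
  simp only [Function.comp, Real.norm_eq_abs, Prod.forall] at hM hP
  have hM0 : 0 ≤ M := (abs_nonneg _).trans (hM t₁ (-r₁) ⟨Ioo_subset_Icc_self ht₁, by
    constructor <;> linarith⟩)
  have hm0 : 0 < z t₁ r₁ := mul_pos (Real.rpow_pos_of_pos (hρ.trans hρr) _) hpos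
  have hzc : ContinuousAt (fun q : ℝ × ℝ => z q.1 q.2) (t₁, r₁) :=
    (continuousAt_snd.rpow_const (Or.inl (hρ.trans hρr).ne')).mul cv.continuousAt
  obtain ⟨δ, hδ, hnear⟩ := Metric.eventually_nhds_iff.1 (hzc.eventually_const_lt (half_lt_self hm0))
  obtain ⟨ε, hε, huc⟩ := box_unique_continuation (a := a) (b := b) (c := -d) (d := -c) (X := -ρ)
    (t₁ := t₁) (ξ := -r₁) (ρ := δ / 2) (m := z t₁ r₁ / 2) (M := M) (P := P)
    (p := fun t x => p t (-x)) ht₁ ⟨by linarith, by linarith⟩ (by linarith) (half_pos hδ)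
    (half_pos hm0) hM0 cp2 (fun s hs y hy => hP s y ⟨hs, hy⟩)
  have hab : a ≤ b := (ht₁.1.trans ht₁.2).le
  refine huc (fun t x => z t (-x)) cz2 (fun s hs y hy => hM s y ⟨hs, hy⟩) (fun s hs y hy => ?_)
    (((hA a b (d + 1)).approxBox hc0 (lt_add_one d)).reflect.weakSol hab (by linarith) cp2 hε.le)
    fun s _ y _ h1 h2 => ?_
  · simp only [hz]
    rw [hv s hs (-y) ⟨by linarith [hy.2], by linarith [hy.1]⟩, mul_zero]
  · refine (@hnear (s, -y) ?_).le
    rw [Prod.dist_eq, max_lt_iff, Real.dist_eq, Real.dist_eq]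
    refine ⟨by linarith, ?_⟩
    rw [← abs_neg, show -(-y - r₁) = y - -r₁ by ring]
    linarith

theorem exists_time_eq_zero {n a b ρ : ℝ} {v pot : ℝ → ℝ → ℝ} (hn : 0 ≤ n) (hab : a < b) (hρ : 0 < ρ)
    (cv : Continuous fun p : ℝ × ℝ => v p.1 p.2) (cp : Continuous fun p : ℝ × ℝ => pot p.1 p.2)
    (hp : ∀ t r, 0 ≤ pot t r) (hA : ∀ a b Y, ApproxSol n v pot a b Y) (h0 : ∀ t, v t 0 = 0)
    (hv : ∀ s ∈ Ioo a b, ∀ r ∈ Ioo 0 ρ, 0 ≤ v s r) : ∃ s ∈ Ioo a b, ∀ r, 0 ≤ r → v s r = 0 := by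
  set δ := (b - a) / 4 with hδ
  have hδ0 : 0 < δ := by linarith
  set r₀ := min (min (ρ / 2) 1) δ with hr₀
  have hr0 : 0 < r₀ := by positivity
  have hrρ : r₀ ≤ ρ / 2 := (min_le_left _ _).trans (min_le_left _ _)
  have hr1 : r₀ ≤ 1 := (min_le_left _ _).trans (min_le_right _ _)
  have hrδ : r₀ ≤ δ := min_le_right _ _
  have hz : ∀ s ∈ Icc (a + δ) (a + 3 * δ), ∀ r ∈ Icc 0 r₀, v s r = 0 := by
    intro s hs r hr
    rcases hr.1.eq_or_lt with h | h
    · rw [← h, h0]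
    · refine eq_zero_near_axis hn cv cp hp hA h0 hv (by linarith [hs.1]) ⟨h, by linarith [hr.2]⟩ ?_
      have h1 : r ^ 2 / (2 * (n + 1)) < δ := by
        rw [div_lt_iff₀ (by positivity)]
        have h2 : r ^ 2 ≤ δ * 1 := by
          rw [sq]
          exact mul_le_mul (by linarith [hr.2]) (by linarith [hr.2]) hr.1 hδ0.le
        nlinarith
      linarith [hs.2]
  refine ⟨a + 2 * δ, ⟨by linarith, by linarith⟩, fun r hr => ?_⟩
  have ht : a + 2 * δ ∈ Ioo (a + δ) (a + 3 * δ) := ⟨by linarith, by linarith⟩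
  have h1 := nonpos_of_eq_zero_near_axis hr0 cv cp hA hz ht hr
  have h2 := nonpos_of_eq_zero_near_axis (v := fun t r => - v t r) hr0 cv.neg cp
    (fun a b Y => (hA a b Y).neg) (fun s hs r hr => by rw [hz s hs r hr, neg_zero]) ht hr
  linarith

theorem EntireLimit.eq_zero {n : ℝ} {K : ℕ} {w v : ℝ → ℝ → ℝ} (hn : 0 ≤ n)
    (h : EntireLimit n K w v) (t r : ℝ) (hr : 0 ≤ r) : v t r = 0 := by
  have key : ∀ a b, a < b → ∃ s ∈ Ioo a b, ∀ r, 0 ≤ r → v s r = 0 := by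
    intro a b hab
    have cp : Continuous fun p : ℝ × ℝ => exp (w p.1 p.2) := continuous_exp.comp h.cw
    by_cases hboth : ∀ t ∈ Ioc a b, ∀ ρ > 0, ∀ τ : ℝ, τ = 1 ∨ τ = -1 →
      ∃ s ∈ Ioo a t, ∃ r ∈ Ioo 0 ρ, 0 < τ * v s r
    · exact absurd ((h.good a b).chain_of_both_signs hn hab (fun t _ => h.v0 t) hboth K) (h.chain a)
    · push Not at hboth
      obtain ⟨t, ht, ρ, hρ, τ, hτ, hs⟩ := hboth
      have hsub : ∀ s ∈ Ioo a t, s ∈ Ioo a b := fun s hs => ⟨hs.1, hs.2.trans_le ht.2⟩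
      rcases hτ with rfl | rfl
      · obtain ⟨s, hs1, hs2⟩ := exists_time_eq_zero (v := fun t r => - v t r) (pot := fun t r => exp (w t r)) hn ht.1 hρ h.cv.neg cp
          (fun _ _ => (exp_pos _).le) (fun a b Y => (h.approx a b Y).neg)
          (fun t => by rw [h.v0, neg_zero]) (fun s hs' r hr => by linarith [hs s hs' r hr])
        exact ⟨s, hsub s hs1, fun r hr => neg_eq_zero.1 (hs2 r hr)⟩
      · obtain ⟨s, hs1, hs2⟩ := exists_time_eq_zero (pot := fun t r => exp (w t r)) hn ht.1 hρ h.cv cp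
          (fun _ _ => (exp_pos _).le) h.approx h.v0 (fun s hs' r hr => by linarith [hs s hs' r hr])
        exact ⟨s, hsub s hs1, hs2⟩
  have hclosed : IsClosed {t | v t r = 0} :=
    isClosed_eq (h.cv.comp (Continuous.prodMk_left r)) continuous_const
  have hdense : Dense {t | v t r = 0} := dense_of_exists_between fun a b hab => by
    obtain ⟨s, hs1, hs2⟩ := key a b hab
    exact ⟨s, hs2 r hr, hs1⟩
  have : t ∈ closure {t | v t r = 0} := hdense t
  rwa [hclosed.closure_eq] at this

/-- Entire limits are stationary. -/
theorem EntireLimit.stationary {n : ℝ} {K : ℕ} {w v : ℝ → ℝ → ℝ} (hn : 0 ≤ n)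
    (h : EntireLimit n K w v) (t r : ℝ) (hr : 0 ≤ r) : w t r = w 0 r := by
  obtain ⟨B, hB, hd⟩ := h.deriv
  have cw : Continuous fun t => w t r := h.cw.comp (Continuous.prodMk_left r)
  have hder : ∀ t, HasDerivWithinAt (fun t => w t r) 0 (Ici t) t := by
    intro t
    rw [hasDerivWithinAt_iff_tendsto_slope, Ici_sdiff_left]
    have hlim : Tendsto (fun s : ℝ => B * √(s - t)) (𝓝[>] t) (𝓝 0) := by
      have : Continuous fun s : ℝ => B * √(s - t) := by fun_prop
      simpa using (this.tendsto t).mono_left nhdsWithin_le_nhds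
    refine squeeze_zero_norm' ?_ hlim
    filter_upwards [Ioo_mem_nhdsGT (lt_add_one t)] with s hs
    have := hd t r (s - t) hr (by linarith [hs.1]) (by linarith [hs.2])
    rw [h.eq_zero hn t r hr, sub_zero, add_sub_cancel] at this
    rw [Real.norm_eq_abs, slope_def_field]
    exact this
  have hc : ∀ a b, a ≤ b → w b r = w a r := fun a b hab =>
    constant_of_has_deriv_right_zero cw.continuousOn (fun x _ => hder x) b ⟨hab, le_rfl⟩
  rcases le_total 0 t with h' | h'
  · exact hc 0 t h'
  · exact (hc t 0 h').symm

theorem radial_le_of_lap_le {n ε Y : ℝ} {D D' D'' : ℝ → ℝ} (hn : 0 ≤ n) (hε : 0 ≤ ε)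
    (h1 : ∀ r ∈ Ico 0 Y, HasDerivAt D (D' r) r) (h2 : ∀ r ∈ Ioo 0 Y, HasDerivAt D' (D'' r) r)
    (hc : ContinuousOn D' (Ico 0 Y)) (h0 : D' 0 = 0)
    (hle : ∀ r ∈ Ioo 0 Y, D'' r + n / r * D' r ≤ ε) {r : ℝ} (hr : r ∈ Ico 0 Y) :
    D r - D 0 ≤ ε * r ^ 2 := by
  have hD' : ∀ s ∈ Ico 0 Y, D' s ≤ ε * s := by
    intro s hs
    rcases hs.1.eq_or_lt with h | hs0
    · rw [← h, h0, mul_zero]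
    have hanti : AntitoneOn (fun x => x ^ n * (D' x - ε * x)) (Icc 0 s) := by
      refine antitoneOn_of_hasDerivWithinAt_nonpos (convex_Icc 0 s)
        (f' := fun x => n * x ^ (n - 1) * (D' x - ε * x) + x ^ n * (D'' x - ε)) ?_ ?_ ?_
      · exact (Real.continuous_rpow_const hn).continuousOn.mul
          ((hc.mono fun x hx => ⟨hx.1, hx.2.trans_lt hs.2⟩).sub (by fun_prop))
      · intro x hx
        rw [interior_Icc] at hx
        have h3 := (h2 x ⟨hx.1, hx.2.trans hs.2⟩).fun_sub ((hasDerivAt_id' x).const_mul ε)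
        have h4 := (Real.hasDerivAt_rpow_const (p := n) (Or.inl hx.1.ne')).fun_mul h3
        rw [mul_one] at h4
        exact h4.hasDerivWithinAt
      · intro x hx
        rw [interior_Icc] at hx
        have h3 := hle x ⟨hx.1, hx.2.trans hs.2⟩
        have h4 : n * x ^ (n - 1) * (D' x - ε * x) + x ^ n * (D'' x - ε) =
            x ^ n * (D'' x + n / x * D' x - ε - n * ε) := by
          rw [Real.rpow_sub_one hx.1.ne']
          have := hx.1.ne'
          field_simp
          ring
        rw [h4]
        exact mul_nonpos_of_nonneg_of_nonpos (Real.rpow_nonneg hx.1.le _)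
          (by linarith [mul_nonneg hn hε])
    have h3 : s ^ n * (D' s - ε * s) ≤ 0 ^ n * (D' 0 - ε * 0) :=
      hanti ⟨le_rfl, hs0.le⟩ ⟨hs0.le, le_rfl⟩ hs0.le
    rw [h0, mul_zero, sub_zero, mul_zero] at h3
    exact sub_nonpos.1 (nonpos_of_mul_nonpos_right h3 (Real.rpow_pos_of_pos hs0 _))
  have hanti : AntitoneOn (fun x => D x - ε * x ^ 2) (Icc 0 r) := by
    refine antitoneOn_of_hasDerivWithinAt_nonpos (convex_Icc 0 r)
      (f' := fun x => D' x - ε * (2 * x)) ?_ ?_ ?_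
    · exact fun x hx => ((h1 x ⟨hx.1, hx.2.trans_lt hr.2⟩).continuousAt.sub
        (by fun_prop)).continuousWithinAt
    · intro x hx
      rw [interior_Icc] at hx
      refine ((h1 x ⟨hx.1.le, hx.2.trans hr.2⟩).fun_sub
        (((hasDerivAt_pow 2 x).const_mul ε).congr_deriv ?_)).hasDerivWithinAt
      norm_num
    · intro x hx
      rw [interior_Icc] at hx
      have := hD' x ⟨hx.1.le, hx.2.trans hr.2⟩
      linarith [mul_nonneg hε hx.1.le]
  have h3 : D r - ε * r ^ 2 ≤ D 0 - ε * 0 ^ 2 := hanti ⟨le_rfl, hr.1⟩ ⟨hr.1, le_rfl⟩ hr.1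
  linarith

theorem radial_abs_le_of_lap_le {n ε Y : ℝ} {D D' D'' : ℝ → ℝ} (hn : 0 ≤ n) (hε : 0 ≤ ε)
    (h1 : ∀ r ∈ Ico 0 Y, HasDerivAt D (D' r) r) (h2 : ∀ r ∈ Ioo 0 Y, HasDerivAt D' (D'' r) r)
    (hc : ContinuousOn D' (Ico 0 Y)) (h0 : D' 0 = 0)
    (hle : ∀ r ∈ Ioo 0 Y, |D'' r + n / r * D' r| ≤ ε) {r : ℝ} (hr : r ∈ Ico 0 Y) :
    |D r - D 0| ≤ ε * r ^ 2 := by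
  refine abs_le.2 ⟨?_, radial_le_of_lap_le hn hε h1 h2 hc h0 (fun r hr => (abs_le.1 (hle r hr)).2) hr⟩
  have := radial_le_of_lap_le (D := fun r => - D r) hn hε (fun r hr => (h1 r hr).fun_neg)
    (fun r hr => (h2 r hr).fun_neg) hc.neg (neg_eq_zero.2 h0)
    (fun r hr => by linarith [(abs_le.1 (hle r hr)).1]) hr
  linarith

/-- The radial Poisson equation on the half line. -/
theorem exists_radial_poisson {n : ℝ} (hn : 0 ≤ n) {q : ℝ → ℝ} (hq : Continuous q) :
    ∃ Ψ Ψ' : ℝ → ℝ, Ψ 0 = 0 ∧ Ψ' 0 = 0 ∧ Continuous Ψ' ∧ (∀ r, HasDerivAt Ψ (Ψ' r) r) ∧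
      ∀ r, 0 < r → HasDerivAt Ψ' (-q r - n / r * Ψ' r) r := by
  set f : ℝ → ℝ := fun s => s ^ n * q s with hf
  have cf : Continuous f := (Real.continuous_rpow_const hn).mul hq
  set Ψ' : ℝ → ℝ := fun r => -(r * ∫ s in (0:ℝ)..1, s ^ n * q (r * s)) with hΨ'
  have cΨ' : Continuous Ψ' := by
    refine (continuous_id.mul ?_).neg
    refine intervalIntegral.continuous_parametric_intervalIntegral_of_continuous' ?_ _ _
    exact ((Real.continuous_rpow_const hn).comp continuous_snd).mul
      (hq.comp (continuous_fst.mul continuous_snd))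
  refine ⟨fun r => ∫ s in (0:ℝ)..r, Ψ' s, Ψ', intervalIntegral.integral_same, by simp [hΨ'], cΨ',
    fun r => cΨ'.integral_hasStrictDerivAt 0 r |>.hasDerivAt, fun r hr => ?_⟩
  have heq : ∀ x, 0 < x → Ψ' x = -(x ^ (-n) * ∫ s in (0:ℝ)..x, f s) := by
    intro x hx
    have h1 : x * (∫ s in (0:ℝ)..1, f (x * s)) = ∫ s in (0:ℝ)..x, f s := by
      simp
    have h2 : ∫ s in (0:ℝ)..1, f (x * s) = x ^ n * ∫ s in (0:ℝ)..1, s ^ n * q (x * s) := by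
      rw [← intervalIntegral.integral_const_mul]
      refine intervalIntegral.integral_congr fun s hs => ?_
      rw [uIcc_of_le zero_le_one] at hs
      simp only [hf]
      rw [Real.mul_rpow hx.le hs.1, mul_assoc]
    have h3 : x ^ (-n) * x ^ n = 1 := by rw [← Real.rpow_add hx, neg_add_cancel, Real.rpow_zero]
    rw [← h1, h2, hΨ']
    linear_combination (x * ∫ s in (0:ℝ)..1, s ^ n * q (x * s)) * h3
  have hF := (cf.integral_hasStrictDerivAt 0 r).hasDerivAt
  have h4 := ((Real.hasDerivAt_rpow_const (p := -n) (Or.inl hr.ne')).fun_mul hF).fun_neg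
  refine (h4.congr_of_eventuallyEq ?_).congr_deriv ?_
  · filter_upwards [Ioi_mem_nhds hr] with x hx using heq x hx
  · have h3 : r ^ (-n) * r ^ n = 1 := by rw [← Real.rpow_add hr, neg_add_cancel, Real.rpow_zero]
    rw [heq r hr, Real.rpow_sub_one hr.ne']
    simp only [hf]
    linear_combination (-q r) * h3

/-- The limit profile of a rescaled sequence solves the stationary equation. -/
theorem RescaledSeq.exists_profile {n L : ℝ} {K : ℕ} {X : ℕ → ℝ} {W Wr Wrr Wt : ℕ → ℝ → ℝ → ℝ}
    (hn : 0 ≤ n) (h : RescaledSeq n L K X W Wr Wrr Wt) {φ : ℕ → ℕ} (hφ : StrictMono φ)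
    {w v : ℝ → ℝ → ℝ} (hE : EntireLimit n K w v)
    (hw : LocUnif (fun i t r => W (φ i) t |r|) w)
    (hv : LocUnif (fun i t r => ext (X (φ i)) (Wt (φ i)) t |r|) v) :
    ∃ Ψ Ψ' : ℝ → ℝ, Ψ 0 = 0 ∧ Ψ' 0 = 0 ∧ (∀ r, HasDerivAt Ψ (Ψ' r) r) ∧
      (∀ r, 0 < r → HasDerivAt Ψ' (-exp (Ψ r) - n / r * Ψ' r) r) ∧
      ∀ t r, 0 ≤ r → w t r = Ψ r := by
  have cq : Continuous fun r => exp (w 0 r) :=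
    continuous_exp.comp (hE.cw.comp (Continuous.prodMk_right 0))
  obtain ⟨Ψ, Ψ', hΨ0, hΨ'0, cΨ', hΨ, hΨ'⟩ := exists_radial_poisson hn cq
  have hprof : ∀ r, 0 ≤ r → w 0 r = Ψ r := by
    intro r hr
    have key : ∀ ε > 0, |w 0 r - Ψ r| ≤ 4 * ε * r ^ 2 := by
      intro ε hε
      have hlim : Tendsto (fun i => |W (φ i) 0 r - Ψ r - (W (φ i) 0 0 - Ψ 0)|) atTop
          (𝓝 |w 0 r - Ψ r - (w 0 0 - Ψ 0)|) := by
        have h1 := hw.tendsto 0 r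
        have h2 := hw.tendsto 0 0
        rw [abs_of_nonneg hr] at h1
        rw [abs_zero] at h2
        exact ((h1.sub_const _).sub (h2.sub_const _)).abs
      rw [show |w 0 r - Ψ r| = |w 0 r - Ψ r - (w 0 0 - Ψ 0)| by
        rw [hE.w0, hΨ0, sub_zero, sub_zero]]
      refine le_of_tendsto hlim ?_
      filter_upwards [hw (r + 1) ε hε, hv (r + 1) ε hε,
        eventually_ge_atTop ⌈r + 1⌉₊] with i hwi hvi hi
      have hc := h.core (φ i)
      have hX : r + 1 ≤ X (φ i) := by
        have h1 : (i : ℝ) ≤ (φ i : ℕ) := Nat.cast_le.2 (hφ.le_apply)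
        have h2 : r + 1 ≤ i := (Nat.le_ceil _).trans (Nat.cast_le.2 hi)
        linarith [h.width (φ i)]
      have ht : (0 : ℝ) ∈ Icc (-((φ i : ℕ) : ℝ) - 1) ((φ i : ℕ) + 1) := by
        have : (0 : ℝ) ≤ (φ i : ℕ) := Nat.cast_nonneg _
        constructor <;> linarith
      rw [← neg_add'] at ht
      have hmem : ∀ x ∈ Ico 0 (r + 1), x ∈ Ioo (-X (φ i)) (X (φ i)) := fun x hx =>
        ⟨by linarith [hx.1, hx.2], by linarith [hx.2]⟩
      refine radial_abs_le_of_lap_le (n := n) (ε := 4 * ε) (Y := r + 1) (D := fun x => W (φ i) 0 x - Ψ x)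
        hn (by linarith)
        (fun x hx => (hc.sol.dr 0 ht x (hmem x hx)).fun_sub (hΨ x))
        (fun x hx => (hc.sol.drr 0 ht x (hmem x (Ioo_subset_Ico_self hx))).fun_sub (hΨ' x hx.1))
        (fun x hx => ((hc.sol.drr 0 ht x (hmem x hx)).continuousAt.sub
          cΨ'.continuousAt).continuousWithinAt)
        (by rw [hc.sol.axis 0 ht, hΨ'0, sub_zero]) (fun x hx => ?_) ⟨hr, lt_add_one r⟩
      have hx1 : |x| ≤ r + 1 := by rw [abs_of_pos hx.1]; exact hx.2.le
      have h0 : |(0 : ℝ)| ≤ r + 1 := by rw [abs_zero]; linarith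
      have h1 := hwi 0 x h0 hx1
      have h2 := hvi 0 x h0 hx1
      have hxX : x < X (φ i) := by linarith [hx.2]
      simp only [abs_of_pos hx.1, ext, if_pos hxX] at h1 h2
      rw [hE.eq_zero hn 0 x hx.1.le, sub_zero] at h2
      have h3 := exp_lipschitz_of_le_one (hc.le_one 0 ht x ⟨hx.1.le, hxX.le⟩) (hE.wle 0 x)
      have h4 := hc.sol.eq_pos 0 ht x ⟨hx.1, hxX⟩
      rw [show Wrr (φ i) 0 x - (-exp (w 0 x) - n / x * Ψ' x) + n / x * (Wr (φ i) 0 x - Ψ' x) =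
        Wt (φ i) 0 x - (exp (W (φ i) 0 x) - exp (w 0 x)) by rw [h4]; ring]
      refine (abs_sub _ _).trans ?_
      linarith
    by_contra hne
    have hpos : 0 < |w 0 r - Ψ r| := abs_pos.2 (sub_ne_zero.2 hne)
    have h1 := key (|w 0 r - Ψ r| / (8 * (r ^ 2 + 1))) (by positivity)
    have h2 : 4 * (|w 0 r - Ψ r| / (8 * (r ^ 2 + 1))) * r ^ 2 < |w 0 r - Ψ r| := by
      rw [show 4 * (|w 0 r - Ψ r| / (8 * (r ^ 2 + 1))) * r ^ 2 =
        |w 0 r - Ψ r| * (4 * r ^ 2) / (8 * (r ^ 2 + 1)) by ring, div_lt_iff₀ (by positivity)]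
      nlinarith [mul_nonneg hpos.le (sq_nonneg r)]
    exact h1.not_gt h2
  exact ⟨Ψ, Ψ', hΨ0, hΨ'0, hΨ, fun r hr => by rw [← hprof r hr.le]; exact hΨ' r hr,
    fun t r hr => (hE.stationary hn t r hr).trans (hprof r hr)⟩

/-- if the blow-up of a radially symmetric solution attaining its maximum
at the origin is of type II, then a suitable intrinsic rescaling converges along a
sequence of times to a steady state (Lemma 3.1 of the paper). -/
theorem stmt_15 {N : ℕ} (hN : 1 ≤ N) (R T : ℝ) (hR : 0 < R) (hT : 0 < T)
    (u : ℝ → Euc N → ℝ) (u₀ : Euc N → ℝ) (U : ℝ → ℝ → ℝ)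
    (hu₀C1 : ContDiffOn ℝ 1 u₀ (closure (ball (0:Euc N) R)))
    (hu₀pos : ∀ x ∈ closure (ball (0:Euc N) R), 0 ≤ u₀ x)
    (hsol : IsClassicalSol (ball (0:Euc N) R) u u₀ (Set.Ico 0 T))
    (hrad : ∀ t, RadiallySymmetric (u t))
    -- `u(0,t) = max_x u(x,t)`:
    (hmax : ∀ t ∈ Set.Ioo (0:ℝ) T, ∀ x ∈ ball (0:Euc N) R, u t x ≤ u t 0)
    (hbu : BlowsUpAt (ball (0:Euc N) R) u T)
    -- `U(|x|,t) = u(x,t)`: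
    (hU : ∀ t : ℝ, ∀ x : Euc N, U ‖x‖ t = u t x)
    -- the blow-up is of type II:
    (htypeII : ¬ TypeIRate (ball (0:Euc N) R) u T) :
    ∃ ts : ℕ → ℝ, StrictMono ts ∧ (∀ i, ts i ∈ Set.Ioo (0:ℝ) T) ∧
      Filter.Tendsto ts Filter.atTop (𝓝 T) ∧
      ∃ ψ : ℝ → ℝ,
        ψ 0 = 0 ∧ HasDerivAt ψ 0 0 ∧
        (∀ ρ : ℝ, 0 < ρ → DifferentiableAt ℝ ψ ρ ∧ DifferentiableAt ℝ (deriv ψ) ρ) ∧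
        (∀ ρ : ℝ, 0 < ρ →
          deriv (deriv ψ) ρ + ((N : ℝ) - 1) / ρ * deriv ψ ρ + Real.exp (ψ ρ) = 0) ∧
        ∀ K : Set (ℝ × ℝ), IsCompact K → K ⊆ Set.Ioi (0:ℝ) ×ˢ Set.Iio (1/4 : ℝ) →
          TendstoUniformlyOn
            (fun i p => -u (ts i) 0 +
              U (Real.exp (-u (ts i) 0 / 2) * p.1) (ts i + Real.exp (-u (ts i) 0) * p.2))
            (fun p => ψ p.1) Filter.atTop K := by
  obtain ⟨i₀⟩ : Nonempty (Fin N) := ⟨⟨0, hN⟩⟩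
  have hn : (0 : ℝ) ≤ (N : ℝ) - 1 := sub_nonneg.2 (Nat.one_le_cast.2 hN)
  obtain ⟨L₀, wr, wrr, wt, hB⟩ := hsol.radialBlowUp i₀ hR hT hu₀C1 hu₀pos hrad hmax hbu htypeII
  obtain ⟨ts, htm, htI, htT, K, X, Wr, Wrr, Wt, hS⟩ := hB.exists_rescaledSeq
  obtain ⟨φ, hφ, w, v, hE, hw, hv⟩ := hS.exists_entireLimit hn (by positivity)
  obtain ⟨ψ, ψ', hψ0, hψ'0, hψ, hψ', hwψ⟩ := hS.exists_profile hn hφ hE hw hv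
  have hd : deriv ψ = ψ' := funext fun r => (hψ r).deriv
  refine ⟨fun i => ts (φ i), htm.comp hφ, fun i => htI _, htT.comp hφ.tendsto_atTop, ψ, hψ0,
    by simpa [hψ'0] using hψ 0, fun ρ hρ => ⟨(hψ ρ).differentiableAt, ?_⟩, fun ρ hρ => ?_,
    fun C hC hCsub => ?_⟩
  · rw [hd]
    exact (hψ' ρ hρ).differentiableAt
  · rw [hd, (hψ' ρ hρ).deriv]
    ring
  obtain ⟨M, hM⟩ := hC.isBounded.exists_norm_le
  rw [Metric.tendstoUniformlyOn_iff]
  intro ε hε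
  filter_upwards [hw M (ε / 2) (half_pos hε)] with i hi p hp
  have hp0 : 0 < p.1 := (hCsub hp).1
  have h1 := hi p.2 p.1 ((norm_snd_le p).trans (hM p hp)) ((norm_fst_le p).trans (hM p hp))
  rw [abs_of_pos hp0, hwψ p.2 p.1 hp0.le] at h1
  have h2 : ∀ t r, 0 ≤ r → U r t = u t (r • EuclideanSpace.single i₀ 1) := by
    intro t r hr
    rw [← hU, norm_smul, EuclideanSpace.norm_single, norm_one, mul_one, Real.norm_of_nonneg hr]
  have h3 : -u (ts (φ i)) 0 + U (exp (-u (ts (φ i)) 0 / 2) * p.1)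
      (ts (φ i) + exp (-u (ts (φ i)) 0) * p.2) =
      resc (fun t r => u t (r • EuclideanSpace.single i₀ 1)) (ts (φ i)) p.2 p.1 := by
    rw [h2 _ _ (mul_nonneg (exp_pos _).le hp0.le)]
    simp only [resc, zero_smul]
    ring
  rw [h3, dist_comm, Real.dist_eq]
  linarith

end ExpBlowup
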